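/- Let $n\geq 3$, let $Y_n$ be the blowup of $\mathbb{P}^3$ at $n$ general points $P_1,\dots,P_n$, with blowup map $\pi:Y_n\to\mathbb{P}^3$, exceptional divisors $E_i=\pi^{-1}(P_i)$, and $D_H$ the preimage of a general hyperplane of $\mathbb{P}^3$. Then a general divisor $D'$ in the linear system $|2nD_H + 2E_1 + \cdots + 2E_n|$ on $Y_n$ is smooth and satisfies $\chi(D') = 8n^3 - 16n^2 + 12n$. -/

import Mathlib

open scoped Manifold Topology
open Filter

noncomputable section

namespace PaperED

/-! Affine algebraic geometry over ℂ: algebraic subsets of ℂⁿ, genericity,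
Zariski tangent spaces, smoothness, and the Euclidean distance degree. -/

/-- "P holds for a general point": P holds on a nonempty Zariski-open subset. -/
def Generically {K : Type} [CommSemiring K] {σ : Type} (P : (σ → K) → Prop) : Prop :=
  ∃ q : MvPolynomial σ K, q ≠ 0 ∧ ∀ a : σ → K, MvPolynomial.eval a q ≠ 0 → P a

/-- Affine algebraic subsets of ℂⁿ (common zero loci of polynomials). -/
def IsAlgSet {n : ℕ} (X : Set (Fin n → ℂ)) : Prop :=
  ∃ S : Set (MvPolynomial (Fin n) ℂ),
    X = {x | ∀ p ∈ S, MvPolynomial.eval x p = 0}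

/-- The differential of a polynomial at a point, as a linear functional. -/
def diffAt {n : ℕ} (p : MvPolynomial (Fin n) ℂ) (x : Fin n → ℂ) : (Fin n → ℂ) →ₗ[ℂ] ℂ :=
  ∑ i, MvPolynomial.eval x (MvPolynomial.pderiv i p) • LinearMap.proj i

/-- The Zariski tangent space of `X ⊆ ℂⁿ` at `x`. -/
def zTangent {n : ℕ} (X : Set (Fin n → ℂ)) (x : Fin n → ℂ) : Submodule ℂ (Fin n → ℂ) :=
  ⨅ p ∈ {p : MvPolynomial (Fin n) ℂ | ∀ y ∈ X, MvPolynomial.eval y p = 0},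
    LinearMap.ker (diffAt p x)

/-- `ψ` is a local holomorphic parametrization of `S` around `x`, with `d` parameters. -/
def IsParamAt {E : Type} [NormedAddCommGroup E] [NormedSpace ℂ E]
    (S : Set E) (x : E) (d : ℕ) (ψ : (Fin d → ℂ) → E) (U : Set (Fin d → ℂ)) : Prop :=
  IsOpen U ∧ (0 : Fin d → ℂ) ∈ U ∧ ψ 0 = x ∧ DifferentiableOn ℂ ψ U ∧
    Set.InjOn ψ U ∧ Function.Injective (fderiv ℂ ψ 0) ∧
    ∃ V ∈ 𝓝 x, ψ '' U = S ∩ V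

/-- `S` is, near `x`, a `d`-dimensional complex submanifold. -/
def IsSmoothGermAt {E : Type} [NormedAddCommGroup E] [NormedSpace ℂ E]
    (S : Set E) (x : E) (d : ℕ) : Prop :=
  ∃ ψ U, IsParamAt S x d ψ U

/-- `X` is a (nonempty) smooth closed subvariety of ℂⁿ of pure dimension `d`. -/
def IsSmoothClosedOfDim {n : ℕ} (X : Set (Fin n → ℂ)) (d : ℕ) : Prop :=
  IsAlgSet X ∧ X.Nonempty ∧
    ∀ x ∈ X, IsSmoothGermAt X x d ∧ Module.finrank ℂ ↥(zTangent X x) = d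

/-- Critical points of the squared distance function `f_α` on the locus of `X` where
the tangent space has dimension `d` (the smooth locus, when `dim X = d`):
the vector `x - α` is orthogonal to the tangent space w.r.t. `∑ zᵢwᵢ`. -/
def edCritSet {n : ℕ} (X : Set (Fin n → ℂ)) (d : ℕ) (α : Fin n → ℂ) : Set (Fin n → ℂ) :=
  {x | x ∈ X ∧ Module.finrank ℂ ↥(zTangent X x) = d ∧
    ∀ v ∈ zTangent X x, (∑ i, (x i - α i) * v i) = 0}

/-- The Euclidean distance degree of `X` (of dimension `d`) equals `k`: for a general
data point `α`, the squared distance function `f_α` has exactly `k` critical points on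
the smooth locus of `X`. -/
def HasEDDeg {n : ℕ} (X : Set (Fin n → ℂ)) (d : ℕ) (k : ℕ) : Prop :=
  Generically (K := ℂ) (σ := Fin n) fun α =>
    (edCritSet X d α).Finite ∧ (edCritSet X d α).ncard = k

/-- `U_β`: the complement in ℂⁿ of the hypersurface `∑ (zᵢ - βᵢ)² + β₀ = 0`. -/
def quadCompl {n : ℕ} (β : Fin (n + 1) → ℂ) : Set (Fin n → ℂ) :=
  {z | (∑ i : Fin n, (z i - β i.succ) ^ 2) + β 0 ≠ 0}

/-! Topological Euler characteristic, via homotopy equivalence with a space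
built from finitely many cells. -/

def cellSphere (d : ℕ) : Set (EuclideanSpace ℝ (Fin d)) := Metric.sphere 0 1
def cellBall (d : ℕ) : Set (EuclideanSpace ℝ (Fin d)) := Metric.closedBall 0 1

def attachRel {d : ℕ} {A : Type} [TopologicalSpace A] (φ : C(↥(cellSphere d), A)) :
    (A ⊕ ↥(cellBall d)) → (A ⊕ ↥(cellBall d)) → Prop := fun p q =>
  ∃ x : ↥(cellSphere d),
    p = Sum.inl (φ x) ∧ q = Sum.inr ⟨x.1, Metric.sphere_subset_closedBall x.2⟩

/-- The space obtained from `A` by attaching a `d`-cell along `φ`. -/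
def attachSp {d : ℕ} {A : Type} [TopologicalSpace A] (φ : C(↥(cellSphere d), A)) : Type :=
  Quot (attachRel φ)

instance {d : ℕ} {A : Type} [TopologicalSpace A] (φ : C(↥(cellSphere d), A)) :
    TopologicalSpace (attachSp φ) := inferInstanceAs (TopologicalSpace (Quot _))

/-- `B` is (homeomorphic to) the result of attaching one `d`-cell to `A`. -/
def AttachOneCell (A B : TopCat.{0}) (d : ℕ) : Prop :=
  ∃ φ : C(↥(cellSphere d), ↑A), Nonempty (↑B ≃ₜ attachSp φ)

/-- `Z` is obtained from `A` by attaching cells whose dimensions are listed in `L`. -/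
def AttachedCells : TopCat.{0} → TopCat.{0} → List ℕ → Prop
  | A, Z, [] => Nonempty (↑A ≃ₜ ↑Z)
  | A, Z, d :: L => ∃ B : TopCat.{0}, AttachOneCell A B d ∧ AttachedCells B Z L

/-- `X` has (topological) Euler characteristic `c`: `X` is homotopy equivalent to a
space built from finitely many cells, and `c` is the alternating sum of the
numbers of cells. -/
def HasEulerChar (X : Type) [TopologicalSpace X] (c : ℤ) : Prop :=
  ∃ (Z : TopCat.{0}) (L : List ℕ),
    AttachedCells (TopCat.of Empty) Z L ∧
    Nonempty (ContinuousMap.HomotopyEquiv X ↑Z) ∧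
    c = (L.map fun d => (-1 : ℤ) ^ d).sum

/-! The multiview variety of `n` cameras in `(ℙ²)ⁿ` and its affine chart. -/

abbrev P2 := Projectivization ℂ (Fin 3 → ℂ)

instance : TopologicalSpace P2 :=
  @instTopologicalSpaceQuotient _ (projectivizationSetoid ℂ (Fin 3 → ℂ)) _

/-- The point of ℙ² with homogeneous coordinate vector `v` (junk value if `v = 0`). -/
def mkP (v : Fin 3 → ℂ) : P2 :=
  if h : v ≠ 0 then Projectivization.mk ℂ v h
  else Projectivization.mk ℂ (fun _ => 1) (by
    intro h0; exact one_ne_zero (congrFun h0 0))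

/-- The tuple of cameras (3×4 matrices) with complex parameters `a`. -/
def camOfC {n : ℕ} (a : Fin n × Fin 3 × Fin 4 → ℂ) : Fin n → Matrix (Fin 3) (Fin 4) ℂ :=
  fun i => Matrix.of fun r c => a (i, r, c)

/-- The tuple of cameras with real parameters `a`, viewed as complex matrices. -/
def camOfR {n : ℕ} (a : Fin n × Fin 3 × Fin 4 → ℝ) : Fin n → Matrix (Fin 3) (Fin 4) ℂ :=
  fun i => Matrix.of fun r c => (a (i, r, c) : ℂ)

/-- The tuple of chart matrices (elements of GL₃ giving affine charts of ℙ²). -/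
def chartOf {n : ℕ} (cpar : Fin n × Fin 3 × Fin 3 → ℂ) : Fin n → Matrix (Fin 3) (Fin 3) ℂ :=
  fun i => Matrix.of fun r c => cpar (i, r, c)

/-- The image of the joint camera map `ℙ³ ⇢ (ℙ²)ⁿ` (on its locus of definition). -/
def mvImage {n : ℕ} (A : Fin n → Matrix (Fin 3) (Fin 4) ℂ) : Set (Fin n → P2) :=
  {P | ∃ y : Fin 4 → ℂ, y ≠ 0 ∧ (∀ i, (A i).mulVec y ≠ 0) ∧ ∀ i, P i = mkP ((A i).mulVec y)}

/-- The multiview variety `Yₙ ⊆ (ℙ²)ⁿ`: the closure of the image of the camera map. -/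
def mvVariety {n : ℕ} (A : Fin n → Matrix (Fin 3) (Fin 4) ℂ) : Set (Fin n → P2) :=
  closure (mvImage A)

def affLift (z : Fin 2 → ℂ) : Fin 3 → ℂ := Fin.cons 1 z

/-- The coordinate pair of the `i`-th factor, for `z ∈ ℂ²ⁿ`. -/
def camCoord (n : ℕ) (z : Fin (2 * n) → ℂ) (i : Fin n) : Fin 2 → ℂ :=
  fun k => z ⟨2 * i.1 + k.1, by have := i.2; have := k.2; omega⟩

/-- The affine chart `ℂ²ⁿ → (ℙ²)ⁿ` determined by the chart matrices `Cs`. -/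
def chartMapN {n : ℕ} (Cs : Fin n → Matrix (Fin 3) (Fin 3) ℂ) (z : Fin (2 * n) → ℂ) :
    Fin n → P2 :=
  fun i => mkP ((Cs i).mulVec <| affLift (camCoord n z i))

/-- The affine multiview variety `Xₙ = Yₙ ∩ ℂ²ⁿ ⊆ ℂ²ⁿ`, in the chart `Cs`. -/
def affineMV {n : ℕ} (A : Fin n → Matrix (Fin 3) (Fin 4) ℂ)
    (Cs : Fin n → Matrix (Fin 3) (Fin 3) ℂ) : Set (Fin (2 * n) → ℂ) :=
  chartMapN Cs ⁻¹' mvVariety A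

/-- The line at infinity of the affine chart of ℙ² given by the matrix `Cm`. -/
def infLine (Cm : Matrix (Fin 3) (Fin 3) ℂ) : Set P2 :=
  {p | ∃ w : Fin 3 → ℂ, w ≠ 0 ∧ w 0 = 0 ∧ p = mkP (Cm.mulVec w)}

/-- `D_{∞,i} = Yₙ ∩ H_{∞,i}`. -/
def Dinf {n : ℕ} (A : Fin n → Matrix (Fin 3) (Fin 4) ℂ)
    (Cs : Fin n → Matrix (Fin 3) (Fin 3) ℂ) (i : Fin n) : Set (Fin n → P2) :=
  mvVariety A ∩ {P | P i ∈ infLine (Cs i)}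

/-- `D_∞ = Yₙ ∩ H_∞`, the divisor at infinity. -/
def DinfAll {n : ℕ} (A : Fin n → Matrix (Fin 3) (Fin 4) ℂ)
    (Cs : Fin n → Matrix (Fin 3) (Fin 3) ℂ) : Set (Fin n → P2) :=
  mvVariety A ∩ ⋃ i, {P | P i ∈ infLine (Cs i)}

/-- The affine quadric hypersurface `∑ (zᵢ - βᵢ)² + β₀ = 0` in `ℂ²ⁿ`. -/
def quadSet (n : ℕ) (β : Fin (2 * n + 1) → ℂ) : Set (Fin (2 * n) → ℂ) :=
  {z | (∑ i : Fin (2 * n), (z i - β i.succ) ^ 2) + β 0 = 0}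

/-- `H_Q`: the closure in `(ℙ²)ⁿ` of the affine quadric hypersurface. -/
def HQ {n : ℕ} (Cs : Fin n → Matrix (Fin 3) (Fin 3) ℂ) (β : Fin (2 * n + 1) → ℂ) :
    Set (Fin n → P2) :=
  closure (chartMapN Cs '' quadSet n β)

/-- `D_Q = Yₙ ∩ H_Q`. -/
def DQ {n : ℕ} (A : Fin n → Matrix (Fin 3) (Fin 4) ℂ)
    (Cs : Fin n → Matrix (Fin 3) (Fin 3) ℂ) (β : Fin (2 * n + 1) → ℂ) :
    Set (Fin n → P2) :=
  mvVariety A ∩ HQ Cs β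

/-! Smooth points of subsets of `(ℙ²)ⁿ`, via standard affine charts. -/

/-- The standard affine chart of `(ℙ²)ⁿ` indexed by `j`, inserting `1` in slot `j i`. -/
def stdChart {n : ℕ} (j : Fin n → Fin 3) (z : Fin n → Fin 2 → ℂ) : Fin n → P2 :=
  fun i => mkP (Fin.insertNth (j i) (1 : ℂ) (z i))

/-- `p` is a smooth point of `S ⊆ (ℙ²)ⁿ`, of local (complex) dimension `d`. -/
def IsSmoothPtP {n : ℕ} (S : Set (Fin n → P2)) (p : Fin n → P2) (d : ℕ) : Prop :=
  ∃ (j : Fin n → Fin 3) (z₀ : Fin n → Fin 2 → ℂ), stdChart j z₀ = p ∧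
    IsSmoothGermAt (E := Fin n → Fin 2 → ℂ) (stdChart j ⁻¹' S) z₀ d

/-- A multihomogeneous form of multidegree `(2,…,2)` on `(ℂ³)ⁿ`, with coefficients `c`. -/
def biquadForm {n : ℕ} (c : (Fin n → Fin 3) × (Fin n → Fin 3) → ℂ)
    (v : Fin n → Fin 3 → ℂ) : ℂ :=
  ∑ jj : (Fin n → Fin 3) × (Fin n → Fin 3),
    c jj * (∏ i, v i (jj.1 i)) * (∏ i, v i (jj.2 i))

/-- The divisor cut out on `Yₙ` by the multidegree-`(2,…,2)` form with coefficients `c`;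
its class is `2nD_H + 2E₁ + ⋯ + 2Eₙ`. -/
def biquadDivisor {n : ℕ} (A : Fin n → Matrix (Fin 3) (Fin 4) ℂ)
    (c : (Fin n → Fin 3) × (Fin n → Fin 3) → ℂ) : Set (Fin n → P2) :=
  mvVariety A ∩ {P | ∃ v : Fin n → Fin 3 → ℂ,
    (∀ i, v i ≠ 0) ∧ (∀ i, P i = mkP (v i)) ∧ biquadForm c v = 0}

section
open ContinuousMap unitInterval

/-! Homotopy equivalences as a property of maps. -/

section HEquiv
variable {X Y Z W : Type} [TopologicalSpace X] [TopologicalSpace Y] [TopologicalSpace Z]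
  [TopologicalSpace W]

/-- `f` is a homotopy equivalence. -/
def IsHEquiv (f : C(X, Y)) : Prop :=
  ∃ g : C(Y, X), (g.comp f).Homotopic (ContinuousMap.id X) ∧
    (f.comp g).Homotopic (ContinuousMap.id Y)

theorem IsHEquiv.nonempty {f : C(X, Y)} (h : IsHEquiv f) : Nonempty (X ≃ₕ Y) := by
  obtain ⟨g, h1, h2⟩ := h
  exact ⟨⟨f, g, h1, h2⟩⟩

theorem isHEquiv_of_equiv (e : X ≃ₕ Y) : IsHEquiv e.toFun := ⟨e.invFun, e.left_inv, e.right_inv⟩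

theorem Homotopic.comp_left {f g : C(X, Y)} (k : C(Y, Z)) (h : f.Homotopic g) :
    (k.comp f).Homotopic (k.comp g) := (ContinuousMap.Homotopic.refl k).comp h

theorem Homotopic.comp_right {f g : C(Y, Z)} (k : C(X, Y)) (h : f.Homotopic g) :
    (f.comp k).Homotopic (g.comp k) := h.comp (ContinuousMap.Homotopic.refl k)

theorem IsHEquiv.of_homotopic {f g : C(X, Y)} (h : IsHEquiv f) (e : g.Homotopic f) :
    IsHEquiv g := by
  obtain ⟨k, h1, h2⟩ := h
  exact ⟨k, (Homotopic.comp_left k e).trans h1, (Homotopic.comp_right k e).trans h2⟩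

theorem IsHEquiv.of_left_right {f : C(X, Y)} {l r : C(Y, X)}
    (hl : (l.comp f).Homotopic (ContinuousMap.id X))
    (hr : (f.comp r).Homotopic (ContinuousMap.id Y)) : IsHEquiv f := by
  refine ⟨r, ?_, hr⟩
  have h1 : r.Homotopic l := by
    have := Homotopic.comp_left l hr
    have h2 := Homotopic.comp_right r hl
    exact (h2.symm.trans this)
  exact (Homotopic.comp_right f h1).trans hl

theorem IsHEquiv.comp {g : C(Y, Z)} {f : C(X, Y)} (hg : IsHEquiv g) (hf : IsHEquiv f) :
    IsHEquiv (g.comp f) := by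
  obtain ⟨g', g1, g2⟩ := hg
  obtain ⟨f', f1, f2⟩ := hf
  refine ⟨f'.comp g', ?_, ?_⟩
  · exact (Homotopic.comp_left f' (Homotopic.comp_right f g1)).trans f1
  · exact (Homotopic.comp_left g (Homotopic.comp_right g' f2)).trans g2

theorem IsHEquiv.of_comp_right {g : C(Y, Z)} {f : C(X, Y)} (hgf : IsHEquiv (g.comp f))
    (hf : IsHEquiv f) : IsHEquiv g := by
  obtain ⟨f', f1, f2⟩ := hf
  have : IsHEquiv ((g.comp f).comp f') := hgf.comp ⟨f, f2, f1⟩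
  exact this.of_homotopic (Homotopic.comp_left g f2).symm

theorem IsHEquiv.of_comp_left {g : C(Y, Z)} {f : C(X, Y)} (hgf : IsHEquiv (g.comp f))
    (hg : IsHEquiv g) : IsHEquiv f := by
  obtain ⟨g', g1, g2⟩ := hg
  have : IsHEquiv (g'.comp (g.comp f)) := IsHEquiv.comp ⟨g, g2, g1⟩ hgf
  exact this.of_homotopic (Homotopic.comp_right f g1).symm

theorem IsHEquiv.two_of_six {h : C(Z, W)} {g : C(Y, Z)} {f : C(X, Y)}
    (hhg : IsHEquiv (h.comp g)) (hgf : IsHEquiv (g.comp f)) : IsHEquiv g := by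
  obtain ⟨a, a1, -⟩ := hhg
  obtain ⟨b, -, b2⟩ := hgf
  exact IsHEquiv.of_left_right (l := a.comp h) (r := f.comp b) a1 b2

theorem isHEquiv_id : IsHEquiv (ContinuousMap.id X) :=
  ⟨ContinuousMap.id X, ContinuousMap.Homotopic.refl _, ContinuousMap.Homotopic.refl _⟩

end HEquiv

/-! Double mapping cylinders. -/

section DMC
variable {U C V W : Type} [TopologicalSpace U] [TopologicalSpace C] [TopologicalSpace V]
  [TopologicalSpace W]

/-- The gluing relation of the double mapping cylinder. -/
inductive DMCRel (f : C(C, U)) (g : C(C, V)) :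
    U ⊕ (C × I) ⊕ V → U ⊕ (C × I) ⊕ V → Prop
  | left (c : C) : DMCRel f g (Sum.inr (Sum.inl (c, 0))) (Sum.inl (f c))
  | right (c : C) : DMCRel f g (Sum.inr (Sum.inl (c, 1))) (Sum.inr (Sum.inr (g c)))

/-- The double mapping cylinder of `U ← C → V`. -/
def DMC (f : C(C, U)) (g : C(C, V)) : Type := Quot (DMCRel f g)

instance (f : C(C, U)) (g : C(C, V)) : TopologicalSpace (DMC f g) :=
  inferInstanceAs (TopologicalSpace (Quot _))

namespace DMC
variable (f : C(C, U)) (g : C(C, V))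

def proj : C(U ⊕ (C × I) ⊕ V, DMC f g) := ⟨Quot.mk _, continuous_quot_mk⟩
def inU : C(U, DMC f g) := (proj f g).comp ⟨Sum.inl, continuous_inl⟩
def inV : C(V, DMC f g) := (proj f g).comp ⟨fun v => Sum.inr (Sum.inr v), by fun_prop⟩
def cyl : C(C × I, DMC f g) := (proj f g).comp ⟨fun v => Sum.inr (Sum.inl v), by fun_prop⟩
/-- The cylinder coordinate, extended to all real parameters by clamping. -/
def cylR : C(C × ℝ, DMC f g) :=
  (cyl f g).comp ⟨fun p => (p.1, Set.projIcc 0 1 zero_le_one p.2), by fun_prop⟩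

variable {f g}

theorem cyl_zero (c : C) : cyl f g (c, 0) = inU f g (f c) := Quot.sound (DMCRel.left c)
theorem cyl_one (c : C) : cyl f g (c, 1) = inV f g (g c) := Quot.sound (DMCRel.right c)
theorem cylR_le (c : C) {t : ℝ} (h : t ≤ 0) : cylR f g (c, t) = inU f g (f c) := by
  rw [← cyl_zero]
  simp [cylR, Set.projIcc_of_le_left _ h]
theorem cylR_ge (c : C) {t : ℝ} (h : 1 ≤ t) : cylR f g (c, t) = inV f g (g c) := by
  rw [← cyl_one]
  simp [cylR, Set.projIcc_of_right_le _ h]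
theorem cylR_coe (c : C) (t : I) : cylR f g (c, t) = cyl f g (c, t) := by
  simp [cylR]

theorem isQuotientMap_proj : Topology.IsQuotientMap (proj f g) := isQuotientMap_quot_mk

@[elab_as_elim]
theorem ind {p : DMC f g → Prop} (hU : ∀ u, p (inU f g u)) (hC : ∀ c t, p (cyl f g (c, t)))
    (hV : ∀ v, p (inV f g v)) (x : DMC f g) : p x := by
  induction x using Quot.ind with
  | mk a =>
    rcases a with u | ⟨c, t⟩ | v
    exacts [hU u, hC c t, hV v]

/-- Descent of functions to the double mapping cylinder. -/
def desc {W : Type} (a : U → W) (H : C × I → W) (b : V → W) (h0 : ∀ c, H (c, 0) = a (f c))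
    (h1 : ∀ c, H (c, 1) = b (g c)) : DMC f g → W :=
  Quot.lift (Sum.elim a (Sum.elim H b)) (by
    rintro _ _ (c | c)
    exacts [h0 c, h1 c])

theorem continuous_iff {k : DMC f g → W} :
    Continuous k ↔ Continuous (k ∘ inU f g) ∧ Continuous (k ∘ cyl f g) ∧
      Continuous (k ∘ inV f g) := by
  constructor
  · intro h
    exact ⟨by fun_prop, by fun_prop, by fun_prop⟩
  · rintro ⟨h1, h2, h3⟩
    rw [isQuotientMap_proj.continuous_iff]
    refine (continuous_sum_dom.2 ⟨h1, continuous_sum_dom.2 ⟨h2, h3⟩⟩)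

theorem continuous_prod {T : Type} [TopologicalSpace T] [LocallyCompactSpace T]
    {k : T × DMC f g → W}
    (hU : Continuous fun p : T × U => k (p.1, inU f g p.2))
    (hC : Continuous fun p : T × (C × I) => k (p.1, cyl f g p.2))
    (hV : Continuous fun p : T × V => k (p.1, inV f g p.2)) : Continuous k := by
  refine isQuotientMap_proj.continuous_lift_prod_right ?_
  let e := (Homeomorph.prodSumDistrib (X := T) (Y := U) (Z := (C × I) ⊕ V)).trans
    ((Homeomorph.refl (T × U)).sumCongr (Homeomorph.prodSumDistrib (X := T) (Y := C × I) (Z := V)))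
  refine (e.symm.isQuotientMap.continuous_iff).2 ?_
  refine (continuous_sum_dom.2 ⟨hU, continuous_sum_dom.2 ⟨hC, hV⟩⟩)

/-- Continuous maps out of the double mapping cylinder. -/
def descC (a : C(U, W)) (H : C(C × I, W)) (b : C(V, W)) (h0 : ∀ c, H (c, 0) = a (f c))
    (h1 : ∀ c, H (c, 1) = b (g c)) : C(DMC f g, W) :=
  ⟨desc a H b h0 h1, continuous_iff.2 ⟨a.continuous, H.continuous, b.continuous⟩⟩

section
variable (a : C(U, W)) (H : C(C × I, W)) (b : C(V, W)) (h0 : ∀ c, H (c, 0) = a (f c))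
  (h1 : ∀ c, H (c, 1) = b (g c))
end

/-- Homotopies between maps out of a double mapping cylinder. -/
theorem homotopic_of {k l : C(DMC f g, W)} (a : C(I × U, W)) (H : C(I × (C × I), W))
    (b : C(I × V, W)) (h0 : ∀ r c, H (r, (c, 0)) = a (r, f c))
    (h1 : ∀ r c, H (r, (c, 1)) = b (r, g c))
    (ka : ∀ u, a (0, u) = k (inU f g u)) (la : ∀ u, a (1, u) = l (inU f g u))
    (kH : ∀ u, H (0, u) = k (cyl f g u)) (lH : ∀ u, H (1, u) = l (cyl f g u))
    (kb : ∀ u, b (0, u) = k (inV f g u)) (lb : ∀ u, b (1, u) = l (inV f g u)) :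
    k.Homotopic l := by
  refine ⟨⟨⟨fun p => desc (f := f) (g := g) (fun u => a (p.1, u)) (fun u => H (p.1, u))
    (fun u => b (p.1, u)) (h0 p.1) (h1 p.1) p.2, ?_⟩, ?_, ?_⟩⟩
  · exact continuous_prod (by exact a.continuous) (by exact H.continuous) (by exact b.continuous)
  · intro x
    induction x using DMC.ind with
    | hU u => exact ka u
    | hC c t => exact kH (c, t)
    | hV u => exact kb u
  · intro x
    induction x using DMC.ind with
    | hU u => exact la u
    | hC c t => exact lH (c, t)
    | hV u => exact lb u

end DMC
end DMC

namespace DMC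
section
variable {U C V W : Type} [TopologicalSpace U] [TopologicalSpace C] [TopologicalSpace V]
  [TopologicalSpace W] 

/-- The map of double mapping cylinders induced by a map of the middle spaces. -/
def mapC {C' : Type} [TopologicalSpace C'] (f : C(C, U)) (g : C(C, V)) (e : C(C', C)) :
    C(DMC (f.comp e) (g.comp e), DMC f g) :=
  descC (inU f g) ((cyl f g).comp (e.prodMap (ContinuousMap.id I))) (inV f g)
    (fun c => cyl_zero (e c)) (fun c => cyl_one (e c))

/-- The map of double mapping cylinders induced by a map of the left spaces. -/
def mapU {U' : Type} [TopologicalSpace U'] (f : C(C, U)) (g : C(C, V)) (k : C(U, U')) :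
    C(DMC f g, DMC (k.comp f) g) :=
  descC ((inU _ g).comp k) (cyl _ g) (inV _ g)
    (fun c => cyl_zero c) (fun c => cyl_one c)

/-- The inclusion of a slice. -/
def slice (C : Type) [TopologicalSpace C] (s : I) : C(C, C × I) := ⟨fun c => (c, s), by fun_prop⟩

/-- Clamping a real number to the unit interval. -/
def cl (t : ℝ) : I := Set.projIcc 0 1 zero_le_one t

@[fun_prop]
theorem continuous_cl_comp {X : Type*} [TopologicalSpace X] {f : X → ℝ} (hf : Continuous f) :
    Continuous fun x => cl (f x) := continuous_projIcc.comp hf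

theorem cl_coe (t : I) : cl (t : ℝ) = t := Set.projIcc_val _ t
theorem cl_le {t : ℝ} (h : t ≤ 0) : cl t = 0 := Set.projIcc_of_le_left _ h
theorem cl_ge {t : ℝ} (h : 1 ≤ t) : cl t = 1 := Set.projIcc_of_right_le _ h

variable (F : C(C × I, U)) (G : C(C × I, V))

/-- The coordinate used to retract the square to three of its sides. -/
def stE (s t : I) : ℝ := (2 * (t : ℝ) - 1) * (1 + s)

/-- The retraction of the square to three of its sides, as a map of double mapping cylinders. -/
def stapleFun (p : (C × I) × I) : DMC (F.comp (slice C 0)) (G.comp (slice C 0)) :=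
  if stE p.1.2 p.2 ≤ -1 then inU _ _ (F (p.1.1, cl (-stE p.1.2 p.2 - 1)))
  else if 1 ≤ stE p.1.2 p.2 then inV _ _ (G (p.1.1, cl (stE p.1.2 p.2 - 1)))
  else cyl _ _ (p.1.1, cl ((stE p.1.2 p.2 + 1) / 2))

theorem continuous_stapleFun : Continuous (stapleFun F G) := by
  unfold stapleFun stE
  refine Continuous.if_le (by fun_prop) (Continuous.if_le (by fun_prop) (by fun_prop)
    (by fun_prop) (by fun_prop) ?_) (by fun_prop) (by fun_prop) ?_
  · intro p hp
    rw [← hp, cl_le (by norm_num), cl_ge (by norm_num), cyl_one]; rfl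
  · intro p hp
    rw [hp, cl_le (by norm_num), if_neg (by norm_num), cl_le (by norm_num), cyl_zero]; rfl

def staple : C(DMC F G, DMC (F.comp (slice C 0)) (G.comp (slice C 0))) :=
  descC (inU _ _) ⟨stapleFun F G, continuous_stapleFun F G⟩ (inV _ _)
    (by
      rintro ⟨c, s⟩
      have : stE s 0 = -(1 + s) := by simp [stE]
      have h2 := s.2.1
      simp only [ContinuousMap.coe_mk, stapleFun, this]
      rw [if_pos (by linarith)]
      congr 3
      convert cl_coe s using 2; ring)
    (by
      rintro ⟨c, s⟩
      have : stE s 1 = (1 + s) := by simp [stE]; ring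
      have h2 := s.2.1
      simp only [ContinuousMap.coe_mk, stapleFun, this]
      rw [if_neg (by linarith), if_pos (by linarith)]
      congr 3
      convert cl_coe s using 2; ring)

theorem staple_cyl (p : (C × I) × I) : mapC F G (slice C 0) (stapleFun F G p) =
    cyl F G ((p.1.1, cl (|stE p.1.2 p.2| - 1)), cl ((stE p.1.2 p.2 + 1) / 2)) := by
  unfold stapleFun
  split_ifs with h1 h2
  · rw [abs_of_nonpos (by linarith), cl_le (t := (_ + 1) / 2) (by linarith), cyl_zero]; rfl
  · rw [abs_of_nonneg (by linarith), cl_ge (t := (_ + 1) / 2) (by linarith), cyl_one]; rfl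
  · rw [cl_le (t := |_| - 1)]
    · rfl
    · rw [sub_nonpos, abs_le]; constructor <;> linarith

theorem isHEquiv_slice_zero : IsHEquiv (mapC F G (slice C 0)) := by
  refine ⟨staple F G, ?_, ?_⟩
  · have : (staple F G).comp (mapC F G (slice C 0)) = ContinuousMap.id _ := by
      ext x
      induction x using DMC.ind with
      | hU u => rfl
      | hV u => rfl
      | hC c t =>
        change stapleFun F G ((c, 0), t) = _
        have : stE 0 t = 2 * t - 1 := by simp [stE]
        have ht := t.2
        simp only [stapleFun, this]
        split_ifs with h1 h2
        · have : t = 0 := Subtype.ext (by simpa using le_antisymm (by linarith) ht.1)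
          subst this
          rw [cl_le (by norm_num)]
          exact (cyl_zero (f := F.comp (slice C 0)) (g := G.comp (slice C 0)) c).symm
        · have : t = 1 := Subtype.ext (by simpa using le_antisymm ht.2 (by linarith))
          subst this
          rw [cl_le (by norm_num)]
          exact (cyl_one (f := F.comp (slice C 0)) (g := G.comp (slice C 0)) c).symm
        · have : (2 * (t : ℝ) - 1 + 1) / 2 = t := by ring
          rw [this, cl_coe]; rfl
    rw [this]
  · let P : I × ((C × I) × I) → ℝ := fun p =>
      (1 - p.1) * (cl (|stE p.2.1.2 p.2.2| - 1)) + p.1 * p.2.1.2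
    let Q : I × ((C × I) × I) → ℝ := fun p =>
      (1 - p.1) * (cl ((stE p.2.1.2 p.2.2 + 1) / 2)) + p.1 * p.2.2
    have hP : Continuous P := by unfold P stE; fun_prop
    have hQ : Continuous Q := by unfold Q stE; fun_prop
    refine homotopic_of ((inU F G).comp ContinuousMap.snd)
      ((cyl F G).comp ⟨fun p => ((p.2.1.1, cl (P p)), cl (Q p)), by fun_prop⟩)
      ((inV F G).comp ContinuousMap.snd) ?_ ?_ ?_ ?_ ?_ ?_ ?_ ?_
    · rintro r ⟨c, s⟩
      have e : stE s 0 = -(1 + s) := by simp [stE]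
      have h2 := s.2.1
      have h1 : P (r, ((c, s), 0)) = s := by
        simp only [P, e]
        rw [abs_neg, abs_of_nonneg (by linarith)]
        have : cl (1 + (s : ℝ) - 1) = s := by convert cl_coe s using 2; ring
        rw [this]; ring
      have h3 : Q (r, ((c, s), 0)) = 0 := by
        simp only [Q, e]
        rw [cl_le (by linarith)]; simp
      simp only [ContinuousMap.comp_apply, ContinuousMap.coe_mk, h1, h3, cl_coe]
      rw [cl_le le_rfl, cyl_zero]; rfl
    · rintro r ⟨c, s⟩
      have e : stE s 1 = (1 + s) := by simp [stE]; ring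
      have h2 := s.2.1
      have h1 : P (r, ((c, s), 1)) = s := by
        simp only [P, e]
        rw [abs_of_nonneg (by linarith)]
        have : cl (1 + (s : ℝ) - 1) = s := by convert cl_coe s using 2; ring
        rw [this]; ring
      have h3 : Q (r, ((c, s), 1)) = 1 := by
        simp only [Q, e]
        rw [cl_ge (by linarith)]; simp
      simp only [ContinuousMap.comp_apply, ContinuousMap.coe_mk, h1, h3, cl_coe]
      rw [cl_ge le_rfl, cyl_one]; rfl
    · intro u; rfl
    · intro u; rfl
    · intro u
      change _ = mapC F G (slice C 0) (stapleFun F G u)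
      rw [staple_cyl]
      simp [P, Q, cl_coe]
    · intro u
      simp [P, Q, cl_coe]
    · intro u; rfl
    · intro u; rfl

/-- Reversal of the cylinder coordinate. -/
def flip (C : Type) [TopologicalSpace C] : C(C × I, C × I) :=
  ⟨fun p => (p.1, unitInterval.symm p.2), by fun_prop⟩

theorem flip_flip : (flip C).comp (flip C) = ContinuousMap.id _ := by
  ext x <;> simp [flip]

theorem isHEquiv_slice_one : IsHEquiv (mapC F G (slice C 1)) := by
  have h := isHEquiv_slice_zero (F.comp (flip C)) (G.comp (flip C))
  have e : (flip C).comp (slice C 0) = slice C 1 := by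
    ext x <;> simp [flip, slice]
  have hf : IsHEquiv (mapC F G (flip C)) := by
    have ff : ∀ p : C × I, flip C (flip C p) = p := fun p => DFunLike.congr_fun flip_flip p
    let k : C(DMC F G, DMC (F.comp (flip C)) (G.comp (flip C))) :=
      descC (inU _ _) ((cyl _ _).comp ((flip C).prodMap (ContinuousMap.id I))) (inV _ _)
        (fun c => (cyl_zero (f := F.comp (flip C)) (g := G.comp (flip C)) (flip C c)).trans
          (congrArg (fun q => inU _ _ (F q)) (ff c)))
        (fun c => (cyl_one (f := F.comp (flip C)) (g := G.comp (flip C)) (flip C c)).trans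
          (congrArg (fun q => inV _ _ (G q)) (ff c)))
    refine ⟨k, ?_, ?_⟩
    · have : k.comp (mapC F G (flip C)) = ContinuousMap.id _ := by
        ext x
        induction x using DMC.ind with
        | hU u => rfl
        | hV u => rfl
        | hC c t =>
          change cyl _ _ (flip C (flip C c), t) = cyl _ _ (c, t)
          rw [ff]
      rw [this]
    · have : (mapC F G (flip C)).comp k = ContinuousMap.id _ := by
        ext x
        induction x using DMC.ind with
        | hU u => rfl
        | hV u => rfl
        | hC c t =>
          change cyl _ _ (flip C (flip C c), t) = cyl _ _ (c, t)
          rw [ff]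
      rw [this]
  have := hf.comp h
  rw [← e]
  refine this.of_homotopic ?_
  have : mapC F G ((flip C).comp (slice C 0)) =
      (mapC F G (flip C)).comp (mapC (F.comp (flip C)) (G.comp (flip C)) (slice C 0)) := by
    ext x
    induction x using DMC.ind <;> rfl
  rw [this]

/-- A self-map homotopic to the identity induces an equivalence of double mapping cylinders. -/
theorem isHEquiv_mapC_of_homotopic_id (f : C(C, U)) (g : C(C, V)) {h : C(C, C)}
    (hh : h.Homotopic (ContinuousMap.id C)) : IsHEquiv (mapC f g h) := by
  obtain ⟨H⟩ := hh
  let H' : C(C × I, C) := H.toContinuousMap.comp ContinuousMap.prodSwap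
  have e0 : H'.comp (slice C 0) = h := by ext x; simp [H', slice]
  have e1 : H'.comp (slice C 1) = ContinuousMap.id C := by ext x; simp [H', slice]
  have c0 := isHEquiv_slice_zero (f.comp H') (g.comp H')
  have c1 := isHEquiv_slice_one (f.comp H') (g.comp H')
  have key : ∀ (k : C(C, C)) (i : C(C, C × I)), k = H'.comp i →
      (IsHEquiv (mapC (f.comp H') (g.comp H') i)) →
      (IsHEquiv (mapC f g k) ↔ IsHEquiv (mapC f g H')) := by
    rintro _ i rfl h1
    have : mapC f g (H'.comp i) = (mapC f g H').comp (mapC (f.comp H') (g.comp H') i) := by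
      ext x
      induction x using DMC.ind <;> rfl
    rw [this]
    exact ⟨fun h2 => h2.of_comp_right h1, fun h2 => h2.comp h1⟩
  rw [key h _ e0.symm c0, ← key _ _ e1.symm c1]
  have : mapC f g (ContinuousMap.id C) = ContinuousMap.id _ := by
    ext x
    induction x using DMC.ind <;> rfl
  rw [this]
  exact isHEquiv_id

theorem isHEquiv_mapC {C' : Type} [TopologicalSpace C'] (f : C(C, U)) (g : C(C, V)) {e : C(C', C)}
    (he : IsHEquiv e) : IsHEquiv (mapC f g e) := by
  obtain ⟨k, k1, k2⟩ := he
  have key : ∀ {C₁ C₂ : Type} [TopologicalSpace C₁] [TopologicalSpace C₂] (f : C(C₁, U))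
      (g : C(C₁, V)) (a : C(C₁, C₂)) (b : C(C₂, C₁)), (b.comp a).Homotopic (ContinuousMap.id _) →
      IsHEquiv ((mapC f g b).comp (mapC (f.comp b) (g.comp b) a)) := by
    intro C₁ C₂ _ _ f g a b h
    refine (isHEquiv_mapC_of_homotopic_id f g h).of_homotopic ?_
    have : ((mapC f g b).comp (mapC (f.comp b) (g.comp b) a)) = mapC f g (b.comp a) := by
      ext x
      induction x using DMC.ind <;> rfl
    rw [this]
  have h1 := key f g k e k2
  have h2 := key (f.comp e) (g.comp e) e k k1
  exact IsHEquiv.of_comp_right h1 (IsHEquiv.two_of_six h1 h2)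

/-- Self-maps of the left space homotopic to the identity. -/
theorem isHEquiv_mapU_of_homotopic_id (f : C(C, U)) (g : C(C, V)) {k : C(U, U)}
    (hk : k.Homotopic (ContinuousMap.id U)) : IsHEquiv (mapU f g k) := by
  obtain ⟨K⟩ := hk.symm
  let F : C(C × I, U) :=
    (K.toContinuousMap.comp ContinuousMap.prodSwap).comp (f.prodMap (ContinuousMap.id I))
  let G : C(C × I, V) := g.comp ContinuousMap.fst
  have e0 : F.comp (slice C 0) = f := by ext x; simp [F, slice]
  have e1 : F.comp (slice C 1) = k.comp f := by ext x; simp [F, slice]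
  have c0 := isHEquiv_slice_zero F G
  have c1 := isHEquiv_slice_one F G
  have key : ∀ (f0 f1 : C(C, U)) (h0 : F.comp (slice C 0) = f0) (h1 : F.comp (slice C 1) = f1)
      (hK : ∀ c r, F (c, r) = K (r, f0 c)) (m : C(DMC f0 g, DMC f1 g)), (∀ u, m (inU _ _ u) = inU _ _ (k u)) →
      (∀ p, m (cyl _ _ p) = cyl _ _ p) → (∀ v, m (inV _ _ v) = inV _ _ v) → IsHEquiv m := by
    rintro _ _ rfl rfl hK m mU mC mV
    refine IsHEquiv.of_comp_left (g := mapC F G (slice C 1)) ?_ c1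
    refine c0.of_homotopic (ContinuousMap.Homotopic.symm ?_)
    refine homotopic_of ((inU F G).comp K.toContinuousMap)
      ((cyl F G).comp ⟨fun p => ((p.2.1, p.1), p.2.2), by fun_prop⟩)
      ((inV F G).comp ContinuousMap.snd) ?_ ?_ ?_ ?_ ?_ ?_ ?_ ?_
    · intro r c
      exact (cyl_zero (f := F) (g := G) (c, r)).trans (congrArg (inU F G) (hK c r))
    · intro r c
      exact cyl_one (f := F) (g := G) (c, r)
    · intro u
      exact congrArg (inU F G) (K.apply_zero u)
    · intro u
      refine (congrArg (inU F G) (K.apply_one u)).trans ?_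
      exact (congrArg (mapC F G (slice C 1)) (mU u)).symm
    · intro u; rfl
    · intro u
      exact (congrArg (mapC F G (slice C 1)) (mC u)).symm
    · intro u; rfl
    · intro u
      exact (congrArg (mapC F G (slice C 1)) (mV u)).symm
  exact key _ _ e0 e1 (fun c r => rfl) _ (fun u => rfl) (fun u => rfl) (fun u => rfl)

theorem isHEquiv_mapU {U' : Type} [TopologicalSpace U'] (f : C(C, U)) (g : C(C, V)) {e : C(U, U')}
    (he : IsHEquiv e) : IsHEquiv (mapU f g e) := by
  obtain ⟨k, k1, k2⟩ := he
  have key : ∀ {U₁ U₂ : Type} [TopologicalSpace U₁] [TopologicalSpace U₂] (f : C(C, U₁))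
      (a : C(U₁, U₂)) (b : C(U₂, U₁)), (b.comp a).Homotopic (ContinuousMap.id _) →
      IsHEquiv ((mapU (a.comp f) g b).comp (mapU f g a)) := by
    intro U₁ U₂ _ _ f a b h
    refine (isHEquiv_mapU_of_homotopic_id f g h).of_homotopic ?_
    have : ((mapU (a.comp f) g b).comp (mapU f g a)) = mapU f g (b.comp a) := by
      ext x
      induction x using DMC.ind <;> rfl
    rw [this]
  have h1 := key f e k k1
  have h2 := key (e.comp f) k e k2
  exact IsHEquiv.of_comp_left h1 (IsHEquiv.two_of_six h2 h1)

/-- Exchanging the two ends. -/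
def swapHomeo (f : C(C, U)) (g : C(C, V)) : DMC f g ≃ₜ DMC g f := 
  let k : ∀ {U V : Type} [TopologicalSpace U] [TopologicalSpace V] (f : C(C, U)) (g : C(C, V)),
    C(DMC f g, DMC g f) := fun f g =>
      descC (inV g f) ((cyl g f).comp (flip C)) (inU g f)
        (fun c => by
          have := cyl_one (f := g) (g := f) c
          simpa [flip] using this)
        (fun c => by
          have := cyl_zero (f := g) (g := f) c
          simpa [flip] using this)
  have hk : ∀ {U V : Type} [TopologicalSpace U] [TopologicalSpace V] (f : C(C, U)) (g : C(C, V)),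
    ∀ x, k g f (k f g x) = x := by
      intro U V _ _ f g x
      induction x using DMC.ind with
      | hU u => rfl
      | hV u => rfl
      | hC c t =>
        change cyl _ _ (flip C (flip C (c, t))) = cyl _ _ (c, t)
        rw [show flip C (flip C (c, t)) = (c, t) from DFunLike.congr_fun flip_flip (c, t)]
  { toFun := k f g
    invFun := k g f
    left_inv := hk f g
    right_inv := hk g f
    continuous_toFun := (k f g).continuous
    continuous_invFun := (k g f).continuous }

end
end DMC

namespace DMC

section Cover
variable {X : Type} [TopologicalSpace X] (U V : Set X)

/-- The inclusions of the intersection of two subsets. -/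
def interL : C(↥(U ∩ V), ↥U) := ⟨fun x => ⟨x.1, x.2.1⟩, by fun_prop⟩
def interR : C(↥(U ∩ V), ↥V) := ⟨fun x => ⟨x.1, x.2.2⟩, by fun_prop⟩

variable {U V}

open Classical in
/-- The point of the double mapping cylinder over `x`, at height `ρ` where this makes sense. -/
def lev (hUV : U ∪ V = Set.univ) (x : X) (ρ : ℝ) : DMC (interL U V) (interR U V) :=
  if h : x ∈ U ∩ V then cylR _ _ (⟨x, h⟩, ρ)
  else if hU : x ∈ U then inU _ _ ⟨x, hU⟩
  else inV _ _ ⟨x, ((hUV.symm ▸ Set.mem_univ x : x ∈ U ∪ V)).resolve_left hU⟩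

theorem lev_inter (hUV : U ∪ V = Set.univ) {x : X} (h : x ∈ U ∩ V) (ρ : ℝ) :
    lev hUV x ρ = cylR _ _ (⟨x, h⟩, ρ) := by simp only [lev, dif_pos h]

theorem lev_left (hUV : U ∪ V = Set.univ) {x : X} (h : x ∈ U) {ρ : ℝ} (hρ : x ∈ V → ρ ≤ 0) :
    lev hUV x ρ = inU _ _ ⟨x, h⟩ := by
  by_cases hV : x ∈ V
  · rw [lev_inter hUV ⟨h, hV⟩, cylR_le _ (hρ hV)]; rfl
  · simp [lev, h, hV]

theorem lev_right (hUV : U ∪ V = Set.univ) {x : X} (h : x ∈ V) {ρ : ℝ} (hρ : x ∈ U → 1 ≤ ρ) :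
    lev hUV x ρ = inV _ _ ⟨x, h⟩ := by
  by_cases hU : x ∈ U
  · rw [lev_inter hUV ⟨hU, h⟩, cylR_ge _ (hρ hU)]; rfl
  · simp [lev, hU]

theorem continuousAt_of_isOpen {T W : Type*} [TopologicalSpace T] [TopologicalSpace W] {k : T → W}
    {O : Set T} (hO : IsOpen O) {p : T} (hp : p ∈ O) (h : Continuous fun q : O => k q) :
    ContinuousAt k p :=
  (continuousOn_iff_continuous_domRestrict.2 h).continuousAt (hO.mem_nhds hp)

theorem continuous_lev (hUV : U ∪ V = Set.univ) (hU : IsOpen U) (hV : IsOpen V)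
    {T : Type} [TopologicalSpace T] {x : T → X} (hx : Continuous x) {ρ : T → ℝ} (hρ : Continuous ρ)
    (hA : ∀ p, x p ∉ V → ∀ᶠ q in 𝓝 p, ρ q ≤ 0) (hB : ∀ p, x p ∉ U → ∀ᶠ q in 𝓝 p, 1 ≤ ρ q) :
    Continuous fun p => lev hUV (x p) (ρ p) := by
  rw [continuous_iff_continuousAt]
  intro p
  by_cases pV : x p ∈ V
  · by_cases pU : x p ∈ U
    · refine continuousAt_of_isOpen (O := x ⁻¹' (U ∩ V)) ((hU.inter hV).preimage hx) ⟨pU, pV⟩ ?_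
      have : (fun q : x ⁻¹' (U ∩ V) => lev hUV (x q) (ρ q)) =
        fun q : x ⁻¹' (U ∩ V) => cylR (interL U V) (interR U V) (⟨x q, q.2⟩, ρ q) := by
        ext q; exact lev_inter hUV q.2 _
      rw [this]
      fun_prop
    · obtain ⟨O, hO1, hO2, hO3⟩ := eventually_nhds_iff.1 (hB p pU)
      refine continuousAt_of_isOpen (O := O ∩ x ⁻¹' V) (hO2.inter (hV.preimage hx)) ⟨hO3, pV⟩ ?_
      have : (fun q : ↥(O ∩ x ⁻¹' V) => lev hUV (x q) (ρ q)) =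
        fun q => inV _ _ ⟨x q, q.2.2⟩ := by
        ext q; exact lev_right hUV q.2.2 (fun _ => hO1 q q.2.1)
      rw [this]
      fun_prop
  · have pU : x p ∈ U := (hUV.symm ▸ Set.mem_univ (x p) : x p ∈ U ∪ V).resolve_right pV
    obtain ⟨O, hO1, hO2, hO3⟩ := eventually_nhds_iff.1 (hA p pV)
    refine continuousAt_of_isOpen (O := O ∩ x ⁻¹' U) (hO2.inter (hU.preimage hx)) ⟨hO3, pU⟩ ?_
    have : (fun q : ↥(O ∩ x ⁻¹' U) => lev hUV (x q) (ρ q)) =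
      fun q => inU _ _ ⟨x q, q.2.2⟩ := by
      ext q; exact lev_left hUV q.2.2 (fun _ => hO1 q q.2.1)
    rw [this]
    fun_prop

/-- A space covered by two open subsets is a homotopy pushout. -/
theorem nonempty_equiv_cover [NormalSpace X] (hUV : U ∪ V = Set.univ) (hU : IsOpen U)
    (hV : IsOpen V) : Nonempty (X ≃ₕ DMC (interL U V) (interR U V)) := by
  have mem : ∀ x, x ∈ U ∪ V := fun x => hUV.symm ▸ Set.mem_univ x
  obtain ⟨θ, hθ0, hθ1, -⟩ := exists_continuous_zero_one_of_isClosed (s := Vᶜ) (t := Uᶜ)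
    hV.isClosed_compl hU.isClosed_compl (by
      rw [Set.disjoint_left]
      intro x h1 h2
      exact (mem x).elim h2 h1)
  let τ : X → ℝ := fun x => cl (3 * θ x - 1)
  have hτ : Continuous τ := by unfold τ; fun_prop
  have τ0 : ∀ x, x ∉ V → ∀ᶠ y in 𝓝 x, τ y = 0 := by
    intro x hx
    have h1 : θ x = 0 := hθ0 hx
    have : ∀ᶠ y in 𝓝 x, θ y < 1 / 3 :=
      θ.continuous.continuousAt.eventually_lt continuousAt_const (by rw [h1]; norm_num)
    filter_upwards [this] with y hy
    simp only [τ]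
    rw [cl_le (by linarith)]; rfl
  have τ1 : ∀ x, x ∉ U → ∀ᶠ y in 𝓝 x, τ y = 1 := by
    intro x hx
    have h1 : θ x = 1 := hθ1 hx
    have : ∀ᶠ y in 𝓝 x, 2 / 3 < θ y :=
      continuousAt_const.eventually_lt θ.continuous.continuousAt (by rw [h1]; norm_num)
    filter_upwards [this] with y hy
    simp only [τ]
    rw [cl_ge (by linarith)]; rfl
  let s : C(X, DMC (interL U V) (interR U V)) := ⟨fun x => lev hUV x (τ x),
    continuous_lev hUV hU hV continuous_id hτ
      (fun p hp => (τ0 p hp).mono fun q hq => hq.le) (fun p hp => (τ1 p hp).mono fun q hq => hq.ge)⟩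
  let π : C(DMC (interL U V) (interR U V), X) := descC ⟨Subtype.val, continuous_subtype_val⟩
    ⟨fun p => p.1.1, by fun_prop⟩ ⟨Subtype.val, continuous_subtype_val⟩ (fun _ => rfl) (fun _ => rfl)
  refine ⟨⟨s, π, ?_, ?_⟩⟩
  · have : π.comp s = ContinuousMap.id X := by
      ext x
      change π (lev hUV x (τ x)) = x
      unfold lev
      split_ifs <;> rfl
    rw [this]
  · refine ContinuousMap.Homotopic.symm ?_
    refine homotopic_of
      ⟨fun p => lev hUV (p.2 : X) (p.1 * τ p.2), continuous_lev hUV hU hV (by fun_prop) (by fun_prop) ?_ ?_⟩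
      ⟨fun p => cylR _ _ (p.2.1, (1 - p.1) * p.2.2 + p.1 * τ p.2.1), by fun_prop⟩
      ⟨fun p => lev hUV (p.2 : X) (1 - p.1 + p.1 * τ p.2), continuous_lev hUV hU hV (by fun_prop) (by fun_prop) ?_ ?_⟩
      ?_ ?_ ?_ ?_ ?_ ?_ ?_ ?_
    · rintro ⟨r, u⟩ h
      have : Tendsto (fun q : I × U => (q.2 : X)) (𝓝 (r, u)) (𝓝 u) :=
        (by fun_prop : Continuous (fun q : I × U => (q.2 : X))).tendsto (r, u)
      filter_upwards [this.eventually (τ0 _ h)] with q hq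
      rw [hq, mul_zero]
    · rintro ⟨r, u⟩ h
      exact (h u.2).elim
    · rintro ⟨r, u⟩ h
      exact (h u.2).elim
    · rintro ⟨r, u⟩ h
      have : Tendsto (fun q : I × V => (q.2 : X)) (𝓝 (r, u)) (𝓝 u) :=
        (by fun_prop : Continuous (fun q : I × V => (q.2 : X))).tendsto (r, u)
      filter_upwards [this.eventually (τ1 _ h)] with q hq
      rw [hq, mul_one]; simp
    · intro r c
      change cylR _ _ _ = lev hUV _ _
      rw [lev_inter hUV (x := (interL U V c : X)) c.2]
      simp [interL]
    · intro r c
      change cylR _ _ _ = lev hUV _ _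
      rw [lev_inter hUV (x := (interR U V c : X)) c.2]
      simp [interR]
    · intro u
      exact lev_left hUV u.2 (fun _ => by simp)
    · intro u
      change lev hUV _ _ = lev hUV _ _
      simp [π]; rfl
    · rintro ⟨c, t⟩
      simp [cylR_coe]
    · rintro ⟨c, t⟩
      change cylR _ _ _ = lev hUV _ _
      rw [lev_inter hUV (by exact c.2)]
      simp [π]; rfl
    · intro u
      exact lev_right hUV u.2 (fun _ => by simp)
    · intro u
      change lev hUV _ _ = lev hUV _ _
      simp [π]; rfl
end Cover
end DMC

/-! Cells. -/

theorem exists_ball_prod_homeo (d : ℕ) : ∃ h : (cellBall d × I) ≃ₜ cellBall (d + 1),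
    ∀ p, ((h p : EuclideanSpace ℝ (Fin (d + 1))) ∈ cellSphere (d + 1) ↔
      (p.1 : EuclideanSpace ℝ (Fin d)) ∈ cellSphere d ∨ p.2 = 0 ∨ p.2 = 1) := by
  let E := EuclideanSpace ℝ (Fin d)
  let L : (E × ℝ) ≃L[ℝ] EuclideanSpace ℝ (Fin (d + 1)) :=
    ContinuousLinearEquiv.ofFinrankEq (by simp [E])
  let s : Set (E × ℝ) := Metric.closedBall 0 1 ×ˢ Set.Icc 0 1
  have hs : Convex ℝ s := (convex_closedBall _ _).prod (convex_Icc _ _)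
  have hsc : IsClosed s := Metric.isClosed_closedBall.prod isClosed_Icc
  have hsk : IsCompact s := (isCompact_closedBall _ _).prod isCompact_Icc
  have hi : (interior s).Nonempty := by
    rw [interior_prod_eq, interior_closedBall _ one_ne_zero, interior_Icc]
    exact ⟨(0, 1 / 2), by simp, by norm_num⟩
  have hf : frontier s = (Metric.closedBall 0 1 ×ˢ {0, 1}) ∪ (Metric.sphere 0 1 ×ˢ Set.Icc 0 1) := by
    rw [frontier_prod_eq, frontier_closedBall _ one_ne_zero, frontier_Icc zero_le_one,
      closure_Icc, Metric.isClosed_closedBall.closure_eq]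
  obtain ⟨e, -, he2, he3⟩ := exists_homeomorph_image_interior_closure_frontier_eq_unitBall
    (s := L '' s) (hs.linear_image L.toLinearMap)
    (by
      have := L.toHomeomorph.image_interior s
      exact (show (interior (L.toHomeomorph '' s)).Nonempty by
        rw [← this]; exact hi.image _))
    (hsk.image L.continuous).isBounded
  let g : (E × ℝ) ≃ₜ EuclideanSpace ℝ (Fin (d + 1)) := L.toHomeomorph.trans e
  have g1 : g '' s = cellBall (d + 1) := by
    rw [(hsk.image L.continuous).isClosed.closure_eq] at he2
    rw [cellBall, ← he2, Set.image_image]; rfl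
  have g2 : g '' frontier s = cellSphere (d + 1) := by
    rw [cellSphere, ← he3]
    have : frontier (L '' s) = L '' frontier s := (L.toHomeomorph.image_frontier s).symm
    rw [this, Set.image_image]; rfl
  let k : (cellBall d × I) ≃ₜ s := 
    { toFun := fun p => ⟨(p.1, p.2), p.1.2, p.2.2⟩
      invFun := fun p => (⟨p.1.1, p.2.1⟩, ⟨p.1.2, p.2.2⟩)
      left_inv := fun p => rfl
      right_inv := fun p => rfl
      continuous_toFun := by fun_prop
      continuous_invFun := by fun_prop }
  refine ⟨(k.trans (g.image s)).trans (Homeomorph.setCongr g1), fun p => ?_⟩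
  change g ((p.1 : E), (p.2 : ℝ)) ∈ _ ↔ _
  rw [← g2, g.injective.mem_set_image, hf]
  have h1 : (p.1 : E) ∈ Metric.closedBall (0 : E) 1 := p.1.2
  have h2 := p.2.2
  have e0 : (p.2 : ℝ) = 0 ↔ p.2 = 0 := Set.Icc.coe_eq_zero
  have e1 : (p.2 : ℝ) = 1 ↔ p.2 = 1 := Set.Icc.coe_eq_one
  simp only [Set.mem_union, Set.mem_prod, h1, h2, Set.mem_insert_iff, Set.mem_singleton_iff, e0, e1,
    true_and, and_true, cellSphere]
  exact or_comm

namespace Att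
section
variable {d : ℕ} {A W : Type} [TopologicalSpace A] [TopologicalSpace W]
  (φ : C(↥(cellSphere d), A))

/-- The inclusion of the sphere in the ball. -/
def bd (x : cellSphere d) : cellBall d := ⟨x.1, Metric.sphere_subset_closedBall x.2⟩

theorem continuous_bd : Continuous (bd (d := d)) := by unfold bd; fun_prop

def proj : C(A ⊕ cellBall d, attachSp φ) := ⟨Quot.mk _, continuous_quot_mk⟩
def inA : C(A, attachSp φ) := (proj φ).comp ⟨Sum.inl, continuous_inl⟩
def inB : C(cellBall d, attachSp φ) := (proj φ).comp ⟨Sum.inr, continuous_inr⟩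

theorem glue (x : cellSphere d) : inA φ (φ x) = inB φ (bd x) := Quot.sound ⟨x, rfl, rfl⟩

variable {φ}

theorem isQuotientMap_proj : Topology.IsQuotientMap (proj φ) := isQuotientMap_quot_mk

@[elab_as_elim]
theorem ind {p : attachSp φ → Prop} (hA : ∀ u, p (inA φ u)) (hB : ∀ v, p (inB φ v))
    (x : attachSp φ) : p x := by
  induction x using Quot.ind with
  | mk a =>
    rcases a with u | v
    exacts [hA u, hB v]

def desc {W : Type} (a : A → W) (b : cellBall d → W) (h : ∀ x, a (φ x) = b (bd x)) :
    attachSp φ → W :=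
  Quot.lift (Sum.elim a b) (by
    rintro _ _ ⟨x, rfl, rfl⟩
    exact h x)

theorem continuous_iff {k : attachSp φ → W} :
    Continuous k ↔ Continuous (k ∘ inA φ) ∧ Continuous (k ∘ inB φ) := by
  constructor
  · intro h
    exact ⟨by fun_prop, by fun_prop⟩
  · rintro ⟨h1, h2⟩
    rw [isQuotientMap_proj.continuous_iff]
    exact continuous_sum_dom.2 ⟨h1, h2⟩

theorem continuous_prod {T : Type} [TopologicalSpace T] [LocallyCompactSpace T]
    {k : attachSp φ × T → W}
    (hA : Continuous fun p : A × T => k (inA φ p.1, p.2))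
    (hB : Continuous fun p : cellBall d × T => k (inB φ p.1, p.2)) : Continuous k := by
  refine isQuotientMap_proj.continuous_lift_prod_left ?_
  refine ((Homeomorph.sumProdDistrib (X := A) (Y := cellBall d)
    (Z := T)).symm.isQuotientMap.continuous_iff).2 ?_
  exact continuous_sum_dom.2 ⟨hA, hB⟩

def descC (a : C(A, W)) (b : C(cellBall d, W)) (h : ∀ x, a (φ x) = b (bd x)) : C(attachSp φ, W) :=
  ⟨desc a b h, continuous_iff.2 ⟨a.continuous, b.continuous⟩⟩

end
end Att

theorem closed_cover_three {X Y : Type*} [TopologicalSpace X] [TopologicalSpace Y] {f : X → Y}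
    {a b c : Set X} (ha : IsClosed a) (hb : IsClosed b) (hc : IsClosed c)
    (h : ∀ x, x ∈ a ∨ x ∈ b ∨ x ∈ c) (fa : Continuous fun x : a => f x)
    (fb : Continuous fun x : b => f x) (fc : Continuous fun x : c => f x) : Continuous f := by
  have fa' : ContinuousOn f a := continuousOn_iff_continuous_domRestrict.2 fa
  have fb' : ContinuousOn f b := continuousOn_iff_continuous_domRestrict.2 fb
  have fc' : ContinuousOn f c := continuousOn_iff_continuous_domRestrict.2 fc
  have := (fa'.union_of_isClosed (fb'.union_of_isClosed fc' hb hc) ha (hb.union hc))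
  rw [← continuousOn_univ]
  convert this using 1
  ext x
  simpa using h x

section
variable {d : ℕ} {A U V : Type} [TopologicalSpace A] [TopologicalSpace U] [TopologicalSpace V]
  (φ : C(↥(cellSphere d), A)) (f : C(attachSp φ, U)) (g : C(attachSp φ, V))

open Classical in
/-- The attaching map of the cell `D^d × I` of a double mapping cylinder, before identifying
the boundary of `D^d × I` with a sphere. -/
def cylBd (p : cellBall d × I) : DMC (f.comp (Att.inA φ)) (g.comp (Att.inA φ)) :=
  if p.2 = 0 then DMC.inU _ _ (f (Att.inB φ p.1))
  else if p.2 = 1 then DMC.inV _ _ (g (Att.inB φ p.1))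
  else if h : (p.1 : EuclideanSpace ℝ (Fin d)) ∈ cellSphere d then
    DMC.cyl _ _ (φ ⟨p.1, h⟩, p.2)
  else DMC.inU _ _ (f (Att.inB φ p.1))

theorem cylBd_zero (x) : cylBd φ f g (x, 0) = DMC.inU _ _ (f (Att.inB φ x)) := by simp [cylBd]
theorem cylBd_one (x) : cylBd φ f g (x, 1) = DMC.inV _ _ (g (Att.inB φ x)) := by simp [cylBd]
theorem cylBd_side (x t) : cylBd φ f g (Att.bd x, t) = DMC.cyl _ _ (φ x, t) := by
  by_cases h0 : t = 0
  · subst h0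
    rw [cylBd_zero, DMC.cyl_zero, ← Att.glue]; rfl
  by_cases h1 : t = 1
  · subst h1
    rw [cylBd_one, DMC.cyl_one, ← Att.glue]; rfl
  simp [cylBd, h0, h1, Att.bd]

theorem mapC_cylBd (p : cellBall d × I)
    (hp : (p.1 : EuclideanSpace ℝ (Fin d)) ∈ cellSphere d ∨ p.2 = 0 ∨ p.2 = 1) :
    DMC.mapC f g (Att.inA φ) (cylBd φ f g p) = DMC.cyl f g (Att.inB φ p.1, p.2) := by
  obtain ⟨x, t⟩ := p
  rcases hp with h | h | h
  · obtain ⟨y, rfl⟩ : ∃ y, x = Att.bd y := ⟨⟨x, h⟩, rfl⟩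
    rw [cylBd_side, ← Att.glue]; rfl
  · obtain rfl : t = 0 := h
    rw [cylBd_zero, DMC.cyl_zero]; rfl
  · obtain rfl : t = 1 := h
    rw [cylBd_one, DMC.cyl_one]; rfl

theorem continuous_cylBd {T : Type} [TopologicalSpace T] {k : T → cellBall d × I}
    (hk : Continuous k) (h : ∀ p, ((k p).1 : EuclideanSpace ℝ (Fin d)) ∈ cellSphere d ∨
      (k p).2 = 0 ∨ (k p).2 = 1) : Continuous fun p => cylBd φ f g (k p) := by
  refine closed_cover_three
    (a := {p | ((k p).1 : EuclideanSpace ℝ (Fin d)) ∈ cellSphere d})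
    (b := {p | (k p).2 = 0}) (c := {p | (k p).2 = 1})
    (Metric.isClosed_sphere.preimage (by fun_prop))
    (isClosed_eq (by fun_prop) continuous_const) (isClosed_eq (by fun_prop) continuous_const) h
    ?_ ?_ ?_
  · have : (fun p : {p | ((k p).1 : EuclideanSpace ℝ (Fin d)) ∈ cellSphere d} =>
      cylBd φ f g (k p)) =
      fun p : {p | ((k p).1 : EuclideanSpace ℝ (Fin d)) ∈ cellSphere d} =>
        DMC.cyl _ _ (φ ⟨(k p).1, p.2⟩, (k p).2) := by
      ext p
      exact cylBd_side φ f g ⟨(k p).1, p.2⟩ (k p).2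
    rw [this]
    fun_prop
  · have : (fun p : {p | (k p).2 = 0} => cylBd φ f g (k p)) =
      fun p : {p | (k p).2 = 0} => DMC.inU _ _ (f (Att.inB φ (k p).1)) := by
      ext p
      rw [← cylBd_zero]
      exact congrArg (cylBd φ f g) (Prod.ext rfl p.2)
    rw [this]
    fun_prop
  · have : (fun p : {p | (k p).2 = 1} => cylBd φ f g (k p)) =
      fun p : {p | (k p).2 = 1} => DMC.inV _ _ (g (Att.inB φ (k p).1)) := by
      ext p
      rw [← cylBd_one]
      exact congrArg (cylBd φ f g) (Prod.ext rfl p.2)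
    rw [this]
    fun_prop

/-- A cell of the middle space gives a cell of the double mapping cylinder, one dimension up. -/
theorem exists_attach_DMC : ∃ ψ : C(↥(cellSphere (d + 1)),
    DMC (f.comp (Att.inA φ)) (g.comp (Att.inA φ))), Nonempty (DMC f g ≃ₜ attachSp ψ) := by
  obtain ⟨h, hh⟩ := exists_ball_prod_homeo d
  have hs : ∀ y : cellSphere (d + 1), ((h.symm (Att.bd y)).1 : EuclideanSpace ℝ (Fin d)) ∈
      cellSphere d ∨ (h.symm (Att.bd y)).2 = 0 ∨ (h.symm (Att.bd y)).2 = 1 := by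
    intro y
    rw [← hh, h.apply_symm_apply]
    exact y.2
  obtain ⟨ψ, hψ⟩ : ∃ ψ : C(↥(cellSphere (d + 1)), DMC (f.comp (Att.inA φ)) (g.comp (Att.inA φ))),
      ∀ y, ψ y = cylBd φ f g (h.symm (Att.bd y)) :=
    ⟨⟨fun y => cylBd φ f g (h.symm (Att.bd y)),
      continuous_cylBd φ f g (h.symm.continuous.comp Att.continuous_bd) hs⟩, fun _ => rfl⟩
  have key : ∀ p : cellBall d × I, (p.1 : EuclideanSpace ℝ (Fin d)) ∈ cellSphere d ∨
      p.2 = 0 ∨ p.2 = 1 → Att.inA ψ (cylBd φ f g p) = Att.inB ψ (h p) := by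
    intro p hp
    obtain ⟨y, hy⟩ : ∃ y, h p = Att.bd y := ⟨⟨h p, (hh p).2 hp⟩, rfl⟩
    rw [hy, ← Att.glue, hψ, ← hy, h.symm_apply_apply]
  have key' : ∀ (x : cellSphere d) (t : I),
      Att.inA ψ (DMC.cyl _ _ (φ x, t)) = Att.inB ψ (h (Att.bd x, t)) := fun x t =>
    (congrArg (Att.inA ψ) (cylBd_side φ f g x t)).symm.trans (key (Att.bd x, t) (Or.inl x.2))
  refine ⟨ψ, ⟨?_⟩⟩
  let cylF : attachSp φ × I → attachSp ψ := fun p =>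
    Att.desc (φ := φ) (fun a => Att.inA ψ (DMC.cyl (f.comp (Att.inA φ)) (g.comp (Att.inA φ)) (a, p.2))) (fun x => Att.inB ψ (h (x, p.2)))
      (fun x => key' x p.2) p.1
  have cylFc : Continuous cylF := by
    refine Att.continuous_prod ?_ ?_
    · change Continuous fun p : A × I => Att.inA ψ (DMC.cyl (f.comp (Att.inA φ)) (g.comp (Att.inA φ)) (p.1, p.2))
      exact (Att.inA ψ).continuous.comp (DMC.cyl _ _).continuous
    · change Continuous fun p : cellBall d × I => Att.inB ψ (h (p.1, p.2))
      exact (Att.inB ψ).continuous.comp h.continuous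
  let F : C(DMC f g, attachSp ψ) := DMC.descC ((Att.inA ψ).comp (DMC.inU _ _)) ⟨cylF, cylFc⟩
    ((Att.inA ψ).comp (DMC.inV _ _))
    (by
      intro c
      induction c using Att.ind with
      | hA a => exact congrArg (Att.inA ψ) (DMC.cyl_zero (f := f.comp (Att.inA φ))
          (g := g.comp (Att.inA φ)) a)
      | hB x => exact (key (x, 0) (by simp)).symm.trans (congrArg _ (cylBd_zero φ f g x)))
    (by
      intro c
      induction c using Att.ind with
      | hA a => exact congrArg (Att.inA ψ) (DMC.cyl_one (f := f.comp (Att.inA φ))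
          (g := g.comp (Att.inA φ)) a)
      | hB x => exact (key (x, 1) (by simp)).symm.trans (congrArg _ (cylBd_one φ f g x)))
  let G : C(attachSp ψ, DMC f g) := Att.descC (DMC.mapC f g (Att.inA φ))
    ⟨fun y => DMC.cyl f g (Att.inB φ (h.symm y).1, (h.symm y).2), by fun_prop⟩
    (fun y => (congrArg _ (hψ y)).trans (mapC_cylBd φ f g _ (hs y)))
  refine ⟨⟨F, G, ?_, ?_⟩, F.continuous, G.continuous⟩
  · intro x
    induction x using DMC.ind with
    | hU u => rfl
    | hV u => rfl
    | hC c t =>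
      induction c using Att.ind with
      | hA a => rfl
      | hB x =>
        change DMC.cyl f g (Att.inB φ (h.symm (h (x, t))).1, (h.symm (h (x, t))).2) = _
        rw [h.symm_apply_apply]
  · intro x
    induction x using Att.ind with
    | hA a =>
      induction a using DMC.ind <;> rfl
    | hB y =>
      change Att.inB ψ (h ((h.symm y).1, (h.symm y).2)) = _
      rw [Prod.mk.eta, h.apply_symm_apply]

end

section
variable {d : ℕ} {A A' U : Type} [TopologicalSpace A] [TopologicalSpace A'] [TopologicalSpace U]

/-- Transport of an attaching map along a homeomorphism. -/
def attachHomeo (φ : C(↥(cellSphere d), A)) (e : A ≃ₜ A') :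
    attachSp φ ≃ₜ attachSp ((e : C(A, A')).comp φ) :=
  let F : C(attachSp φ, attachSp ((e : C(A, A')).comp φ)) :=
    Att.descC ((Att.inA _).comp e) (Att.inB _) (fun x => Att.glue ((e : C(A, A')).comp φ) x)
  let G : C(attachSp ((e : C(A, A')).comp φ), attachSp φ) :=
    Att.descC ((Att.inA _).comp e.symm) (Att.inB _) (fun x => by
      rw [← Att.glue]
      change Att.inA φ (e.symm (e (φ x))) = _
      rw [e.symm_apply_apply])
  { toFun := F
    invFun := G
    left_inv := fun x => by
      induction x using Att.ind with
      | hA a => exact congrArg (Att.inA φ) (e.symm_apply_apply a)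
      | hB a => rfl
    right_inv := fun x => by
      induction x using Att.ind with
      | hA a => exact congrArg (Att.inA _) (e.apply_symm_apply a)
      | hB a => rfl
    continuous_toFun := F.continuous
    continuous_invFun := G.continuous }

/-- Attaching a cell to the right summand of a disjoint union. -/
def attachSumHomeo (U : Type) [TopologicalSpace U] (φ : C(↥(cellSphere d), A)) :
    (U ⊕ attachSp φ) ≃ₜ
      attachSp (A := U ⊕ A) ((⟨Sum.inr, continuous_inr⟩ : C(A, U ⊕ A)).comp φ) :=
  let ψ : C(↥(cellSphere d), U ⊕ A) := (⟨Sum.inr, continuous_inr⟩ : C(A, U ⊕ A)).comp φ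
  let F1 : C(attachSp φ, attachSp ψ) :=
    Att.descC ((Att.inA ψ).comp ⟨Sum.inr, continuous_inr⟩) (Att.inB ψ) (fun x => Att.glue ψ x)
  let G : C(attachSp ψ, U ⊕ attachSp φ) :=
    Att.descC ⟨Sum.map id (Att.inA φ), continuous_id.sumMap (Att.inA φ).continuous⟩
      ⟨fun b => Sum.inr (Att.inB φ b), continuous_inr.comp (Att.inB φ).continuous⟩
      (fun x => congrArg Sum.inr (Att.glue φ x))
  { toFun := Sum.elim (fun u => Att.inA ψ (Sum.inl u)) F1
    invFun := G
    left_inv := fun x => by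
      rcases x with u | x
      · rfl
      · induction x using Att.ind <;> rfl
    right_inv := fun x => by
      induction x using Att.ind with
      | hA a => rcases a <;> rfl
      | hB a => rfl
    continuous_toFun := continuous_sum_dom.2
      ⟨(Att.inA ψ).continuous.comp continuous_inl, F1.continuous⟩
    continuous_invFun := G.continuous }

/-- Reparametrizing the middle space of a double mapping cylinder. -/
def DMC.mapCHomeo {C C' V : Type} [TopologicalSpace C] [TopologicalSpace C'] [TopologicalSpace V]
    (f : C(C, U)) (g : C(C, V)) (e : C' ≃ₜ C) :
    DMC (f.comp (e : C(C', C))) (g.comp (e : C(C', C))) ≃ₜ DMC f g :=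
  let G : C(DMC f g, DMC (f.comp (e : C(C', C))) (g.comp (e : C(C', C)))) :=
    DMC.descC (DMC.inU _ _) ((DMC.cyl _ _).comp ((e.symm : C(C, C')).prodMap (ContinuousMap.id I)))
      (DMC.inV _ _)
      (fun c => by
        have := DMC.cyl_zero (f := f.comp (e : C(C', C))) (g := g.comp (e : C(C', C))) (e.symm c)
        simpa using this)
      (fun c => by
        have := DMC.cyl_one (f := f.comp (e : C(C', C))) (g := g.comp (e : C(C', C))) (e.symm c)
        simpa using this)
  { toFun := DMC.mapC f g (e : C(C', C))
    invFun := G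
    left_inv := fun x => by
      induction x using DMC.ind with
      | hU u => rfl
      | hV u => rfl
      | hC c t => exact congrArg (fun c => DMC.cyl _ _ (c, t)) (e.symm_apply_apply c)
    right_inv := fun x => by
      induction x using DMC.ind with
      | hU u => rfl
      | hV u => rfl
      | hC c t => exact congrArg (fun c => DMC.cyl _ _ (c, t)) (e.apply_symm_apply c)
    continuous_toFun := (DMC.mapC f g (e : C(C', C))).continuous
    continuous_invFun := G.continuous }

/-- A double mapping cylinder with empty middle space. -/
def DMC.emptyHomeo {C V : Type} [TopologicalSpace C] [TopologicalSpace V] [IsEmpty C]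
    (f : C(C, U)) (g : C(C, V)) : (U ⊕ V) ≃ₜ DMC f g :=
  let G : C(DMC f g, U ⊕ V) := DMC.descC ⟨Sum.inl, continuous_inl⟩
      ⟨fun p => isEmptyElim p.1, by
        have : IsEmpty (C × I) := ⟨fun p => isEmptyElim p.1⟩
        exact continuous_of_const fun p => isEmptyElim p⟩ ⟨Sum.inr, continuous_inr⟩
      isEmptyElim isEmptyElim
  { toFun := Sum.elim (DMC.inU f g) (DMC.inV f g)
    invFun := G
    left_inv := fun x => by rcases x with u | x <;> rfl
    right_inv := fun x => by
      induction x using DMC.ind with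
      | hU u => rfl
      | hV u => rfl
      | hC c t => exact isEmptyElim c
    continuous_toFun := continuous_sum_dom.2 ⟨(DMC.inU f g).continuous, (DMC.inV f g).continuous⟩
    continuous_invFun := G.continuous }
end

/-! Cell structures. -/

theorem AttachedCells.congr_left {L : List ℕ} : ∀ {A A' Z : TopCat.{0}},
    AttachedCells A Z L → (A ≃ₜ A') → AttachedCells A' Z L := by
  cases L with
  | nil => rintro A Z Z' ⟨h⟩ e; exact ⟨e.symm.trans h⟩
  | cons d L =>
    rintro A Z Z' ⟨B, ⟨φ, ⟨h1⟩⟩, h2⟩ e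
    exact ⟨B, ⟨_, ⟨h1.trans (attachHomeo φ e)⟩⟩, h2⟩

theorem AttachedCells.trans {L L' : List ℕ} : ∀ {A B Z : TopCat.{0}},
    AttachedCells A B L → AttachedCells B Z L' → AttachedCells A Z (L ++ L') := by
  induction L with
  | nil => rintro A Z Z' ⟨h⟩ h'; exact h'.congr_left h.symm
  | cons d L ih => rintro A Z Z' ⟨B, h1, h2⟩ h'; exact ⟨B, h1, ih h2 h'⟩

theorem AttachedCells.sum_left {L : List ℕ} (U : Type) [TopologicalSpace U] :
    ∀ {A Z : TopCat.{0}},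
    AttachedCells A Z L → AttachedCells (TopCat.of (U ⊕ A)) (TopCat.of (U ⊕ Z)) L := by
  induction L with
  | nil => rintro A Z ⟨h⟩; exact ⟨(Homeomorph.refl U).sumCongr h⟩
  | cons d L ih =>
    rintro A Z ⟨B, ⟨φ, ⟨h1⟩⟩, h2⟩
    exact ⟨TopCat.of (U ⊕ B), ⟨_, ⟨((Homeomorph.refl U).sumCongr h1).trans
      (attachSumHomeo U φ)⟩⟩, ih h2⟩

/-- Disjoint unions of cell complexes. -/
theorem AttachedCells.sum {L L' : List ℕ} {Z Z' : TopCat.{0}}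
    (h : AttachedCells (TopCat.of Empty) Z L) (h' : AttachedCells (TopCat.of Empty) Z' L') :
    AttachedCells (TopCat.of Empty) (TopCat.of (Z ⊕ Z')) (L ++ L') :=
  h.trans ((h'.sum_left Z).congr_left (Homeomorph.sumEmpty Z Empty))

theorem AttachedCells.dmc {U V : Type} [TopologicalSpace U] [TopologicalSpace V] {L : List ℕ} :
    ∀ {A Z : TopCat.{0}}, AttachedCells A Z L → ∀ (f : C(Z, U)) (g : C(Z, V)),
    ∃ i : C(A, Z), AttachedCells (TopCat.of (DMC (f.comp i) (g.comp i))) (TopCat.of (DMC f g))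
      (L.map Nat.succ) := by
  induction L with
  | nil => 
    rintro A Z ⟨e⟩ f g
    exact ⟨e, ⟨DMC.mapCHomeo f g e⟩⟩
  | cons d L ih =>
    rintro A Z ⟨B, ⟨φ, ⟨e⟩⟩, h2⟩ f g
    obtain ⟨i, hi⟩ := ih h2 f g
    let j : C(attachSp φ, Z) := i.comp e.symm
    obtain ⟨ψ, ⟨hψ⟩⟩ := exists_attach_DMC φ (f.comp j) (g.comp j)
    refine ⟨j.comp (Att.inA φ), TopCat.of (DMC (f.comp i) (g.comp i)), ⟨ψ, ⟨?_⟩⟩, hi⟩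
    exact (DMC.mapCHomeo (f.comp i) (g.comp i) e.symm).symm.trans hψ

/-- The double mapping cylinder of cell complexes is a cell complex. -/
theorem AttachedCells.dmc_empty {U V C : TopCat.{0}} {LU LV LC : List ℕ}
    (hU : AttachedCells (TopCat.of Empty) U LU) (hV : AttachedCells (TopCat.of Empty) V LV)
    (hC : AttachedCells (TopCat.of Empty) C LC) (f : C(C, U)) (g : C(C, V)) :
    AttachedCells (TopCat.of Empty) (TopCat.of (DMC f g)) ((LU ++ LV) ++ LC.map Nat.succ) := by
  obtain ⟨i, hi⟩ := hC.dmc f g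
  refine (hU.sum hV).trans (hi.congr_left ?_)
  have : IsEmpty (TopCat.of Empty) := inferInstanceAs (IsEmpty Empty)
  exact (DMC.emptyHomeo _ _).symm

theorem HasEulerChar.congr {X Y : Type} [TopologicalSpace X] [TopologicalSpace Y] {c : ℤ}
    (h : HasEulerChar X c) (e : ContinuousMap.HomotopyEquiv X Y) : HasEulerChar Y c := by
  obtain ⟨Z, L, hZ, ⟨e'⟩, rfl⟩ := h
  exact ⟨Z, L, hZ, ⟨e.symm.trans e'⟩, rfl⟩

theorem HasEulerChar.congr_homeo {X Y : Type} [TopologicalSpace X] [TopologicalSpace Y] {c : ℤ}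
    (h : HasEulerChar X c) (e : X ≃ₜ Y) : HasEulerChar Y c := h.congr e.toHomotopyEquiv

theorem hasEulerChar_empty {X : Type} [TopologicalSpace X] [IsEmpty X] : HasEulerChar X 0 :=
  ⟨TopCat.of Empty, [], ⟨Homeomorph.refl _⟩, ⟨(Homeomorph.empty : X ≃ₜ Empty).toHomotopyEquiv⟩, rfl⟩

theorem isEmpty_cellSphere_zero : IsEmpty (cellSphere 0) := by
  refine ⟨fun x => ?_⟩
  have := mem_sphere_zero_iff_norm.1 x.2
  rw [Subsingleton.elim (x : EuclideanSpace ℝ (Fin 0)) 0, norm_zero] at this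
  exact zero_ne_one this

theorem attachedCells_unit : AttachedCells (TopCat.of Empty) (TopCat.of Unit) [0] := by
  have := isEmpty_cellSphere_zero
  refine ⟨TopCat.of Unit, ⟨⟨isEmptyElim, continuous_of_const isEmptyElim⟩, ⟨?_⟩⟩,
    ⟨Homeomorph.refl _⟩⟩
  let x0 : cellBall 0 := ⟨0, by simp [cellBall]⟩
  exact
  { toFun := fun _ => Att.inB _ x0
    invFun := fun _ => ()
    left_inv := fun x => rfl
    right_inv := fun x => by
      induction x using Att.ind with
      | hA a => exact a.elim
      | hB b => exact congrArg _ (Subtype.ext (Subsingleton.elim _ _))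
    continuous_toFun := continuous_const
    continuous_invFun := continuous_const }

theorem hasEulerChar_contractible {X : Type} [TopologicalSpace X] [ContractibleSpace X] :
    HasEulerChar X 1 :=
  ⟨TopCat.of Unit, [0], attachedCells_unit, ContractibleSpace.hequiv_unit X, by simp⟩

theorem list_eul_succ (L : List ℕ) : ((L.map Nat.succ).map fun d => (-1 : ℤ) ^ d).sum =
    - (L.map fun d => (-1 : ℤ) ^ d).sum := by
  induction L with
  | nil => simp
  | cons d L ih => simp only [List.map_cons, List.sum_cons, ih, pow_succ]; ring

/-- Euler characteristic of a homotopy pushout. -/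
theorem HasEulerChar.dmc {U V C : Type} [TopologicalSpace U] [TopologicalSpace V]
    [TopologicalSpace C] {a b c : ℤ} (hU : HasEulerChar U a) (hV : HasEulerChar V b)
    (hC : HasEulerChar C c) (f : C(C, U)) (g : C(C, V)) : HasEulerChar (DMC f g) (a + b - c) := by
  obtain ⟨ZU, LU, hLU, ⟨eU⟩, rfl⟩ := hU
  obtain ⟨ZV, LV, hLV, ⟨eV⟩, rfl⟩ := hV
  obtain ⟨ZC, LC, hLC, ⟨eC⟩, rfl⟩ := hC
  let f' := f.comp eC.symm.toFun
  let g' := g.comp eC.symm.toFun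
  have h1 : IsHEquiv (DMC.mapC f g eC.symm.toFun) := DMC.isHEquiv_mapC f g (isHEquiv_of_equiv eC.symm)
  have h2 : IsHEquiv (DMC.mapU f' g' eU.toFun) := DMC.isHEquiv_mapU f' g' (isHEquiv_of_equiv eU)
  have h3 : IsHEquiv (DMC.mapU g' (eU.toFun.comp f') eV.toFun) :=
    DMC.isHEquiv_mapU _ _ (isHEquiv_of_equiv eV)
  have h4 := AttachedCells.dmc_empty hLV hLU hLC (eV.toFun.comp g') (eU.toFun.comp f')
  obtain ⟨k1⟩ := h1.nonempty
  obtain ⟨k2⟩ := h2.nonempty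
  obtain ⟨k3⟩ := h3.nonempty
  refine ⟨_, _, h4, ⟨k1.symm.trans (k2.trans ((DMC.swapHomeo _ _).toHomotopyEquiv.trans k3))⟩, ?_⟩
  rw [List.map_append, List.sum_append, list_eul_succ, List.map_append, List.sum_append]
  ring

/-- Additivity of the Euler characteristic over open covers with two members. -/
theorem hasEulerChar_union {X : Type} [TopologicalSpace X] [NormalSpace X] {U V : Set X}
    {a b c : ℤ} (hUV : U ∪ V = Set.univ) (hU : IsOpen U) (hV : IsOpen V) (ha : HasEulerChar U a)
    (hb : HasEulerChar V b) (hc : HasEulerChar ↥(U ∩ V) c) : HasEulerChar X (a + b - c) := by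
  obtain ⟨e⟩ := DMC.nonempty_equiv_cover hUV hU hV
  exact (ha.dmc hb hc _ _).congr e.symm

/-! Euler characteristics of elementary spaces. -/

theorem HasEulerChar.sum {X Y : Type} [TopologicalSpace X] [TopologicalSpace Y] {a b : ℤ}
    (hX : HasEulerChar X a) (hY : HasEulerChar Y b) : HasEulerChar (X ⊕ Y) (a + b) := by
  have h := hX.dmc hY (hasEulerChar_empty (X := Empty)) ⟨Empty.elim, continuous_of_const (by rintro ⟨⟩)⟩
    ⟨Empty.elim, continuous_of_const (by rintro ⟨⟩)⟩
  rw [sub_zero] at h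
  exact h.congr_homeo (DMC.emptyHomeo _ _).symm

theorem HasEulerChar.contractible_prod {K Y : Type} [TopologicalSpace K] [TopologicalSpace Y]
    [ContractibleSpace K] {c : ℤ} (hY : HasEulerChar Y c) : HasEulerChar (K × Y) c := by
  obtain ⟨e⟩ := ContractibleSpace.hequiv_unit K
  exact hY.congr ((Homeomorph.uniqueProd Unit Y).symm.toHomotopyEquiv.trans
    (e.symm.prodCongr (ContinuousMap.HomotopyEquiv.refl Y)))

theorem HasEulerChar.fin_prod {Y : Type} [TopologicalSpace Y] {c : ℤ} (hY : HasEulerChar Y c)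
    (n : ℕ) : HasEulerChar (Fin n × Y) (n * c) := by
  induction n with
  | zero => simpa using hasEulerChar_empty
  | succ n ih =>
    have h := hY.sum ih
    have e : (Y ⊕ (Fin n × Y)) ≃ₜ (Fin (n + 1) × Y) :=
    { toFun := Sum.elim (fun y => (0, y)) (fun p => (p.1.succ, p.2))
      invFun := fun p => Fin.cases (motive := fun _ => Y ⊕ (Fin n × Y)) (Sum.inl p.2)
        (fun i => Sum.inr (i, p.2)) p.1
      left_inv := by rintro (y | ⟨i, y⟩) <;> rfl
      right_inv := by
        rintro ⟨i, y⟩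
        refine Fin.cases ?_ (fun i => ?_) i <;> rfl
      continuous_toFun := by
        refine continuous_sum_dom.2 ⟨?_, ?_⟩
        · exact (by fun_prop : Continuous fun y : Y => ((0 : Fin (n + 1)), y))
        · exact ((continuous_of_discreteTopology (f := Fin.succ)).comp continuous_fst).prodMk
            continuous_snd
      continuous_invFun := by
        refine continuous_prod_of_discrete_left.2 fun i => ?_
        refine Fin.cases ?_ (fun i => ?_) i
        · exact continuous_inl
        · exact continuous_inr.comp (continuous_const.prodMk continuous_id) }
    convert h.congr_homeo e using 1
    push_cast
    ring

theorem HasEulerChar.finite_prod {R Y : Type} [TopologicalSpace Y] [TopologicalSpace R]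
    [DiscreteTopology R] [Finite R] {c : ℤ} (hY : HasEulerChar Y c) :
    HasEulerChar (R × Y) (Nat.card R * c) := by
  let e := Finite.equivFin R
  exact (hY.fin_prod (Nat.card R)).congr_homeo
    ((Homeomorph.mk e.symm continuous_of_discreteTopology continuous_of_discreteTopology).prodCongr
      (Homeomorph.refl Y))

theorem hasEulerChar_finite {R : Type} [TopologicalSpace R]
    [DiscreteTopology R] [Finite R] : HasEulerChar R (Nat.card R) := by
  have h := (hasEulerChar_contractible (X := Unit)).finite_prod (R := R)
  rw [mul_one] at h
  exact h.congr_homeo (Homeomorph.prodUnique R Unit)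

/-- The subset version of `hasEulerChar_union`. -/
theorem hasEulerChar_union_set {X : Type} [TopologicalSpace X] [T2Space X]
    [TopologicalSpace.MetrizableSpace X] {S U V : Set X}
    {a b c : ℤ} (hUV : S ⊆ U ∪ V) (hU : IsOpen U) (hV : IsOpen V)
    (ha : HasEulerChar ↥(S ∩ U) a)
    (hb : HasEulerChar ↥(S ∩ V) b) (hc : HasEulerChar ↥(S ∩ (U ∩ V)) c) :
    HasEulerChar S (a + b - c) := by
  have key : ∀ W : Set X, ((S ∩ W : Set X) ≃ₜ ((↑) ⁻¹' W : Set S)) := fun W =>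
    { toFun := fun x => ⟨⟨x.1, x.2.1⟩, x.2.2⟩
      invFun := fun x => ⟨x.1.1, x.1.2, x.2⟩
      left_inv := fun x => rfl
      right_inv := fun x => rfl
      continuous_toFun := by fun_prop
      continuous_invFun := by fun_prop }
  let _ := TopologicalSpace.metrizableSpaceMetric X
  refine hasEulerChar_union (X := S) (U := (↑) ⁻¹' U) (V := (↑) ⁻¹' V) ?_
    (hU.preimage continuous_subtype_val) (hV.preimage continuous_subtype_val)
    (ha.congr_homeo (key U)) (hb.congr_homeo (key V)) (hc.congr_homeo
      (show _ ≃ₜ ↥(((↑) ⁻¹' U : Set S) ∩ ((↑) ⁻¹' V)) from key (U ∩ V)))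
  ext x
  simpa using hUV x.2

/-! Roots of unity and branches of roots. -/

/-- The `d`-th roots of unity. -/
abbrev RU (d : ℕ) : Type := {ζ : ℂ // ζ ^ d = 1}

theorem finite_RU {d : ℕ} (hd : d ≠ 0) : Finite (RU d) := by
  have : {ζ : ℂ | ζ ^ d = 1} = (Polynomial.nthRootsFinset d (1 : ℂ) : Set ℂ) := by
    ext x
    simp [Polynomial.mem_nthRootsFinset (Nat.pos_of_ne_zero hd)]
  exact Set.Finite.to_subtype (s := {ζ : ℂ | ζ ^ d = 1}) (this ▸ Finset.finite_toSet _)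

theorem card_RU {d : ℕ} (hd : d ≠ 0) : Nat.card (RU d) = d := by
  have : {ζ : ℂ | ζ ^ d = 1} = (Polynomial.nthRootsFinset d (1 : ℂ) : Set ℂ) := by
    ext x
    simp [Polynomial.mem_nthRootsFinset (Nat.pos_of_ne_zero hd)]
  have h2 : Nat.card {ζ : ℂ | ζ ^ d = 1} = d := by
    rw [this, Nat.card_coe_set_eq, Set.ncard_coe_finset]
    exact (Complex.isPrimitiveRoot_exp d hd).card_nthRootsFinset
  exact h2

theorem discrete_RU {d : ℕ} (hd : d ≠ 0) : DiscreteTopology (RU d) := by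
  have := finite_RU hd
  infer_instance

/-- The principal `d`-th root. -/
def rt (d : ℕ) (s : ℂ) : ℂ := s ^ ((d : ℂ)⁻¹)

theorem rt_pow {d : ℕ} (hd : d ≠ 0) (s : ℂ) : rt d s ^ d = s := Complex.cpow_nat_inv_pow s hd

theorem rt_ne_zero {d : ℕ} (hd : d ≠ 0) {s : ℂ} (hs : s ≠ 0) : rt d s ≠ 0 := by
  intro h
  apply hs
  rw [← rt_pow hd s, h, zero_pow hd]

theorem Continuous.rt {X : Type*} [TopologicalSpace X] {f : X → ℂ} (hf : Continuous f) (d : ℕ)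
    (h : ∀ x, f x ∈ Complex.slitPlane) : Continuous fun x => PaperED.rt d (f x) :=
  continuous_iff_continuousAt.2 fun x =>
    ContinuousAt.comp (f := f) (g := PaperED.rt d) (continuousAt_cpow_const (h x)) hf.continuousAt

/-- The set `{v | v ^ d = a}` has `d` elements. -/
def rootsHomeo {d : ℕ} (a : ℂ) (ha : a ≠ 0) (hd : d ≠ 0) : RU d ≃ₜ {w : ℂ | w ^ d = a} where
  toFun ζ := ⟨ζ.1 * rt d a, by simp [mul_pow, ζ.2, rt_pow hd]⟩
  invFun w := ⟨w.1 / rt d a, by rw [div_pow, rt_pow hd, w.2.out, div_self ha]⟩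
  left_inv ζ := Subtype.ext (mul_div_cancel_right₀ _ (rt_ne_zero hd ha))
  right_inv ζ := Subtype.ext (div_mul_cancel₀ _ (rt_ne_zero hd ha))
  continuous_toFun := by fun_prop
  continuous_invFun := by
    refine Continuous.subtype_mk ?_ _
    exact Continuous.div_const continuous_subtype_val _

theorem hasEulerChar_roots {d : ℕ} (a : ℂ) (ha : a ≠ 0) (hd : d ≠ 0) :
    HasEulerChar {w : ℂ | w ^ d = a} d := by
  have := finite_RU hd
  have := discrete_RU hd
  have h := hasEulerChar_finite (R := RU d)
  rw [card_RU hd] at h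
  exact h.congr_homeo (rootsHomeo a ha hd)

/-- Products as subsets. -/
def fstMemHomeo {X Y : Type} [TopologicalSpace X] [TopologicalSpace Y] (K : Set X) :
    (K × Y) ≃ₜ {p : X × Y | p.1 ∈ K} where
  toFun p := ⟨(p.1, p.2), p.1.2⟩
  invFun p := (⟨p.1.1, p.2⟩, p.1.2)
  left_inv _ := rfl
  right_inv _ := rfl
  continuous_toFun := by fun_prop
  continuous_invFun := by fun_prop

/-- The punctured disc. -/
def pDisc (r : ℝ) : Set ℂ := {x | x ≠ 0 ∧ ‖x‖ < r}

theorem HasEulerChar.congr_set {X : Type} [TopologicalSpace X] {S T : Set X} {a : ℤ}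
    (h : HasEulerChar S a) (e : S = T) : HasEulerChar T a := e ▸ h

theorem hasEulerChar_pDisc_prod {Y : Type} [TopologicalSpace Y] [TopologicalSpace.MetrizableSpace Y]
    {y : ℤ} (hY : HasEulerChar Y y) {r : ℝ} (hr : 0 < r) : HasEulerChar (pDisc r × Y) 0 := by
  have key : ∀ (K : Set ℂ) (x : ℂ), x ∈ K → StarConvex ℝ x K → 
      HasEulerChar {p : ℂ × Y | p.1 ∈ K} y := fun K x hx hK =>
    have := hK.contractibleSpace ⟨x, hx⟩
    (hY.contractible_prod (K := K)).congr_homeo (fstMemHomeo K)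
  have hball : Convex ℝ {x : ℂ | ‖x‖ < r} := by
    have : {x : ℂ | ‖x‖ < r} = Metric.ball 0 r := by ext; simp
    rw [this]
    exact convex_ball (0 : ℂ) r
  have hc : Continuous (fun p : ℂ × Y => p.1.im) := by fun_prop
  have e1 : ‖((r / 2 : ℝ) : ℂ)‖ < r := by
    rw [Complex.norm_real, Real.norm_of_nonneg (by positivity)]; linarith
  have e2 : ‖((r / 2 : ℝ) : ℂ) * Complex.I‖ < r := by simpa using e1
  have hpos : HasEulerChar {p : ℂ × Y | ‖p.1‖ < r ∧ p.1 ∈ Complex.slitPlane} y :=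
    key {x | ‖x‖ < r ∧ x ∈ Complex.slitPlane} ((r / 2 : ℝ) : ℂ)
      ⟨e1, Complex.ofReal_mem_slitPlane.2 (by positivity)⟩
      ((hball.starConvex e1).inter (Complex.starConvex_ofReal_slitPlane (by positivity)))
  have hneg : HasEulerChar {p : ℂ × Y | ‖p.1‖ < r ∧ -p.1 ∈ Complex.slitPlane} y := by
    refine hpos.congr_homeo ?_
    exact
    { toFun := fun p => ⟨(-p.1.1, p.1.2), by simpa [-Subtype.coe_prop] using p.2.out⟩
      invFun := fun p => ⟨(-p.1.1, p.1.2), by simpa [-Subtype.coe_prop] using p.2.out⟩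
      left_inv := fun p => by simp
      right_inv := fun p => by simp
      continuous_toFun := by fun_prop
      continuous_invFun := by fun_prop }
  have hup : HasEulerChar {p : ℂ × Y | ‖p.1‖ < r ∧ 0 < p.1.im} y :=
    key {x | ‖x‖ < r ∧ 0 < x.im} (((r / 2 : ℝ) : ℂ) * Complex.I)
      ⟨e2, by simpa using hr⟩
      ((hball.starConvex e2).inter ((convex_halfSpace_im_gt 0).starConvex (by simpa using hr)))
  have hdown : HasEulerChar {p : ℂ × Y | ‖p.1‖ < r ∧ p.1.im < 0} y := by
    refine key {x | ‖x‖ < r ∧ x.im < 0} (-(((r / 2 : ℝ) : ℂ) * Complex.I))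
      ⟨by rw [norm_neg]; exact e2, by simpa using hr⟩
      ((hball.starConvex (by rw [Set.mem_ofPred_eq, norm_neg]; exact e2)).inter
        ((convex_halfSpace_im_lt 0).starConvex (by simpa using hr)))
  have hmid : HasEulerChar {p : ℂ × Y | ‖p.1‖ < r ∧ p.1.im ≠ 0} (y + y - 0) := by
    refine hasEulerChar_union_set (U := {p : ℂ × Y | 0 < p.1.im}) (V := {p : ℂ × Y | p.1.im < 0}) ?_
      (isOpen_lt continuous_const hc) (isOpen_lt hc continuous_const) ?_ ?_ ?_
    · rintro p ⟨-, h⟩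
      exact (lt_or_gt_of_ne h).symm
    · refine hup.congr_set ?_
      ext p; simp only [Set.mem_inter_iff, Set.mem_ofPred_eq]
      exact ⟨fun h => ⟨⟨h.1, h.2.ne'⟩, h.2⟩, fun h => ⟨h.1.1, h.2⟩⟩
    · refine hdown.congr_set ?_
      ext p; simp only [Set.mem_inter_iff, Set.mem_ofPred_eq]
      exact ⟨fun h => ⟨⟨h.1, h.2.ne⟩, h.2⟩, fun h => ⟨h.1.1, h.2⟩⟩
    · have : IsEmpty ↥({p : ℂ × Y | ‖p.1‖ < r ∧ p.1.im ≠ 0} ∩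
          ({p | 0 < p.1.im} ∩ {p | p.1.im < 0})) := ⟨fun p => by
        have h1 : 0 < p.1.1.im := p.2.2.1
        exact lt_asymm h1 p.2.2.2⟩
      exact hasEulerChar_empty
  have : HasEulerChar {p : ℂ × Y | p.1 ∈ pDisc r} (y + y - (y + y - 0)) := by
    refine hasEulerChar_union_set (U := {p : ℂ × Y | p.1 ∈ Complex.slitPlane})
      (V := {p : ℂ × Y | -p.1 ∈ Complex.slitPlane}) ?_
      (Complex.isOpen_slitPlane.preimage continuous_fst)
      (Complex.isOpen_slitPlane.preimage continuous_fst.neg) ?_ ?_ ?_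
    · rintro p ⟨h, -⟩
      exact Complex.mem_slitPlane_or_neg_mem_slitPlane h
    · refine hpos.congr_set ?_
      ext p; simp only [Set.mem_inter_iff, Set.mem_ofPred_eq, pDisc]
      exact ⟨fun h => ⟨⟨Complex.slitPlane_ne_zero h.2, h.1⟩, h.2⟩, fun h => ⟨h.1.2, h.2⟩⟩
    · refine hneg.congr_set ?_
      ext p; simp only [Set.mem_inter_iff, Set.mem_ofPred_eq, pDisc]
      exact ⟨fun h => ⟨⟨neg_ne_zero.1 (Complex.slitPlane_ne_zero h.2), h.1⟩, h.2⟩,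
        fun h => ⟨h.1.2, h.2⟩⟩
    · refine hmid.congr_set ?_
      ext p; simp only [Set.mem_inter_iff, Set.mem_ofPred_eq, pDisc, Complex.mem_slitPlane_iff,
        Complex.neg_re, Complex.neg_im]
      constructor
      · rintro ⟨h, h1⟩
        refine ⟨⟨fun h0 => h1 (by simp [h0]), h⟩, Or.inr h1, Or.inr (by simpa using h1)⟩
      · rintro ⟨⟨-, h⟩, h1, h2⟩
        refine ⟨h, fun h0 => ?_⟩
        simp only [h0, ne_eq, not_true, neg_zero, or_false] at h1 h2
        linarith
  have h2 := this.congr_homeo (fstMemHomeo (Y := Y) (pDisc r)).symm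
  convert h2 using 1
  ring

section Join
variable {V : Type} [NormedAddCommGroup V] [NormedSpace ℂ V] {d : ℕ} {q : V → ℂ}

/-- The first chart of a join. -/
def joinHomeoA (hd : d ≠ 0) (hqh : ∀ (c : ℂ) v, q (c • v) = c ^ d * q v) {K : Set ℂ}
    (hK : ∀ x ∈ K, 1 - x ^ d ∈ Complex.slitPlane) :
    (K × {v | q v = 1}) ≃ₜ ↥({p : ℂ × V | p.1 ^ d + q p.2 = 1} ∩ {p | p.1 ∈ K}) := by
  have c1 : Continuous fun p : K × {v | q v = 1} => rt d (1 - p.1.1 ^ d) :=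
    Continuous.rt (f := fun p : K × {v | q v = 1} => 1 - p.1.1 ^ d) (by fun_prop) d
      (fun p => hK _ p.1.2)
  have c2 : Continuous fun p : ↥({p : ℂ × V | p.1 ^ d + q p.2 = 1} ∩ {p | p.1 ∈ K}) =>
      rt d (1 - p.1.1 ^ d) :=
    Continuous.rt (f := fun p : ↥({p : ℂ × V | p.1 ^ d + q p.2 = 1} ∩ {p | p.1 ∈ K}) =>
      1 - p.1.1 ^ d) (by fun_prop) d (fun p => hK _ p.2.2)
  have n1 : ∀ x ∈ K, rt d (1 - x ^ d) ≠ 0 := fun x hx =>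
    rt_ne_zero hd (Complex.slitPlane_ne_zero (hK x hx))
  exact
  { toFun := fun p => ⟨(p.1.1, rt d (1 - p.1.1 ^ d) • p.2.1), by
      have h1 : q p.2.1 = 1 := p.2.2
      refine ⟨?_, p.1.2⟩
      change p.1.1 ^ d + q _ = 1
      rw [hqh, rt_pow hd, h1]; ring⟩
    invFun := fun p => (⟨p.1.1, p.2.2⟩, ⟨(rt d (1 - p.1.1 ^ d))⁻¹ • p.1.2, by
      have h1 : p.1.1 ^ d + q p.1.2 = 1 := p.2.1
      change q _ = 1
      rw [hqh, inv_pow, rt_pow hd, ← eq_sub_iff_add_eq'.2 h1, inv_mul_cancel₀]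
      rw [eq_sub_iff_add_eq'.2 h1]
      exact Complex.slitPlane_ne_zero (hK _ p.2.2)⟩)
    left_inv := fun p => by
      refine Prod.ext rfl (Subtype.ext ?_)
      exact inv_smul_smul₀ (n1 _ p.1.2) _
    right_inv := fun p => by
      refine Subtype.ext (Prod.ext rfl ?_)
      exact smul_inv_smul₀ (n1 _ p.2.2) _
    continuous_toFun := by
      refine Continuous.subtype_mk ?_ _
      exact (continuous_subtype_val.comp continuous_fst).prodMk
        (c1.smul (continuous_subtype_val.comp continuous_snd))
    continuous_invFun := by
      refine Continuous.prodMk (Continuous.subtype_mk ?_ _) (Continuous.subtype_mk ?_ _)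
      · exact continuous_fst.comp continuous_subtype_val
      · exact (c2.inv₀ fun p => n1 _ p.2.2).smul (continuous_snd.comp continuous_subtype_val) }

/-- The second chart of a join. -/
def joinHomeoB (hd : d ≠ 0) (hq : Continuous q) {K : Set V}
    (hK : ∀ v ∈ K, 1 - q v ∈ Complex.slitPlane) :
    (RU d × K) ≃ₜ ↥({p : ℂ × V | p.1 ^ d + q p.2 = 1} ∩ {p | p.2 ∈ K}) := by
  have c1 : Continuous fun p : RU d × K => rt d (1 - q p.2.1) :=
    Continuous.rt (f := fun p : RU d × K => 1 - q p.2.1)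
      (by fun_prop) d (fun p => hK _ p.2.2)
  have e0 : ∀ p : ↥({p : ℂ × V | p.1 ^ d + q p.2 = 1} ∩ {p | p.2 ∈ K}),
      p.1.1 ^ d ∈ Complex.slitPlane := fun p => by
    have h1 : p.1.1 ^ d + q p.1.2 = 1 := p.2.1
    rw [eq_sub_iff_add_eq.2 h1]
    exact hK _ p.2.2
  have c2 : Continuous fun p : ↥({p : ℂ × V | p.1 ^ d + q p.2 = 1} ∩ {p | p.2 ∈ K}) =>
      rt d (p.1.1 ^ d) :=
    Continuous.rt (f := fun p : ↥({p : ℂ × V | p.1 ^ d + q p.2 = 1} ∩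
      {p | p.2 ∈ K}) => p.1.1 ^ d) (by fun_prop) d e0
  have e1 : ∀ p : RU d × K,
      (p.1.1 * rt d (1 - q p.2.1)) ^ d = 1 - q p.2.1 := fun p => by
    rw [mul_pow, p.1.2, rt_pow hd, one_mul]
  exact
  { toFun := fun p => ⟨(p.1.1 * rt d (1 - q p.2.1), p.2.1), by
      refine ⟨?_, p.2.2⟩
      change (p.1.1 * _) ^ d + q p.2.1 = 1
      rw [e1]; ring⟩
    invFun := fun p => (⟨p.1.1 * (rt d (p.1.1 ^ d))⁻¹, by
        rw [mul_pow, inv_pow, rt_pow hd, mul_inv_cancel₀ (Complex.slitPlane_ne_zero (e0 p))]⟩,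
      ⟨p.1.2, p.2.2⟩)
    left_inv := fun p => by
      refine Prod.ext (Subtype.ext ?_) rfl
      change p.1.1 * rt d _ * (rt d ((p.1.1 * rt d _) ^ d))⁻¹ = _
      rw [e1, mul_assoc, mul_inv_cancel₀, mul_one]
      exact rt_ne_zero hd (Complex.slitPlane_ne_zero (hK _ p.2.2))
    right_inv := fun p => by
      have h1 : p.1.1 ^ d + q p.1.2 = 1 := p.2.1
      refine Subtype.ext (Prod.ext ?_ rfl)
      change p.1.1 * (rt d (p.1.1 ^ d))⁻¹ * rt d (1 - q p.1.2) = _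
      rw [← eq_sub_iff_add_eq.2 h1, mul_assoc, inv_mul_cancel₀, mul_one]
      exact rt_ne_zero hd (Complex.slitPlane_ne_zero (e0 p))
    continuous_toFun := by
      refine Continuous.subtype_mk ?_ _
      exact ((continuous_subtype_val.comp continuous_fst).mul c1).prodMk
        (continuous_subtype_val.comp continuous_snd)
    continuous_invFun := by
      refine Continuous.prodMk (Continuous.subtype_mk ?_ _) (Continuous.subtype_mk ?_ _)
      · exact (continuous_fst.comp continuous_subtype_val).mul
          (c2.inv₀ fun p => rt_ne_zero hd (Complex.slitPlane_ne_zero (e0 p)))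
      · exact continuous_snd.comp continuous_subtype_val }

/-- The overlap of the two charts of a join. -/
def joinHomeoC (hd : d ≠ 0) (hqh : ∀ (c : ℂ) v, q (c • v) = c ^ d * q v) :
    (RU d × {s : ℂ | 1 - s ∈ Complex.slitPlane ∧ s ∈ Complex.slitPlane} × {v | q v = 1}) ≃ₜ
      ↥({p : ℂ × V | p.1 ^ d + q p.2 = 1} ∩
        ({p | 1 - p.1 ^ d ∈ Complex.slitPlane} ∩ {p | p.1 ^ d ∈ Complex.slitPlane})) := by
  have c1 : Continuous fun p : RU d × {s : ℂ | 1 - s ∈ Complex.slitPlane ∧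
      s ∈ Complex.slitPlane} × {v | q v = 1} => rt d p.2.1.1 :=
    Continuous.rt (f := fun p : RU d × {s : ℂ | 1 - s ∈ Complex.slitPlane ∧
      s ∈ Complex.slitPlane} × {v | q v = 1} => p.2.1.1) (by fun_prop) d (fun p => p.2.1.2.out.2)
  have c2 : Continuous fun p : RU d × {s : ℂ | 1 - s ∈ Complex.slitPlane ∧
      s ∈ Complex.slitPlane} × {v | q v = 1} => rt d (1 - p.2.1.1) :=
    Continuous.rt (f := fun p : RU d × {s : ℂ | 1 - s ∈ Complex.slitPlane ∧
      s ∈ Complex.slitPlane} × {v | q v = 1} => 1 - p.2.1.1) (by fun_prop) d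
      (fun p => p.2.1.2.out.1)
  have c3 : Continuous fun p : ↥({p : ℂ × V | p.1 ^ d + q p.2 = 1} ∩
        ({p | 1 - p.1 ^ d ∈ Complex.slitPlane} ∩ {p | p.1 ^ d ∈ Complex.slitPlane})) =>
      rt d (p.1.1 ^ d) :=
    Continuous.rt (f := fun p : ↥({p : ℂ × V | p.1 ^ d + q p.2 = 1} ∩
        ({p | 1 - p.1 ^ d ∈ Complex.slitPlane} ∩ {p | p.1 ^ d ∈ Complex.slitPlane})) =>
        p.1.1 ^ d) (by fun_prop) d (fun p => p.2.2.2)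
  have c4 : Continuous fun p : ↥({p : ℂ × V | p.1 ^ d + q p.2 = 1} ∩
        ({p | 1 - p.1 ^ d ∈ Complex.slitPlane} ∩ {p | p.1 ^ d ∈ Complex.slitPlane})) =>
      rt d (1 - p.1.1 ^ d) :=
    Continuous.rt (f := fun p : ↥({p : ℂ × V | p.1 ^ d + q p.2 = 1} ∩
        ({p | 1 - p.1 ^ d ∈ Complex.slitPlane} ∩ {p | p.1 ^ d ∈ Complex.slitPlane})) =>
        1 - p.1.1 ^ d) (by fun_prop) d (fun p => p.2.2.1)
  have n1 : ∀ s : ℂ, s ∈ Complex.slitPlane → rt d s ≠ 0 := fun s hs =>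
    rt_ne_zero hd (Complex.slitPlane_ne_zero hs)
  have e1 : ∀ p : RU d × {s : ℂ | 1 - s ∈ Complex.slitPlane ∧
      s ∈ Complex.slitPlane} × {v | q v = 1}, (p.1.1 * rt d p.2.1.1) ^ d = p.2.1.1 := fun p => by
    rw [mul_pow, p.1.2, rt_pow hd, one_mul]
  exact
  { toFun := fun p => ⟨(p.1.1 * rt d p.2.1.1, rt d (1 - p.2.1.1) • p.2.2.1), by
      have h1 : q p.2.2.1 = 1 := p.2.2.2
      refine ⟨?_, ?_, ?_⟩
      · change (p.1.1 * _) ^ d + q _ = 1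
        rw [e1, hqh, rt_pow hd, h1]; ring
      · change 1 - (p.1.1 * _) ^ d ∈ Complex.slitPlane
        rw [e1]; exact p.2.1.2.out.1
      · change (p.1.1 * _) ^ d ∈ Complex.slitPlane
        rw [e1]; exact p.2.1.2.out.2⟩
    invFun := fun p => (⟨p.1.1 * (rt d (p.1.1 ^ d))⁻¹, by
        rw [mul_pow, inv_pow, rt_pow hd, mul_inv_cancel₀ (Complex.slitPlane_ne_zero p.2.2.2)]⟩,
      ⟨p.1.1 ^ d, p.2.2⟩, ⟨(rt d (1 - p.1.1 ^ d))⁻¹ • p.1.2, by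
        have h1 : p.1.1 ^ d + q p.1.2 = 1 := p.2.1
        change q _ = 1
        rw [hqh, inv_pow, rt_pow hd, ← eq_sub_iff_add_eq'.2 h1, inv_mul_cancel₀]
        rw [eq_sub_iff_add_eq'.2 h1]
        exact Complex.slitPlane_ne_zero p.2.2.1⟩)
    left_inv := fun p => by
      refine Prod.ext (Subtype.ext ?_) (Prod.ext (Subtype.ext (e1 p)) (Subtype.ext ?_))
      · change p.1.1 * rt d _ * (rt d ((p.1.1 * rt d _) ^ d))⁻¹ = _
        rw [e1, mul_assoc, mul_inv_cancel₀ (n1 _ p.2.1.2.out.2), mul_one]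
      · change (rt d (1 - (p.1.1 * rt d _) ^ d))⁻¹ • rt d _ • _ = _
        rw [e1]
        exact inv_smul_smul₀ (n1 _ p.2.1.2.out.1) _
    right_inv := fun p => by
      refine Subtype.ext (Prod.ext ?_ (smul_inv_smul₀ (n1 _ p.2.2.1) _))
      change p.1.1 * (rt d (p.1.1 ^ d))⁻¹ * rt d (p.1.1 ^ d) = _
      rw [mul_assoc, inv_mul_cancel₀ (n1 _ p.2.2.2), mul_one]
    continuous_toFun := by
      refine Continuous.subtype_mk ?_ _
      exact ((continuous_subtype_val.comp continuous_fst).mul c1).prodMk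
        (c2.smul (continuous_subtype_val.comp (continuous_snd.comp continuous_snd)))
    continuous_invFun := by
      refine Continuous.prodMk (Continuous.subtype_mk ?_ _)
        (Continuous.prodMk (Continuous.subtype_mk ?_ _) (Continuous.subtype_mk ?_ _))
      · exact (continuous_fst.comp continuous_subtype_val).mul
          (c3.inv₀ fun p => n1 _ p.2.2.2)
      · exact (continuous_fst.comp continuous_subtype_val).pow d
      · exact (c4.inv₀ fun p => n1 _ p.2.2.1).smul
          (continuous_snd.comp continuous_subtype_val) }

theorem one_sub_slit {z : ℂ} (hz : 1 - z ∈ Complex.slitPlane) {t : ℝ} (h0 : 0 ≤ t) (h1 : t ≤ 1) :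
    1 - (t : ℂ) * z ∈ Complex.slitPlane := by
  have := Complex.starConvex_one_slitPlane hz (sub_nonneg.2 h1) h0 (by ring : 1 - t + t = 1)
  convert this using 1
  simp only [Complex.real_smul]; push_cast; ring

theorem starConvex_one_sub (hqh : ∀ (c : ℂ) v, q (c • v) = c ^ d * q v) :
    StarConvex ℝ (0 : V) {v | 1 - q v ∈ Complex.slitPlane} := by
  intro v hv a b ha hb hab
  have h1 : b ≤ 1 := by linarith
  have h2 : b ^ d ≤ 1 := pow_le_one₀ hb h1
  have := one_sub_slit hv.out (pow_nonneg hb d) h2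
  rw [Set.mem_ofPred_eq, smul_zero, zero_add, RCLike.real_smul_eq_coe_smul (K := ℂ), hqh]
  simpa using this

theorem starConvex_slit_two : StarConvex ℝ ((1 / 2 : ℝ) : ℂ)
    {s : ℂ | 1 - s ∈ Complex.slitPlane ∧ s ∈ Complex.slitPlane} := by
  have h := Complex.starConvex_ofReal_slitPlane (by norm_num : (0 : ℝ) < 1 / 2)
  intro s hs a b ha hb hab
  refine ⟨?_, h hs.2 ha hb hab⟩
  have := h hs.1 ha hb hab
  convert this using 1
  have e : (b : ℂ) = 1 - a := by
    rw [eq_sub_iff_add_eq']; exact_mod_cast hab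
  simp only [Complex.real_smul, e]
  push_cast; ring

/-- The Euler characteristic of the Milnor fibre of a join. -/
theorem hasEulerChar_join (hd : d ≠ 0) (hq : Continuous q)
    (hqh : ∀ (c : ℂ) v, q (c • v) = c ^ d * q v) {e : ℤ} (he : HasEulerChar {v | q v = 1} e) :
    HasEulerChar {p : ℂ × V | p.1 ^ d + q p.2 = 1} (e + d - d * e) := by
  have : Finite (RU d) := finite_RU hd
  have : DiscreteTopology (RU d) := discrete_RU hd
  have q0 : q 0 = 0 := by
    have := hqh 0 0
    rwa [zero_pow hd, zero_mul, smul_zero] at this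
  have hA : HasEulerChar ({x : ℂ | 1 - x ^ d ∈ Complex.slitPlane} × {v | q v = 1}) e := by
    have h : StarConvex ℝ (0 : ℂ) {x : ℂ | 1 - x ^ d ∈ Complex.slitPlane} :=
      starConvex_one_sub (d := d) (q := fun x : ℂ => x ^ d) (fun c v => by
        simp [mul_pow])
    have := h.contractibleSpace ⟨0, by simp [hd]⟩
    exact he.contractible_prod
  have hB : HasEulerChar {v | 1 - q v ∈ Complex.slitPlane} 1 := by
    have := (starConvex_one_sub hqh).contractibleSpace ⟨0, by simp [q0]⟩
    exact hasEulerChar_contractible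
  have hC : HasEulerChar ({s : ℂ | 1 - s ∈ Complex.slitPlane ∧ s ∈ Complex.slitPlane} ×
      {v | q v = 1}) e := by
    have := starConvex_slit_two.contractibleSpace ⟨((1 / 2 : ℝ) : ℂ), by
      refine ⟨?_, Complex.ofReal_mem_slitPlane.2 (by norm_num)⟩
      have : (1 : ℂ) - ((1 / 2 : ℝ) : ℂ) = ((1 / 2 : ℝ) : ℂ) := by push_cast; ring
      rw [this]
      exact Complex.ofReal_mem_slitPlane.2 (by norm_num)⟩
    exact he.contractible_prod
  have c0 : Continuous fun p : ℂ × V => p.1 ^ d := by fun_prop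
  have := hasEulerChar_union_set (S := {p : ℂ × V | p.1 ^ d + q p.2 = 1})
    (U := {p | 1 - p.1 ^ d ∈ Complex.slitPlane}) (V := {p | p.1 ^ d ∈ Complex.slitPlane})
    (fun p _ => ?_) (Complex.isOpen_slitPlane.preimage (continuous_const.sub c0))
    (Complex.isOpen_slitPlane.preimage c0)
    (hA.congr_homeo (joinHomeoA hd hqh fun _ h => h))
    (((hB.finite_prod (R := RU d)).congr_homeo (joinHomeoB hd hq fun _ h => h)).congr_set ?_)
    ((hC.finite_prod (R := RU d)).congr_homeo (joinHomeoC hd hqh))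
  · rw [card_RU hd, mul_one] at this
    exact this
  · by_contra h
    simp only [Set.mem_union, Set.mem_ofPred_eq, not_or, Complex.mem_slitPlane_iff,
      Complex.sub_re, Complex.one_re, not_lt, Complex.sub_im, Complex.one_im] at h
    linarith [h.1.1, h.2.1]
  · ext p
    refine and_congr_right fun h => ?_
    have h1 : p.1 ^ d + q p.2 = 1 := h
    change 1 - q p.2 ∈ Complex.slitPlane ↔ p.1 ^ d ∈ Complex.slitPlane
    rw [eq_sub_iff_add_eq.2 h1]

end Join

section Proj
variable {κ : Type} [Fintype κ]

/-- The projector onto the line spanned by a vector. -/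
def prj (v : κ → ℂ) : κ → κ → ℂ := fun a b =>
  v a * (starRingEnd ℂ) (v b) / ((∑ c, ‖v c‖ ^ 2 : ℝ) : ℂ)

theorem sum_sq_pos {v : κ → ℂ} (hv : v ≠ 0) : 0 < ∑ c, ‖v c‖ ^ 2 := by
  obtain ⟨a, ha⟩ := Function.ne_iff.1 hv
  exact Finset.sum_pos' (fun _ _ => by positivity) ⟨a, Finset.mem_univ _, by
    have := norm_pos_iff.2 ha
    positivity⟩

theorem sum_sq_ne {v : κ → ℂ} (hv : v ≠ 0) : ((∑ c, ‖v c‖ ^ 2 : ℝ) : ℂ) ≠ 0 :=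
  Complex.ofReal_ne_zero.2 (sum_sq_pos hv).ne'

theorem prj_diag (v : κ → ℂ) (a : κ) :
    prj v a a = ((‖v a‖ ^ 2 / ∑ c, ‖v c‖ ^ 2 : ℝ) : ℂ) := by
  rw [prj, Complex.mul_conj, Complex.normSq_eq_norm_sq]; push_cast; rfl

theorem prj_diag_ne {v : κ → ℂ} {a : κ} (hv : v ≠ 0) : prj v a a ≠ 0 ↔ v a ≠ 0 := by
  rw [prj, Complex.mul_conj, Complex.normSq_eq_norm_sq]
  simp [sum_sq_ne hv, -Complex.ofReal_sum]

theorem norm_prj_diag {v : κ → ℂ} (hv : v ≠ 0) (a : κ) :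
    ‖prj v a a‖ = ‖v a‖ ^ 2 / ∑ c, ‖v c‖ ^ 2 := by
  rw [prj_diag, Complex.norm_real, Real.norm_of_nonneg]
  have := sum_sq_pos hv
  positivity

theorem prj_smul {c : ℂ} (hc : c ≠ 0) (v : κ → ℂ) : prj (c • v) = prj v := by
  funext a b
  have h1 : ((∑ e, ‖(c • v) e‖ ^ 2 : ℝ) : ℂ) = c * (starRingEnd ℂ) c * ((∑ e, ‖v e‖ ^ 2 : ℝ) : ℂ) := by
    rw [Complex.mul_conj, Complex.normSq_eq_norm_sq, ← Complex.ofReal_mul, Finset.mul_sum]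
    simp [mul_pow]
  have h2 : c * (starRingEnd ℂ) c ≠ 0 := by simpa using hc
  rw [prj, prj, h1]
  simp only [Pi.smul_apply, smul_eq_mul, map_mul]
  rw [← mul_div_mul_left (v a * (starRingEnd ℂ) (v b)) _ h2]
  congr 1; ring

theorem prj_div {v : κ → ℂ} {a : κ} (ha : v a ≠ 0) (b : κ) :
    prj v b a / prj v a a = v b / v a := by
  have hv : v ≠ 0 := fun h => ha (by rw [h]; rfl)
  have h1 := sum_sq_ne hv
  have h2 : (starRingEnd ℂ) (v a) ≠ 0 := by simpa using ha
  rw [prj, prj]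
  field_simp

theorem prj_inj {v w : κ → ℂ} (hv : v ≠ 0) (hw : w ≠ 0) (h : prj v = prj w) :
    ∃ c : ℂ, c ≠ 0 ∧ w = c • v := by
  obtain ⟨a, ha⟩ := Function.ne_iff.1 hv
  have ha' : v a ≠ 0 := ha
  have hb : w a ≠ 0 := by
    rw [← prj_diag_ne hw, ← h, prj_diag_ne hv]; exact ha
  refine ⟨w a / v a, div_ne_zero hb ha, ?_⟩
  funext b
  have := prj_div ha' b
  rw [h, prj_div hb] at this
  rw [div_eq_div_iff hb ha'] at this
  rw [Pi.smul_apply, smul_eq_mul]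
  field_simp
  rw [this, mul_comm]

theorem continuousAt_prj {v : κ → ℂ} (hv : v ≠ 0) : ContinuousAt (prj (κ := κ)) v := by
  refine continuousAt_pi.2 fun a => continuousAt_pi.2 fun b => ?_
  have h1 : Continuous fun v : κ → ℂ => v a * (starRingEnd ℂ) (v b) :=
    (continuous_apply a).mul (Complex.continuous_conj.comp (continuous_apply b))
  have h2 : Continuous fun v : κ → ℂ => ((∑ c, ‖v c‖ ^ 2 : ℝ) : ℂ) :=
    Complex.continuous_ofReal.comp (continuous_finsetSum _ fun c _ => by fun_prop)
  exact h1.continuousAt.div h2.continuousAt (sum_sq_ne hv)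

theorem continuous_prj_comp {X : Type*} [TopologicalSpace X] {f : X → κ → ℂ} (hf : Continuous f)
    (h0 : ∀ x, f x ≠ 0) : Continuous fun x => prj (f x) :=
  continuous_iff_continuousAt.2 fun x =>
    ContinuousAt.comp (f := f) (g := PaperED.prj) (continuousAt_prj (h0 x)) hf.continuousAt

/-- An affine chart of a scaling-invariant subset of projective space. -/
def prjChart {P : Type} [TopologicalSpace P] (a : κ) (G : P → κ → ℂ) (H : (κ → ℂ) → P)
    (hG : Continuous G) (hH : Continuous H) (hHG : ∀ p, H (G p) = p) (hGa : ∀ p, G p a = 1)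
    (hGH : ∀ v : κ → ℂ, v a = 1 → G (H v) = v) (Q : Set (κ → ℂ))
    (hQ : ∀ (c : ℂ) v, c ≠ 0 → v ∈ Q → c • v ∈ Q) :
    {p | G p ∈ Q} ≃ₜ ↥(prj '' {v | v a ≠ 0 ∧ v ∈ Q}) := by
  have key : ∀ v : κ → ℂ, v a ≠ 0 → (fun b => prj v b a / prj v a a) = (v a)⁻¹ • v := fun v hv => by
    funext b; rw [prj_div hv, Pi.smul_apply, smul_eq_mul, div_eq_inv_mul]
  have n1 : ∀ p : ↥(prj '' {v | v a ≠ 0 ∧ v ∈ Q}), p.1 a a ≠ 0 := by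
    rintro ⟨_, v, hv, rfl⟩
    exact (prj_diag_ne fun h => hv.1 (by rw [h]; rfl)).2 hv.1
  have key2 : ∀ v : κ → ℂ, v a ≠ 0 → G (H ((v a)⁻¹ • v)) = (v a)⁻¹ • v := fun v hv =>
    hGH _ (by simp [hv])
  exact
  { toFun := fun p => ⟨prj (G p.1), G p.1, ⟨by rw [hGa]; exact one_ne_zero, p.2⟩, rfl⟩
    invFun := fun p => ⟨H fun b => p.1 b a / p.1 a a, by
      obtain ⟨_, v, hv, rfl⟩ := p
      change G (H fun b => prj v b a / prj v a a) ∈ Q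
      rw [key v hv.1, key2 v hv.1]
      exact hQ _ _ (inv_ne_zero hv.1) hv.2⟩
    left_inv := fun p => by
      refine Subtype.ext ?_
      change H (fun b => prj (G p.1) b a / prj (G p.1) a a) = _
      rw [key _ (by rw [hGa]; exact one_ne_zero), hGa, inv_one, one_smul, hHG]
    right_inv := by
      rintro ⟨_, v, hv, rfl⟩
      refine Subtype.ext ?_
      change prj (G (H fun b => prj v b a / prj v a a)) = _
      rw [key v hv.1, key2 v hv.1, prj_smul (inv_ne_zero hv.1)]
    continuous_toFun := by
      refine Continuous.subtype_mk ?_ _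
      refine continuous_prj_comp (hG.comp continuous_subtype_val) fun p h => ?_
      have := congrFun h a
      rw [hGa] at this
      exact one_ne_zero this
    continuous_invFun := by
      refine Continuous.subtype_mk (hH.comp ?_) _
      refine continuous_pi fun b => Continuous.div ?_ ?_ n1
      · exact (continuous_apply_apply b a).comp continuous_subtype_val
      · exact (continuous_apply_apply a a).comp continuous_subtype_val }

end Proj

theorem prj_norm_lt {κ : Type} [Fintype κ] {v : κ → ℂ} (hv : v ≠ 0) (a b : κ) {r : ℝ} (hr : 0 < r) :
    r ^ 2 * ‖prj v a a‖ < ‖prj v b b‖ ↔ r * ‖v a‖ < ‖v b‖ := by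
  rw [norm_prj_diag hv, norm_prj_diag hv, ← mul_div_assoc, div_lt_div_iff_of_pos_right (sum_sq_pos hv),
    ← mul_pow]
  exact pow_lt_pow_iff_left₀ (by positivity) (norm_nonneg _) two_ne_zero

/-- The part of a projective set in an open set on which some coordinate does not vanish. -/
def prjChartInter {κ P : Type} [Fintype κ] [TopologicalSpace P] (a : κ) (G : P → κ → ℂ)
    (H : (κ → ℂ) → P)
    (hG : Continuous G) (hH : Continuous H) (hHG : ∀ p, H (G p) = p) (hGa : ∀ p, G p a = 1)
    (hGH : ∀ v : κ → ℂ, v a = 1 → G (H v) = v) (Q : Set (κ → ℂ))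
    (hQ : ∀ (c : ℂ) v, c ≠ 0 → v ∈ Q → c • v ∈ Q) (U : Set (κ → κ → ℂ))
    (hU : ∀ v, v ≠ 0 → prj v ∈ U → v a ≠ 0) :
    {p | G p ∈ Q ∧ prj (G p) ∈ U} ≃ₜ ↥(prj '' {v | v ≠ 0 ∧ v ∈ Q} ∩ U) :=
  (prjChart a G H hG hH hHG hGa hGH (Q ∩ prj ⁻¹' U) (fun c v hc hv => ⟨hQ c v hc hv.1, by
    rw [Set.mem_preimage, prj_smul hc]; exact hv.2⟩)).trans (Homeomorph.setCongr (by
      ext p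
      constructor
      · rintro ⟨v, ⟨h1, h2, h3⟩, rfl⟩
        exact ⟨⟨v, ⟨fun h => h1 (by rw [h]; rfl), h2⟩, rfl⟩, h3⟩
      · rintro ⟨⟨v, ⟨h1, h2⟩, rfl⟩, h3⟩
        exact ⟨v, ⟨hU v h1 h3, h2, h3⟩, rfl⟩))

section Fermat
variable {d : ℕ}

/-- The cone over the Fermat surface. -/
def fermatCone (d : ℕ) : Set (Fin 4 → ℂ) := {v | v 0 ^ d - v 1 ^ d + v 2 ^ d - v 3 ^ d = 0}

theorem fermatCone_smul (c : ℂ) (v : Fin 4 → ℂ) (_ : c ≠ 0) (hv : v ∈ fermatCone d) :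
    c • v ∈ fermatCone d := by
  have h : v 0 ^ d - v 1 ^ d + v 2 ^ d - v 3 ^ d = 0 := hv
  change (c * v 0) ^ d - (c * v 1) ^ d + (c * v 2) ^ d - (c * v 3) ^ d = 0
  simp only [mul_pow]
  linear_combination c ^ d * h

/-- The Fermat surface. -/
def fermatSurface (d : ℕ) : Set (Fin 4 → Fin 4 → ℂ) := prj '' {v | v ≠ 0 ∧ v ∈ fermatCone d}

theorem hasEulerChar_fermatCurve (hd : d ≠ 0) :
    HasEulerChar {p : ℂ × ℂ | p.1 ^ d + (-1) * p.2 ^ d = 1} ((d : ℤ) + d - d * d) := by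
  refine hasEulerChar_join hd (q := fun w : ℂ => (-1) * w ^ d) (by fun_prop) (fun c v => by
    simp only [smul_eq_mul, mul_pow]; ring) ?_
  refine (hasEulerChar_roots (-1) (by norm_num) hd).congr_set ?_
  ext w
  constructor <;> intro h
  · have h : w ^ d = -1 := h
    change (-1) * w ^ d = 1
    rw [h]; ring
  · have h : (-1) * w ^ d = 1 := h
    change w ^ d = -1
    linear_combination -h

theorem one_sub_pow_slit (hd : d ≠ 0) {x : ℂ} (hx : ‖x‖ < 1) : 1 - x ^ d ∈ Complex.slitPlane := by
  refine Complex.mem_slitPlane_iff.2 (Or.inl ?_)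
  have h1 : ‖x ^ d‖ < 1 := by
    rw [norm_pow]; exact pow_lt_one₀ (norm_nonneg _) hx hd
  have := (Complex.abs_re_le_norm (x ^ d)).trans_lt h1
  rw [Complex.sub_re, Complex.one_re]
  linarith [(abs_lt.1 this).2]

theorem one_sub_slit_of_norm {z : ℂ} (hz : ‖z‖ < 1) : 1 - z ∈ Complex.slitPlane := by
  simpa using one_sub_pow_slit one_ne_zero hz

def fermatG₀ (p : ℂ × ℂ × ℂ) : Fin 4 → ℂ := ![1, p.1, p.2.1, p.2.2]
def fermatG₁ (p : ℂ × ℂ × ℂ) : Fin 4 → ℂ := ![p.1, 1, p.2.1, p.2.2]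
def fermatG₃ (p : ℂ × ℂ × ℂ) : Fin 4 → ℂ := ![p.2.1, p.2.2, p.1, 1]

theorem fermatPart₁ (hd : d ≠ 0) {U : Set (Fin 4 → Fin 4 → ℂ)}
    (hU : ∀ v, v ≠ 0 → (prj v ∈ U ↔ v 1 ≠ 0)) :
    HasEulerChar ↥(fermatSurface d ∩ U)
      (((d : ℤ) + d - d * d) + d - d * ((d : ℤ) + d - d * d)) := by
  have h0 : ∀ p, fermatG₁ p ≠ 0 := fun p h => one_ne_zero (congrFun h 1)
  refine HasEulerChar.congr_homeo ?_ (prjChartInter 1 fermatG₁ (fun v => (v 0, v 2, v 3))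
    (continuous_pi fun i => by fin_cases i <;> simp [fermatG₁] <;> fun_prop) (by fun_prop)
    (fun p => rfl) (fun p => rfl) (fun v hv => ?_) (fermatCone d) fermatCone_smul U
    (fun v h => (hU v h).1))
  · refine (hasEulerChar_join hd (q := fun w : ℂ × ℂ => w.1 ^ d + (-1) * w.2 ^ d) (by fun_prop)
      (fun c v => ?_) (hasEulerChar_fermatCurve hd)).congr_set ?_
    · simp only [Prod.smul_fst, Prod.smul_snd, smul_eq_mul, mul_pow]; ring
    · ext p
      have h1 : prj (fermatG₁ p) ∈ U := (hU _ (h0 p)).2 one_ne_zero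
      simp only [Set.mem_ofPred_eq, h1, and_true]
      change _ ↔ p.1 ^ d - 1 ^ d + p.2.1 ^ d - p.2.2 ^ d = 0
      rw [one_pow]
      constructor <;> intro h <;> linear_combination h
  · funext i; fin_cases i
    · rfl
    · exact hv.symm
    · rfl
    · rfl

theorem fermatPart₀ (hd : d ≠ 0) {U : Set (Fin 4 → Fin 4 → ℂ)} {K : Set ℂ} {c : ℤ}
    (hK : ∀ x ∈ K, ‖x‖ < 1) (hU0 : ∀ v, v ≠ 0 → prj v ∈ U → v 0 ≠ 0)
    (hU : ∀ v, v ≠ 0 → v 0 = 1 → (prj v ∈ U ↔ v 1 ∈ K))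
    (hc : HasEulerChar (K × {p : ℂ × ℂ | p.1 ^ d + (-1) * p.2 ^ d = 1}) c) :
    HasEulerChar ↥(fermatSurface d ∩ U) c := by
  have h0 : ∀ p, fermatG₀ p ≠ 0 := fun p h => one_ne_zero (congrFun h 0)
  refine HasEulerChar.congr_homeo ?_ (prjChartInter 0 fermatG₀ (fun v => (v 1, v 2, v 3))
    (continuous_pi fun i => by fin_cases i <;> simp [fermatG₀] <;> fun_prop) (by fun_prop)
    (fun p => rfl) (fun p => rfl) (fun v hv => ?_) (fermatCone d) fermatCone_smul U hU0)
  · have e : {p : ℂ × ℂ | p.1 ^ d + (-1) * p.2 ^ d = 1} ≃ₜ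
        {p : ℂ × ℂ | (fun w : ℂ × ℂ => w.2 ^ d + (-1) * w.1 ^ d) p = 1} :=
      { toFun := fun p => ⟨(p.1.2, p.1.1), p.2⟩
        invFun := fun p => ⟨(p.1.2, p.1.1), p.2⟩
        left_inv := fun _ => rfl
        right_inv := fun _ => rfl
        continuous_toFun := by fun_prop
        continuous_invFun := by fun_prop }
    refine ((hc.congr_homeo ((Homeomorph.refl _).prodCongr e)).congr_homeo
      (joinHomeoA (q := fun w : ℂ × ℂ => w.2 ^ d + (-1) * w.1 ^ d) hd (fun c v => ?_)
      fun x hx => one_sub_pow_slit hd (hK x hx))).congr_set ?_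
    · simp only [Prod.smul_fst, Prod.smul_snd, smul_eq_mul, mul_pow]; ring
    · ext p
      have h1 : prj (fermatG₀ p) ∈ U ↔ p.1 ∈ K := hU _ (h0 p) rfl
      refine and_congr ?_ h1.symm
      change _ ↔ 1 ^ d - p.1 ^ d + p.2.1 ^ d - p.2.2 ^ d = 0
      simp only [Set.mem_ofPred_eq, one_pow]
      constructor <;> intro h <;> linear_combination -h
  · funext i; fin_cases i
    · exact hv.symm
    · rfl
    · rfl
    · rfl

theorem fermatPart₃ (hd : d ≠ 0) {U : Set (Fin 4 → Fin 4 → ℂ)} {K : Set (ℂ × ℂ)} {c : ℤ}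
    (hK : ∀ x ∈ K, 2 * ‖x.1‖ < 1 ∧ 2 * ‖x.2‖ < 1) (hU0 : ∀ v, v ≠ 0 → prj v ∈ U → v 3 ≠ 0)
    (hU : ∀ v, v ≠ 0 → v 3 = 1 → (prj v ∈ U ↔ (v 0, v 1) ∈ K))
    (hc : HasEulerChar K c) :
    HasEulerChar ↥(fermatSurface d ∩ U) (d * c) := by
  have : Finite (RU d) := finite_RU hd
  have : DiscreteTopology (RU d) := discrete_RU hd
  have h0 : ∀ p, fermatG₃ p ≠ 0 := fun p h => one_ne_zero (congrFun h 3)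
  refine HasEulerChar.congr_homeo ?_ (prjChartInter 3 fermatG₃ (fun v => (v 2, v 0, v 1))
    (continuous_pi fun i => by fin_cases i <;> simp [fermatG₃] <;> fun_prop) (by fun_prop)
    (fun p => rfl) (fun p => rfl) (fun v hv => ?_) (fermatCone d) fermatCone_smul U hU0)
  · have hc' := hc.finite_prod (R := RU d)
    rw [card_RU hd] at hc'
    refine (hc'.congr_homeo
      (joinHomeoB (q := fun w : ℂ × ℂ => w.1 ^ d - w.2 ^ d) hd (by fun_prop) (K := K)
      fun x hx => one_sub_slit_of_norm ?_)).congr_set ?_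
    · have h1 : ∀ y : ℂ, 2 * ‖y‖ < 1 → ‖y ^ d‖ < 1 / 2 := fun y hy => by
        rw [norm_pow]
        exact (pow_le_of_le_one (norm_nonneg _) (by linarith) hd).trans_lt (by linarith)
      have := norm_sub_le (x.1 ^ d) (x.2 ^ d)
      linarith [h1 _ (hK x hx).1, h1 _ (hK x hx).2]
    · ext p
      have h1 : prj (fermatG₃ p) ∈ U ↔ p.2 ∈ K := hU _ (h0 p) rfl
      refine and_congr ?_ h1.symm
      change _ ↔ p.2.1 ^ d - p.2.2 ^ d + p.1 ^ d - 1 ^ d = 0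
      simp only [Set.mem_ofPred_eq, one_pow]
      constructor <;> intro h <;> linear_combination h
  · funext i; fin_cases i
    · rfl
    · rfl
    · rfl
    · exact hv.symm

theorem convex_norm_lt (r : ℝ) : Convex ℝ {x : ℂ | 2 * ‖x‖ < r} := by
  have : {x : ℂ | 2 * ‖x‖ < r} = Metric.ball 0 (r / 2) := by
    ext x
    simp only [Set.mem_ofPred_eq, Metric.mem_ball, dist_zero_right]
    constructor <;> intro h <;> linarith
  rw [this]
  exact convex_ball (0 : ℂ) _

theorem hasEulerChar_bidisc_punctured :
    HasEulerChar {x : ℂ × ℂ | x ≠ 0 ∧ 2 * ‖x.1‖ < 1 ∧ 2 * ‖x.2‖ < 1} 0 := by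
  have hD : HasEulerChar {x : ℂ | 2 * ‖x‖ < 1} 1 := by
    have := ((convex_norm_lt 1).starConvex (x := 0) (by simp)).contractibleSpace ⟨0, by simp⟩
    exact hasEulerChar_contractible
  have hP0 : HasEulerChar (pDisc (1 / 2)) 0 := by
    have h := hasEulerChar_pDisc_prod (Y := Unit) hasEulerChar_contractible
      (by norm_num : (0 : ℝ) < 1 / 2)
    exact h.congr_homeo (Homeomorph.prodPUnit _)
  have hPD := hasEulerChar_pDisc_prod hD (by norm_num : (0 : ℝ) < 1 / 2)
  have hPP := hasEulerChar_pDisc_prod hP0 (by norm_num : (0 : ℝ) < 1 / 2)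
  have hh : ∀ x : ℂ, ‖x‖ < 1 / 2 ↔ 2 * ‖x‖ < 1 := fun x => by
    constructor <;> intro h <;> linarith
  have hprod : ∀ (K L : Set ℂ) (c : ℤ), HasEulerChar (K × L) c →
      HasEulerChar (K ×ˢ L : Set (ℂ × ℂ)) c := fun K L c h =>
    h.congr_homeo (Homeomorph.Set.prod K L).symm
  have := hasEulerChar_union_set (S := {x : ℂ × ℂ | x ≠ 0 ∧ 2 * ‖x.1‖ < 1 ∧ 2 * ‖x.2‖ < 1})
    (U := {x | x.1 ≠ 0}) (V := {x | x.2 ≠ 0}) (fun p hp => ?_)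
    (isOpen_ne_fun continuous_fst continuous_const) (isOpen_ne_fun continuous_snd continuous_const)
    ((hprod _ _ _ hPD).congr_set ?_)
    ((hprod _ _ _ (hPD.congr_homeo (Homeomorph.prodComm _ _))).congr_set ?_)
    ((hprod _ _ _ hPP).congr_set ?_)
  · simpa using this
  · by_contra h
    simp only [Set.mem_union, Set.mem_ofPred_eq, not_or, not_not] at h
    exact hp.1 (Prod.ext h.1 h.2)
  · ext p
    simp only [Set.mem_prod, pDisc, Set.mem_ofPred_eq, Set.mem_inter_iff, hh]
    exact ⟨fun h => ⟨⟨fun h0 => h.1.1 (by rw [h0]; rfl), h.1.2, h.2⟩, h.1.1⟩,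
      fun h => ⟨⟨h.2, h.1.2.1⟩, h.1.2.2⟩⟩
  · ext p
    simp only [Set.mem_prod, pDisc, Set.mem_ofPred_eq, Set.mem_inter_iff, hh]
    exact ⟨fun h => ⟨⟨fun h0 => h.2.1 (by rw [h0]; rfl), h.1, h.2.2⟩, h.2.1⟩,
      fun h => ⟨h.1.2.1, h.2, h.1.2.2⟩⟩
  · ext p
    simp only [Set.mem_prod, pDisc, Set.mem_ofPred_eq, Set.mem_inter_iff, hh]
    exact ⟨fun h => ⟨⟨fun h0 => h.2.1 (by rw [h0]; rfl), h.1.2, h.2.2⟩, h.1.1, h.2.1⟩,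
      fun h => ⟨⟨h.2.1, h.1.2.1⟩, h.2.2, h.1.2.2⟩⟩

theorem hasEulerChar_fermatSurface (hd : d ≠ 0) :
    HasEulerChar (fermatSurface d) ((d : ℤ) ^ 3 - 4 * (d : ℤ) ^ 2 + 6 * d) := by
  have cc : ∀ a b, Continuous fun p : Fin 4 → Fin 4 → ℂ => p a b := fun a b =>
    continuous_apply_apply a b
  have hone : ∀ {v : Fin 4 → ℂ} {a}, v ≠ 0 → (prj v a a ≠ 0 ↔ v a ≠ 0) := fun h => prj_diag_ne h
  have hlt : ∀ {v : Fin 4 → ℂ} a b, v ≠ 0 → (‖prj v a a‖ < ‖prj v b b‖ ↔ ‖v a‖ < ‖v b‖) :=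
    fun a b h => by simpa using prj_norm_lt h a b one_pos
  have hlt4 : ∀ {v : Fin 4 → ℂ} a b, v ≠ 0 →
      (4 * ‖prj v a a‖ < ‖prj v b b‖ ↔ 2 * ‖v a‖ < ‖v b‖) :=
    fun a b h => by
      have := prj_norm_lt h a b two_pos
      norm_num at this; exact this
  have hD : HasEulerChar {x : ℂ × ℂ | 2 * ‖x.1‖ < 1 ∧ 2 * ‖x.2‖ < 1} 1 := by
    have : StarConvex ℝ (0 : ℂ × ℂ) {x : ℂ × ℂ | 2 * ‖x.1‖ < 1 ∧ 2 * ‖x.2‖ < 1} :=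
      ((convex_norm_lt 1).prod (convex_norm_lt 1)).starConvex (by simp)
    have := this.contractibleSpace ⟨0, by simp⟩
    exact hasEulerChar_contractible
  have hA : HasEulerChar ↥(fermatSurface d ∩ {p | p 0 0 ≠ 0 ∨ p 1 1 ≠ 0}) _ :=
    hasEulerChar_union_set (X := Fin 4 → Fin 4 → ℂ)
    (S := fermatSurface d ∩ {p | p 0 0 ≠ 0 ∨ p 1 1 ≠ 0})
    (U := {p | p 1 1 ≠ 0}) (V := {p | ‖p 1 1‖ < ‖p 0 0‖})
    (fun p hp => by
      by_cases h : p 1 1 = 0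
      · right
        have : p 0 0 ≠ 0 := hp.2.resolve_right (not_not.2 h)
        simpa [h] using this
      · exact Or.inl h)
    (isOpen_ne_fun (cc 1 1) continuous_const) (isOpen_lt (cc 1 1).norm (cc 0 0).norm)
    ((fermatPart₁ hd (U := {p | p 1 1 ≠ 0}) fun v hv => hone hv).congr_set (by
      ext p
      exact ⟨fun h => ⟨⟨h.1, Or.inr h.2⟩, h.2⟩, fun h => ⟨h.1.1, h.2⟩⟩))
    ((fermatPart₀ hd (U := {p | ‖p 1 1‖ < ‖p 0 0‖}) (K := {x | ‖x‖ < 1}) (fun x h => h)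
      (fun v hv h => by
        rw [Set.mem_ofPred_eq, hlt _ _ hv] at h
        exact norm_pos_iff.1 ((norm_nonneg _).trans_lt h))
      (fun v hv h => by rw [Set.mem_ofPred_eq, hlt _ _ hv, h, norm_one]; rfl)
      (by
        have h : StarConvex ℝ (0 : ℂ) {x : ℂ | ‖x‖ < 1} := by
          have h' : {x : ℂ | ‖x‖ < 1} = Metric.ball 0 1 := by ext; simp
          rw [h']; exact (convex_ball _ _).starConvex (by simp)
        have := h.contractibleSpace ⟨0, by simp⟩
        exact (hasEulerChar_fermatCurve hd).contractible_prod)).congr_set (by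
      ext p
      refine ⟨fun h => ⟨⟨h.1, Or.inl ?_⟩, h.2⟩, fun h => ⟨h.1.1, h.2⟩⟩
      exact norm_pos_iff.1 ((norm_nonneg _).trans_lt h.2)))
    ((fermatPart₀ hd (U := {p | p 1 1 ≠ 0 ∧ ‖p 1 1‖ < ‖p 0 0‖}) (K := pDisc 1) (fun x h => h.2)
      (fun v hv h => by
        have h := h.2
        rw [hlt _ _ hv] at h
        exact norm_pos_iff.1 ((norm_nonneg _).trans_lt h))
      (fun v hv h => by rw [Set.mem_ofPred_eq, hone hv, hlt _ _ hv, h, norm_one]; rfl)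
      (hasEulerChar_pDisc_prod (hasEulerChar_fermatCurve hd) one_pos)).congr_set (by
      ext p
      exact ⟨fun h => ⟨⟨h.1, Or.inr h.2.1⟩, h.2⟩, fun h => ⟨h.1.1, h.2⟩⟩))
  have hB : HasEulerChar ↥(fermatSurface d ∩ {p | 4 * ‖p 0 0‖ < ‖p 3 3‖ ∧ 4 * ‖p 1 1‖ < ‖p 3 3‖}) _ :=
    fermatPart₃ hd (fun x h => h)
      (fun v hv h => by
        have h := h.1
        rw [hlt4 _ _ hv] at h
        exact norm_pos_iff.1 ((by positivity : 0 ≤ 2 * ‖v 0‖).trans_lt h))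
      (fun v hv h => by rw [Set.mem_ofPred_eq, hlt4 _ _ hv, hlt4 _ _ hv, h, norm_one]; rfl) hD
  have hAB : HasEulerChar ↥(fermatSurface d ∩ ({p | p 0 0 ≠ 0 ∨ p 1 1 ≠ 0} ∩
      {p | 4 * ‖p 0 0‖ < ‖p 3 3‖ ∧ 4 * ‖p 1 1‖ < ‖p 3 3‖})) _ :=
    fermatPart₃ hd (fun x h => h.2)
      (fun v hv h => by
        have h := h.2.1
        rw [hlt4 _ _ hv] at h
        exact norm_pos_iff.1 ((by positivity : 0 ≤ 2 * ‖v 0‖).trans_lt h))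
      (fun v hv h => by
        rw [Set.mem_inter_iff, Set.mem_ofPred_eq, Set.mem_ofPred_eq, Set.mem_ofPred_eq,
          hlt4 _ _ hv, hlt4 _ _ hv, hone hv, hone hv, h, norm_one]
        refine and_congr_left fun _ => ?_
        rw [← not_and_or]
        exact not_congr ⟨fun h => Prod.ext h.1 h.2, fun h => ⟨congrArg Prod.fst h,
          congrArg Prod.snd h⟩⟩)
      hasEulerChar_bidisc_punctured
  have := hasEulerChar_union_set (X := Fin 4 → Fin 4 → ℂ) (S := fermatSurface d)
    (U := {p | p 0 0 ≠ 0 ∨ p 1 1 ≠ 0})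
    (V := {p | 4 * ‖p 0 0‖ < ‖p 3 3‖ ∧ 4 * ‖p 1 1‖ < ‖p 3 3‖}) (by
    rintro _ ⟨v, ⟨h1, h2⟩, rfl⟩
    simp only [Set.mem_union, Set.mem_ofPred_eq, hone h1, hlt4 _ _ h1]
    by_cases h : v 0 ≠ 0 ∨ v 1 ≠ 0
    · exact Or.inl h
    · right
      simp only [not_or, not_not] at h
      have h3 : v 3 ≠ 0 := fun h3 => by
        have h2 : v 0 ^ d - v 1 ^ d + v 2 ^ d - v 3 ^ d = 0 := h2
        rw [h.1, h.2, h3, zero_pow hd, sub_zero, sub_self, zero_add] at h2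
        refine h1 (funext fun i => ?_)
        fin_cases i
        · exact h.1
        · exact h.2
        · exact eq_zero_of_pow_eq_zero h2
        · exact h3
      simpa [h.1, h.2] using h3)
    ((isOpen_ne_fun (cc 0 0) continuous_const).union (isOpen_ne_fun (cc 1 1) continuous_const))
    ((isOpen_lt (continuous_const.mul (cc 0 0).norm) (cc 3 3).norm).inter
      (isOpen_lt (continuous_const.mul (cc 1 1).norm) (cc 3 3).norm)) hA hB hAB
  convert this using 1
  ring

end Fermat

/-- `K` contains approximate midpoints of nearby points, with a quadratic error. -/
def MidP {E : Type} [NormedAddCommGroup E] [NormedSpace ℝ E] (K : Set E) (ε C : ℝ) : Prop :=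
  ∀ x ∈ K, ∀ y ∈ K, ‖x - y‖ < ε → ∃ z ∈ K, ‖z - (2 : ℝ)⁻¹ • (x + y)‖ ≤ C * ‖x - y‖ ^ 2

section Reach
variable {E : Type} [NormedAddCommGroup E] [InnerProductSpace ℝ E]

theorem MidP.nearest_unique {K : Set E} {ε C r : ℝ} (hK : MidP K ε C) (hC : 0 ≤ C) {p x y : E}
    (hx : x ∈ K) (hy : y ∈ K) (hpx : dist p x = r) (hpy : dist p y = r)
    (hmin : ∀ z ∈ K, r ≤ dist p z) (h1 : 2 * r < ε) (h2 : 8 * C * r < 1) : x = y := by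
  rw [dist_eq_norm] at hpx hpy
  have hr : 0 ≤ r := hpx ▸ norm_nonneg _
  have hs : ‖x - y‖ ≤ 2 * r := by
    have : x - y = (p - y) - (p - x) := by abel
    rw [this]
    exact (norm_sub_le _ _).trans (by rw [hpx, hpy]; linarith)
  obtain ⟨z, hz, hzm⟩ := hK x hx y hy (hs.trans_lt h1)
  have hpz : r ≤ ‖p - (2 : ℝ)⁻¹ • (x + y)‖ + C * ‖x - y‖ ^ 2 := by
    have h := hmin z hz
    rw [dist_eq_norm] at h
    have : p - z = (p - (2 : ℝ)⁻¹ • (x + y)) - (z - (2 : ℝ)⁻¹ • (x + y)) := by abel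
    rw [this] at h
    exact h.trans ((norm_sub_le _ _).trans (by linarith))
  have hpar : 4 * ‖p - (2 : ℝ)⁻¹ • (x + y)‖ ^ 2 + ‖x - y‖ ^ 2 = 4 * r ^ 2 := by
    have h := parallelogram_law_with_norm ℝ (p - x) (p - y)
    have e1 : (p - x) + (p - y) = (2 : ℝ) • (p - (2 : ℝ)⁻¹ • (x + y)) := by
      rw [smul_sub, smul_inv_smul₀ two_ne_zero, two_smul]; abel
    have e2 : (p - x) - (p - y) = -(x - y) := by abel
    rw [e1, e2, norm_neg, norm_smul, hpx, hpy, Real.norm_two] at h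
    linarith
  set s := ‖x - y‖ with hsdef
  set a := ‖p - (2 : ℝ)⁻¹ • (x + y)‖ with hadef
  have ha : 0 ≤ a := norm_nonneg _
  have hs0 : 0 ≤ s := norm_nonneg _
  have hCs : C * s ^ 2 ≤ r := by
    have h3 : s ^ 2 ≤ (2 * r) ^ 2 := pow_le_pow_left₀ hs0 hs 2
    have h4 := mul_le_mul_of_nonneg_left h3 hC
    nlinarith
  have h5 : (r - C * s ^ 2) ^ 2 ≤ a ^ 2 := pow_le_pow_left₀ (by linarith) (by linarith) 2
  have h6 : s ^ 2 * (1 - 8 * C * r) ≤ 0 := by nlinarith [sq_nonneg (C * s ^ 2)]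
  have h7 : s ^ 2 ≤ 0 := by
    by_contra h
    nlinarith [mul_pos (not_le.1 h) (sub_pos.2 h2)]
  have h8 : s = 0 := by
    have := le_antisymm h7 (sq_nonneg s)
    exact pow_eq_zero_iff two_ne_zero |>.1 this
  exact sub_eq_zero.1 (norm_eq_zero.1 h8)

theorem MidP.exists_retraction {K : Set E} {ε C δ : ℝ} (hK : MidP K ε C) (hC : 0 ≤ C)
    (hc : IsCompact K) (h1 : 2 * δ < ε) (h2 : 8 * C * δ < 1) :
    ∃ ρ : C({p : E // ∃ x ∈ K, dist p x < δ}, K),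
      ∀ p, ∀ x ∈ K, dist p.1 (ρ p).1 ≤ dist p.1 x := by
  have hex : ∀ p : {p : E // ∃ x ∈ K, dist p x < δ}, ∃ x : K, ∀ y ∈ K, dist p.1 x.1 ≤ dist p.1 y := by
    rintro ⟨p, x, hx, -⟩
    obtain ⟨z, hz, hmin⟩ := hc.exists_isMinOn ⟨x, hx⟩
      (f := fun y => dist p y) (by fun_prop)
    exact ⟨⟨z, hz⟩, fun y hy => hmin hy⟩
  choose ρ hρ using hex
  refine ⟨⟨ρ, ?_⟩, hρ⟩
  have : CompactSpace K := isCompact_iff_compactSpace.1 hc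
  refine continuous_iff_continuousAt.2 fun p => ?_
  refine isCompact_univ.tendsto_nhds_of_unique_mapClusterPt (Eventually.of_forall fun _ =>
    Set.mem_univ _) fun y _ hy => ?_
  have hle : ∀ z ∈ K, dist p.1 y.1 ≤ dist p.1 z := by
    intro z hz
    by_contra hlt
    rw [not_le] at hlt
    have ho : IsOpen {w : {p : E // ∃ x ∈ K, dist p x < δ} × K | dist w.1.1 z < dist w.1.1 w.2.1} :=
      isOpen_lt (by fun_prop) (by fun_prop)
    obtain ⟨u, hu, v, hv, huv⟩ := mem_nhds_prod_iff.1 (ho.mem_nhds (show (p, y) ∈ _ from hlt))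
    obtain ⟨w, hwv, hwu⟩ := ((hy.frequently hv).and_eventually hu).exists
    exact absurd (hρ w z hz) (not_le.2 (huv (Set.mk_mem_prod hwu hwv)))
  have hlt : dist p.1 (ρ p).1 < δ := by
    obtain ⟨x, hx, hd⟩ := p.2
    exact (hρ p x hx).trans_lt hd
  refine Subtype.ext (hK.nearest_unique hC y.2 (ρ p).2
    (le_antisymm (hle _ (ρ p).2) (hρ p _ y.2)) rfl (hρ p) (by linarith) ?_)
  exact (mul_le_mul_of_nonneg_left hlt.le (by positivity)).trans_lt h2

theorem MidP.homotopy_id {K L : Set E} {ε C η : ℝ} (hK : MidP K ε C) (hC : 0 ≤ C)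
    (hc : IsCompact K) (h1 : 4 * η < ε) (h2 : 16 * C * η < 1) (f : C(K, L))
    (hf : ∀ x, dist x.1 (f x).1 < η) (g : C(L, K)) (hg : ∀ x, dist x.1 (g x).1 < η) :
    (g.comp f).Homotopic (ContinuousMap.id K) := by
  obtain ⟨ρ, hρ⟩ := hK.exists_retraction (δ := 2 * η) hC hc (by linarith) (by linarith)
  have hgf : ∀ x : K, dist x.1 (g (f x)).1 < 2 * η := fun x => by
    have := dist_triangle x.1 (f x).1 (g (f x)).1
    linarith [hf x, hg (f x)]
  have hρK : ∀ (x : K) h, ρ ⟨x.1, h⟩ = x := fun x h => by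
    have := hρ ⟨x.1, h⟩ x.1 x.2
    rw [dist_self] at this
    exact (Subtype.ext (dist_le_zero.1 this)).symm
  have hmem : ∀ (t : I) (x : K), ∃ z ∈ K,
      dist (AffineMap.lineMap (k := ℝ) (g (f x)).1 x.1 (t : ℝ)) z < 2 * η := fun t x => by
    refine ⟨x.1, x.2, ?_⟩
    rw [dist_lineMap_right, dist_comm, Real.norm_of_nonneg (by linarith [t.2.2])]
    refine (mul_le_of_le_one_left dist_nonneg (by linarith [t.2.1])).trans_lt (hgf x)
  refine ⟨⟨⟨fun p => ρ ⟨_, hmem p.1 p.2⟩, ?_⟩, fun x => ?_, fun x => ?_⟩⟩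
  · refine ρ.continuous.comp (Continuous.subtype_mk ?_ _)
    simp only [AffineMap.lineMap_apply_module]
    fun_prop
  · have e : (AffineMap.lineMap (k := ℝ) (g (f x)).1 x.1 ((0 : I) : ℝ)) = (g (f x)).1 := by simp
    have e2 : (⟨_, hmem 0 x⟩ : {p : E // ∃ x ∈ K, dist p x < 2 * η}) =
      ⟨(g (f x)).1, e ▸ hmem 0 x⟩ := Subtype.ext e
    change ρ _ = g (f x)
    rw [e2, hρK]
  · have e : (AffineMap.lineMap (k := ℝ) (g (f x)).1 x.1 ((1 : I) : ℝ)) = x.1 := by simp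
    have e2 : (⟨_, hmem 1 x⟩ : {p : E // ∃ x ∈ K, dist p x < 2 * η}) =
      ⟨x.1, e ▸ hmem 1 x⟩ := Subtype.ext e
    change ρ _ = x
    rw [e2, hρK]

theorem MidP.homotopyEquiv {K L : Set E} {ε C η : ℝ} (hK : MidP K ε C) (hL : MidP L ε C)
    (hC : 0 ≤ C) (hcK : IsCompact K) (hcL : IsCompact L) (h1 : 4 * η < ε) (h2 : 16 * C * η < 1)
    (hKL : ∀ x ∈ K, ∃ y ∈ L, dist x y < η) (hLK : ∀ x ∈ L, ∃ y ∈ K, dist x y < η)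
    (hη : 0 < η) :
    Nonempty (K ≃ₕ L) := by
  have key : ∀ {K L : Set E}, MidP L ε C → IsCompact L → (∀ x ∈ K, ∃ y ∈ L, dist x y < η) →
      ∃ f : C(K, L), ∀ x, dist x.1 (f x).1 < η := by
    intro K L hL hcL hKL
    obtain ⟨ρ, hρ⟩ := hL.exists_retraction (δ := η) hC hcL (by linarith) (by
      nlinarith [mul_nonneg hC hη.le])
    refine ⟨⟨fun x => ρ ⟨x.1, hKL x.1 x.2⟩, by fun_prop⟩, fun x => ?_⟩
    obtain ⟨y, hy, hd⟩ := hKL x.1 x.2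
    exact (hρ ⟨x.1, hKL x.1 x.2⟩ y hy).trans_lt hd
  obtain ⟨f, hf⟩ := key hL hcL hKL
  obtain ⟨g, hg⟩ := key hK hcK hLK
  exact ⟨⟨f, g, hK.homotopy_id hC hcK h1 h2 f hf g hg, hL.homotopy_id hC hcL h1 h2 g hg f hf⟩⟩

end Reach

/-- Nearby compact sets with uniform approximate midpoints are homotopy equivalent. -/
theorem MidP.eventually_homotopyEquiv {E T : Type} [NormedAddCommGroup E] [NormedSpace ℝ E]
    [FiniteDimensional ℝ E] (K : T → Set E) (l : Filter T) (t₀ : T) {ε C : ℝ} (hε : 0 < ε)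
    (hm : ∀ᶠ t in l, MidP (K t) ε C) (hm0 : MidP (K t₀) ε C)
    (hc : ∀ᶠ t in l, IsCompact (K t)) (hc0 : IsCompact (K t₀))
    (hl : ∀ η > 0, ∀ᶠ t in l, ∀ x ∈ K t₀, ∃ y ∈ K t, dist x y < η)
    (hu : ∀ η > 0, ∀ᶠ t in l, ∀ x ∈ K t, ∃ y ∈ K t₀, dist x y < η) :
    ∀ᶠ t in l, Nonempty (K t ≃ₕ K t₀) := by
  let e : E ≃L[ℝ] EuclideanSpace ℝ (Fin (Module.finrank ℝ E)) := toEuclidean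
  obtain ⟨a, ha, hea⟩ : ∃ a : ℝ, 0 < a ∧ ∀ x, ‖e x‖ ≤ a * ‖x‖ :=
    ⟨‖(e : E →L[ℝ] EuclideanSpace ℝ (Fin (Module.finrank ℝ E)))‖ + 1, add_pos_of_nonneg_of_pos (norm_nonneg _) one_pos, fun x =>
      ((e : E →L[ℝ] EuclideanSpace ℝ (Fin (Module.finrank ℝ E))).le_opNorm x).trans (by gcongr; simp)⟩
  obtain ⟨b, hb, heb⟩ : ∃ b : ℝ, 0 < b ∧ ∀ x, ‖x‖ ≤ b * ‖e x‖ :=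
    ⟨‖(e.symm : EuclideanSpace ℝ (Fin (Module.finrank ℝ E)) →L[ℝ] E)‖ + 1, add_pos_of_nonneg_of_pos (norm_nonneg _) one_pos, fun x => by
      have := (e.symm : EuclideanSpace ℝ (Fin (Module.finrank ℝ E)) →L[ℝ] E).le_opNorm (e x)
      simp only [ContinuousLinearEquiv.coe_coe, ContinuousLinearEquiv.symm_apply_apply] at this
      exact this.trans (by gcongr; linarith)⟩
  set C' := a * |C| * b ^ 2 with hC'
  have hC0 : 0 ≤ C' := by positivity
  have htr : ∀ S : Set E, MidP S ε C → MidP (e '' S) (ε / b) C' := by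
    rintro S hS _ ⟨x, hx, rfl⟩ _ ⟨y, hy, rfl⟩ hxy
    rw [← map_sub] at hxy ⊢
    have h1 : ‖x - y‖ < ε := (heb _).trans_lt (by rw [lt_div_iff₀ hb] at hxy; linarith)
    obtain ⟨z, hz, hzm⟩ := hS x hx y hy h1
    refine ⟨e z, ⟨z, hz, rfl⟩, ?_⟩
    rw [← map_add, ← map_smul, ← map_sub]
    calc _ ≤ a * ‖z - (2 : ℝ)⁻¹ • (x + y)‖ := hea _
      _ ≤ a * (|C| * ‖x - y‖ ^ 2) := by
        gcongr
        exact hzm.trans (by gcongr; exact le_abs_self C)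
      _ ≤ a * (|C| * (b * ‖e (x - y)‖) ^ 2) := by gcongr; exact heb _
      _ = _ := by rw [hC']; ring
  obtain ⟨η, hη, h1, h2⟩ : ∃ η > 0, 4 * η < ε / b ∧ 16 * C' * η < 1 := by
    refine ⟨min (ε / b / 8) (1 / (16 * C' + 1) / 2), by positivity, ?_, ?_⟩
    · have := min_le_left (ε / b / 8) (1 / (16 * C' + 1) / 2)
      have : 0 < ε / b := by positivity
      linarith
    · have h := min_le_right (ε / b / 8) (1 / (16 * C' + 1) / 2)
      have h3 := mul_le_mul_of_nonneg_left h (by positivity : 0 ≤ 16 * C')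
      have h4 : 16 * C' * (1 / (16 * C' + 1)) ≤ 1 := by
        rw [mul_one_div, div_le_one (by positivity)]; linarith
      linarith
  have hd : ∀ x y : E, dist x y < η / a → dist (e x) (e y) < η := fun x y h => by
    rw [dist_eq_norm] at h ⊢
    rw [← map_sub]
    rw [lt_div_iff₀ ha] at h
    exact (hea _).trans_lt (by linarith)
  filter_upwards [hm, hc, hl (η / a) (by positivity), hu (η / a) (by positivity)] with t ht hct hlt hut
  have := MidP.homotopyEquiv (htr _ ht) (htr _ hm0) hC0 (hct.image e.continuous)
    (hc0.image e.continuous) h1 h2 (by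
      rintro _ ⟨x, hx, rfl⟩
      obtain ⟨y, hy, h⟩ := hut x hx
      exact ⟨e y, ⟨y, hy, rfl⟩, hd _ _ h⟩) (by
      rintro _ ⟨x, hx, rfl⟩
      obtain ⟨y, hy, h⟩ := hlt x hx
      exact ⟨e y, ⟨y, hy, rfl⟩, hd _ _ h⟩) hη
  obtain ⟨w⟩ := this
  exact ⟨((e.toHomeomorph.image (K t)).toHomotopyEquiv.trans w).trans
    (e.toHomeomorph.image (K t₀)).symm.toHomotopyEquiv⟩

/-- Second differences of a `C²` function are quadratically small. -/
theorem exists_second_difference_le {W F : Type} [NormedAddCommGroup W] [NormedSpace ℝ W]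
    [NormedAddCommGroup F] [NormedSpace ℝ F] {g : W → F} {w₀ : W} (hg : ContDiffAt ℝ 2 g w₀) :
    ∃ C ≥ 0, ∃ U ∈ 𝓝 w₀, ∀ x ∈ U, ∀ y ∈ U,
      ‖g x + g y - (2 : ℝ) • g ((2 : ℝ)⁻¹ • (x + y))‖ ≤ C * ‖x - y‖ ^ 2 := by
  obtain ⟨K, s, hs, hK⟩ := (hg.fderiv_right (m := 1) (by norm_num)).exists_lipschitzOnWith
  have hd : ∀ᶠ w in 𝓝 w₀, DifferentiableAt ℝ g w :=
    (hg.eventually (by simp)).mono fun w hw => hw.differentiableAt (by simp)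
  obtain ⟨r, hr, hrs⟩ := Metric.mem_nhds_iff.1 (inter_mem hs hd)
  refine ⟨K, K.2, Metric.ball w₀ r, Metric.ball_mem_nhds _ hr, fun x hx y hy => ?_⟩
  set m := (2 : ℝ)⁻¹ • (x + y) with hm
  have hseg : ∀ z ∈ Metric.ball w₀ r, z - m = (2 : ℝ)⁻¹ • (z + z - (x + y)) := fun z _ => by
    rw [hm, smul_sub, ← two_smul ℝ z, inv_smul_smul₀ two_ne_zero]
  have hmem : m ∈ Metric.ball w₀ r := by
    have := (convex_ball w₀ r) hx hy (by norm_num : (0 : ℝ) ≤ 2⁻¹) (by norm_num : (0 : ℝ) ≤ 2⁻¹)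
      (by norm_num)
    rwa [← smul_add] at this
  have key : ∀ z ∈ Metric.ball w₀ r,
      ‖g z - g m - fderiv ℝ g m (z - m)‖ ≤ K * ‖z - m‖ * ‖z - m‖ := fun z hz => by
    refine Convex.norm_image_sub_le_of_norm_hasFDerivWithin_le' (s := segment ℝ m z)
      (f' := fderiv ℝ g) (fun w hw => ?_) (fun w hw => ?_) (convex_segment _ _)
      (left_mem_segment _ _ _) (right_mem_segment _ _ _)
    · exact (hrs ((convex_ball w₀ r).segment_subset hmem hz hw)).2.hasFDerivAt.hasFDerivWithinAt
    · have hw' := hrs ((convex_ball w₀ r).segment_subset hmem hz hw)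
      refine (hK.norm_sub_le hw'.1 (hrs hmem).1).trans ?_
      gcongr
      have := norm_sub_le_of_mem_segment hw
      exact this
  have ex : x - m = (2 : ℝ)⁻¹ • (x - y) := by rw [hseg x hx]; congr 1; abel
  have ey : y - m = -((2 : ℝ)⁻¹ • (x - y)) := by rw [hseg y hy, ← smul_neg]; congr 1; abel
  have hx' := key x hx
  have hy' := key y hy
  have hn : ‖(2 : ℝ)⁻¹ • (x - y)‖ = ‖x - y‖ / 2 := by
    rw [norm_smul, norm_inv, Real.norm_two]; ring
  rw [ex, hn] at hx'
  rw [ey, norm_neg, hn, map_neg] at hy'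
  have e : g x + g y - (2 : ℝ) • g m = (g x - g m - fderiv ℝ g m ((2 : ℝ)⁻¹ • (x - y))) +
      (g y - g m - -fderiv ℝ g m ((2 : ℝ)⁻¹ • (x - y))) := by rw [two_smul]; abel
  rw [e]
  refine (norm_add_le _ _).trans ((add_le_add hx' hy').trans ?_)
  nlinarith [mul_nonneg K.2 (sq_nonneg ‖x - y‖), NNReal.coe_nonneg K]

/-- Solving `f (t, ζ) = 0` near an approximate solution, uniformly in the parameter. -/
theorem exists_zero_near {T X F : Type} [NormedAddCommGroup T] [NormedSpace ℝ T]
    [NormedAddCommGroup X] [NormedSpace ℝ X] [NormedAddCommGroup F] [NormedSpace ℝ F]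
    [CompleteSpace T] [CompleteSpace X] [CompleteSpace F]
    {f : T × X → F} {f' : T × X →L[ℝ] F} {w₀ : T × X} (hf : HasStrictFDerivAt f f' w₀)
    (hs : Function.Surjective fun v : X => f' (0, v)) (h0 : f w₀ = 0) :
    ∃ C ≥ 0, ∀ᶠ w in 𝓝 w₀, ∃ ζ, f (w.1, ζ) = 0 ∧ ‖ζ - w.2‖ ≤ C * ‖f w‖ := by
  let G' : T × X →L[ℝ] T × F := (ContinuousLinearMap.fst ℝ T X).prod f'
  have hG : HasStrictFDerivAt (fun w : T × X => (w.1, f w)) G' w₀ :=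
    hasStrictFDerivAt_fst.prodMk hf
  have hsurj : Function.Surjective G' := by
    rintro ⟨a, b⟩
    obtain ⟨v, hv⟩ := hs (b - f' (a, 0))
    refine ⟨(a, v), Prod.ext rfl ?_⟩
    have : f' (a, v) = f' (a, 0) + f' (0, v) := by rw [← map_add]; simp
    change f' (a, v) = b
    rw [this]
    simp only at hv
    rw [hv]; abel
  have hrange : G'.range = ⊤ := LinearMap.range_eq_top.2 hsurj
  let R := G'.nonlinearRightInverseOfSurjective hrange
  have hN : 0 < R.nnnorm := G'.nonlinearRightInverseOfSurjective_nnnorm_pos hrange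
  obtain ⟨s, hs, happ⟩ := hG.approximates_deriv_on_nhds (c := R.nnnorm⁻¹ / 2)
    (Or.inr (by positivity))
  obtain ⟨r, hr, hrs⟩ := Metric.mem_nhds_iff.1 hs
  refine ⟨2 * R.nnnorm, by positivity, ?_⟩
  have hcont : ContinuousAt f w₀ := hf.continuousAt
  have h1 : ∀ᶠ w in 𝓝 w₀, 2 * R.nnnorm * ‖f w‖ < r / 2 := by
    have : Tendsto (fun w => 2 * (R.nnnorm : ℝ) * ‖f w‖) (𝓝 w₀) (𝓝 (2 * R.nnnorm * ‖f w₀‖)) :=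
      (tendsto_const_nhds).mul hcont.norm
    rw [h0, norm_zero, mul_zero] at this
    exact this.eventually (gt_mem_nhds (by positivity))
  filter_upwards [h1, Metric.ball_mem_nhds w₀ (half_pos hr)] with w hw hwr
  have hsub : Metric.closedBall w (2 * R.nnnorm * ‖f w‖) ⊆ s := fun z hz => hrs <| by
    rw [Metric.mem_closedBall] at hz
    rw [Metric.mem_ball] at hwr ⊢
    linarith [dist_triangle z w w₀]
  obtain ⟨z, hz, hze⟩ := happ.surjOn_closedBall_of_nonlinearRightInverse R (by positivity) hsub
    (show (w.1, (0 : F)) ∈ _ by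
      rw [Metric.mem_closedBall, Prod.dist_eq]
      have hNr : (0 : ℝ) < R.nnnorm := hN
      have e : (((R.nnnorm : ℝ))⁻¹ - ((R.nnnorm⁻¹ / 2 : NNReal) : ℝ)) * (2 * R.nnnorm * ‖f w‖) =
          ‖f w‖ := by
        push_cast; field_simp; ring
      rw [e]
      simp)
  have hz1 : z.1 = w.1 := congrArg (Prod.fst (α := T) (β := F)) hze
  have hz2 : f z = 0 := congrArg (Prod.snd (α := T) (β := F)) hze
  refine ⟨z.2, by rw [← hz1]; exact hz2, ?_⟩
  rw [Metric.mem_closedBall, dist_eq_norm] at hz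
  exact (norm_snd_le (z - w)).trans hz

/-- Near `x₀`, the sets `K t` have approximate midpoints and approach `x₀`. -/
structure LocMid {E T : Type} [NormedAddCommGroup E] [NormedSpace ℝ E] [TopologicalSpace T]
    (K : T → Set E) (t₀ : T) (x₀ : E) : Prop where
  mid : ∃ C ≥ 0, ∃ U ∈ 𝓝 x₀, ∀ᶠ t in 𝓝 t₀, ∀ x ∈ K t ∩ U, ∀ y ∈ K t ∩ U, ∃ z ∈ K t,
    ‖z - (2 : ℝ)⁻¹ • (x + y)‖ ≤ C * ‖x - y‖ ^ 2
  lower : ∀ η > 0, ∀ᶠ t in 𝓝 t₀, ∃ y ∈ K t, dist x₀ y < η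

theorem LocMid.of_chart {E T X F : Type} [NormedAddCommGroup E] [NormedSpace ℝ E]
    [NormedAddCommGroup T] [NormedSpace ℝ T]
    [NormedAddCommGroup X] [NormedSpace ℝ X] [NormedAddCommGroup F] [NormedSpace ℝ F]
    [CompleteSpace T] [CompleteSpace X] [CompleteSpace F]
    {K : T → Set E} {t₀ : T} {x₀ : E} {κ : X → E} {l : E → X} {ξ₀ : X} {f : T × X → F}
    (hκ : ContDiffAt ℝ 2 κ ξ₀) (hl : ContDiffAt ℝ 1 l x₀) (hκ0 : κ ξ₀ = x₀) (hl0 : l x₀ = ξ₀)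
    (hκl : ∀ᶠ p : T × E in 𝓝 (t₀, x₀), p.2 ∈ K p.1 → κ (l p.2) = p.2)
    (hf : ContDiffAt ℝ 2 f (t₀, ξ₀))
    (hs : Function.Surjective fun v : X => fderiv ℝ f (t₀, ξ₀) (0, v))
    (hK : ∀ᶠ p : T × X in 𝓝 (t₀, ξ₀), κ p.2 ∈ K p.1 ↔ f p = 0) (hx₀ : x₀ ∈ K t₀) :
    LocMid K t₀ x₀ := by
  have h0 : f (t₀, ξ₀) = 0 := hK.self_of_nhds.1 (by rw [hκ0]; exact hx₀)
  obtain ⟨C1, hC1, hz⟩ := exists_zero_near (hf.hasStrictFDerivAt (by simp)) hs h0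
  have hzt : ∀ N ∈ 𝓝 ξ₀, ∀ᶠ p : T × X in 𝓝 (t₀, ξ₀),
      ∃ ζ ∈ N, κ ζ ∈ K p.1 ∧ ‖ζ - p.2‖ ≤ C1 * ‖f p‖ := by
    intro N hN
    have hK' : ∀ᶠ p : T × X in 𝓝 (t₀, ξ₀), ∀ ζ, ‖ζ - p.2‖ ≤ C1 * ‖f p‖ →
        (κ ζ ∈ K p.1 ↔ f (p.1, ζ) = 0) ∧ ζ ∈ N := by
      obtain ⟨r, hr, hrs⟩ := Metric.mem_nhds_iff.1
        (inter_mem hK (continuous_snd.continuousAt (x := (t₀, ξ₀)) hN))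
      have h1 : ∀ᶠ p : T × X in 𝓝 (t₀, ξ₀), C1 * ‖f p‖ < r / 2 := by
        have : Tendsto (fun w => C1 * ‖f w‖) (𝓝 (t₀, ξ₀)) (𝓝 (C1 * ‖f (t₀, ξ₀)‖)) :=
          (tendsto_const_nhds).mul hf.continuousAt.norm
        rw [h0, norm_zero, mul_zero] at this
        exact this.eventually (gt_mem_nhds (by positivity))
      filter_upwards [h1, Metric.ball_mem_nhds _ (half_pos hr)] with p hp hpr ζ hζ
      have hm : (p.1, ζ) ∈ Metric.ball (t₀, ξ₀) r := by
        rw [Metric.mem_ball, Prod.dist_eq] at hpr ⊢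
        rw [max_lt_iff] at hpr ⊢
        refine ⟨by simp only; linarith [hpr.1], ?_⟩
        have := dist_triangle ζ p.2 ξ₀
        rw [dist_eq_norm ζ p.2] at this
        simp only at hpr ⊢
        linarith [hpr.2]
      exact ⟨(hrs hm).1, (hrs hm).2⟩
    filter_upwards [hz, hK'] with p ⟨ζ, hζ, hn⟩ hp
    exact ⟨ζ, (hp ζ hn).2, (hp ζ hn).1.2 hζ, hn⟩
  refine ⟨?_, fun η hη => ?_⟩
  · obtain ⟨C2, hC2, U2, hU2, h2⟩ := exists_second_difference_le hf
    obtain ⟨C3, hC3, U3, hU3, h3⟩ := exists_second_difference_le hκ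
    obtain ⟨L, V, hV, hL⟩ := hl.exists_lipschitzOnWith
    obtain ⟨M, W, hW, hM⟩ :=
      (hκ.of_le (by norm_num : (1 : WithTop ℕ∞) ≤ 2)).exists_lipschitzOnWith
    obtain ⟨r, hr, hball⟩ := Metric.mem_nhds_iff.1 (inter_mem (inter_mem hU2 (hzt W hW))
      (inter_mem hK (continuous_snd.continuousAt (x := (t₀, ξ₀)) (inter_mem hU3 hW))))
    obtain ⟨A, hA, U, hU, hAU⟩ := mem_nhds_prod_iff.1 hκl
    have hb : ∀ t ∈ Metric.ball t₀ r, ∀ ξ ∈ Metric.ball ξ₀ r, (t, ξ) ∈ Metric.ball (t₀, ξ₀) r :=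
      fun t ht ξ hξ => by
        rw [← ball_prod_same]; exact ⟨ht, hξ⟩
    refine ⟨M * (C1 * (C2 / 2)) * L ^ 2 + C3 / 2 * L ^ 2, by positivity,
      U ∩ (V ∩ l ⁻¹' Metric.ball ξ₀ r), inter_mem hU (inter_mem hV
        (hl.continuousAt.preimage_mem_nhds (by rw [hl0]; exact Metric.ball_mem_nhds _ hr))), ?_⟩
    filter_upwards [hA, Metric.ball_mem_nhds t₀ hr] with t htA htr x hx y hy
    obtain ⟨hxK, hxU, hxV, hxr⟩ := hx
    obtain ⟨hyK, hyU, hyV, hyr⟩ := hy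
    have ex : κ (l x) = x := hAU (show (t, x) ∈ _ from ⟨htA, hxU⟩) hxK
    have ey : κ (l y) = y := hAU (show (t, y) ∈ _ from ⟨htA, hyU⟩) hyK
    have bx := hball (hb t htr _ hxr)
    have by' := hball (hb t htr _ hyr)
    have fx : f (t, l x) = 0 := bx.2.1.1 (by rw [ex]; exact hxK)
    have fy : f (t, l y) = 0 := by'.2.1.1 (by rw [ey]; exact hyK)
    set m := (2 : ℝ)⁻¹ • (l x + l y) with hm
    have hmr : m ∈ Metric.ball ξ₀ r := by
      have := (convex_ball ξ₀ r) hxr hyr (by norm_num : (0 : ℝ) ≤ 2⁻¹)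
        (by norm_num : (0 : ℝ) ≤ 2⁻¹) (by norm_num)
      rwa [← smul_add] at this
    have bm := hball (hb t htr _ hmr)
    obtain ⟨ζ, hζW, hζK, hζ⟩ := bm.1.2
    simp only at hζ hζK
    have hfm : ‖f (t, m)‖ ≤ C2 / 2 * ‖l x - l y‖ ^ 2 := by
      have h := h2 _ bx.1.1 _ by'.1.1
      have e : (2 : ℝ)⁻¹ • ((t, l x) + (t, l y)) = (t, m) := by
        rw [Prod.mk_add_mk, Prod.smul_mk, ← two_smul ℝ t, inv_smul_smul₀ two_ne_zero]
      rw [e, fx, fy, add_zero, zero_sub, norm_neg, norm_smul, Real.norm_two, Prod.mk_sub_mk,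
        sub_self, Prod.norm_mk, norm_zero, max_eq_right (norm_nonneg _)] at h
      linarith
    have hκm : ‖κ m - (2 : ℝ)⁻¹ • (x + y)‖ ≤ C3 / 2 * ‖l x - l y‖ ^ 2 := by
      have h := h3 _ bx.2.2.1 _ by'.2.2.1
      simp only [ex, ey] at h
      have e : x + y - (2 : ℝ) • κ m = -((2 : ℝ) • (κ m - (2 : ℝ)⁻¹ • (x + y))) := by
        rw [smul_sub, smul_inv_smul₀ two_ne_zero]; abel
      rw [← hm, e, norm_neg, norm_smul, Real.norm_two] at h
      linarith
    have hlxy : ‖l x - l y‖ ≤ L * ‖x - y‖ := hL.norm_sub_le hxV hyV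
    have hl2 : ‖l x - l y‖ ^ 2 ≤ L ^ 2 * ‖x - y‖ ^ 2 := by
      rw [← mul_pow]; gcongr
    refine ⟨κ ζ, hζK, ?_⟩
    have e : κ ζ - (2 : ℝ)⁻¹ • (x + y) = (κ ζ - κ m) + (κ m - (2 : ℝ)⁻¹ • (x + y)) := by abel
    rw [e]
    calc _ ≤ ‖κ ζ - κ m‖ + ‖κ m - (2 : ℝ)⁻¹ • (x + y)‖ := norm_add_le _ _
      _ ≤ M * (C1 * (C2 / 2 * (L ^ 2 * ‖x - y‖ ^ 2))) + C3 / 2 * (L ^ 2 * ‖x - y‖ ^ 2) := by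
        gcongr
        · refine (hM.norm_sub_le hζW bm.2.2.2).trans ?_
          gcongr
          refine hζ.trans ?_
          gcongr
          exact hfm.trans (by gcongr)
        · exact hκm.trans (by gcongr)
      _ = _ := by ring
  · have hN : {ζ | dist x₀ (κ ζ) < η} ∈ 𝓝 ξ₀ := by
      have : ContinuousAt (fun ζ => dist x₀ (κ ζ)) ξ₀ := continuousAt_const.dist hκ.continuousAt
      exact this.preimage_mem_nhds (by rw [hκ0, dist_self]; exact gt_mem_nhds hη)
    have hc : ContinuousAt (fun t : T => (t, ξ₀)) t₀ := by fun_prop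
    filter_upwards [hc (hzt _ hN)] with t ⟨ζ, hζ, hζK, _⟩
    exact ⟨κ ζ, hζK, hζ⟩

/-- Local constancy of the homotopy type in a family of compact sets. -/
theorem eventually_homotopyEquiv_of_locMid {E T : Type} [NormedAddCommGroup E] [NormedSpace ℝ E]
    [FiniteDimensional ℝ E] [TopologicalSpace T] {K : T → Set E} {Q : Set E} (hQ : IsCompact Q)
    (hKQ : ∀ t, K t ⊆ Q) (hcl : IsClosed {p : T × E | p.2 ∈ K p.1}) {t₀ : T}
    (hloc : ∀ x ∈ K t₀, LocMid K t₀ x) :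
    ∀ᶠ t in 𝓝 t₀, Nonempty (K t ≃ₕ K t₀) := by
  have hc : ∀ t, IsCompact (K t) := fun t => hQ.of_isClosed_subset
    (hcl.preimage (by fun_prop : Continuous fun x : E => (t, x))) (hKQ t)
  have upper : ∀ O : Set E, IsOpen O → K t₀ ⊆ O → ∀ᶠ t in 𝓝 t₀, K t ⊆ O := by
    intro O hO hKO
    have hcomp : IsCompact (Q \ O) := hQ.diff hO
    have := hcomp.eventually_forall_of_forall_eventually (x₀ := t₀)
      (P := fun t x => x ∉ K t) (fun x hx => by
        refine (hcl.isOpen_compl.mem_nhds (show (t₀, x) ∉ _ from fun h => hx.2 (hKO h))))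
    filter_upwards [this] with t ht x hx
    by_contra h
    exact ht x ⟨hKQ t hx, h⟩ hx
  choose! C hC U hU hmid using fun x hx => (hloc x hx).mid
  have hr : ∀ x ∈ K t₀, ∃ r > 0, Metric.ball x (2 * r) ⊆ U x := fun x hx => by
    obtain ⟨r, hr, h⟩ := Metric.mem_nhds_iff.1 (hU x hx)
    exact ⟨r / 2, half_pos hr, by rwa [mul_div_cancel₀ _ two_ne_zero]⟩
  choose! r hr0 hr using hr
  obtain ⟨S, hS⟩ := (hc t₀).elim_nhds_subcover' (fun x hx => Metric.ball x (r x))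
    (fun x hx => Metric.ball_mem_nhds _ (hr0 x hx))
  obtain ⟨ε, hε, hεr⟩ : ∃ ε > 0, ∀ x ∈ S, ε ≤ r x.1 := by
    rcases S.eq_empty_or_nonempty with h | h
    · exact ⟨1, one_pos, by simp [h]⟩
    · obtain ⟨x, hx, hmin⟩ := S.exists_min_image (fun x => r x.1) h
      exact ⟨r x.1, hr0 _ x.2, hmin⟩
  obtain ⟨D, hD⟩ : ∃ D, ∀ x ∈ S, C x.1 ≤ D :=
    ⟨∑ x ∈ S, C x.1, fun x hx => Finset.single_le_sum (f := fun x : K t₀ => C x.1)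
      (fun y _ => hC _ y.2) hx⟩
  have hm : ∀ᶠ t in 𝓝 t₀, MidP (K t) ε D := by
    have h1 : ∀ᶠ t in 𝓝 t₀, ∀ s ∈ S, ∀ x ∈ K t ∩ U s.1, ∀ y ∈ K t ∩ U s.1, ∃ z ∈ K t,
        ‖z - (2 : ℝ)⁻¹ • (x + y)‖ ≤ C s.1 * ‖x - y‖ ^ 2 :=
      (Finset.eventually_all S).2 fun s _ => hmid s.1 s.2
    filter_upwards [h1, upper _ (isOpen_biUnion fun s _ => Metric.isOpen_ball) hS]
      with t ht hsub x hx y hy hxy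
    obtain ⟨s, hs, hxs⟩ := Set.mem_iUnion₂.1 (hsub hx)
    have hrs := hr s.1 s.2
    rw [Metric.mem_ball] at hxs
    obtain ⟨z, hz, h⟩ := ht s hs x ⟨hx, hrs (by
        rw [Metric.mem_ball]; linarith [hr0 s.1 s.2])⟩ y ⟨hy, hrs (by
        rw [Metric.mem_ball]
        have h1 := dist_triangle y x s.1
        rw [dist_comm y x, dist_eq_norm x y] at h1
        linarith [hεr s hs])⟩
    exact ⟨z, hz, h.trans (by gcongr; exact hD s hs)⟩
  refine MidP.eventually_homotopyEquiv K (𝓝 t₀) t₀ hε hm hm.self_of_nhds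
    (Eventually.of_forall hc) (hc t₀) (fun η hη => ?_) (fun η hη => ?_)
  · obtain ⟨S', hS'⟩ := (hc t₀).elim_nhds_subcover' (fun x _ => Metric.ball x (η / 2))
      (fun x _ => Metric.ball_mem_nhds _ (half_pos hη))
    have h1 : ∀ᶠ t in 𝓝 t₀, ∀ s ∈ S', ∃ y ∈ K t, dist s.1 y < η / 2 :=
      (Finset.eventually_all S').2 fun s _ => (hloc s.1 s.2).lower _ (half_pos hη)
    filter_upwards [h1] with t ht x hx
    obtain ⟨s, hs, hxs⟩ := Set.mem_iUnion₂.1 (hS' hx)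
    obtain ⟨y, hy, hd⟩ := ht s hs
    rw [Metric.mem_ball] at hxs
    exact ⟨y, hy, by linarith [dist_triangle x s.1 y]⟩
  · have hsub : K t₀ ⊆ ⋃ x ∈ K t₀, Metric.ball x η := fun x hx =>
      Set.mem_iUnion₂.2 ⟨x, hx, Metric.mem_ball_self hη⟩
    filter_upwards [upper _ (isOpen_biUnion fun s _ => Metric.isOpen_ball) hsub] with t ht x hx
    obtain ⟨y, hy, h⟩ := Set.mem_iUnion₂.1 (ht hx)
    exact ⟨y, hy, h⟩

theorem exists_algebraic_relation {ι τ : Type} [Fintype ι] [Fintype τ]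
    (h : Fintype.card τ < Fintype.card ι) (Φ : ι → MvPolynomial τ ℂ) :
    ∃ q : MvPolynomial ι ℂ, q ≠ 0 ∧ ∀ s, MvPolynomial.eval (fun i => MvPolynomial.eval s (Φ i)) q = 0 := by
  have hn : ¬ AlgebraicIndependent ℂ Φ := fun hΦ => by
    have := hΦ.cardinalMk_le_trdeg
    rw [MvPolynomial.trdeg_of_isDomain] at this
    simp only [Cardinal.mk_fintype, Cardinal.lift_natCast, Nat.cast_le] at this
    omega
  rw [algebraicIndependent_iff] at hn
  push Not at hn
  obtain ⟨q, hq, hq0⟩ := hn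
  refine ⟨q, hq0, fun s => ?_⟩
  have := congrArg (MvPolynomial.eval s) hq
  rw [map_zero] at this
  rw [← this, ← MvPolynomial.coe_aeval_eq_eval, ← MvPolynomial.coe_aeval_eq_eval]
  exact (MvPolynomial.comp_aeval_apply (f := Φ) (MvPolynomial.aeval s) q).symm

theorem exists_submatrix_det_ne_zero {ι : Type} [Fintype ι] {k : ℕ}
    (M : Matrix (Fin k) ι ℂ) (h : Function.Surjective M.mulVec) :
    ∃ g : Fin k → ι, Function.Injective g ∧ (M.submatrix id g).det ≠ 0 := by
  have hspan : Submodule.span ℂ (Set.range M.col) = ⊤ := by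
    rw [← Matrix.range_mulVecLin]
    exact LinearMap.range_eq_top.2 h
  obtain ⟨f, hf, -, hli⟩ := Submodule.exists_fun_fin_finrank_span_eq ℂ (Set.range M.col)
  have hk : Module.finrank ℂ (Submodule.span ℂ (Set.range M.col)) = k := by
    rw [hspan, finrank_top, Module.finrank_fin_fun]
  choose g hg using hf
  have hli' : LinearIndependent ℂ ((M.submatrix id (g ∘ Fin.cast hk.symm)).col) := by
    have : (M.submatrix id (g ∘ Fin.cast hk.symm)).col = f ∘ Fin.cast hk.symm := by
      funext i; exact hg _
    rw [this]
    exact hli.comp _ (Fin.cast_injective _)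
  refine ⟨g ∘ Fin.cast hk.symm, fun a b hab => hli'.injective ?_, ?_⟩
  · funext r
    exact congrArg (M r) hab
  · rw [← isUnit_iff_ne_zero, ← Matrix.isUnit_iff_isUnit_det]
    exact Matrix.linearIndependent_cols_iff_isUnit.1 hli'

/-- The kernels of a family of `k × ι` matrices depending polynomially on fewer than `k` parameters
do not fill the space. -/
theorem exists_poly_of_linear_conditions {ι p : Type} [Fintype ι] [DecidableEq ι] [Fintype p]
    {k : ℕ} (hkm : Fintype.card p < k) (M : Matrix (Fin k) ι (MvPolynomial p ℂ)) :
    ∃ q : MvPolynomial ι ℂ, q ≠ 0 ∧ ∀ (x : p → ℂ) (t : ι → ℂ),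
      Function.Surjective (M.map (MvPolynomial.eval x)).mulVec →
      (M.map (MvPolynomial.eval x)).mulVec t = 0 → MvPolynomial.eval t q = 0 := by
  have key : ∀ g : Fin k → ι, ∃ q : MvPolynomial ι ℂ, q ≠ 0 ∧ ∀ (x : p → ℂ) (t : ι → ℂ),
      Function.Injective g → ((M.map (MvPolynomial.eval x)).submatrix id g).det ≠ 0 →
      (M.map (MvPolynomial.eval x)).mulVec t = 0 → MvPolynomial.eval t q = 0 := by
    intro g
    by_cases hg : Function.Injective g
    swap
    · exact ⟨1, one_ne_zero, fun x t h => absurd h hg⟩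
    let R := MvPolynomial (p ⊕ {i // i ∉ Set.range g}) ℂ
    let M' : Matrix (Fin k) ι R := M.map (MvPolynomial.rename Sum.inl)
    let S : ι → R := fun i => if h : i ∉ Set.range g then MvPolynomial.X (Sum.inr ⟨i, h⟩) else 0
    let Φ : ι → R := fun i => (M'.submatrix id g).det * S i -
      ∑ a, if g a = i then ((M'.submatrix id g).adjugate.mulVec (M'.mulVec S)) a else 0
    have hcard : Fintype.card (p ⊕ {i // i ∉ Set.range g}) < Fintype.card ι := by
      have h1 : Fintype.card {i // i ∈ Set.range g} = k := by
        exact (Fintype.card_congr (Equiv.ofInjective g hg)).symm.trans (Fintype.card_fin k)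
      have h2 := Fintype.card_subtype_compl (fun i => i ∈ Set.range g)
      have h3 := Fintype.card_subtype_le (fun i => i ∈ Set.range g)
      rw [Fintype.card_sum]
      simp only [h1] at h2 h3
      omega
    obtain ⟨q, hq, hqΦ⟩ := exists_algebraic_relation hcard Φ
    refine ⟨q, hq, fun x t _ hdet ht => ?_⟩
    set N := M.map (MvPolynomial.eval x) with hN
    set D := (N.submatrix id g).det with hD
    let s : p ⊕ {i // i ∉ Set.range g} → ℂ := Sum.elim x fun i => t i.1 / D
    have hM' : M'.map (MvPolynomial.eval s) = N := by
      ext a b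
      simp only [M', N, Matrix.map_apply, MvPolynomial.eval_rename]
      rfl
    have hS : ∀ i, MvPolynomial.eval s (S i) = if i ∉ Set.range g then t i / D else 0 := by
      intro i
      by_cases h : i ∈ Set.range g
      · rw [if_neg (not_not.2 h)]
        simp only [S]
        rw [dif_neg (not_not.2 h), map_zero]
      · simp only [S, h, not_false_iff, dif_pos, if_true, MvPolynomial.eval_X]
        rfl
    have hsub : (M'.submatrix id g).map (MvPolynomial.eval s) = N.submatrix id g := by
      rw [← hM']; rfl
    have hdetS : MvPolynomial.eval s (M'.submatrix id g).det = D := by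
      rw [RingHom.map_det, RingHom.mapMatrix_apply, hsub]
    set S₀ : ι → ℂ := fun i => if i ∉ Set.range g then t i / D else 0 with hS₀
    have hcomp : (MvPolynomial.eval s) ∘ S = S₀ := funext hS
    have hv : ∀ a, MvPolynomial.eval s
        (((M'.submatrix id g).adjugate.mulVec (M'.mulVec S)) a) = - t (g a) := by
      intro a
      rw [RingHom.map_mulVec]
      have e1 : (MvPolynomial.eval s) ∘ (M'.mulVec S) = N.mulVec S₀ := by
        funext b
        rw [Function.comp_apply, RingHom.map_mulVec, hM', hcomp]
      have e2 : (M'.submatrix id g).adjugate.map (MvPolynomial.eval s) =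
          (N.submatrix id g).adjugate := by
        rw [← RingHom.mapMatrix_apply, RingHom.map_adjugate, RingHom.mapMatrix_apply, hsub]
      rw [e1, e2]
      have e3 : D • S₀ = t - fun i => ∑ b, if g b = i then t (g b) else 0 := by
        funext i
        simp only [Pi.smul_apply, smul_eq_mul, Pi.sub_apply, hS₀]
        by_cases h : i ∈ Set.range g
        · obtain ⟨b, rfl⟩ := h
          simp [hg.eq_iff]
        · rw [if_pos h, mul_div_cancel₀ _ hdet, Finset.sum_eq_zero, sub_zero]
          intro b _
          rw [if_neg fun hb => h ⟨b, hb⟩]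
      have e4 : N.mulVec (fun i => ∑ b, if g b = i then t (g b) else 0) =
          (N.submatrix id g).mulVec (t ∘ g) := by
        funext r
        simp only [Matrix.mulVec, dotProduct, Finset.mul_sum, Matrix.submatrix_apply, id,
          Function.comp_apply]
        rw [Finset.sum_comm]
        refine Finset.sum_congr rfl fun b _ => ?_
        simp
      have e5 : D • (N.submatrix id g).adjugate.mulVec (N.mulVec S₀) = D • -(t ∘ g) := by
        rw [← Matrix.mulVec_smul, ← Matrix.mulVec_smul, e3, Matrix.mulVec_sub, ht, e4, zero_sub,
          Matrix.mulVec_neg, Matrix.mulVec_mulVec, Matrix.adjugate_mul, Matrix.smul_mulVec,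
          Matrix.one_mulVec, smul_neg]
      exact congrFun (smul_right_injective _ hdet e5) a
    convert hqΦ s using 2
    congr 1
    funext i
    simp only [Φ]
    rw [map_sub, map_mul, map_sum, hS, hdetS]
    simp only [apply_ite (MvPolynomial.eval s), hv, map_zero]
    by_cases h : i ∈ Set.range g
    · obtain ⟨b, rfl⟩ := h
      simp [hg.eq_iff]
    · rw [if_pos h, mul_div_cancel₀ _ hdet, Finset.sum_eq_zero, sub_zero]
      intro b _
      rw [if_neg fun hb => h ⟨b, hb⟩]
  choose Q hQ0 hQ using key
  refine ⟨∏ g, Q g, Finset.prod_ne_zero_iff.2 fun g _ => hQ0 g, fun x t hs ht => ?_⟩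
  obtain ⟨g, hg, hdet⟩ := exists_submatrix_det_ne_zero _ hs
  rw [map_prod]
  exact Finset.prod_eq_zero (Finset.mem_univ g) (hQ g x t hg hdet ht)

/-- Polynomial functions. -/
def IsPoly {p : Type} (g : (p → ℂ) → ℂ) : Prop :=
  ∃ P : MvPolynomial p ℂ, ∀ x, g x = MvPolynomial.eval x P

namespace IsPoly
variable {p : Type} {f g : (p → ℂ) → ℂ}

theorem const (c : ℂ) : IsPoly fun _ : p → ℂ => c := ⟨MvPolynomial.C c, fun x => by simp⟩

theorem coord (i : p) : IsPoly fun x : p → ℂ => x i := ⟨MvPolynomial.X i, fun x => by simp⟩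

theorem add (hf : IsPoly f) (hg : IsPoly g) : IsPoly fun x => f x + g x := by
  obtain ⟨P, hP⟩ := hf
  obtain ⟨Q, hQ⟩ := hg
  exact ⟨P + Q, fun x => by simp [hP, hQ]⟩

theorem mul (hf : IsPoly f) (hg : IsPoly g) : IsPoly fun x => f x * g x := by
  obtain ⟨P, hP⟩ := hf
  obtain ⟨Q, hQ⟩ := hg
  exact ⟨P * Q, fun x => by simp [hP, hQ]⟩

theorem sum {ι : Type} (s : Finset ι) {f : ι → (p → ℂ) → ℂ} (hf : ∀ i, IsPoly (f i)) :
    IsPoly fun x => ∑ i ∈ s, f i x := by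
  choose P hP using hf
  exact ⟨∑ i ∈ s, P i, fun x => by simp [hP, map_sum]⟩

theorem prod {ι : Type} (s : Finset ι) {f : ι → (p → ℂ) → ℂ} (hf : ∀ i, IsPoly (f i)) :
    IsPoly fun x => ∏ i ∈ s, f i x := by
  choose P hP using hf
  exact ⟨∏ i ∈ s, P i, fun x => by simp [hP, map_prod]⟩

theorem comp {r : Type} (hf : IsPoly f) {φ : (r → ℂ) → p → ℂ} (hφ : ∀ i, IsPoly fun x => φ x i) :
    IsPoly fun x => f (φ x) := by
  obtain ⟨P, hP⟩ := hf
  choose Q hQ using hφ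
  refine ⟨MvPolynomial.aeval Q P, fun x => ?_⟩
  have hx : φ x = fun i => MvPolynomial.eval x (Q i) := funext fun i => hQ i x
  change f (φ x) = _
  rw [hP, hx, ← MvPolynomial.coe_aeval_eq_eval, ← MvPolynomial.coe_aeval_eq_eval]
  exact (MvPolynomial.comp_aeval_apply (f := Q) (MvPolynomial.aeval x) P).symm

theorem contDiff [Fintype p] (hf : IsPoly f) {n : WithTop ℕ∞} : ContDiff ℂ n f := by
  obtain ⟨P, hP⟩ := hf
  rw [funext hP]
  clear hP
  induction P using MvPolynomial.induction_on with
  | C a => simpa using contDiff_const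
  | add P Q h1 h2 =>
    simp only [map_add]
    exact h1.add h2
  | mul_X P i h =>
    simp only [map_mul, MvPolynomial.eval_X]
    exact h.mul (contDiff_apply ℂ ℂ i)

theorem differentiable [Fintype p] (hf : IsPoly f) : Differentiable ℂ f :=
  (hf.contDiff (n := 1)).differentiable (by simp)

theorem fderiv [Fintype p] (hf : IsPoly f) (v : p → ℂ) : IsPoly fun x => fderiv ℂ f x v := by
  obtain ⟨P, hP⟩ := hf
  rw [funext hP]
  have hd : ∀ Q : MvPolynomial p ℂ, Differentiable ℂ fun x => MvPolynomial.eval x Q :=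
    fun Q => IsPoly.differentiable ⟨Q, fun _ => rfl⟩
  induction P using MvPolynomial.induction_on generalizing f with
  | C a => simpa using const 0
  | add P Q h1 h2 =>
    simp only [map_add]
    have : (fun x => _root_.fderiv ℂ (fun x => MvPolynomial.eval x P + MvPolynomial.eval x Q) x v)
        = fun x => _root_.fderiv ℂ (fun x => MvPolynomial.eval x P) x v +
          _root_.fderiv ℂ (fun x => MvPolynomial.eval x Q) x v := by
      funext x
      rw [fderiv_fun_add (hd P x) (hd Q x)]
      rfl
    rw [this]
    exact (h1 fun _ => rfl).add (h2 fun _ => rfl)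
  | mul_X P i h =>
    simp only [map_mul, MvPolynomial.eval_X]
    have : (fun x => _root_.fderiv ℂ (fun x => MvPolynomial.eval x P * x i) x v)
        = fun x => MvPolynomial.eval x P * v i +
          x i * _root_.fderiv ℂ (fun x => MvPolynomial.eval x P) x v := by
      funext x
      have hi : HasFDerivAt (fun x : p → ℂ => x i) (ContinuousLinearMap.proj i) x :=
        (ContinuousLinearMap.proj (R := ℂ) (φ := fun _ : p => ℂ) i).hasFDerivAt
      rw [fderiv_fun_mul (hd P x) hi.differentiableAt, hi.fderiv]
      rfl
    rw [this]
    exact (IsPoly.mul ⟨P, fun _ => rfl⟩ (const _)).add ((coord i).mul (h fun _ => rfl))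

end IsPoly

theorem exists_eval_ne_zero {ι : Type} {q : MvPolynomial ι ℂ} (hq : q ≠ 0) :
    ∃ t, MvPolynomial.eval t q ≠ 0 := by
  by_contra! h
  exact hq (MvPolynomial.funext fun t => by rw [h t, map_zero])

/-- Fewer than `k` parameters cannot make `k` independent linear equations solvable for a general
vector of coefficients. -/
theorem exists_poly_avoiding {ι p κ : Type} [Fintype ι] [Fintype p] [Fintype κ]
    (hκ : Fintype.card p < Fintype.card κ) (L : (p → ℂ) → (ι → ℂ) →ₗ[ℂ] (κ → ℂ))
    (hL : ∀ t a, IsPoly fun x => L x t a) :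
    ∃ q : MvPolynomial ι ℂ, q ≠ 0 ∧ ∀ t, MvPolynomial.eval t q ≠ 0 → ∀ x,
      (∀ φ : κ → ℂ, (∀ t, ∑ a, φ a * L x t a = 0) → φ = 0) → L x t ≠ 0 := by
  classical
  let e := Fintype.equivFin κ
  choose P hP using fun i (a : κ) => hL (Pi.single i 1) a
  obtain ⟨q, hq, h⟩ := exists_poly_of_linear_conditions hκ
    (Matrix.of fun b i => P i (e.symm b))
  refine ⟨q, hq, fun t ht x hs h0 => ht (h x t ?_ ?_)⟩
  all_goals
    have hm : ∀ t, ((Matrix.of fun b i => P i (e.symm b)).map (MvPolynomial.eval x)).mulVec t =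
        fun b => L x t (e.symm b) := by
      intro t
      funext b
      have ht : t = ∑ i, t i • Pi.single i (1 : ℂ) := by
        funext j; simp [Finset.sum_apply, Pi.single_apply]
      conv_rhs => rw [ht, map_sum]
      simp only [Matrix.mulVec, dotProduct, Matrix.map_apply, Matrix.of_apply, ← hP,
        map_smul, Finset.sum_apply, Pi.smul_apply, smul_eq_mul]
      exact Finset.sum_congr rfl fun i _ => mul_comm _ _
  · have hsurj : Function.Surjective (L x) := by
      rw [← LinearMap.range_eq_top]
      by_contra hne
      obtain ⟨φ, hφ0, hφ⟩ := Submodule.exists_le_ker_of_lt_top _ (lt_top_iff_ne_top.2 hne)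
      refine hφ0 ?_
      have hφe : ∀ w : κ → ℂ, φ w = ∑ a, φ (Pi.single a 1) * w a := fun w => by
        have hw : w = ∑ i, w i • Pi.single i (1 : ℂ) := by
          funext j; simp [Finset.sum_apply, Pi.single_apply]
        conv_lhs => rw [hw, map_sum]
        simp only [map_smul, smul_eq_mul]
        exact Finset.sum_congr rfl fun i _ => mul_comm _ _
      have := hs (fun a => φ (Pi.single a 1)) fun t => by
        rw [← hφe]
        exact hφ (LinearMap.mem_range_self _ t)
      ext w
      have h1 := congrFun this w
      simpa using h1
    intro w
    obtain ⟨t, ht⟩ := hsurj fun a => w (e a)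
    refine ⟨t, ?_⟩
    rw [hm, ht]
    funext b
    simp
  · rw [hm, h0]
    rfl

theorem finite_eval_line_eq_zero {ι : Type} (q : MvPolynomial ι ℂ) (t d : ι → ℂ) {z₀ : ℂ}
    (h : MvPolynomial.eval (t + z₀ • d) q ≠ 0) :
    {z : ℂ | MvPolynomial.eval (t + z • d) q = 0}.Finite := by
  let P : Polynomial ℂ := MvPolynomial.aeval (fun i => Polynomial.C (t i) +
    Polynomial.X * Polynomial.C (d i)) q
  have hP : ∀ z, P.eval z = MvPolynomial.eval (t + z • d) q := fun z => by
    have hz : t + z • d = fun i => Polynomial.aeval z (Polynomial.C (t i) +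
        Polynomial.X * Polynomial.C (d i)) := by
      funext i
      simp only [Pi.add_apply, Pi.smul_apply, smul_eq_mul, map_add, map_mul, Polynomial.aeval_X,
        Polynomial.aeval_C, Algebra.algebraMap_self, RingHom.id_apply]
    rw [← Polynomial.coe_aeval_eq_eval, hz, ← MvPolynomial.coe_aeval_eq_eval]
    exact (MvPolynomial.comp_aeval_apply (f := fun i => Polynomial.C (t i) +
        Polynomial.X * Polynomial.C (d i)) (Polynomial.aeval z) q)
  have hP0 : P ≠ 0 := fun h0 => h (by rw [← hP, h0, Polynomial.eval_zero])
  refine (Polynomial.finite_setOfPred_isRoot hP0).subset fun z hz => ?_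
  exact (hP z).trans hz

theorem isPreconnected_eval_ne_zero {ι : Type} [Fintype ι] (q : MvPolynomial ι ℂ) :
    IsPreconnected {t : ι → ℂ | MvPolynomial.eval t q ≠ 0} := by
  refine isPreconnected_of_forall_pair fun x hx y hy => ?_
  have hf := finite_eval_line_eq_zero q x (y - x) (z₀ := 0) (by simpa using hx)
  have hc := hf.countable.isPathConnected_compl_of_one_lt_rank (by
    rw [Complex.rank_real_complex]; norm_num)
  refine ⟨(fun z : ℂ => x + z • (y - x)) '' _, ?_, ⟨0, ?_, by simp⟩, ⟨1, ?_, by simp⟩,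
    hc.isConnected.isPreconnected.image _ (by fun_prop)⟩
  · rintro _ ⟨z, hz, rfl⟩
    exact hz
  · intro h
    exact hx (by simpa using h.out)
  · intro h
    exact hy (by simpa using h.out)

theorem dense_eval_ne_zero {ι : Type} [Fintype ι] {q : MvPolynomial ι ℂ} (hq : q ≠ 0) :
    Dense {t : ι → ℂ | MvPolynomial.eval t q ≠ 0} := by
  obtain ⟨y, hy⟩ := exists_eval_ne_zero hq
  intro x
  have hf := finite_eval_line_eq_zero q x (y - x) (z₀ := 1) (by simpa using hy)
  have hd := hf.countable.dense_compl ℝ 0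
  have hc : Continuous fun z : ℂ => x + z • (y - x) := by fun_prop
  have := map_mem_closure hc hd (t := {t : ι → ℂ | MvPolynomial.eval t q ≠ 0}) fun z hz => hz
  simpa using this

/-- Propagating an Euler characteristic along a family. -/
theorem hasEulerChar_of_family {E ι : Type} [TopologicalSpace E] [Fintype ι]
    {K : (ι → ℂ) → Set E} {S : Set (ι → ℂ)} {q : MvPolynomial ι ℂ} (hq : q ≠ 0)
    (hqS : ∀ t, MvPolynomial.eval t q ≠ 0 → t ∈ S)
    (hS : ∀ t ∈ S, ∀ᶠ s in 𝓝 t, Nonempty (K s ≃ₕ K t)) {χ : ℤ} {t₀ t₁ : ι → ℂ} (h₀ : t₀ ∈ S)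
    (h₁ : t₁ ∈ S) (h : HasEulerChar (K t₀) χ) : HasEulerChar (K t₁) χ := by
  have hd := dense_eval_ne_zero hq
  have hnear : ∀ t ∈ S, ∃ s, MvPolynomial.eval s q ≠ 0 ∧ Nonempty (K s ≃ₕ K t) := fun t ht => by
    obtain ⟨s, hs, hsq⟩ := hd.exists_mem_open isOpen_interior
      ⟨t, mem_interior_iff_mem_nhds.2 (hS t ht)⟩
    have hsq' := interior_subset (s := {s | Nonempty (K s ≃ₕ K t)}) hsq
    exact ⟨s, hs, hsq'⟩
  obtain ⟨s₀, hs₀, ⟨e₀⟩⟩ := hnear t₀ h₀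
  obtain ⟨s₁, hs₁, ⟨e₁⟩⟩ := hnear t₁ h₁
  refine HasEulerChar.congr ?_ e₁
  refine (isPreconnected_eval_ne_zero q).induction₂
    (fun t s => HasEulerChar (K t) χ ↔ HasEulerChar (K s) χ) (fun t ht => ?_)
    (fun _ _ _ _ _ _ h h' => h.trans h') (fun _ _ _ _ h => h.symm) hs₀ hs₁ |>.1
    (h.congr e₀.symm)
  filter_upwards [nhdsWithin_le_nhds (hS t (hqS t ht))] with s ⟨e⟩
  exact ⟨fun h => h.congr e.symm, fun h => h.congr e⟩

theorem IsPoly.ite {p : Type} {f g : (p → ℂ) → ℂ} (c : Prop) [Decidable c] (hf : IsPoly f)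
    (hg : IsPoly g) : IsPoly fun x => if c then f x else g x := by
  split_ifs
  exacts [hf, hg]

theorem exists_poly_forall_exists_ne {ι p κ : Type} [Fintype ι] [Fintype p] [Fintype κ]
    (hκ : Fintype.card p < Fintype.card κ) (g : κ → ι → (p → ℂ) → ℂ)
    (hg : ∀ b a, IsPoly (g b a)) :
    ∃ q : MvPolynomial ι ℂ, q ≠ 0 ∧ ∀ t, MvPolynomial.eval t q ≠ 0 → ∀ x,
      (∀ φ : κ → ℂ, (∀ a, ∑ b, φ b * g b a x = 0) → φ = 0) → ∃ b, ∑ a, t a * g b a x ≠ 0 := by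
  classical
  let L : (p → ℂ) → (ι → ℂ) →ₗ[ℂ] (κ → ℂ) := fun x =>
    Matrix.mulVecLin (Matrix.of fun b a => g b a x)
  have hL : ∀ x t b, L x t b = ∑ a, t a * g b a x := fun x t b => by
    simp [L, Matrix.mulVec, dotProduct, mul_comm]
  obtain ⟨q, hq, h⟩ := exists_poly_avoiding hκ L fun t b => by
    simp only [hL]
    exact IsPoly.sum _ fun a => (IsPoly.const _).mul (hg b a)
  refine ⟨q, hq, fun t ht x hx => ?_⟩
  have := h t ht x fun φ hφ => hx φ fun a => by
    have h1 := hφ (Pi.single a 1)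
    simp only [hL] at h1
    simpa [Pi.single_apply] using h1
  by_contra! h0
  exact this (funext fun b => by rw [hL]; exact h0 b)

/-- The member with coefficients `c` of the linear system spanned by the functions `g`. -/
def lin {ι X : Type} [Fintype ι] (g : ι → X → ℂ) (c : ι → ℂ) (x : X) : ℂ := ∑ a, c a * g a x

theorem IsPoly.lin {ι p : Type} [Fintype ι] {g : ι → (p → ℂ) → ℂ} (hg : ∀ a, IsPoly (g a))
    (c : ι → ℂ) : IsPoly (lin g c) :=
  IsPoly.sum _ fun a => (IsPoly.const (c a)).mul (hg a)

/-- The linear system `g` separates values and first derivatives at `x`. -/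
def SepJets {ι X : Type} [NormedAddCommGroup X] [NormedSpace ℂ X] (g : ι → X → ℂ) (x : X) : Prop :=
  ∀ (α : ℂ) (η : X), (∀ a, α * g a x + fderiv ℂ (g a) x η = 0) → α = 0 ∧ η = 0

theorem SepJets.exists_ne {ι X : Type} [NormedAddCommGroup X] [NormedSpace ℂ X] {g : ι → X → ℂ}
    {x : X} (h : SepJets g x) : ∃ a, g a x ≠ 0 := by
  by_contra! h0
  exact one_ne_zero (h 1 0 fun a => by simp [h0 a]).1

theorem SepJets.mul {ι X : Type} [NormedAddCommGroup X] [NormedSpace ℂ X] {g : ι → X → ℂ}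
    (hd : ∀ a, Differentiable ℂ (g a)) {x : X} (h : SepJets g x) :
    SepJets (fun (a : ι × ι) x => g a.1 x * g a.2 x) x := by
  intro α η hα
  obtain ⟨b, hb⟩ := h.exists_ne
  obtain ⟨h1, rfl⟩ := h (α + fderiv ℂ (g b) x η / g b x) η fun a => by
    have := hα (a, b)
    rw [fderiv_fun_mul (hd a x) (hd b x)] at this
    simp only [_root_.add_apply, _root_.smul_apply, smul_eq_mul] at this
    field_simp
    linear_combination this
  exact ⟨by simpa using h1, rfl⟩

theorem fderiv_lin {ι X : Type} [Fintype ι] [NormedAddCommGroup X] [NormedSpace ℂ X]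
    {g : ι → X → ℂ} (hd : ∀ a, Differentiable ℂ (g a)) (c : ι → ℂ) (x η : X) :
    fderiv ℂ (lin g c) x η = ∑ a, c a * fderiv ℂ (g a) x η := by
  have : HasFDerivAt (lin g c) (∑ a, c a • fderiv ℂ (g a) x) x :=
    HasFDerivAt.fun_sum fun a _ => (hd a x).hasFDerivAt.const_mul (c a)
  rw [this.fderiv]
  simp

theorem clm_apply_eq_sum {p : Type} [Fintype p] [DecidableEq p] (l : (p → ℂ) →L[ℂ] ℂ)
    (η : p → ℂ) : l η = ∑ j, η j * l (Pi.single j 1) := by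
  have hw : η = ∑ i, η i • Pi.single i (1 : ℂ) := by
    funext j; simp [Finset.sum_apply, Pi.single_apply]
  conv_lhs => rw [hw, map_sum]
  simp

/-- A general member of a linear system is nonsingular where first jets are separated. -/
theorem exists_poly_smooth {ι p : Type} [Fintype ι] [Fintype p] {g : ι → (p → ℂ) → ℂ}
    (hg : ∀ a, IsPoly (g a)) :
    ∃ q : MvPolynomial ι ℂ, q ≠ 0 ∧ ∀ t, MvPolynomial.eval t q ≠ 0 → ∀ x, SepJets g x →
      lin g t x = 0 → ∃ η, fderiv ℂ (lin g t) x η ≠ 0 := by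
  classical
  obtain ⟨q, hq, h⟩ := exists_poly_forall_exists_ne (ι := ι) (p := p) (κ := Option p) (by simp)
    (fun b a x => b.elim (g a x) fun j => fderiv ℂ (g a) x (Pi.single j 1)) (by
      rintro (_ | j) a
      exacts [hg a, (hg a).fderiv _])
  refine ⟨q, hq, fun t ht x hx h0 => ?_⟩
  obtain ⟨b, hb⟩ := h t ht x fun φ hφ => by
    obtain ⟨h1, h2⟩ := hx (φ none) (fun j => φ (some j)) fun a => by
      rw [clm_apply_eq_sum]
      simpa [Fintype.sum_option] using hφ a
    funext b
    rcases b with _ | j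
    exacts [h1, congrFun h2 j]
  rcases b with _ | j
  · exact absurd h0 hb
  · refine ⟨Pi.single j 1, ?_⟩
    rw [fderiv_lin fun a => (hg a).differentiable]
    exact hb

/-- A general `2 × 2` matrix of members of a linear system vanishes nowhere on a threefold. -/
theorem exists_poly_matrix_ne_zero {ι p : Type} [Fintype ι] [Fintype p] (hp : Fintype.card p < 4)
    {g : ι → (p → ℂ) → ℂ} (hg : ∀ a, IsPoly (g a)) :
    ∃ q : MvPolynomial (Fin 2 × Fin 2 × ι) ℂ, q ≠ 0 ∧ ∀ t, MvPolynomial.eval t q ≠ 0 → ∀ x,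
      (∃ a, g a x ≠ 0) → ∃ k l, lin g (fun a => t (k, l, a)) x ≠ 0 := by
  obtain ⟨q, hq, h⟩ := exists_poly_forall_exists_ne (ι := Fin 2 × Fin 2 × ι) (p := p)
    (κ := Fin 2 × Fin 2) (by simpa using hp)
    (fun b a x => if b = (a.1, a.2.1) then g a.2.2 x else 0)
    (fun b a => IsPoly.ite _ (hg _) (IsPoly.const 0))
  refine ⟨q, hq, fun t ht x ⟨a, ha⟩ => ?_⟩
  obtain ⟨⟨k, l⟩, hb⟩ := h t ht x fun φ hφ => by
    funext b
    have := hφ (b.1, b.2, a)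
    simpa [ha] using this
  refine ⟨k, l, fun h0 => hb ?_⟩
  refine Eq.trans ?_ h0
  simp only [lin, Fintype.sum_prod_type, Prod.mk.injEq]
  rw [Finset.sum_eq_single k (by
      intro b _ hbk
      simp [hbk.symm]) (by simp),
    Finset.sum_eq_single l (by
      intro b _ hbk
      simp [hbk.symm]) (by simp)]
  simp

/-- Affine coordinate on the projective line. -/
def pline (e : Fin 2) (m : ℂ) : Fin 2 → ℂ := fun l => if l = e then 1 else m

theorem exists_pline {μ : Fin 2 → ℂ} (hμ : μ ≠ 0) : ∃ (e : Fin 2) (m c : ℂ), c ≠ 0 ∧ μ = c • pline e m := by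
  obtain ⟨e, he⟩ := Function.ne_iff.1 hμ
  simp only [Pi.zero_apply] at he
  refine ⟨e, μ (1 - e) / μ e, μ e, he, ?_⟩
  funext l
  fin_cases e <;> fin_cases l <;> simp_all [pline, mul_div_cancel₀]

theorem pline_self (e : Fin 2) (m : ℂ) : pline e m e = 1 := by simp [pline]

theorem pline_flip (e : Fin 2) (m : ℂ) : pline e m (1 - e) = m := by
  fin_cases e <;> simp [pline]

theorem sum_fin_two_flip (e : Fin 2) (f : Fin 2 → ℂ) : ∑ l, f l = f e + f (1 - e) := by
  fin_cases e <;> simp [Fin.sum_univ_two, add_comm]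

theorem forall_fin_two_flip (e : Fin 2) {P : Fin 2 → Prop} (h1 : P e) (h2 : P (1 - e)) :
    ∀ l, P l := by
  fin_cases e <;> simpa [Fin.forall_fin_two, and_comm] using And.intro h1 h2


/-- Nonsingularity of the zero locus of `2 × 2` systems `M μ = 0`, where the entries of `M` are
general members of a linear system. -/
theorem exists_poly_corank_smooth {ι : Type} [Fintype ι] {g : ι → (Fin 3 → ℂ) → ℂ}
    (hg : ∀ a, IsPoly (g a)) :
    ∃ q : MvPolynomial (Fin 2 × Fin 2 × ι) ℂ, q ≠ 0 ∧ ∀ t, MvPolynomial.eval t q ≠ 0 → ∀ x,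
      SepJets g x → ∀ μ η : Fin 2 → ℂ, μ ≠ 0 → η ≠ 0 →
      (∀ k, ∑ l, lin g (fun a => t (k, l, a)) x * μ l = 0) →
      (∀ l, ∑ k, η k * lin g (fun a => t (k, l, a)) x = 0) →
      ∃ ξ, ∑ k, ∑ l, η k * fderiv ℂ (lin g fun a => t (k, l, a)) x ξ * μ l ≠ 0 := by
  classical
  have key : ∀ ef : Fin 2 × Fin 2, ∃ q : MvPolynomial (Fin 2 × Fin 2 × ι) ℂ, q ≠ 0 ∧
      ∀ t, MvPolynomial.eval t q ≠ 0 → ∀ x, SepJets g x → ∀ m m',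
      (∀ k, ∑ l, lin g (fun a => t (k, l, a)) x * pline ef.1 m l = 0) →
      (∀ l, ∑ k, pline ef.2 m' k * lin g (fun a => t (k, l, a)) x = 0) →
      ∃ ξ, ∑ k, ∑ l, pline ef.2 m' k * fderiv ℂ (lin g fun a => t (k, l, a)) x ξ *
        pline ef.1 m l ≠ 0 := by
    rintro ⟨e, f⟩
    have hx : ∀ j : Fin 3 ⊕ Fin 2, IsPoly fun x : Fin 3 ⊕ Fin 2 → ℂ => x j := IsPoly.coord
    have hg' : ∀ a, IsPoly fun x : Fin 3 ⊕ Fin 2 → ℂ => g a (fun j => x (Sum.inl j)) :=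
      fun a => (hg a).comp fun j => hx _
    have hpl : ∀ e j k, IsPoly fun x : Fin 3 ⊕ Fin 2 → ℂ => pline e (x (Sum.inr j)) k :=
      fun e j k => IsPoly.ite _ (IsPoly.const 1) (hx _)
    obtain ⟨q, hq, h⟩ := exists_poly_forall_exists_ne (ι := Fin 2 × Fin 2 × ι)
      (p := Fin 3 ⊕ Fin 2) (κ := Fin 2 ⊕ Option (Fin 3)) (by simp)
      (fun b a x => Sum.elim
        (fun k => if k = a.1 then pline e (x (Sum.inr 0)) a.2.1 *
          g a.2.2 (fun j => x (Sum.inl j)) else 0)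
        (fun o => o.elim
          (if a.2.1 = 1 - e then pline f (x (Sum.inr 1)) a.1 *
            g a.2.2 (fun j => x (Sum.inl j)) else 0)
          fun j => pline f (x (Sum.inr 1)) a.1 * pline e (x (Sum.inr 0)) a.2.1 *
            fderiv ℂ (g a.2.2) (fun j => x (Sum.inl j)) (Pi.single j 1)) b) (by
        rintro (k | _ | j) a
        · exact IsPoly.ite _ ((hpl _ _ _).mul (hg' _)) (IsPoly.const 0)
        · exact IsPoly.ite _ ((hpl _ _ _).mul (hg' _)) (IsPoly.const 0)
        · exact ((hpl _ _ _).mul (hpl _ _ _)).mul (((hg _).fderiv _).comp fun j => hx _))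
    refine ⟨q, hq, fun t ht x hs m m' h1 h2 => ?_⟩
    obtain ⟨b, hb⟩ := h t ht (Sum.elim x ![m, m']) fun φ hφ => by
      obtain ⟨a₀, ha₀⟩ := hs.exists_ne
      simp only [Fintype.sum_sum_type, Fintype.sum_option, Sum.elim_inl, Sum.elim_inr,
        Option.elim, Matrix.cons_val_zero, Matrix.cons_val_one, mul_ite, mul_zero] at hφ
      have hφ' : ∀ k l a, φ (Sum.inl k) * (pline e m l * g a x) +
          ((if l = 1 - e then φ (Sum.inr none) * (pline f m' k * g a x) else 0) +
          pline f m' k * pline e m l *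
            fderiv ℂ (g a) x (fun j => φ (Sum.inr (some j)))) = 0 := fun k l a => by
        have := hφ (k, l, a)
        rw [clm_apply_eq_sum, Finset.mul_sum]
        simp only [Finset.sum_ite_eq', Finset.mem_univ, if_true] at this
        refine Eq.trans ?_ this
        congr 2
        exact Finset.sum_congr rfl fun j _ => by ring
      have hψ : φ (Sum.inr none) = 0 := by
        have h3 := hφ' f (1 - e) a₀
        have h4 := hφ' f e a₀
        have h5 : e ≠ 1 - e := by fin_cases e <;> simp
        rw [pline_self, if_neg h5] at h4
        rw [pline_flip, if_pos rfl] at h3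
        rw [pline_self] at h3 h4
        have : φ (Sum.inr none) * g a₀ x = 0 := by linear_combination h3 - m * h4
        exact (mul_eq_zero.1 this).resolve_right ha₀
      obtain ⟨h6, h7⟩ := hs (φ (Sum.inl f)) (fun j => φ (Sum.inr (some j))) fun a => by
        have h4 := hφ' f e a
        rw [pline_self, pline_self, hψ] at h4
        simpa using h4
      have h8 : φ (Sum.inl (1 - f)) = 0 := by
        have h4 := hφ' (1 - f) e a₀
        rw [pline_self, hψ, h7] at h4
        simpa [ha₀] using h4
      funext b
      rcases b with k | _ | j
      · exact forall_fin_two_flip f (P := fun k => φ (Sum.inl k) = 0) h6 h8 k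
      · exact hψ
      · exact congrFun h7 j
    rcases b with k | _ | j
    · refine absurd (h1 k) fun h0 => hb (Eq.trans ?_ h0)
      simp only [Fintype.sum_prod_type, Sum.elim_inl, Sum.elim_inr, Matrix.cons_val_zero, lin,
        Finset.sum_mul]
      rw [Finset.sum_eq_single k (by
        intro b _ hbk
        simp [hbk.symm]) (by simp)]
      refine Finset.sum_congr rfl fun l _ => Finset.sum_congr rfl fun a _ => ?_
      rw [if_pos rfl]
      ring
    · refine absurd (h2 (1 - e)) fun h0 => hb (Eq.trans ?_ h0)
      simp only [Fintype.sum_prod_type, Sum.elim_inr, Option.elim, Matrix.cons_val_one, lin,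
        Finset.mul_sum, Sum.elim_inl]
      refine Finset.sum_congr rfl fun k _ => ?_
      rw [Finset.sum_eq_single (1 - e) (by
        intro b _ hbk
        simp [hbk]) (by simp)]
      refine Finset.sum_congr rfl fun a _ => ?_
      rw [if_pos rfl, show (![m'] : Fin 1 → ℂ) 0 = m' from rfl]
      ring
    · refine ⟨Pi.single j 1, fun h0 => hb (Eq.trans ?_ h0)⟩
      simp only [Fintype.sum_prod_type, Sum.elim_inr, Option.elim, Matrix.cons_val_one,
        Matrix.cons_val_zero, Sum.elim_inl, fderiv_lin fun a => (hg a).differentiable,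
        Finset.mul_sum, Finset.sum_mul]
      refine Finset.sum_congr rfl fun k _ => Finset.sum_congr rfl fun l _ =>
        Finset.sum_congr rfl fun a _ => ?_
      ring
  choose q hq h using key
  refine ⟨∏ ef, q ef, Finset.prod_ne_zero_iff.2 fun ef _ => hq ef,
    fun t ht x hs μ η hμ hη h1 h2 => ?_⟩
  rw [map_prod, Finset.prod_ne_zero_iff] at ht
  obtain ⟨e, m, c, hc, rfl⟩ := exists_pline hμ
  obtain ⟨f, m', c', hc', rfl⟩ := exists_pline hη
  simp only [Pi.smul_apply, smul_eq_mul] at h1 h2 ⊢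
  obtain ⟨ξ, hξ⟩ := h (e, f) t (ht _ (Finset.mem_univ _)) x hs m m'
    (fun k => by
      refine (mul_eq_zero.1 ?_).resolve_left hc
      rw [← h1 k, Finset.mul_sum]
      exact Finset.sum_congr rfl fun _ _ => by ring)
    (fun k => by
      refine (mul_eq_zero.1 ?_).resolve_left hc'
      rw [← h2 k, Finset.mul_sum]
      exact Finset.sum_congr rfl fun _ _ => by ring)
  refine ⟨ξ, fun h0 => hξ ?_⟩
  refine (mul_eq_zero.1 ?_).resolve_left (mul_ne_zero hc hc')
  rw [← h0]
  simp only [Finset.mul_sum]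
  exact Finset.sum_congr rfl fun _ _ => Finset.sum_congr rfl fun _ _ => by ring

/-- For three independent vectors `w r` of coefficients, the matrices obtained by pairing with a
general `2 × 2` matrix of vectors do not satisfy a common equation `η M μ = 0`. -/
theorem exists_poly_pairing_ne_zero {ι : Type} [Fintype ι] {w : Fin 3 → ι → ℂ}
    (hw : ∀ φ : Fin 3 → ℂ, (∀ a, ∑ r, φ r * w r a = 0) → φ = 0) :
    ∃ q : MvPolynomial (Fin 2 × Fin 2 × ι) ℂ, q ≠ 0 ∧ ∀ t, MvPolynomial.eval t q ≠ 0 →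
      ∀ μ η : Fin 2 → ℂ, μ ≠ 0 → η ≠ 0 →
      ∃ r, ∑ k, ∑ l, η k * (∑ a, t (k, l, a) * w r a) * μ l ≠ 0 := by
  have key : ∀ ef : Fin 2 × Fin 2, ∃ q : MvPolynomial (Fin 2 × Fin 2 × ι) ℂ, q ≠ 0 ∧
      ∀ t, MvPolynomial.eval t q ≠ 0 → ∀ m m',
      ∃ r, ∑ k, ∑ l, pline ef.2 m' k * (∑ a, t (k, l, a) * w r a) * pline ef.1 m l ≠ 0 := by
    rintro ⟨e, f⟩
    obtain ⟨q, hq, h⟩ := exists_poly_forall_exists_ne (ι := Fin 2 × Fin 2 × ι)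
      (p := Fin 2) (κ := Fin 3) (by simp)
      (fun r a x => pline f (x 1) a.1 * pline e (x 0) a.2.1 * w r a.2.2)
      (fun r a => ((IsPoly.ite _ (IsPoly.const 1) (IsPoly.coord _)).mul
        (IsPoly.ite _ (IsPoly.const 1) (IsPoly.coord _))).mul (IsPoly.const _))
    refine ⟨q, hq, fun t ht m m' => ?_⟩
    obtain ⟨r, hr⟩ := h t ht ![m, m'] fun φ hφ => hw φ fun a => by
      have := hφ (f, e, a)
      simpa [pline_self] using this
    refine ⟨r, fun h0 => hr (Eq.trans ?_ h0)⟩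
    simp only [Fintype.sum_prod_type, Matrix.cons_val_one, Matrix.cons_val_zero, Finset.mul_sum,
      Finset.sum_mul]
    refine Finset.sum_congr rfl fun k _ => Finset.sum_congr rfl fun l _ =>
      Finset.sum_congr rfl fun a _ => ?_
    ring
  choose q hq h using key
  refine ⟨∏ ef, q ef, Finset.prod_ne_zero_iff.2 fun ef _ => hq ef,
    fun t ht μ η hμ hη => ?_⟩
  rw [map_prod, Finset.prod_ne_zero_iff] at ht
  obtain ⟨e, m, c, hc, rfl⟩ := exists_pline hμ
  obtain ⟨f, m', c', hc', rfl⟩ := exists_pline hη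
  obtain ⟨r, hr⟩ := h (e, f) t (ht _ (Finset.mem_univ _)) m m'
  refine ⟨r, fun h0 => hr ?_⟩
  refine (mul_eq_zero.1 ?_).resolve_left (mul_ne_zero hc hc')
  rw [← h0]
  simp only [Finset.mul_sum, Finset.sum_mul, Pi.smul_apply, smul_eq_mul]
  exact Finset.sum_congr rfl fun _ _ => Finset.sum_congr rfl fun _ _ =>
    Finset.sum_congr rfl fun _ _ => by ring

/-- For a nonzero `2 × 2` matrix with kernel `μ` and cokernel `η`, the differential of the
determinant is proportional to `N ↦ η N μ`. -/
theorem exists_det_differential {M : Fin 2 → Fin 2 → ℂ} (hM : ∃ k l, M k l ≠ 0) {μ η : Fin 2 → ℂ}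
    (hμ0 : μ ≠ 0) (hη0 : η ≠ 0) (hμ : ∀ k, ∑ l, M k l * μ l = 0)
    (hη : ∀ l, ∑ k, η k * M k l = 0) :
    ∃ c : ℂ, c ≠ 0 ∧ ∀ N : Fin 2 → Fin 2 → ℂ,
      M 0 0 * N 1 1 + M 1 1 * N 0 0 - M 0 1 * N 1 0 - M 1 0 * N 0 1 =
        c * ∑ k, ∑ l, η k * N k l * μ l := by
  obtain ⟨e, he⟩ := Function.ne_iff.1 hμ0
  obtain ⟨f, hf⟩ := Function.ne_iff.1 hη0
  simp only [Fin.sum_univ_two, Fin.forall_fin_two, Pi.zero_apply] at hμ hη he hf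
  obtain ⟨h1, h2⟩ := hμ
  obtain ⟨h3, h4⟩ := hη
  obtain ⟨c, h11, h01, h10, h00⟩ : ∃ c, M 1 1 = c * μ 0 * η 0 ∧ M 0 1 = -(c * μ 0 * η 1) ∧
      M 1 0 = -(c * μ 1 * η 0) ∧ M 0 0 = c * μ 1 * η 1 := by
    fin_cases e <;> fin_cases f <;> simp only [Fin.mk_zero, Fin.mk_one] at he hf
    · refine ⟨M 1 1 / (μ 0 * η 0), ?_, ?_, ?_, ?_⟩ <;> field_simp
      · linear_combination h4
      · linear_combination h2
      · linear_combination η 0 * h1 - μ 1 * h4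
    · refine ⟨-M 0 1 / (μ 0 * η 1), ?_, ?_, ?_, ?_⟩ <;> field_simp
      · linear_combination h4
      · linear_combination μ 0 * h3 - η 0 * h1
      · linear_combination h1
    · refine ⟨-M 1 0 / (μ 1 * η 0), ?_, ?_, ?_, ?_⟩ <;> field_simp
      · linear_combination h2
      · linear_combination η 0 * h1 - μ 0 * h3
      · linear_combination h3
    · refine ⟨M 0 0 / (μ 1 * η 1), ?_, ?_, ?_, ?_⟩ <;> field_simp
      · linear_combination μ 1 * h4 - η 0 * h1
      · linear_combination h1
      · linear_combination h3
  refine ⟨c, ?_, fun N => ?_⟩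
  · rintro rfl
    obtain ⟨k, l, hkl⟩ := hM
    fin_cases k <;> fin_cases l <;> simp_all
  · simp only [Fin.sum_univ_two, h11, h01, h10, h00]
    ring

/-- The multilinear monomials in `n` vectors of length `k`. -/
def mono {n k : ℕ} (j : Fin n → Fin k) (v : Fin n → Fin k → ℂ) : ℂ := ∏ i, v i (j i)

theorem lin_mono_prod {n k : ℕ} (l v : Fin n → Fin k → ℂ) :
    lin mono (fun j => ∏ i, l i (j i)) v = ∏ i, ∑ r, l i r * v i r := by
  rw [Finset.prod_univ_sum, Fintype.piFinset_univ]
  exact Finset.sum_congr rfl fun j _ => by rw [mono, Finset.prod_mul_distrib]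

theorem lin_mono_update {n k : ℕ} (t : (Fin n → Fin k) → ℂ) (v : Fin n → Fin k → ℂ) (i : Fin n)
    (w : Fin k → ℂ) : lin mono t (Function.update v i w) =
      ∑ r, w r * lin mono t (Function.update v i (Pi.single r 1)) := by
  have h : ∀ w : Fin k → ℂ, lin mono t (Function.update v i w) =
      ∑ j, t j * (w (j i) * ∏ l ∈ Finset.univ.erase i, v l (j l)) := fun w => by
    refine Finset.sum_congr rfl fun j _ => ?_
    rw [mono, ← Finset.mul_prod_erase _ _ (Finset.mem_univ i)]
    congr 2
    · simp
    · refine Finset.prod_congr rfl fun l hl => ?_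
      rw [Function.update_of_ne (Finset.ne_of_mem_erase hl)]
  simp only [h, Finset.mul_sum]
  rw [Finset.sum_comm]
  refine Finset.sum_congr rfl fun j _ => ?_
  rw [Finset.sum_eq_single (j i) (fun r _ hr => by simp [hr.symm]) (by simp)]
  simp
  ring

theorem lin_mono_smul {n k : ℕ} (t : (Fin n → Fin k) → ℂ) (v : Fin n → Fin k → ℂ) (c : Fin n → ℂ) :
    lin mono t (fun i => c i • v i) = (∏ i, c i) * lin mono t v := by
  simp only [lin, mono, Finset.mul_sum, Pi.smul_apply, smul_eq_mul, Finset.prod_mul_distrib]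
  exact Finset.sum_congr rfl fun _ _ => by ring

theorem isPoly_mono {n k : ℕ} {p : Type} {V : (p → ℂ) → Fin n → Fin k → ℂ}
    (hV : ∀ i r, IsPoly fun x => V x i r) (j : Fin n → Fin k) : IsPoly fun x => mono j (V x) :=
  IsPoly.prod _ fun i => hV i (j i)

/-- Infinitesimal injectivity of a map to a product of projective spaces given by vectors of
homogeneous coordinates. -/
def ImmersiveAt {n k : ℕ} {X : Type} [NormedAddCommGroup X] [NormedSpace ℂ X]
    (V : X → Fin n → Fin k → ℂ) (x : X) : Prop :=
  ∀ η : X, (∀ i, ∃ ρ : ℂ, ∀ r, fderiv ℂ (fun x => V x i r) x η = ρ * V x i r) → η = 0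

theorem sepJets_mono {n k : ℕ} {X : Type} [NormedAddCommGroup X] [NormedSpace ℂ X]
    {V : X → Fin n → Fin k → ℂ} (hd : ∀ i r, Differentiable ℂ fun x => V x i r) {x : X}
    (hV : ∀ i, V x i ≠ 0) (hi : ImmersiveAt V x) : SepJets (fun j x => mono j (V x)) x := by
  classical
  intro α η h
  have key : ∀ l : Fin n → Fin k → ℂ, α * ∏ i, ∑ r, l i r * V x i r +
      ∑ i, (∏ m ∈ Finset.univ.erase i, ∑ r, l m r * V x m r) *
        ∑ r, l i r * fderiv ℂ (fun x => V x i r) x η = 0 := by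
    intro l
    have h1 : ∑ j, (∏ i, l i (j i)) * fderiv ℂ (fun x => mono j (V x)) x η =
        ∑ i, (∏ m ∈ Finset.univ.erase i, ∑ r, l m r * V x m r) *
        ∑ r, l i r * fderiv ℂ (fun x => V x i r) x η := by
      have hd' : ∀ j, Differentiable ℂ fun x => mono j (V x) := fun j x =>
        (HasFDerivAt.finsetProd (u := Finset.univ) (g := fun i x => V x i (j i))
          fun i _ => (hd i (j i) x).hasFDerivAt).differentiableAt
      rw [← fderiv_lin hd' (fun j => ∏ i, l i (j i))]
      have h2 : lin (fun j x => mono j (V x)) (fun j => ∏ i, l i (j i)) =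
          fun x => ∏ i, ∑ r, l i r * V x i r := funext fun x => lin_mono_prod l (V x)
      have h3 : ∀ i, HasFDerivAt (fun x => ∑ r, l i r * V x i r)
          (∑ r, l i r • fderiv ℂ (fun x => V x i r) x) x := fun i =>
        HasFDerivAt.fun_sum fun r _ => ((hd i r) x).hasFDerivAt.const_mul (l i r)
      rw [h2, (HasFDerivAt.finsetProd (u := Finset.univ) fun i _ => h3 i).fderiv]
      simp
    rw [← h1, ← lin_mono_prod, lin, Finset.mul_sum, ← Finset.sum_add_distrib]
    refine Finset.sum_eq_zero fun j _ => ?_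
    linear_combination (∏ i, l i (j i)) * h j
  have hη : η = 0 := hi η fun i => by
    obtain ⟨a, ha⟩ := Function.ne_iff.1 (hV i)
    simp only [Pi.zero_apply] at ha
    choose b hb using fun m => Function.ne_iff.1 (hV m)
    simp only [Pi.zero_apply] at hb
    refine ⟨fderiv ℂ (fun x => V x i a) x η / V x i a, fun r => ?_⟩
    let l₀ : Fin n → Fin k → ℂ := fun m => Pi.single (b m) 1
    let l : Fin n → Fin k → ℂ :=
      Function.update l₀ i (V x i a • Pi.single r 1 - V x i r • Pi.single a 1)
    have hk := key l
    have hz : ∑ s, l i s * V x i s = 0 := by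
      simp [l, sub_mul, Finset.sum_sub_distrib, Pi.single_apply]
      ring
    rw [Finset.prod_eq_zero (Finset.mem_univ i) hz, mul_zero, zero_add,
      Finset.sum_eq_single i _ (by simp)] at hk
    · have h4 := (mul_eq_zero.1 hk).resolve_left (Finset.prod_ne_zero_iff.2 fun m hm => by
        simp only [l]
        rw [Function.update_of_ne (Finset.ne_of_mem_erase hm)]
        simpa [l₀, Pi.single_apply] using hb m)
      simp [l, sub_mul, Finset.sum_sub_distrib, Pi.single_apply] at h4
      field_simp
      linear_combination h4
    · intro m _ hm
      rw [Finset.prod_eq_zero (Finset.mem_erase.2 ⟨hm.symm, Finset.mem_univ i⟩) hz, zero_mul]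
  refine ⟨?_, hη⟩
  choose b hb using fun m => Function.ne_iff.1 (hV m)
  have := h b
  rw [hη, map_zero, add_zero] at this
  exact (mul_eq_zero.1 this).resolve_right (Finset.prod_ne_zero_iff.2 fun m _ => hb m)

/-- A system of linear equations with polynomial coefficients that has only the trivial solution
for one value of the parameters has only the trivial solution generically. -/
theorem exists_poly_trivial_kernel {ι κ p : Type} [Fintype κ] [Fintype p]
    (M : Matrix κ p (MvPolynomial ι ℂ)) (a₀ : ι → ℂ)
    (h : ∀ x : p → ℂ, (∀ b, ∑ j, MvPolynomial.eval a₀ (M b j) * x j = 0) → x = 0) :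
    ∃ q : MvPolynomial ι ℂ, q ≠ 0 ∧ ∀ a, MvPolynomial.eval a q ≠ 0 →
      ∀ x : p → ℂ, (∀ b, ∑ j, MvPolynomial.eval a (M b j) * x j = 0) → x = 0 := by
  classical
  let N : (ι → ℂ) → Matrix κ p ℂ := fun a => M.map (MvPolynomial.eval a)
  obtain ⟨g, hg⟩ := LinearMap.exists_leftInverse_of_injective (Matrix.toLin' (N a₀))
    (LinearMap.ker_eq_bot'.2 fun x hx => h x fun b => congrFun hx b)
  let B := LinearMap.toMatrix' g
  let D : Matrix p p (MvPolynomial ι ℂ) := Matrix.of fun i j => ∑ k, MvPolynomial.C (B i k) * M k j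
  have hev : ∀ a, MvPolynomial.eval a D.det = Matrix.det (B * N a : Matrix p p ℂ) := fun a => by
    rw [RingHom.map_det, RingHom.mapMatrix_apply]
    congr 1
    ext i j
    simp [D, N, Matrix.mul_apply]
  refine ⟨D.det, fun h0 => ?_, fun a ha x hx => ?_⟩
  · have := hev a₀
    rw [h0, map_zero, show B * N a₀ = 1 by
      rw [← LinearMap.toMatrix'_id, ← hg, LinearMap.toMatrix'_comp, LinearMap.toMatrix'_toLin'],
      Matrix.det_one] at this
    exact zero_ne_one this
  · rw [hev] at ha
    have h1 : (N a).mulVec x = 0 := funext fun b => hx b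
    refine Matrix.eq_zero_of_mulVec_eq_zero ha ?_
    rw [← Matrix.mulVec_mulVec, h1, Matrix.mulVec_zero]

/-- Cameras in general position. -/
structure GenCams {n : ℕ} (A : Fin n → Matrix (Fin 3) (Fin 4) ℂ) : Prop where
  surj : ∀ i w, ∃ y, (A i).mulVec y = w
  ker : ∀ i j, i ≠ j → ∀ y, (A i).mulVec y = 0 → (A j).mulVec y = 0 → y = 0
  indep : ∃ i₀ i₁ i₂, ∀ x y, (A i₀).mulVec x = 0 → (A i₁).mulVec y = 0 →
    (A i₂).mulVec (x + y) = 0 → x = 0 ∧ y = 0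

theorem exists_poly_genCams {n : ℕ} (hn : 3 ≤ n) :
    ∃ q : MvPolynomial (Fin n × Fin 3 × Fin 4) ℂ, q ≠ 0 ∧ ∀ a, MvPolynomial.eval a q ≠ 0 →
      (∀ i, (camOfC a i).rank = 3) → GenCams (camOfC a) := by
  classical
  have h1 : ∀ ij : Fin n × Fin n, ∃ q : MvPolynomial (Fin n × Fin 3 × Fin 4) ℂ, q ≠ 0 ∧
      ∀ a, MvPolynomial.eval a q ≠ 0 → ij.1 ≠ ij.2 → ∀ y, (camOfC a ij.1).mulVec y = 0 →
        (camOfC a ij.2).mulVec y = 0 → y = 0 := by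
    rintro ⟨i, j⟩
    by_cases hij : i = j
    · exact ⟨1, one_ne_zero, fun a _ h => absurd hij h⟩
    obtain ⟨q, hq, h⟩ := exists_poly_trivial_kernel (ι := Fin n × Fin 3 × Fin 4)
      (κ := Fin 3 ⊕ Fin 3) (p := Fin 4)
      (Matrix.of fun b c => MvPolynomial.X (Sum.elim (fun r => (i, r, c)) (fun r => (j, r, c)) b))
      (fun t => if t.1 = i then (if t.2.2 = t.2.1.succ then 1 else 0) else
        if t.2.2 = t.2.1.castSucc then 1 else 0) (fun x hx => by
        have h2 := fun r => hx (Sum.inl r)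
        have h3 := hx (Sum.inr 0)
        simp [Ne.symm hij] at h2 h3
        funext c
        refine Fin.cases h3 h2 c)
    refine ⟨q, hq, fun a ha _ y h2 h3 => h a ha y ?_⟩
    rintro (r | r)
    · simpa [camOfC, Matrix.mulVec, dotProduct] using congrFun h2 r
    · simpa [camOfC, Matrix.mulVec, dotProduct] using congrFun h3 r
  choose q₁ hq₁ hh₁ using h1
  let i₀ : Fin n := ⟨0, by omega⟩
  let i₁ : Fin n := ⟨1, by omega⟩
  let i₂ : Fin n := ⟨2, by omega⟩
  have hi₁ : i₁ ≠ i₀ := by simp [i₁, i₀]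
  have hi₂ : i₂ ≠ i₀ := by simp [i₂, i₀]
  have hi₃ : i₂ ≠ i₁ := by simp [i₂, i₁]
  obtain ⟨q₂, hq₂, hh₂⟩ := exists_poly_trivial_kernel (ι := Fin n × Fin 3 × Fin 4)
      (κ := Fin 3 ⊕ Fin 3 ⊕ Fin 3) (p := Fin 4 ⊕ Fin 4)
      (Matrix.of fun b c => Sum.elim
        (fun r => Sum.elim (fun c => MvPolynomial.X (i₀, r, c)) (fun _ => 0) c)
        (Sum.elim (fun r => Sum.elim (fun _ => 0) (fun c => MvPolynomial.X (i₁, r, c)) c)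
          (fun r => Sum.elim (fun c => MvPolynomial.X (i₂, r, c))
            (fun c => MvPolynomial.X (i₂, r, c)) c)) b)
      (fun t => if t.1 = i₀ then (if t.2.2 = t.2.1.succ then 1 else 0) else
        if t.1 = i₁ then (if t.2.2 = t.2.1.castSucc then 1 else 0) else
        if t.2.1 = 0 then (if t.2.2 = 0 then 1 else 0) else
        if t.2.1 = 1 then (if t.2.2 = 3 then 1 else 0) else if t.2.2 = 1 then 1 else 0) (fun x hx => by
        have h2 := fun r => hx (Sum.inl r)
        have h3 := fun r => hx (Sum.inr (Sum.inl r))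
        have h4 := hx (Sum.inr (Sum.inr 0))
        have h5 := hx (Sum.inr (Sum.inr 1))
        simp [hi₁, hi₂, hi₃] at h2 h3 h4 h5
        rw [show (0 : Fin 4) = (0 : Fin 3).castSucc from rfl, h3 0, add_zero] at h4
        rw [show (3 : Fin 4) = (2 : Fin 3).succ from rfl, h2 2, zero_add] at h5
        funext c
        rcases c with c | c
        · exact Fin.cases (motive := fun c => x (Sum.inl c) = 0) h4 h2 c
        · exact Fin.lastCases (motive := fun c => x (Sum.inr c) = 0) h5 h3 c)
  refine ⟨q₂ * ∏ ij, q₁ ij, mul_ne_zero hq₂ (Finset.prod_ne_zero_iff.2 fun ij _ => hq₁ ij),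
    fun a ha hr => ⟨fun i => ?_, fun i j hij => ?_, i₀, i₁, i₂, fun x y h2 h3 h4 => ?_⟩⟩
  · have : LinearMap.range (camOfC a i).mulVecLin = ⊤ :=
      Submodule.eq_top_of_finrank_eq (by rw [← Matrix.rank, hr i]; simp)
    exact fun w => LinearMap.range_eq_top.1 this w
  · rw [map_mul, map_prod] at ha
    exact hh₁ (i, j) a (Finset.prod_ne_zero_iff.1 (right_ne_zero_of_mul ha) _ (Finset.mem_univ _)) hij
  · rw [map_mul] at ha
    have := hh₂ a (left_ne_zero_of_mul ha) (Sum.elim x y) (by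
      rw [Matrix.mulVec_add] at h4
      rintro (r | r | r)
      · simpa [camOfC, Matrix.mulVec, dotProduct] using congrFun h2 r
      · simpa [camOfC, Matrix.mulVec, dotProduct] using congrFun h3 r
      · simpa [camOfC, Matrix.mulVec, dotProduct] using congrFun h4 r)
    exact ⟨funext fun c => congrFun this (Sum.inl c), funext fun c => congrFun this (Sum.inr c)⟩

/-- The multicone over the blow-up of `ℙ³` at the camera centres. -/
def bCone {n : ℕ} (A : Fin n → Matrix (Fin 3) (Fin 4) ℂ) :
    Set ((Fin 4 → ℂ) × (Fin n → Fin 3 → ℂ)) :=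
  {x | x.1 ≠ 0 ∧ ∀ i, x.2 i ≠ 0 ∧ ∃ ρ : ℂ, (A i).mulVec x.1 = ρ • x.2 i}

theorem GenCams.eq_smul {n : ℕ} {A : Fin n → Matrix (Fin 3) (Fin 4) ℂ} (hA : GenCams A)
    {y : Fin 4 → ℂ} {v : Fin n → Fin 3 → ℂ} (hy : y ≠ 0)
    (hv : ∀ i, ∃ ρ : ℂ, (A i).mulVec y = ρ • v i) {z : Fin 4 → ℂ}
    (hz : ∀ i, ∃ ρ : ℂ, (A i).mulVec z = ρ • v i) : ∃ c : ℂ, z = c • y := by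
  by_contra hcon
  push Not at hcon
  have hlin : ∀ α β : ℂ, α • y + β • z = 0 → α = 0 ∧ β = 0 := fun α β h => by
    have hβ : β = 0 := by
      by_contra hβ
      refine hcon (-(β⁻¹ * α)) ?_
      have h2 : β⁻¹ • (α • y + β • z) = 0 := by rw [h, smul_zero]
      rw [smul_add, smul_smul, smul_smul, inv_mul_cancel₀ hβ, one_smul, add_comm] at h2
      rw [eq_neg_of_add_eq_zero_left h2, neg_smul]
    rw [hβ, zero_smul, add_zero] at h
    exact ⟨(smul_eq_zero.1 h).resolve_right hy, hβ⟩
  have hker : ∀ i, ∃ α β : ℂ, ¬ (α = 0 ∧ β = 0) ∧ (A i).mulVec (α • y + β • z) = 0 := fun i => by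
    obtain ⟨ρ, hρ⟩ := hv i
    obtain ⟨σ', hσ⟩ := hz i
    by_cases h0 : ρ = 0
    · refine ⟨1, 0, by simp, ?_⟩
      rw [one_smul, zero_smul, add_zero, hρ, h0, zero_smul]
    · refine ⟨σ', -ρ, by simp [h0], ?_⟩
      rw [Matrix.mulVec_add, Matrix.mulVec_smul, Matrix.mulVec_smul, hρ, hσ, smul_smul, smul_smul,
        ← add_smul]
      rw [show σ' * ρ + -ρ * σ' = 0 by ring, zero_smul]
  obtain ⟨i₀, i₁, i₂, hind⟩ := hA.indep
  obtain ⟨α₀, β₀, n₀, h₀⟩ := hker i₀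
  obtain ⟨α₁, β₁, n₁, h₁⟩ := hker i₁
  obtain ⟨α₂, β₂, n₂, h₂⟩ := hker i₂
  have key : ∀ c₀ c₁ c₂ : ℂ, c₀ • (α₀ • y + β₀ • z) + c₁ • (α₁ • y + β₁ • z) =
      c₂ • (α₂ • y + β₂ • z) → c₀ = 0 ∧ c₁ = 0 := fun c₀ c₁ c₂ h => by
    obtain ⟨e₀, e₁⟩ := hind (c₀ • (α₀ • y + β₀ • z)) (c₁ • (α₁ • y + β₁ • z))
      (by rw [Matrix.mulVec_smul, h₀, smul_zero]) (by rw [Matrix.mulVec_smul, h₁, smul_zero])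
      (by rw [h, Matrix.mulVec_smul, h₂, smul_zero])
    exact ⟨(smul_eq_zero.1 e₀).resolve_right fun h => n₀ (hlin _ _ h),
      (smul_eq_zero.1 e₁).resolve_right fun h => n₁ (hlin _ _ h)⟩
  by_cases hD : α₀ * β₁ - α₁ * β₀ = 0
  · have a := key α₁ (-α₀) 0 (by
      have : α₁ • (α₀ • y + β₀ • z) + (-α₀) • (α₁ • y + β₁ • z) = (-(α₀ * β₁ - α₁ * β₀)) • z := by
        module
      rw [this, hD]; simp)
    have b := key β₁ (-β₀) 0 (by
      have : β₁ • (α₀ • y + β₀ • z) + (-β₀) • (α₁ • y + β₁ • z) = (α₀ * β₁ - α₁ * β₀) • y := by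
        module
      rw [this, hD]; simp)
    exact n₁ ⟨a.1, b.1⟩
  · obtain ⟨a, b⟩ := key (α₁ * β₂ - α₂ * β₁) (α₂ * β₀ - α₀ * β₂) (-(α₀ * β₁ - α₁ * β₀)) (by module)
    have : (α₀ * β₁ - α₁ * β₀) • (α₂ • y + β₂ • z) = 0 := by
      have e : (α₀ * β₁ - α₁ * β₀) • (α₂ • y + β₂ • z) =
        -((α₁ * β₂ - α₂ * β₁) • (α₀ • y + β₀ • z) +
          (α₂ * β₀ - α₀ * β₂) • (α₁ • y + β₁ • z)) := by module
      rw [e, a, b]; simp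
    exact n₂ (hlin _ _ ((smul_eq_zero.1 this).resolve_left hD))

/-- Data for a coordinate chart of the blow-up of `ℙ³` at the camera centres. -/
structure BChart {n : ℕ} (A : Fin n → Matrix (Fin 3) (Fin 4) ℂ) where
  i : Fin n
  r : Fin 3
  lam : (Fin 4 → ℂ) →ₗ[ℂ] ℂ
  P : Fin 4 → ℂ
  B : (Fin 3 → ℂ) →ₗ[ℂ] (Fin 4 → ℂ)
  AP : (A i).mulVec P = 0
  AB : ∀ w, (A i).mulVec (B w) = w
  lamP : lam P = 1
  lamB : ∀ w, lam (B w) = 0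
  decomp : ∀ z, z = lam z • P + B ((A i).mulVec z)

/-- The affine chart of `ℙ²`. -/
def cV (r : Fin 3) (ξ : Fin 3 → ℂ) : Fin 3 → ℂ := Fin.insertNth r (1 : ℂ) fun b => ξ b.succ

theorem cV_self (r : Fin 3) (ξ : Fin 3 → ℂ) : cV r ξ r = 1 := by simp [cV]

theorem cV_succAbove (r : Fin 3) (ξ : Fin 3 → ℂ) (b : Fin 2) : cV r ξ (r.succAbove b) = ξ b.succ := by
  simp [cV]

theorem cV_ne_zero (r : Fin 3) (ξ : Fin 3 → ℂ) : cV r ξ ≠ 0 := fun h =>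
  one_ne_zero ((cV_self r ξ).symm.trans (congrFun h r))

namespace BChart

variable {n : ℕ} {A : Fin n → Matrix (Fin 3) (Fin 4) ℂ} (k : BChart A)

/-- The point of `ℙ³`. -/
def cY (ξ : Fin 3 → ℂ) : Fin 4 → ℂ := k.P + ξ 0 • k.B (cV k.r ξ)

open Classical in
/-- The points of the image planes. -/
def chV (ξ : Fin 3 → ℂ) : Fin n → Fin 3 → ℂ := fun j =>
  if j = k.i then cV k.r ξ else (A j).mulVec (k.cY ξ)

/-- The domain of the chart. -/
def dom : Set (Fin 3 → ℂ) := {ξ | ∀ j, k.chV ξ j ≠ 0}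

theorem mulVec_cY (ξ : Fin 3 → ℂ) : (A k.i).mulVec (k.cY ξ) = ξ 0 • cV k.r ξ := by
  rw [cY, Matrix.mulVec_add, k.AP, Matrix.mulVec_smul, k.AB, zero_add]

theorem lam_cY (ξ : Fin 3 → ℂ) : k.lam (k.cY ξ) = 1 := by
  rw [cY, map_add, k.lamP, map_smul, k.lamB, smul_zero, add_zero]

theorem cY_ne_zero (ξ : Fin 3 → ℂ) : k.cY ξ ≠ 0 := fun h => by
  have := k.lam_cY ξ
  rw [h, map_zero] at this
  exact zero_ne_one this

theorem chV_self (ξ : Fin 3 → ℂ) : k.chV ξ k.i = cV k.r ξ := if_pos rfl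

theorem chV_of_ne {j : Fin n} (h : j ≠ k.i) (ξ : Fin 3 → ℂ) :
    k.chV ξ j = (A j).mulVec (k.cY ξ) := if_neg h

theorem exists_smul (ξ : Fin 3 → ℂ) (j : Fin n) :
    ∃ ρ : ℂ, (A j).mulVec (k.cY ξ) = ρ • k.chV ξ j := by
  by_cases h : j = k.i
  · subst h
    exact ⟨ξ 0, by rw [chV_self, mulVec_cY]⟩
  · exact ⟨1, by rw [chV_of_ne k h, one_smul]⟩

theorem mem_bCone {ξ : Fin 3 → ℂ} (h : ξ ∈ k.dom) : (k.cY ξ, k.chV ξ) ∈ bCone A :=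
  ⟨k.cY_ne_zero ξ, fun j => ⟨h j, k.exists_smul ξ j⟩⟩

/-- The coordinates of a point. -/
def coord (y : Fin 4 → ℂ) (v : Fin 3 → ℂ) : Fin 3 → ℂ :=
  Fin.cons ((A k.i).mulVec y k.r / k.lam y) fun b => v (k.r.succAbove b) / v k.r

theorem cV_coord (y : Fin 4 → ℂ) {v : Fin 3 → ℂ} (hv : v k.r ≠ 0) :
    cV k.r (k.coord y v) = (v k.r)⁻¹ • v := by
  funext s
  refine Fin.succAboveCases k.r ?_ (fun b => ?_) s
  · simp [cV_self, hv]
  · rw [cV_succAbove]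
    simp [coord, div_eq_inv_mul]

theorem cY_coord {y : Fin 4 → ℂ} {v : Fin 3 → ℂ} {ρ : ℂ} (h : (A k.i).mulVec y = ρ • v)
    (hy : k.lam y ≠ 0) (hv : v k.r ≠ 0) : k.cY (k.coord y v) = (k.lam y)⁻¹ • y := by
  refine Eq.trans ?_ (congrArg ((k.lam y)⁻¹ • ·) (k.decomp y).symm)
  rw [cY, cV_coord k y hv, smul_add, smul_smul, inv_mul_cancel₀ hy, one_smul, h, map_smul,
    map_smul, smul_smul, smul_smul]
  congr 2
  simp only [coord, Fin.cons_zero, h, Pi.smul_apply, smul_eq_mul]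
  field_simp

theorem chV_coord {y : Fin 4 → ℂ} {v : Fin n → Fin 3 → ℂ}
    (h : ∀ j, ∃ ρ : ℂ, (A j).mulVec y = ρ • v j)
    (hy : k.lam y ≠ 0) (hv : v k.i k.r ≠ 0) (hj : ∀ j, j ≠ k.i → (A j).mulVec y ≠ 0) (j : Fin n) :
    ∃ c : ℂ, c ≠ 0 ∧ k.chV (k.coord y (v k.i)) j = c • v j := by
  by_cases e : j = k.i
  · subst e
    exact ⟨_, inv_ne_zero hv, by rw [chV_self, cV_coord k y hv]⟩
  · obtain ⟨ρ', h'⟩ := h k.i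
    obtain ⟨ρ, hρ⟩ := h j
    have hρ0 : ρ ≠ 0 := fun h0 => hj j e (by rw [hρ, h0, zero_smul])
    exact ⟨(k.lam y)⁻¹ * ρ, mul_ne_zero (inv_ne_zero hy) hρ0, by
      rw [chV_of_ne k e, cY_coord k h' hy hv, Matrix.mulVec_smul, hρ, smul_smul]⟩

end BChart

theorem exists_bChart {n : ℕ} {A : Fin n → Matrix (Fin 3) (Fin 4) ℂ} (i : Fin n) (r : Fin 3) (lam : (Fin 4 → ℂ) →ₗ[ℂ] ℂ)
    (hl : ∀ z, (A i).mulVec z = 0 → lam z = 0 → z = 0) :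
    ∃ k : BChart A, k.i = i ∧ k.r = r ∧ k.lam = lam := by
  let g : (Fin 4 → ℂ) →ₗ[ℂ] ℂ × (Fin 3 → ℂ) := lam.prod (A i).mulVecLin
  have hg : Function.Injective g := by
    refine LinearMap.ker_eq_bot.1 (LinearMap.ker_eq_bot'.2 fun z hz => ?_)
    exact hl z (congrArg Prod.snd hz) (congrArg Prod.fst hz)
  let e := LinearEquiv.ofInjectiveOfFinrankEq g hg (by simp)
  have he : ∀ z, e z = (lam z, (A i).mulVec z) := fun z => rfl
  have h1 : ∀ p, (lam (e.symm p), (A i).mulVec (e.symm p)) = p := fun p => by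
    rw [← he, e.apply_symm_apply]
  refine ⟨⟨i, r, lam, e.symm (1, 0), e.symm.toLinearMap ∘ₗ LinearMap.inr ℂ ℂ (Fin 3 → ℂ),
    congrArg Prod.snd (h1 (1, 0)), fun w => congrArg Prod.snd (h1 (0, w)),
    congrArg Prod.fst (h1 (1, 0)), fun w => congrArg Prod.fst (h1 (0, w)), fun z => ?_⟩,
    rfl, rfl, rfl⟩
  have : z = e.symm (lam z • (1, 0) + (0, (A i).mulVec z)) := by
    rw [e.eq_symm_apply, he]; simp
  conv_lhs => rw [this, map_add, map_smul]
  rfl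

/-- A finite atlas of the blow-up. -/
theorem GenCams.exists_center {n : ℕ} {A : Fin n → Matrix (Fin 3) (Fin 4) ℂ} (hA : GenCams A)
    (i : Fin n) : ∃ P : Fin 4 → ℂ, P ≠ 0 ∧ (A i).mulVec P = 0 ∧
      ∀ z, (A i).mulVec z = 0 → ∃ c : ℂ, z = c • P := by
  have hrk : Module.finrank ℂ (LinearMap.ker (A i).mulVecLin) = 1 := by
    have h1 := LinearMap.finrank_range_add_finrank_ker (A i).mulVecLin
    rw [LinearMap.range_eq_top.2 fun w => hA.surj i w, finrank_top] at h1
    simp at h1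
    omega
  obtain ⟨P, hP, h⟩ := finrank_eq_one_iff'.1 hrk
  refine ⟨P, fun h => hP (Subtype.ext h), P.2, fun z hz => ?_⟩
  obtain ⟨c, hc⟩ := h ⟨z, hz⟩
  exact ⟨c, (congrArg Subtype.val hc).symm⟩

theorem GenCams.exists_atlas {n : ℕ} (hn : 3 ≤ n) {A : Fin n → Matrix (Fin 3) (Fin 4) ℂ}
    (hA : GenCams A) : ∃ (ι : Type) (_ : Fintype ι) (ch : ι → BChart A), ∀ x ∈ bCone A,
      ∃ k, (ch k).lam x.1 ≠ 0 ∧ x.2 (ch k).i (ch k).r ≠ 0 ∧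
        ∀ j, j ≠ (ch k).i → (A j).mulVec x.1 ≠ 0 := by
  classical
  let lam : Fin 4 → Fin 4 → (Fin 4 → ℂ) →ₗ[ℂ] ℂ := fun a b =>
    (LinearMap.proj a : (Fin 4 → ℂ) →ₗ[ℂ] ℂ) + LinearMap.proj b
  let T := {t : Fin n × Fin 3 × Fin 4 × Fin 4 //
    ∀ z, (A t.1).mulVec z = 0 → lam t.2.2.1 t.2.2.2 z = 0 → z = 0}
  choose ch hi hr hl using fun t : T => exists_bChart (A := A) t.1.1 t.1.2.1 (lam t.1.2.2.1 t.1.2.2.2) t.2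
  refine ⟨T, inferInstance, ch, ?_⟩
  rintro ⟨y, v⟩ ⟨hy, hv⟩
  obtain ⟨i, hi₀⟩ : ∃ i, ∀ j, j ≠ i → (A j).mulVec y ≠ 0 := by
    by_cases h : ∃ i, (A i).mulVec y = 0
    · obtain ⟨i, h⟩ := h
      exact ⟨i, fun j hj h' => hy (hA.ker j i hj y h' h)⟩
    · push Not at h
      exact ⟨⟨0, by omega⟩, fun j _ => h j⟩
  obtain ⟨r, hr₀⟩ := Function.ne_iff.1 (hv i).1
  obtain ⟨P, hP0, -, hP⟩ := hA.exists_center i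
  obtain ⟨a, b, hya, hPa⟩ : ∃ a b, lam a b y ≠ 0 ∧ lam a b P ≠ 0 := by
    obtain ⟨a, ha⟩ := Function.ne_iff.1 hy
    obtain ⟨b, hb⟩ := Function.ne_iff.1 hP0
    simp only [Pi.zero_apply] at ha hb
    by_cases h1 : P a = 0
    · by_cases h2 : y b = 0
      · exact ⟨a, b, by simpa [lam, h2] using ha, by simpa [lam, h1] using hb⟩
      · exact ⟨b, b, by simpa [lam, ← two_mul] using h2, by simpa [lam, ← two_mul] using hb⟩
    · exact ⟨a, a, by simpa [lam, ← two_mul] using ha, by simpa [lam, ← two_mul] using h1⟩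
  refine ⟨⟨(i, r, a, b), fun z hz hz' => ?_⟩, ?_, ?_, ?_⟩
  · obtain ⟨c, rfl⟩ := hP z hz
    rw [map_smul, smul_eq_mul] at hz'
    rw [(mul_eq_zero.1 hz').resolve_right hPa, zero_smul]
  · rw [hl]; exact hya
  · rw [hi, hr]; exact hr₀
  · rw [hi]; exact hi₀

theorem fderiv_eq_of_quadratic {X : Type} [NormedAddCommGroup X] [NormedSpace ℂ X] {f : X → ℂ}
    {x η : X} (hf : DifferentiableAt ℂ f x) (d e : ℂ)
    (h : ∀ t : ℂ, f (x + t • η) = f x + t * d + t * t * e) : fderiv ℂ f x η = d := by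
  rw [← hf.lineDeriv_eq_fderiv]
  have h1 : HasDerivAt (fun t : ℂ => f (x + t • η)) d 0 := by
    rw [funext h]
    have h2 := (((hasDerivAt_id (0 : ℂ)).mul_const d).const_add (f x)).add
      (((hasDerivAt_id (0 : ℂ)).mul (hasDerivAt_id (0 : ℂ))).mul_const e)
    exact HasDerivAt.congr_deriv h2 (by simp)
  exact HasLineDerivAt.lineDeriv h1

/-- The differential of `cV`. -/
def dV (r : Fin 3) (η : Fin 3 → ℂ) : Fin 3 → ℂ := Fin.insertNth r (0 : ℂ) fun b => η b.succ

theorem cV_add (r : Fin 3) (ξ η : Fin 3 → ℂ) (t : ℂ) :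
    cV r (ξ + t • η) = cV r ξ + t • dV r η := by
  funext s
  refine Fin.succAboveCases r ?_ (fun b => ?_) s <;> simp [cV, dV]

theorem isPoly_cV (r s : Fin 3) : IsPoly fun ξ => cV r ξ s := by
  refine Fin.succAboveCases r ?_ (fun b => ?_) s
  · simp only [cV_self]
    exact IsPoly.const 1
  · simp only [cV_succAbove]
    exact IsPoly.coord _

theorem isPoly_linearMap {a b : ℕ} {p : Type} (L : (Fin a → ℂ) →ₗ[ℂ] (Fin b → ℂ))
    {f : (p → ℂ) → Fin a → ℂ} (hf : ∀ i, IsPoly fun x => f x i) (j : Fin b) :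
    IsPoly fun x => L (f x) j := by
  have : ∀ x, L (f x) j = ∑ i, LinearMap.toMatrix' L j i * f x i := fun x => by
    conv_lhs => rw [← LinearMap.toMatrix'_mulVec]
    rfl
  simp only [this]
  exact IsPoly.sum _ fun i => (IsPoly.const _).mul (hf i)

namespace BChart

variable {n : ℕ} {A : Fin n → Matrix (Fin 3) (Fin 4) ℂ} (k : BChart A)

/-- The differential of `cY`. -/
def dY (ξ η : Fin 3 → ℂ) : Fin 4 → ℂ := η 0 • k.B (cV k.r ξ) + ξ 0 • k.B (dV k.r η)

theorem cY_add (ξ η : Fin 3 → ℂ) (t : ℂ) : k.cY (ξ + t • η) =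
    k.cY ξ + t • k.dY ξ η + (t * t) • (η 0 • k.B (dV k.r η)) := by
  simp only [cY, dY, cV_add, map_add, map_smul, Pi.add_apply, Pi.smul_apply, smul_eq_mul]
  module

theorem isPoly_cY (a : Fin 4) : IsPoly fun ξ => k.cY ξ a :=
  (IsPoly.const (k.P a)).add ((IsPoly.coord 0).mul (isPoly_linearMap k.B (isPoly_cV k.r) a))

theorem isPoly_chV (j : Fin n) (s : Fin 3) : IsPoly fun ξ => k.chV ξ j s := by
  by_cases h : j = k.i
  · subst h
    simp only [chV_self]
    exact isPoly_cV _ _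
  · simp only [chV_of_ne k h]
    exact isPoly_linearMap (A j).mulVecLin k.isPoly_cY s

theorem fderiv_chV_self (ξ η : Fin 3 → ℂ) (s : Fin 3) :
    fderiv ℂ (fun ξ => k.chV ξ k.i s) ξ η = dV k.r η s :=
  fderiv_eq_of_quadratic ((k.isPoly_chV k.i s).differentiable ξ) _ 0 fun t => by
    rw [chV_self, chV_self, cV_add, mul_zero, add_zero]; rfl

theorem fderiv_chV_of_ne {j : Fin n} (h : j ≠ k.i) (ξ η : Fin 3 → ℂ) (s : Fin 3) :
    fderiv ℂ (fun ξ => k.chV ξ j s) ξ η = (A j).mulVec (k.dY ξ η) s :=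
  fderiv_eq_of_quadratic ((k.isPoly_chV j s).differentiable ξ) _
    ((A j).mulVec (η 0 • k.B (dV k.r η)) s) fun t => by
    rw [chV_of_ne k h, chV_of_ne k h, cY_add, Matrix.mulVec_add, Matrix.mulVec_add,
      Matrix.mulVec_smul, Matrix.mulVec_smul _ (t * t)]
    rfl

theorem immersiveAt (hA : GenCams A) (ξ : Fin 3 → ℂ) : ImmersiveAt k.chV ξ := by
  intro η h
  have h0 : ∀ b : Fin 2, η b.succ = 0 := by
    obtain ⟨ρ, hρ⟩ := h k.i
    have hr := hρ k.r
    rw [fderiv_chV_self, chV_self, cV_self] at hr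
    simp only [dV, Fin.insertNth_apply_same, mul_one] at hr
    intro b
    have hb := hρ (k.r.succAbove b)
    rw [fderiv_chV_self, ← hr, zero_mul] at hb
    simpa [dV] using hb
  have hdV : dV k.r η = 0 := by
    funext s
    refine Fin.succAboveCases k.r ?_ (fun b => ?_) s
    · simp [dV]
    · simp [dV, h0]
  have hdY : k.dY ξ η = η 0 • k.B (cV k.r ξ) := by rw [dY, hdV, map_zero, smul_zero, add_zero]
  obtain ⟨c, hc⟩ := hA.eq_smul (k.cY_ne_zero ξ) (k.exists_smul ξ) (z := k.dY ξ η) fun j => by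
    by_cases hj : j = k.i
    · subst hj
      exact ⟨η 0, by rw [hdY, Matrix.mulVec_smul, k.AB, chV_self]⟩
    · obtain ⟨ρ, hρ⟩ := h j
      exact ⟨ρ, funext fun s => by rw [← fderiv_chV_of_ne k hj, hρ]; rfl⟩
  have hc0 : c = 0 := by
    have := congrArg k.lam hc
    rw [hdY, map_smul, k.lamB, smul_zero, map_smul, lam_cY, smul_eq_mul, mul_one] at this
    exact this.symm
  have hη : η 0 = 0 := by
    have h1 : (A k.i).mulVec (k.dY ξ η) = 0 := by rw [hc, hc0, zero_smul, Matrix.mulVec_zero]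
    rw [hdY, Matrix.mulVec_smul, k.AB] at h1
    exact (smul_eq_zero.1 h1).resolve_right (cV_ne_zero _ _)
  funext b
  exact Fin.cases hη h0 b

theorem sepJets (hA : GenCams A) {ξ : Fin 3 → ℂ} (hξ : ξ ∈ k.dom) :
    SepJets (fun j ξ => mono j (k.chV ξ)) ξ :=
  sepJets_mono (fun j s => (k.isPoly_chV j s).differentiable) hξ (k.immersiveAt hA ξ)

end BChart

/-- The divisor of a form of multidegree `(2,…,2)` is nonsingular in the given charts. -/
def SmoothX {n : ℕ} {A : Fin n → Matrix (Fin 3) (Fin 4) ℂ} {ι : Type} (ch : ι → BChart A)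
    (c : (Fin n → Fin 3) × (Fin n → Fin 3) → ℂ) : Prop :=
  ∀ k, ∀ ξ ∈ (ch k).dom, biquadForm c ((ch k).chV ξ) = 0 →
    ∃ η, fderiv ℂ (fun ξ => biquadForm c ((ch k).chV ξ)) ξ η ≠ 0

theorem biquadForm_eq_lin {n : ℕ} {X : Type} (c : (Fin n → Fin 3) × (Fin n → Fin 3) → ℂ)
    (V : X → Fin n → Fin 3 → ℂ) : (fun x => biquadForm c (V x)) =
      lin (fun (a : (Fin n → Fin 3) × (Fin n → Fin 3)) x => mono a.1 (V x) * mono a.2 (V x)) c := by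
  funext x
  exact Finset.sum_congr rfl fun a _ => mul_assoc _ _ _

theorem exists_poly_smoothX {n : ℕ} {A : Fin n → Matrix (Fin 3) (Fin 4) ℂ} (hA : GenCams A)
    {ι : Type} [Fintype ι] (ch : ι → BChart A) :
    ∃ q : MvPolynomial ((Fin n → Fin 3) × (Fin n → Fin 3)) ℂ, q ≠ 0 ∧
      ∀ c, MvPolynomial.eval c q ≠ 0 → SmoothX ch c := by
  classical
  have hp : ∀ k j, IsPoly fun ξ => mono j ((ch k).chV ξ) := fun k j =>
    isPoly_mono (ch k).isPoly_chV j
  choose q hq h using fun k => exists_poly_smooth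
    (g := fun (a : (Fin n → Fin 3) × (Fin n → Fin 3)) ξ =>
      mono a.1 ((ch k).chV ξ) * mono a.2 ((ch k).chV ξ)) fun a => (hp k a.1).mul (hp k a.2)
  refine ⟨∏ k, q k, Finset.prod_ne_zero_iff.2 fun k _ => hq k, fun c hc k ξ hξ h0 => ?_⟩
  rw [map_prod] at hc
  rw [biquadForm_eq_lin]
  refine h k c (Finset.prod_ne_zero_iff.1 hc k (Finset.mem_univ _)) ξ
    (SepJets.mul (fun j => (hp k j).differentiable) ((ch k).sepJets hA hξ)) ?_
  rw [← biquadForm_eq_lin]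
  exact h0

theorem isClosed_total {T S E : Type} [TopologicalSpace T] [TopologicalSpace S] [CompactSpace S]
    [TopologicalSpace E] [T2Space E] {φ : S → E} (hφ : Continuous φ) {W : Set (T × S)}
    (hW : IsClosed W) : IsClosed {p : T × E | ∃ s, (p.1, s) ∈ W ∧ φ s = p.2} := by
  have h : IsClosed {q : (T × E) × S | (q.1.1, q.2) ∈ W ∧ φ q.2 = q.1.2} :=
    (hW.preimage (by fun_prop)).inter (isClosed_eq (by fun_prop) (by fun_prop))
  convert isClosedMap_fst_of_compactSpace _ h using 1
  ext p
  constructor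
  · rintro ⟨s, hs⟩
    exact ⟨(p, s), hs, rfl⟩
  · rintro ⟨⟨p', s⟩, hs, rfl⟩
    exact ⟨s, hs⟩

section Smooth
variable {κ : Type} [Fintype κ]

theorem contDiffAt_prj {v : κ → ℂ} (hv : v ≠ 0) {m : WithTop ℕ∞} :
    ContDiffAt ℝ m (prj (κ := κ)) v := by
  refine contDiffAt_pi.2 fun a => contDiffAt_pi.2 fun b => ?_
  have h1 : ContDiff ℝ m fun v : κ → ℂ => v a * (starRingEnd ℂ) (v b) :=
    (contDiff_apply ℝ ℂ a).mul (Complex.conjCLE.contDiff.comp (contDiff_apply ℝ ℂ b))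
  have h2 : ContDiff ℝ m fun v : κ → ℂ => ((∑ c, ‖v c‖ ^ 2 : ℝ) : ℂ) :=
    Complex.ofRealCLM.contDiff.comp
      (ContDiff.sum fun c _ => (contDiff_norm_sq ℝ).comp (contDiff_apply ℝ ℂ c))
  simp only [prj, div_eq_mul_inv]
  exact h1.contDiffAt.mul (h2.contDiffAt.inv (sum_sq_ne hv))

theorem prj_col {v : κ → ℂ} {b : κ} (hb : v b ≠ 0) :
    ∃ c : ℂ, c ≠ 0 ∧ (fun a => prj v a b) = c • v := by
  have hv : v ≠ 0 := fun h => hb (congrFun h b)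
  refine ⟨(starRingEnd ℂ) (v b) / ((∑ c, ‖v c‖ ^ 2 : ℝ) : ℂ), div_ne_zero (by simpa using hb)
    (sum_sq_ne hv), funext fun a => ?_⟩
  simp only [prj, Pi.smul_apply, smul_eq_mul]
  ring

end Smooth

theorem IsPoly.contDiff_real {p : Type} [Fintype p] {f : (p → ℂ) → ℂ} (hf : IsPoly f)
    {m : WithTop ℕ∞} : ContDiff ℝ m f := hf.contDiff.restrict_scalars ℝ

/-- The complex differential of a slice. -/
theorem fderiv_slice {T X F : Type} [NormedAddCommGroup T] [NormedSpace ℝ T]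
    [NormedAddCommGroup X] [NormedSpace ℂ X] [NormedAddCommGroup F] [NormedSpace ℂ F]
    {f : T × X → F} {t : T} {ξ : X} (hf : DifferentiableAt ℝ f (t, ξ))
    (hg : DifferentiableAt ℂ (fun x => f (t, x)) ξ) (v : X) :
    fderiv ℝ f (t, ξ) (0, v) = fderiv ℂ (fun x => f (t, x)) ξ v := by
  have h1 : HasFDerivAt (fun x => f (t, x))
      ((fderiv ℝ f (t, ξ)).comp (ContinuousLinearMap.inr ℝ T X)) ξ :=
    hf.hasFDerivAt.comp ξ (hasFDerivAt_prodMk_right t ξ)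
  have h2 := hg.hasFDerivAt.restrictScalars ℝ
  exact DFunLike.congr_fun (h1.unique h2) v

/-- Embedding of the product of projective spaces by projectors. -/
def embB {n : ℕ} (x : (Fin 4 → ℂ) × (Fin n → Fin 3 → ℂ)) :
    (Fin 4 → Fin 4 → ℂ) × (Fin n → Fin 3 → Fin 3 → ℂ) := (prj x.1, fun i => prj (x.2 i))

/-- The divisor of a form of multidegree `(2,…,2)` on the blow-up, embedded by projectors. -/
def KX {n : ℕ} (A : Fin n → Matrix (Fin 3) (Fin 4) ℂ) (c : (Fin n → Fin 3) × (Fin n → Fin 3) → ℂ) :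
    Set ((Fin 4 → Fin 4 → ℂ) × (Fin n → Fin 3 → Fin 3 → ℂ)) :=
  embB '' {x | x ∈ bCone A ∧ biquadForm c x.2 = 0}

theorem embB_eq_of_smul {n : ℕ} {x x' : (Fin 4 → ℂ) × (Fin n → Fin 3 → ℂ)}
    (h : ∃ c : ℂ, c ≠ 0 ∧ x'.1 = c • x.1) (h' : ∀ j, ∃ c : ℂ, c ≠ 0 ∧ x'.2 j = c • x.2 j) :
    embB x' = embB x := by
  obtain ⟨c, hc, e⟩ := h
  refine Prod.ext ?_ (funext fun j => ?_)
  · simp only [embB, e, prj_smul hc]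
  · obtain ⟨c, hc, e⟩ := h' j
    simp only [embB, e, prj_smul hc]

theorem embB_inj {n : ℕ} {x x' : (Fin 4 → ℂ) × (Fin n → Fin 3 → ℂ)} (h1 : x.1 ≠ 0) (h1' : x'.1 ≠ 0)
    (h2 : ∀ j, x.2 j ≠ 0) (h2' : ∀ j, x'.2 j ≠ 0) (h : embB x = embB x') :
    (∃ c : ℂ, c ≠ 0 ∧ x'.1 = c • x.1) ∧ ∀ j, ∃ c : ℂ, c ≠ 0 ∧ x'.2 j = c • x.2 j :=
  ⟨prj_inj h1 h1' (congrArg Prod.fst h),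
    fun j => prj_inj (h2 j) (h2' j) (congrFun (congrArg Prod.snd h) j)⟩

theorem biquadForm_smul {n : ℕ} (c : (Fin n → Fin 3) × (Fin n → Fin 3) → ℂ)
    (v : Fin n → Fin 3 → ℂ) (a : Fin n → ℂ) :
    biquadForm c (fun i => a i • v i) = (∏ i, a i) ^ 2 * biquadForm c v := by
  simp only [biquadForm, Pi.smul_apply, smul_eq_mul, Finset.prod_mul_distrib, Finset.mul_sum]
  exact Finset.sum_congr rfl fun _ _ => by ring

theorem biquadForm_eq_zero_iff {n : ℕ} (c : (Fin n → Fin 3) × (Fin n → Fin 3) → ℂ)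
    {v w : Fin n → Fin 3 → ℂ} (h : ∀ j, ∃ a : ℂ, a ≠ 0 ∧ w j = a • v j) :
    biquadForm c w = 0 ↔ biquadForm c v = 0 := by
  choose a ha h using h
  rw [funext h, biquadForm_smul, mul_eq_zero, or_iff_right]
  exact pow_ne_zero _ (Finset.prod_ne_zero_iff.2 fun j _ => ha j)

theorem exists_smul_iff_minors {κ : Type} {w v : κ → ℂ} (hv : v ≠ 0) :
    (∃ ρ : ℂ, w = ρ • v) ↔ ∀ r s, w r * v s = w s * v r := by
  constructor
  · rintro ⟨ρ, rfl⟩ r s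
    simp only [Pi.smul_apply, smul_eq_mul]; ring
  · intro h
    obtain ⟨s, hs⟩ := Function.ne_iff.1 hv
    have hs' : v s ≠ 0 := hs
    refine ⟨w s / v s, funext fun r => ?_⟩
    rw [Pi.smul_apply, smul_eq_mul, div_mul_eq_mul_div, eq_div_iff hs', h]

theorem exists_smul_mem_sphere {κ : Type} [Fintype κ] {v : κ → ℂ} (hv : v ≠ 0) :
    ∃ c : ℂ, c ≠ 0 ∧ c • v ∈ Metric.sphere (0 : κ → ℂ) 1 := by
  have h : ‖v‖ ≠ 0 := norm_ne_zero_iff.2 hv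
  exact ⟨((‖v‖⁻¹ : ℝ) : ℂ), Complex.ofReal_ne_zero.2 (inv_ne_zero h), by
    rw [mem_sphere_zero_iff_norm, norm_smul, Complex.norm_real, norm_inv, norm_norm,
      inv_mul_cancel₀ h]⟩

theorem ne_zero_of_mem_sphere {κ : Type} [Fintype κ] {v : κ → ℂ}
    (h : v ∈ Metric.sphere (0 : κ → ℂ) 1) : v ≠ 0 := by
  rintro rfl
  simp at h

/-- The product of unit spheres over the product of projective spaces. -/
abbrev SphB (n : ℕ) : Type :=
  ↥(Metric.sphere (0 : Fin 4 → ℂ) 1) × (Fin n → ↥(Metric.sphere (0 : Fin 3 → ℂ) 1))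

/-- The underlying vectors. -/
def SphB.val {n : ℕ} (s : SphB n) : (Fin 4 → ℂ) × (Fin n → Fin 3 → ℂ) :=
  (s.1.1, fun i => (s.2 i).1)

theorem continuous_sphB_val {n : ℕ} : Continuous (SphB.val (n := n)) := by
  unfold SphB.val
  fun_prop

theorem continuous_embB_val {n : ℕ} : Continuous fun s : SphB n => embB s.val := by
  refine (continuous_prj_comp (by fun_prop) fun s => ne_zero_of_mem_sphere s.1.2).prodMk
    (continuous_pi fun i => continuous_prj_comp (f := fun s : SphB n => (s.2 i).1) (by fun_prop)
      fun s => ne_zero_of_mem_sphere (s.2 i).2)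

theorem continuous_biquadForm {n : ℕ} : Continuous fun p : ((Fin n → Fin 3) × (Fin n → Fin 3) → ℂ) ×
    (Fin n → Fin 3 → ℂ) => biquadForm p.1 p.2 := by
  unfold biquadForm
  fun_prop

theorem mem_KX_iff {n : ℕ} {A : Fin n → Matrix (Fin 3) (Fin 4) ℂ}
    {c : (Fin n → Fin 3) × (Fin n → Fin 3) → ℂ} {e} : e ∈ KX A c ↔ ∃ s : SphB n,
      ((∀ i r r', (A i).mulVec s.val.1 r * s.val.2 i r' = (A i).mulVec s.val.1 r' * s.val.2 i r) ∧
        biquadForm c s.val.2 = 0) ∧ embB s.val = e := by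
  constructor
  · rintro ⟨⟨y, v⟩, ⟨⟨hy, hv⟩, h0⟩, rfl⟩
    obtain ⟨a, ha, hs⟩ := exists_smul_mem_sphere hy
    choose b hb ht using fun i => exists_smul_mem_sphere (hv i).1
    refine ⟨(⟨_, hs⟩, fun i => ⟨_, ht i⟩), ⟨fun i => ?_, ?_⟩,
      embB_eq_of_smul ⟨a, ha, rfl⟩ fun i => ⟨b i, hb i, rfl⟩⟩
    · obtain ⟨ρ, hρ⟩ := (hv i).2
      refine (exists_smul_iff_minors (ne_zero_of_mem_sphere (ht i))).1 ⟨a * ρ * (b i)⁻¹, ?_⟩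
      simp only [SphB.val, Matrix.mulVec_smul]
      rw [show (A i).mulVec y = ρ • v i from hρ, smul_smul, smul_smul, mul_assoc, inv_mul_cancel₀ (hb i), mul_one]
    · exact (biquadForm_eq_zero_iff c fun i => ⟨b i, hb i, rfl⟩).2 h0
  · rintro ⟨s, ⟨h1, h2⟩, rfl⟩
    exact ⟨s.val, ⟨⟨ne_zero_of_mem_sphere s.1.2, fun i => ⟨ne_zero_of_mem_sphere (s.2 i).2,
      (exists_smul_iff_minors (ne_zero_of_mem_sphere (s.2 i).2)).2 (h1 i)⟩⟩, h2⟩, rfl⟩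

theorem isClosed_total_KX {n : ℕ} (A : Fin n → Matrix (Fin 3) (Fin 4) ℂ) :
    IsClosed {p : ((Fin n → Fin 3) × (Fin n → Fin 3) → ℂ) × _ | p.2 ∈ KX A p.1} := by
  have hc := continuous_sphB_val (n := n)
  have h := isClosed_total (T := (Fin n → Fin 3) × (Fin n → Fin 3) → ℂ) (continuous_embB_val (n := n))
    (W := {p | (∀ i r r', (A i).mulVec p.2.val.1 r * p.2.val.2 i r' =
      (A i).mulVec p.2.val.1 r' * p.2.val.2 i r) ∧ biquadForm p.1 p.2.val.2 = 0}) (by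
    have hv : Continuous fun p : ((Fin n → Fin 3) × (Fin n → Fin 3) → ℂ) × SphB n => p.2.val :=
      hc.comp continuous_snd
    have hm : ∀ i r, Continuous fun p : ((Fin n → Fin 3) × (Fin n → Fin 3) → ℂ) × SphB n =>
        (A i).mulVec p.2.val.1 r := fun i r =>
      (continuous_apply r).comp ((A i).mulVecLin.continuous_of_finiteDimensional.comp hv.fst)
    have hv2 : ∀ i r, Continuous fun p : ((Fin n → Fin 3) × (Fin n → Fin 3) → ℂ) × SphB n =>
        p.2.val.2 i r := fun i r =>
      (continuous_apply r).comp ((continuous_apply i).comp hv.snd)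
    refine IsClosed.inter ?_ (isClosed_eq
      (continuous_biquadForm.comp (continuous_fst.prodMk hv.snd)) continuous_const)
    have hi : IsClosed (⋂ i, ⋂ r, ⋂ r', {p : ((Fin n → Fin 3) × (Fin n → Fin 3) → ℂ) × SphB n |
        (A i).mulVec p.2.val.1 r * p.2.val.2 i r' = (A i).mulVec p.2.val.1 r' * p.2.val.2 i r}) :=
      isClosed_iInter fun i => isClosed_iInter fun r => isClosed_iInter fun r' =>
      isClosed_eq ((hm i r).mul (hv2 i r')) ((hm i r').mul (hv2 i r))
    refine (congrArg IsClosed (Set.ext fun p => ?_)).mpr hi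
    simp only [Set.mem_iInter]
    exact Iff.rfl)
  convert h using 1
  ext p
  exact mem_KX_iff

theorem contDiff_linearMap_comp {a : ℕ} {F G : Type} [NormedAddCommGroup F] [NormedSpace ℂ F]
    [NormedAddCommGroup G] [NormedSpace ℝ G] {m : WithTop ℕ∞} (L : (Fin a → ℂ) →ₗ[ℂ] F)
    {f : G → Fin a → ℂ} (hf : ContDiff ℝ m f) : ContDiff ℝ m fun x => L (f x) :=
  ((LinearMap.toContinuousLinearMap L).restrictScalars ℝ).contDiff.comp hf

theorem contDiff_lin {a X : Type} [Fintype a] [NormedAddCommGroup X] [NormedSpace ℝ X]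
    {g : a → X → ℂ} {m : WithTop ℕ∞} (hg : ∀ i, ContDiff ℝ m (g i)) :
    ContDiff ℝ m fun p : (a → ℂ) × X => lin g p.1 p.2 := by
  unfold lin
  refine ContDiff.sum fun i _ => ?_
  have h1 : ContDiff ℝ m fun p : (a → ℂ) × X => p.1 i := (contDiff_apply ℝ ℂ i).comp contDiff_fst
  have h2 : ContDiff ℝ m fun p : (a → ℂ) × X => g i p.2 := (hg i).comp contDiff_snd
  exact h1.mul h2

namespace BChart

variable {n : ℕ} {A : Fin n → Matrix (Fin 3) (Fin 4) ℂ} (k : BChart A)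

theorem coord_smul (y : Fin 4 → ℂ) (v : Fin 3 → ℂ) {c c' : ℂ} (hc : c ≠ 0) (hc' : c' ≠ 0) :
    k.coord (c • y) (c' • v) = k.coord y v := by
  simp only [coord, Matrix.mulVec_smul, map_smul, Pi.smul_apply, smul_eq_mul,
    mul_div_mul_left _ _ hc, mul_div_mul_left _ _ hc']

/-- The coordinates as a function of the projectors. -/
def loc (b : Fin 4) (e : (Fin 4 → Fin 4 → ℂ) × (Fin n → Fin 3 → Fin 3 → ℂ)) : Fin 3 → ℂ :=
  k.coord (fun a => e.1 a b) fun a => e.2 k.i a k.r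

/-- The open set on which the chart is defined. -/
def locDom (b : Fin 4) : Set ((Fin 4 → Fin 4 → ℂ) × (Fin n → Fin 3 → Fin 3 → ℂ)) :=
  {e | k.lam (fun a => e.1 a b) ≠ 0 ∧ e.2 k.i k.r k.r ≠ 0 ∧
    ∀ j, j ≠ k.i → (A j).mulVec (fun a => e.1 a b) ≠ 0}

theorem isOpen_locDom (b : Fin 4) : IsOpen (k.locDom b) := by
  have hc : Continuous fun e : (Fin 4 → Fin 4 → ℂ) × (Fin n → Fin 3 → Fin 3 → ℂ) =>
    fun a => e.1 a b := by fun_prop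
  refine IsOpen.inter (isOpen_ne_fun (k.lam.continuous_of_finiteDimensional.comp hc)
    continuous_const) (IsOpen.inter (isOpen_ne_fun (by fun_prop) continuous_const) ?_)
  have : IsOpen (⋂ j, {e : (Fin 4 → Fin 4 → ℂ) × (Fin n → Fin 3 → Fin 3 → ℂ) | j ≠ k.i →
      (A j).mulVec (fun a => e.1 a b) ≠ 0}) := by
    refine isOpen_iInter_of_finite fun j => ?_
    by_cases h : j = k.i
    · simp [h]
    · simp only [h, ne_eq, not_false_eq_true, forall_const]
      exact isOpen_ne_fun ((A j).mulVecLin.continuous_of_finiteDimensional.comp hc) continuous_const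
  refine (congrArg IsOpen (Set.ext fun p => ?_)).mpr this
  simp only [Set.mem_iInter]
  exact Iff.rfl

theorem contDiffAt_loc (b : Fin 4) {e} (he : e ∈ k.locDom b) {m : WithTop ℕ∞} :
    ContDiffAt ℝ m (k.loc b) e := by
  have hc : ContDiff ℝ m fun e : (Fin 4 → Fin 4 → ℂ) × (Fin n → Fin 3 → Fin 3 → ℂ) =>
      fun a => e.1 a b := contDiff_pi.2 fun a =>
    (contDiff_apply_apply ℝ ℂ a b).comp contDiff_fst
  have h2 : ∀ a, ContDiff ℝ m fun e : (Fin 4 → Fin 4 → ℂ) × (Fin n → Fin 3 → Fin 3 → ℂ) =>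
      e.2 k.i a k.r := fun a =>
    (contDiff_apply_apply ℝ ℂ a k.r).comp ((contDiff_apply ℝ _ k.i).comp contDiff_snd)
  refine contDiffAt_pi.2 fun s => ?_
  refine Fin.cases ?_ (fun b' => ?_) s
  · simp only [loc, coord, Fin.cons_zero, div_eq_mul_inv]
    exact ((contDiff_apply ℝ ℂ k.r).comp
      (contDiff_linearMap_comp (A k.i).mulVecLin hc)).contDiffAt.mul
        ((contDiff_linearMap_comp k.lam hc).contDiffAt.inv he.1)
  · simp only [loc, coord, Fin.cons_succ, div_eq_mul_inv]
    exact (h2 _).contDiffAt.mul ((h2 _).contDiffAt.inv he.2.1)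

/-- Points in the domain of the chart. -/
theorem loc_spec (b : Fin 4) {x} (hx : x ∈ bCone A) (he : embB x ∈ k.locDom b) :
    k.lam x.1 ≠ 0 ∧ x.2 k.i k.r ≠ 0 ∧ (∀ j, j ≠ k.i → (A j).mulVec x.1 ≠ 0) ∧
      k.loc b (embB x) = k.coord x.1 (x.2 k.i) := by
  obtain ⟨h1, h2, h3⟩ := he
  have hb : x.1 b ≠ 0 := fun h0 => h1 (by
    have : (fun a => (embB x).1 a b) = 0 := funext fun a => by simp [embB, prj, h0]
    rw [this, map_zero])
  have hr : x.2 k.i k.r ≠ 0 := (prj_diag_ne (hx.2 k.i).1).1 h2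
  obtain ⟨c, hc, e⟩ := prj_col hb
  obtain ⟨c', hc', e'⟩ := prj_col hr
  have e1 : (fun a => (embB x).1 a b) = c • x.1 := e
  have e2 : (fun a => (embB x).2 k.i a k.r) = c' • x.2 k.i := e'
  rw [e1, map_smul, smul_eq_mul] at h1
  refine ⟨right_ne_zero_of_mul h1, hr, fun j hj h0 => h3 j hj ?_, ?_⟩
  · rw [e1, Matrix.mulVec_smul, h0, smul_zero]
  · rw [loc, e1, e2, coord_smul k _ _ hc hc']

theorem mem_locDom {b : Fin 4} {x} (hx : x ∈ bCone A) (hb : x.1 b ≠ 0) (h1 : k.lam x.1 ≠ 0)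
    (h2 : x.2 k.i k.r ≠ 0) (h3 : ∀ j, j ≠ k.i → (A j).mulVec x.1 ≠ 0) : embB x ∈ k.locDom b := by
  obtain ⟨c, hc, e⟩ := prj_col hb
  have e1 : (fun a => (embB x).1 a b) = c • x.1 := e
  refine ⟨?_, (prj_diag_ne (hx.2 k.i).1).2 h2, fun j hj => ?_⟩
  · rw [e1, map_smul]
    exact mul_ne_zero hc h1
  · rw [e1, Matrix.mulVec_smul]
    exact smul_ne_zero hc (h3 j hj)

/-- The parametrization by projectors. -/
def par (ξ : Fin 3 → ℂ) : (Fin 4 → Fin 4 → ℂ) × (Fin n → Fin 3 → Fin 3 → ℂ) :=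
  embB (k.cY ξ, k.chV ξ)

theorem coord_spec {x} (hx : x ∈ bCone A) (h1 : k.lam x.1 ≠ 0)
    (h2 : x.2 k.i k.r ≠ 0) (h3 : ∀ j, j ≠ k.i → (A j).mulVec x.1 ≠ 0) :
    k.coord x.1 (x.2 k.i) ∈ k.dom ∧ k.par (k.coord x.1 (x.2 k.i)) = embB x := by
  have hc := k.chV_coord (fun j => (hx.2 j).2) h1 h2 h3
  refine ⟨fun j => ?_, embB_eq_of_smul ?_ hc⟩
  · obtain ⟨c, hc, e⟩ := hc j
    rw [e]
    exact smul_ne_zero hc (hx.2 j).1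
  · obtain ⟨ρ, hρ⟩ := (hx.2 k.i).2
    exact ⟨_, inv_ne_zero h1, k.cY_coord hρ h1 h2⟩

theorem coord_self (ξ : Fin 3 → ℂ) : k.coord (k.cY ξ) (k.chV ξ k.i) = ξ := by
  rw [chV_self]
  funext s
  refine Fin.cases ?_ (fun b => ?_) s
  · simp [coord, mulVec_cY, lam_cY, cV_self]
  · simp [coord, cV_self, cV_succAbove]

theorem isOpen_dom : IsOpen k.dom := by
  have : k.dom = ⋂ j, {ξ | k.chV ξ j ≠ 0} := by
    ext ξ
    rw [Set.mem_iInter]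
    exact Iff.rfl
  rw [this]
  refine isOpen_iInter_of_finite fun j => isOpen_ne_fun (continuous_pi fun s => ?_) continuous_const
  exact (k.isPoly_chV j s).differentiable.continuous

theorem contDiffAt_par {ξ : Fin 3 → ℂ} (hξ : ξ ∈ k.dom) {m : WithTop ℕ∞} :
    ContDiffAt ℝ m k.par ξ := by
  refine ContDiffAt.prodMk ?_ (contDiffAt_pi.2 fun j => ?_)
  · exact ContDiffAt.comp (f := k.cY) ξ (contDiffAt_prj (k.cY_ne_zero ξ))
      (contDiff_pi.2 fun a => (k.isPoly_cY a).contDiff_real).contDiffAt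
  · exact ContDiffAt.comp (f := fun ξ => k.chV ξ j) ξ (contDiffAt_prj (hξ j))
      (contDiff_pi.2 fun a => (k.isPoly_chV j a).contDiff_real).contDiffAt

theorem par_mem_KX_iff {c : (Fin n → Fin 3) × (Fin n → Fin 3) → ℂ} {ξ : Fin 3 → ℂ}
    (hξ : ξ ∈ k.dom) : k.par ξ ∈ KX A c ↔ biquadForm c (k.chV ξ) = 0 := by
  constructor
  · rintro ⟨x, ⟨hx, h0⟩, e⟩
    have hm := k.mem_bCone hξ
    exact (biquadForm_eq_zero_iff c (embB_inj hx.1 hm.1 (fun j => (hx.2 j).1) (fun j => (hm.2 j).1)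
      e).2).2 h0
  · exact fun h => ⟨_, ⟨k.mem_bCone hξ, h⟩, rfl⟩

theorem isPoly_mono_mul_mono (a : (Fin n → Fin 3) × (Fin n → Fin 3)) :
    IsPoly fun ξ => mono a.1 (k.chV ξ) * mono a.2 (k.chV ξ) :=
  (isPoly_mono k.isPoly_chV a.1).mul (isPoly_mono k.isPoly_chV a.2)

theorem isPoly_biquadForm (c : (Fin n → Fin 3) × (Fin n → Fin 3) → ℂ) :
    IsPoly fun ξ => biquadForm c (k.chV ξ) := by
  have h := IsPoly.lin k.isPoly_mono_mul_mono c
  rwa [← biquadForm_eq_lin] at h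

theorem contDiff_biquadForm {m : WithTop ℕ∞} : ContDiff ℝ m
    fun p : ((Fin n → Fin 3) × (Fin n → Fin 3) → ℂ) × (Fin 3 → ℂ) =>
      biquadForm p.1 (k.chV p.2) := by
  have h := contDiff_lin (m := m) fun a => (k.isPoly_mono_mul_mono a).contDiff_real
  refine (congrArg (ContDiff ℝ m) (funext fun p => ?_)).mpr h
  exact congrFun (biquadForm_eq_lin p.1 k.chV) p.2

end BChart

/-- `ch` is an atlas of the blow-up. -/
def IsAtlas {n : ℕ} {A : Fin n → Matrix (Fin 3) (Fin 4) ℂ} {ι : Type} (ch : ι → BChart A) : Prop :=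
  ∀ x ∈ bCone A, ∃ k, (ch k).lam x.1 ≠ 0 ∧ x.2 (ch k).i (ch k).r ≠ 0 ∧
    ∀ j, j ≠ (ch k).i → (A j).mulVec x.1 ≠ 0

theorem locMid_KX {n : ℕ} {A : Fin n → Matrix (Fin 3) (Fin 4) ℂ} {ι : Type} {ch : ι → BChart A}
    (hch : IsAtlas ch) {c : (Fin n → Fin 3) × (Fin n → Fin 3) → ℂ} (hc : SmoothX ch c) {e}
    (he : e ∈ KX A c) : LocMid (KX A) c e := by
  obtain ⟨x, ⟨hx, h0⟩, rfl⟩ := id he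
  obtain ⟨k, h1, h2, h3⟩ := hch x hx
  obtain ⟨b, hb⟩ := Function.ne_iff.1 hx.1
  have hd := (ch k).mem_locDom hx hb h1 h2 h3
  obtain ⟨-, -, -, h4⟩ := (ch k).loc_spec b hx hd
  obtain ⟨h5, h6⟩ := (ch k).coord_spec hx h1 h2 h3
  rw [← h4] at h5 h6
  have hF := (ch k).contDiff_biquadForm (m := 2)
  refine LocMid.of_chart (κ := (ch k).par) (l := (ch k).loc b) (ξ₀ := (ch k).loc b (embB x))
    (f := fun p => biquadForm p.1 ((ch k).chV p.2)) ((ch k).contDiffAt_par h5)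
    ((ch k).contDiffAt_loc b hd) h6 rfl ?_ hF.contDiffAt ?_ ?_ he
  · have : ∀ᶠ p : ((Fin n → Fin 3) × (Fin n → Fin 3) → ℂ) × _ in 𝓝 (c, embB x),
        p.2 ∈ (ch k).locDom b :=
      continuous_snd.continuousAt.eventually_mem (((ch k).isOpen_locDom b).mem_nhds hd)
    filter_upwards [this]
    rintro ⟨t, e⟩ ht ⟨x', ⟨hx', -⟩, rfl⟩
    obtain ⟨a1, a2, a3, a4⟩ := (ch k).loc_spec b hx' ht
    exact (congrArg _ a4).trans ((ch k).coord_spec hx' a1 a2 a3).2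
  · have h7 : biquadForm c ((ch k).chV ((ch k).loc b (embB x))) = 0 :=
      ((ch k).par_mem_KX_iff h5).1 (by rw [h6]; exact he)
    obtain ⟨η, hη⟩ := hc k _ h5 h7
    have hsl := fderiv_slice (t := c) (ξ := (ch k).loc b (embB x)) (hF.differentiable (by simp) _)
      (((ch k).isPoly_biquadForm c).differentiable _)
    intro z
    refine ⟨(z / fderiv ℂ (fun ξ => biquadForm c ((ch k).chV ξ)) ((ch k).loc b (embB x)) η) • η, ?_⟩
    beta_reduce
    rw [hsl]
    simp only [map_smul, smul_eq_mul]
    exact div_mul_cancel₀ z hη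
  · have : ∀ᶠ p : ((Fin n → Fin 3) × (Fin n → Fin 3) → ℂ) × _ in 𝓝 (c, (ch k).loc b (embB x)),
        p.2 ∈ (ch k).dom :=
      continuous_snd.continuousAt.eventually_mem ((ch k).isOpen_dom.mem_nhds h5)
    filter_upwards [this] with p hp
    exact (ch k).par_mem_KX_iff hp

theorem isCompact_range_embB {n : ℕ} : IsCompact (Set.range fun s : SphB n => embB s.val) :=
  isCompact_range continuous_embB_val

theorem KX_subset {n : ℕ} (A : Fin n → Matrix (Fin 3) (Fin 4) ℂ)
    (c : (Fin n → Fin 3) × (Fin n → Fin 3) → ℂ) :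
    KX A c ⊆ Set.range fun s : SphB n => embB s.val := fun _ he => by
  obtain ⟨s, -, rfl⟩ := mem_KX_iff.1 he
  exact ⟨s, rfl⟩

theorem eventually_homotopyEquiv_KX {n : ℕ} {A : Fin n → Matrix (Fin 3) (Fin 4) ℂ} {ι : Type}
    {ch : ι → BChart A} (hch : IsAtlas ch) {c : (Fin n → Fin 3) × (Fin n → Fin 3) → ℂ}
    (hc : SmoothX ch c) : ∀ᶠ t in 𝓝 c, Nonempty (KX A t ≃ₕ KX A c) :=
  eventually_homotopyEquiv_of_locMid isCompact_range_embB (KX_subset A) (isClosed_total_KX A)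
    fun _ he => locMid_KX hch hc he

/-- The entries of the `2 × 2` matrix of forms of degree `n` given by a tensor. -/
def entry {n : ℕ} (τ : Fin 2 × Fin 2 × (Fin n → Fin 4) → ℂ) (k l : Fin 2) : (Fin 4 → ℂ) → ℂ :=
  lin (fun a y => mono a fun _ => y) fun a => τ (k, l, a)

section Entry
variable {n : ℕ} (τ : Fin 2 × Fin 2 × (Fin n → Fin 4) → ℂ) (k l : Fin 2)

theorem isPoly_mono_diag (a : Fin n → Fin 4) : IsPoly fun y : Fin 4 → ℂ => mono a fun _ => y :=
  isPoly_mono (V := fun y _ => y) (fun _ r => IsPoly.coord r) a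

theorem isPoly_entry : IsPoly (entry τ k l) := IsPoly.lin isPoly_mono_diag _

theorem entry_smul (c : ℂ) (y : Fin 4 → ℂ) : entry τ k l (c • y) = c ^ n * entry τ k l y := by
  have := lin_mono_smul (fun a => τ (k, l, a)) (fun _ : Fin n => y) fun _ => c
  rwa [Finset.prod_const, Finset.card_univ, Fintype.card_fin] at this

theorem fderiv_entry_self (y : Fin 4 → ℂ) : fderiv ℂ (entry τ k l) y y = n * entry τ k l y := by
  have h1 : HasDerivAt (fun s : ℂ => entry τ k l (s • y)) (fderiv ℂ (entry τ k l) y y) 1 := by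
    have h2 : HasDerivAt (fun s : ℂ => s • y) y 1 := by
      simpa using (hasDerivAt_id (1 : ℂ)).smul_const y
    have h3 : HasFDerivAt (entry τ k l) (fderiv ℂ (entry τ k l) y) ((1 : ℂ) • y) := by
      rw [one_smul]
      exact ((isPoly_entry τ k l).differentiable y).hasFDerivAt
    exact h3.comp_hasDerivAt 1 h2
  have h4 : HasDerivAt (fun s : ℂ => entry τ k l (s • y)) (n * entry τ k l y) 1 := by
    simp only [entry_smul]
    exact ((hasDerivAt_pow n (1 : ℂ)).mul_const _).congr_deriv (by simp)
  exact h1.unique h4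

end Entry

/-- The incidence variety of kernel vectors of a matrix of forms. -/
def KZ {n : ℕ} (τ : Fin 2 × Fin 2 × (Fin n → Fin 4) → ℂ) :
    Set ((Fin 4 → Fin 4 → ℂ) × (Fin 2 → Fin 2 → ℂ)) :=
  (fun x : (Fin 4 → ℂ) × (Fin 2 → ℂ) => (prj x.1, prj x.2)) ''
    {x | x.1 ≠ 0 ∧ x.2 ≠ 0 ∧ ∀ k, ∑ l, entry τ k l x.1 * x.2 l = 0}

/-- Smoothness of the incidence variety. -/
def SmoothZ {n : ℕ} (τ : Fin 2 × Fin 2 × (Fin n → Fin 4) → ℂ) : Prop :=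
  ∀ (y : Fin 4 → ℂ) (b : Fin 4), y b = 1 → ∀ μ η : Fin 2 → ℂ, μ ≠ 0 → η ≠ 0 →
    (∀ k, ∑ l, entry τ k l y * μ l = 0) → (∀ l, ∑ k, η k * entry τ k l y = 0) →
    ∃ z, ∑ k, ∑ l, η k * fderiv ℂ (entry τ k l) y z * μ l ≠ 0

/-- The affine charts of projective space. -/
def cone (b : Fin 4) (ξ : Fin 3 → ℂ) : Fin 4 → ℂ := Fin.insertNth (α := fun _ => ℂ) b 1 ξ

/-- The linear part of an affine chart. -/
def coneL (b : Fin 4) : (Fin 3 → ℂ) →L[ℂ] (Fin 4 → ℂ) :=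
  LinearMap.toContinuousLinearMap
    { toFun := fun ξ => Fin.insertNth (α := fun _ => ℂ) b 0 ξ
      map_add' := fun x y => by
        funext s
        refine Fin.succAboveCases b ?_ (fun s => ?_) s <;> simp
      map_smul' := fun c x => by
        funext s
        refine Fin.succAboveCases b ?_ (fun s => ?_) s <;> simp }

theorem cone_self (b : Fin 4) (ξ : Fin 3 → ℂ) : cone b ξ b = 1 := by simp [cone]

theorem cone_succAbove (b : Fin 4) (ξ : Fin 3 → ℂ) (s : Fin 3) : cone b ξ (b.succAbove s) = ξ s := by
  simp [cone]

theorem cone_ne_zero (b : Fin 4) (ξ : Fin 3 → ℂ) : cone b ξ ≠ 0 := fun h => by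
  simpa [cone_self] using congrFun h b

theorem coneL_apply (b : Fin 4) (ξ : Fin 3 → ℂ) :
    coneL b ξ = Fin.insertNth (α := fun _ => ℂ) b 0 ξ := rfl

theorem cone_eq (b : Fin 4) (ξ : Fin 3 → ℂ) : cone b ξ = cone b 0 + coneL b ξ := by
  funext s
  refine Fin.succAboveCases b ?_ (fun s => ?_) s <;> simp [cone, coneL_apply]

theorem hasFDerivAt_cone (b : Fin 4) (ξ : Fin 3 → ℂ) : HasFDerivAt (cone b) (coneL b) ξ := by
  have h : HasFDerivAt (fun ξ => cone b 0 + coneL b ξ) (coneL b) ξ :=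
    (coneL b).hasFDerivAt.const_add _
  exact h.congr_of_eventuallyEq (Eventually.of_forall (cone_eq b))

theorem isPoly_cone (b s : Fin 4) : IsPoly fun ξ => cone b ξ s := by
  refine Fin.succAboveCases b ?_ (fun s => ?_) s
  · simp only [cone_self]
    exact IsPoly.const 1
  · simp only [cone_succAbove]
    exact IsPoly.coord s

theorem eq_cone {y : Fin 4 → ℂ} {b : Fin 4} (hy : y b = 1) :
    y = cone b fun s => y (b.succAbove s) := by
  funext s
  refine Fin.succAboveCases b ?_ (fun s => ?_) s
  · rw [cone_self, hy]
  · rw [cone_succAbove]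

theorem smul_eq_cone {y : Fin 4 → ℂ} {b : Fin 4} (hy : y b ≠ 0) :
    cone b (fun s => y (b.succAbove s) / y b) = (y b)⁻¹ • y := by
  funext s
  refine Fin.succAboveCases b ?_ (fun s => ?_) s
  · simp [cone_self, hy]
  · simp [cone_succAbove, div_eq_inv_mul]

theorem exists_coneL {y z : Fin 4 → ℂ} {b : Fin 4} (hy : y b = 1) :
    ∃ v, z = z b • y + coneL b v := by
  refine ⟨fun s => z (b.succAbove s) - z b * y (b.succAbove s), funext fun s => ?_⟩
  refine Fin.succAboveCases b ?_ (fun s => ?_) s <;> simp [coneL_apply, hy]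

theorem exists_poly_smoothZ {n : ℕ} (hn : 0 < n) :
    ∃ q : MvPolynomial (Fin 2 × Fin 2 × (Fin n → Fin 4)) ℂ, q ≠ 0 ∧
      ∀ τ, MvPolynomial.eval τ q ≠ 0 → SmoothZ τ := by
  have hp : ∀ (b : Fin 4) (a : Fin n → Fin 4), IsPoly fun ξ => mono a fun _ => cone b ξ :=
    fun b a => isPoly_mono (V := fun ξ _ => cone b ξ) (fun _ r => isPoly_cone b r) a
  choose q hq h using fun b => exists_poly_corank_smooth (hp b)
  refine ⟨∏ b, q b, Finset.prod_ne_zero_iff.2 fun b _ => hq b, fun τ hτ y b hb μ η hμ hη h1 h2 => ?_⟩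
  rw [map_prod] at hτ
  set ξ := fun s => y (b.succAbove s) with hξ
  have hyc : y = cone b ξ := eq_cone hb
  have hj : SepJets (fun (a : Fin n → Fin 4) ξ => mono a fun _ => cone b ξ) ξ := by
    refine sepJets_mono (V := fun ξ _ => cone b ξ) (fun _ r => (isPoly_cone b r).differentiable)
      (fun _ => cone_ne_zero b ξ) fun v hv => ?_
    obtain ⟨ρ, hρ⟩ := hv ⟨0, hn⟩
    have hd : ∀ r, fderiv ℂ (fun ξ => cone b ξ r) ξ v = coneL b v r := fun r => by
      rw [((hasFDerivAt_pi'.1 (hasFDerivAt_cone b ξ)) r).fderiv]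
      rfl
    simp only [hd] at hρ
    have h0 := hρ b
    rw [cone_self, mul_one, coneL_apply, Fin.insertNth_apply_same] at h0
    funext s
    have := hρ (b.succAbove s)
    rw [← h0, zero_mul, coneL_apply, Fin.insertNth_apply_succAbove] at this
    exact this
  have he : ∀ k l, lin (fun (a : Fin n → Fin 4) ξ => mono a fun _ => cone b ξ)
      (fun a => τ (k, l, a)) = fun ξ => entry τ k l (cone b ξ) := fun k l => rfl
  obtain ⟨v, hv⟩ := h b τ (Finset.prod_ne_zero_iff.1 hτ b (Finset.mem_univ b)) ξ hj μ η hμ hη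
    (by simpa only [he, ← hyc] using h1) (by simpa only [he, ← hyc] using h2)
  refine ⟨coneL b v, ?_⟩
  have hc : ∀ k l, fderiv ℂ (fun ξ => entry τ k l (cone b ξ)) ξ v =
      fderiv ℂ (entry τ k l) y (coneL b v) := fun k l => by
    have h3 : HasFDerivAt (entry τ k l) (fderiv ℂ (entry τ k l) y) (cone b ξ) := by
      rw [hyc]
      exact ((isPoly_entry τ k l).differentiable _).hasFDerivAt
    exact DFunLike.congr_fun (h3.comp ξ (hasFDerivAt_cone b ξ)).fderiv v
  simpa only [he, hc] using hv

theorem pline_ne_zero (e : Fin 2) (m : ℂ) : pline e m ≠ 0 := fun h => by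
  simpa [pline_self] using congrFun h e

theorem smul_eq_pline {μ : Fin 2 → ℂ} {e : Fin 2} (h : μ e ≠ 0) :
    pline e (μ (1 - e) / μ e) = (μ e)⁻¹ • μ := by
  funext l
  revert l
  refine forall_fin_two_flip e ?_ ?_
  · simp [pline_self, h]
  · rw [pline_flip, Pi.smul_apply, smul_eq_mul, div_eq_inv_mul]

section
variable {n : ℕ} (b : Fin 4) (e : Fin 2)

/-- The embedded incidence variety in an affine chart. -/
def parZ (x : (Fin 3 → ℂ) × ℂ) : (Fin 4 → Fin 4 → ℂ) × (Fin 2 → Fin 2 → ℂ) :=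
  (prj (cone b x.1), prj (pline e x.2))

/-- The coordinates of an affine chart. -/
def locZ (p : (Fin 4 → Fin 4 → ℂ) × (Fin 2 → Fin 2 → ℂ)) : (Fin 3 → ℂ) × ℂ :=
  (fun s => p.1 (b.succAbove s) b / p.1 b b, p.2 (1 - e) e / p.2 e e)

/-- The equations of the incidence variety in an affine chart. -/
def eqZ (p : (Fin 2 × Fin 2 × (Fin n → Fin 4) → ℂ) × ((Fin 3 → ℂ) × ℂ)) : Fin 2 → ℂ :=
  fun k => ∑ l, entry p.1 k l (cone b p.2.1) * pline e p.2.2 l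

theorem contDiff_pline {m : WithTop ℕ∞} (l : Fin 2) : ContDiff ℝ m fun x : ℂ => pline e x l := by
  by_cases h : l = e
  · simp only [pline, h, if_true]
    exact contDiff_const
  · simp only [pline, h, if_false]
    exact contDiff_id

theorem contDiff_cone {m : WithTop ℕ∞} : ContDiff ℝ m (cone b) :=
  contDiff_pi.2 fun s => (isPoly_cone b s).contDiff_real

theorem contDiff_entry_cone {m : WithTop ℕ∞} (k l : Fin 2) :
    ContDiff ℝ m fun p : (Fin 2 × Fin 2 × (Fin n → Fin 4) → ℂ) × (Fin 3 → ℂ) =>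
      entry p.1 k l (cone b p.2) := by
  have h1 := contDiff_lin (m := m) fun a : Fin n → Fin 4 => (isPoly_mono_diag a).contDiff_real
  have h2 : ContDiff ℝ m fun p : (Fin 2 × Fin 2 × (Fin n → Fin 4) → ℂ) × (Fin 3 → ℂ) =>
      fun a => p.1 (k, l, a) :=
    contDiff_pi.2 fun a => (contDiff_apply ℝ ℂ (k, l, a)).comp contDiff_fst
  have h3 : ContDiff ℝ m fun p : (Fin 2 × Fin 2 × (Fin n → Fin 4) → ℂ) × (Fin 3 → ℂ) =>
      cone b p.2 := (contDiff_cone b).comp contDiff_snd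
  exact h1.comp (h2.prodMk h3)

theorem contDiff_eqZ {m : WithTop ℕ∞} : ContDiff ℝ m (eqZ (n := n) b e) := by
  refine contDiff_pi.2 fun k => ContDiff.sum fun l _ => ?_
  have h1 : ContDiff ℝ m fun p : (Fin 2 × Fin 2 × (Fin n → Fin 4) → ℂ) × ((Fin 3 → ℂ) × ℂ) =>
      entry p.1 k l (cone b p.2.1) :=
    (contDiff_entry_cone b k l).comp (contDiff_fst.prodMk (contDiff_fst.comp contDiff_snd))
  have h2 : ContDiff ℝ m fun p : (Fin 2 × Fin 2 × (Fin n → Fin 4) → ℂ) × ((Fin 3 → ℂ) × ℂ) =>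
      pline e p.2.2 l := (contDiff_pline e l).comp (contDiff_snd.comp contDiff_snd)
  exact h1.mul h2

theorem hasFDerivAt_pline (m : ℂ) (l : Fin 2) : HasFDerivAt (fun x : ℂ => pline e x l)
    (if l = e then 0 else ContinuousLinearMap.id ℂ ℂ : ℂ →L[ℂ] ℂ) m := by
  by_cases h : l = e
  · simp only [pline, h, if_true]
    exact hasFDerivAt_const _ _
  · simp only [pline, h, if_false]
    exact hasFDerivAt_id _

theorem hasFDerivAt_eqZ (τ : Fin 2 × Fin 2 × (Fin n → Fin 4) → ℂ) (x : (Fin 3 → ℂ) × ℂ) :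
    ∃ L : ((Fin 3 → ℂ) × ℂ) →L[ℂ] (Fin 2 → ℂ), HasFDerivAt (fun x => eqZ b e (τ, x)) L x ∧
      ∀ v k, L v k = ∑ l, (entry τ k l (cone b x.1) * (if l = e then 0 else v.2) +
        fderiv ℂ (entry τ k l) (cone b x.1) (coneL b v.1) * pline e x.2 l) := by
  have h1 : ∀ k l, HasFDerivAt (fun x : (Fin 3 → ℂ) × ℂ => entry τ k l (cone b x.1))
      ((fderiv ℂ (entry τ k l) (cone b x.1)).comp ((coneL b).comp
        (ContinuousLinearMap.fst ℂ (Fin 3 → ℂ) ℂ))) x := fun k l => by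
    have h3 := ((isPoly_entry τ k l).differentiable (cone b x.1)).hasFDerivAt
    have h4 : HasFDerivAt (fun x : (Fin 3 → ℂ) × ℂ => cone b x.1) _ x :=
      (hasFDerivAt_cone b x.1).comp x hasFDerivAt_fst
    exact h3.comp x h4
  have h2 : ∀ l, HasFDerivAt (fun x : (Fin 3 → ℂ) × ℂ => pline e x.2 l) _ x := fun l =>
    (hasFDerivAt_pline e x.2 l).comp x hasFDerivAt_snd
  have h5 : ∀ k, HasFDerivAt (fun x => eqZ b e (τ, x) k) _ x := fun k =>
    HasFDerivAt.fun_sum fun l _ => (h1 k l).mul (h2 l)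
  refine ⟨_, hasFDerivAt_pi.2 h5, fun v k => ?_⟩
  simp only [ContinuousLinearMap.coe_pi', _root_.sum_apply]
  refine Finset.sum_congr rfl fun l _ => ?_
  by_cases hl : l = e <;> simp [hl, mul_comm]

theorem SmoothZ.surjective {τ : Fin 2 × Fin 2 × (Fin n → Fin 4) → ℂ} (hτ : SmoothZ τ)
    {x : (Fin 3 → ℂ) × ℂ} (h0 : eqZ b e (τ, x) = 0) :
    Function.Surjective (fderiv ℂ (fun x => eqZ b e (τ, x)) x) := by
  obtain ⟨L, hL, hLv⟩ := hasFDerivAt_eqZ b e τ x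
  rw [hL.fderiv]
  by_contra hs
  have hr : LinearMap.range (L : ((Fin 3 → ℂ) × ℂ) →ₗ[ℂ] (Fin 2 → ℂ)) < ⊤ :=
    lt_top_iff_ne_top.2 fun h => hs (LinearMap.range_eq_top.1 h)
  obtain ⟨f, hf, hle⟩ := Submodule.exists_le_ker_of_lt_top _ hr
  set η : Fin 2 → ℂ := fun k => f (Pi.single k 1) with hη
  have hfη : ∀ w, f w = ∑ k, η k * w k := fun w => by
    conv_lhs => rw [pi_eq_sum_univ' w]
    rw [map_sum]
    exact Finset.sum_congr rfl fun k _ => by rw [map_smul, smul_eq_mul, mul_comm]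
  have hη0 : η ≠ 0 := fun h => hf (LinearMap.ext fun w => by simp [hfη, h])
  have hker : ∀ v, ∑ k, η k * L v k = 0 := fun v => by
    rw [← hfη]
    exact hle ⟨v, rfl⟩
  have hk : ∀ k, ∑ l, entry τ k l (cone b x.1) * pline e x.2 l = 0 := fun k => congrFun h0 k
  have hA : ∑ k, η k * entry τ k (1 - e) (cone b x.1) = 0 := by
    have := hker (0, 1)
    simp only [hLv, sum_fin_two_flip e fun l => _ + _] at this
    have he : 1 - e ≠ e := by fin_cases e <;> simp
    simpa [he] using this
  have hB : ∑ k, η k * entry τ k e (cone b x.1) = 0 := by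
    have h1 : ∀ k, entry τ k e (cone b x.1) = - (entry τ k (1 - e) (cone b x.1) * x.2) := fun k => by
      have := hk k
      rw [sum_fin_two_flip e, pline_self, pline_flip] at this
      linear_combination this
    simp only [h1]
    rw [Fin.sum_univ_two] at hA ⊢
    linear_combination (- x.2) * hA
  obtain ⟨z, hz⟩ := hτ (cone b x.1) b (cone_self b _) (pline e x.2) η (pline_ne_zero e _) hη0 hk
    (forall_fin_two_flip e hB hA)
  obtain ⟨v, hv⟩ := exists_coneL (z := z) (cone_self b x.1)
  apply hz
  have h3 := hker (v, 0)
  simp only [hLv, mul_zero, ite_self, zero_add] at h3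
  rw [hv]
  simp only [map_add, map_smul, fderiv_entry_self, smul_eq_mul]
  have hk0 := hk 0
  have hk1 := hk 1
  simp only [Fin.sum_univ_two] at h3 hk0 hk1 ⊢
  linear_combination h3 + η 0 * z b * n * hk0 + η 1 * z b * n * hk1

theorem contDiffAt_parZ (x : (Fin 3 → ℂ) × ℂ) {m : WithTop ℕ∞} : ContDiffAt ℝ m (parZ b e) x := by
  refine ContDiffAt.prodMk ?_ ?_
  · exact ContDiffAt.comp (f := fun x : (Fin 3 → ℂ) × ℂ => cone b x.1) x
      (contDiffAt_prj (cone_ne_zero b _)) ((contDiff_cone b).comp contDiff_fst).contDiffAt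
  · have h : ContDiff ℝ m fun x : (Fin 3 → ℂ) × ℂ => pline e x.2 := contDiff_pi.2 fun l =>
      (contDiff_pline e l).comp contDiff_snd
    exact ContDiffAt.comp (f := fun x : (Fin 3 → ℂ) × ℂ => pline e x.2) x
      (contDiffAt_prj (pline_ne_zero e _)) h.contDiffAt

theorem contDiffAt_locZ {p : (Fin 4 → Fin 4 → ℂ) × (Fin 2 → Fin 2 → ℂ)} (h1 : p.1 b b ≠ 0)
    (h2 : p.2 e e ≠ 0) {m : WithTop ℕ∞} : ContDiffAt ℝ m (locZ b e) p := by
  have hc : ∀ a b, ContDiff ℝ m fun p : (Fin 4 → Fin 4 → ℂ) × (Fin 2 → Fin 2 → ℂ) => p.1 a b :=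
    fun a b => (contDiff_apply_apply ℝ ℂ a b).comp contDiff_fst
  have hc' : ∀ a b, ContDiff ℝ m fun p : (Fin 4 → Fin 4 → ℂ) × (Fin 2 → Fin 2 → ℂ) => p.2 a b :=
    fun a b => (contDiff_apply_apply ℝ ℂ a b).comp contDiff_snd
  unfold locZ
  simp only [div_eq_mul_inv]
  exact ContDiffAt.prodMk (contDiffAt_pi.2 fun s => (hc _ _).contDiffAt.mul
    ((hc _ _).contDiffAt.inv h1)) ((hc' _ _).contDiffAt.mul ((hc' _ _).contDiffAt.inv h2))

theorem parZ_locZ {y : Fin 4 → ℂ} {μ : Fin 2 → ℂ} (hy : y b ≠ 0) (hμ : μ e ≠ 0) :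
    parZ b e (locZ b e (prj y, prj μ)) = (prj y, prj μ) := by
  simp only [parZ, locZ, prj_div hy, prj_div hμ, smul_eq_cone hy, smul_eq_pline hμ,
    prj_smul (inv_ne_zero hy), prj_smul (inv_ne_zero hμ)]

theorem kernel_smul (τ : Fin 2 × Fin 2 × (Fin n → Fin 4) → ℂ) {y : Fin 4 → ℂ} {μ : Fin 2 → ℂ}
    {c d : ℂ} (hc : c ≠ 0) (hd : d ≠ 0) :
    (∀ k, ∑ l, entry τ k l (c • y) * (d • μ) l = 0) ↔ ∀ k, ∑ l, entry τ k l y * μ l = 0 := by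
  refine forall_congr' fun k => ?_
  have : ∑ l, entry τ k l (c • y) * (d • μ) l = c ^ n * d * ∑ l, entry τ k l y * μ l := by
    rw [Finset.mul_sum]
    refine Finset.sum_congr rfl fun l _ => ?_
    rw [entry_smul, Pi.smul_apply, smul_eq_mul]
    ring
  rw [this, mul_eq_zero, or_iff_right (mul_ne_zero (pow_ne_zero _ hc) hd)]

theorem mem_KZ {τ : Fin 2 × Fin 2 × (Fin n → Fin 4) → ℂ} {y : Fin 4 → ℂ} {μ : Fin 2 → ℂ}
    (hy : y ≠ 0) (hμ : μ ≠ 0) :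
    (prj y, prj μ) ∈ KZ τ ↔ ∀ k, ∑ l, entry τ k l y * μ l = 0 := by
  constructor
  · rintro ⟨⟨y', μ'⟩, ⟨hy', hμ', h⟩, e⟩
    obtain ⟨c, hc, rfl⟩ := prj_inj hy' hy (congrArg Prod.fst e)
    obtain ⟨d, hd, rfl⟩ := prj_inj hμ' hμ (congrArg Prod.snd e)
    exact (kernel_smul τ hc hd).2 h
  · exact fun h => ⟨(y, μ), ⟨hy, hμ, h⟩, rfl⟩

end

theorem locMid_KZ {n : ℕ} {τ : Fin 2 × Fin 2 × (Fin n → Fin 4) → ℂ} (hτ : SmoothZ τ) {p}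
    (hp : p ∈ KZ τ) : LocMid KZ τ p := by
  obtain ⟨⟨y, μ⟩, ⟨hy, hμ, h⟩, rfl⟩ := id hp
  obtain ⟨b, hb⟩ := Function.ne_iff.1 hy
  obtain ⟨e, he⟩ := Function.ne_iff.1 hμ
  dsimp only at *
  have hpar := parZ_locZ b e hb he
  have h0 : ∀ (t : Fin 2 × Fin 2 × (Fin n → Fin 4) → ℂ) x, parZ b e x ∈ KZ t ↔ eqZ b e (t, x) = 0 :=
    fun t x => (mem_KZ (cone_ne_zero b _) (pline_ne_zero e _)).trans funext_iff.symm
  have hd1 : (prj y) b b ≠ 0 := (prj_diag_ne hy).2 hb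
  have hd2 : (prj μ) e e ≠ 0 := (prj_diag_ne hμ).2 he
  refine LocMid.of_chart (κ := parZ b e) (l := locZ b e) (ξ₀ := locZ b e (prj y, prj μ))
    (f := eqZ b e) (contDiffAt_parZ b e _)
    (contDiffAt_locZ b e hd1 hd2) hpar rfl ?_ (contDiff_eqZ b e).contDiffAt ?_
    (Eventually.of_forall fun q => h0 q.1 q.2) hp
  · have h1 : ContinuousAt (fun q : (Fin 2 × Fin 2 × (Fin n → Fin 4) → ℂ) ×
        ((Fin 4 → Fin 4 → ℂ) × (Fin 2 → Fin 2 → ℂ)) => q.2.1 b b) (τ, (prj y, prj μ)) := by fun_prop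
    have h2 : ContinuousAt (fun q : (Fin 2 × Fin 2 × (Fin n → Fin 4) → ℂ) ×
        ((Fin 4 → Fin 4 → ℂ) × (Fin 2 → Fin 2 → ℂ)) => q.2.2 e e) (τ, (prj y, prj μ)) := by fun_prop
    filter_upwards [h1.eventually_ne hd1, h2.eventually_ne hd2]
    rintro ⟨t, -⟩ ht1 ht2 ⟨⟨y', μ'⟩, ⟨hy', hμ', -⟩, rfl⟩
    exact parZ_locZ b e ((prj_diag_ne hy').1 ht1) ((prj_diag_ne hμ').1 ht2)
  · have hz : eqZ b e (τ, locZ b e (prj y, prj μ)) = 0 := (h0 _ _).1 (by rw [hpar]; exact hp)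
    obtain ⟨L, hL, -⟩ := hasFDerivAt_eqZ b e τ (locZ b e (prj y, prj μ))
    intro w
    obtain ⟨v, hv⟩ := hτ.surjective b e hz w
    refine ⟨v, Eq.trans ?_ hv⟩
    exact fderiv_slice (((contDiff_eqZ (m := 1) b e).differentiable (by simp)) _)
      hL.differentiableAt v

/-- The product of unit spheres over the product of projective spaces. -/
abbrev SphZ : Type := ↥(Metric.sphere (0 : Fin 4 → ℂ) 1) × ↥(Metric.sphere (0 : Fin 2 → ℂ) 1)

theorem continuous_prj_sphZ : Continuous fun s : SphZ => (prj s.1.1, prj s.2.1) :=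
  (continuous_prj_comp (by fun_prop) fun s => ne_zero_of_mem_sphere s.1.2).prodMk
    (continuous_prj_comp (by fun_prop) fun s => ne_zero_of_mem_sphere s.2.2)

theorem isClosed_total_KZ {n : ℕ} : IsClosed {p : (Fin 2 × Fin 2 × (Fin n → Fin 4) → ℂ) ×
    ((Fin 4 → Fin 4 → ℂ) × (Fin 2 → Fin 2 → ℂ)) | p.2 ∈ KZ p.1} := by
  have he : ∀ k l, Continuous fun p : (Fin 2 × Fin 2 × (Fin n → Fin 4) → ℂ) × SphZ =>
      entry p.1 k l p.2.1.1 := fun k l => by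
    have h1 : Continuous fun p : (Fin 2 × Fin 2 × (Fin n → Fin 4) → ℂ) × SphZ => p.2.1.1 :=
      continuous_subtype_val.comp (continuous_fst.comp continuous_snd)
    have h2 : ∀ r, Continuous fun p : (Fin 2 × Fin 2 × (Fin n → Fin 4) → ℂ) × SphZ => p.2.1.1 r :=
      fun r => (continuous_apply r).comp h1
    exact continuous_finsetSum _ fun a _ => ((continuous_apply (k, l, a)).comp continuous_fst).mul
      (continuous_finsetProd _ fun i _ => h2 (a i))
  have hm : ∀ l, Continuous fun p : (Fin 2 × Fin 2 × (Fin n → Fin 4) → ℂ) × SphZ => p.2.2.1 l :=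
    fun l => (continuous_apply l).comp
      (continuous_subtype_val.comp (continuous_snd.comp continuous_snd))
  have hW : IsClosed (⋂ k, {p : (Fin 2 × Fin 2 × (Fin n → Fin 4) → ℂ) × SphZ |
      ∑ l, entry p.1 k l p.2.1.1 * p.2.2.1 l = 0}) :=
    isClosed_iInter fun k => isClosed_eq (continuous_finsetSum _ fun l _ =>
      (he k l).mul (hm l)) continuous_const
  convert isClosed_total continuous_prj_sphZ hW using 1
  ext ⟨τ, p⟩
  simp only [Set.mem_iInter]
  constructor
  · rintro ⟨⟨y, μ⟩, ⟨hy, hμ, h⟩, rfl⟩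
    obtain ⟨c, hc, hs⟩ := exists_smul_mem_sphere hy
    obtain ⟨d, hd, ht⟩ := exists_smul_mem_sphere hμ
    exact ⟨(⟨_, hs⟩, ⟨_, ht⟩), (kernel_smul τ hc hd).2 h,
      Prod.ext (prj_smul hc y) (prj_smul hd μ)⟩
  · rintro ⟨s, h, rfl⟩
    exact (mem_KZ (ne_zero_of_mem_sphere s.1.2) (ne_zero_of_mem_sphere s.2.2)).2 h

theorem eventually_homotopyEquiv_KZ {n : ℕ} {τ : Fin 2 × Fin 2 × (Fin n → Fin 4) → ℂ}
    (hτ : SmoothZ τ) : ∀ᶠ t in 𝓝 τ, Nonempty (KZ t ≃ₕ KZ τ) := by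
  refine eventually_homotopyEquiv_of_locMid (isCompact_range continuous_prj_sphZ) ?_ isClosed_total_KZ
    fun _ hp => locMid_KZ hτ hp
  rintro t _ ⟨⟨y, μ⟩, ⟨hy, hμ, -⟩, rfl⟩
  obtain ⟨c, hc, hs⟩ := exists_smul_mem_sphere hy
  obtain ⟨d, hd, ht⟩ := exists_smul_mem_sphere hμ
  exact ⟨(⟨_, hs⟩, ⟨_, ht⟩), Prod.ext (prj_smul hc y) (prj_smul hd μ)⟩

/-- A continuous injective image of a compact set is homeomorphic to it. -/
def homeoImage {E F : Type} [TopologicalSpace E] [TopologicalSpace F] [T2Space F] {K : Set E}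
    (hK : IsCompact K) {f : E → F} (hf : ContinuousOn f K) (hi : Set.InjOn f K) : K ≃ₜ (f '' K) :=
  haveI := isCompact_iff_compactSpace.1 hK
  Continuous.homeoOfEquivCompactToT2 (f := hi.bijOn_image.equiv f)
    (Continuous.subtype_mk (continuousOn_iff_continuous_domRestrict.1 hf) _)

theorem exists_ker_of_det {M : Fin 2 → Fin 2 → ℂ} (h : M 0 0 * M 1 1 - M 0 1 * M 1 0 = 0) :
    ∃ μ : Fin 2 → ℂ, μ ≠ 0 ∧ ∀ k, ∑ l, M k l * μ l = 0 := by
  obtain ⟨μ, hμ, h⟩ := Matrix.exists_mulVec_eq_zero_iff.2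
    (show Matrix.det (Matrix.of M) = 0 by rw [Matrix.det_fin_two]; exact h)
  exact ⟨μ, hμ, fun k => congrFun h k⟩

theorem det_of_ker {M : Fin 2 → Fin 2 → ℂ} {μ : Fin 2 → ℂ} (hμ : μ ≠ 0)
    (h : ∀ k, ∑ l, M k l * μ l = 0) : M 0 0 * M 1 1 - M 0 1 * M 1 0 = 0 := by
  have := Matrix.exists_mulVec_eq_zero_iff (M := Matrix.of M).1 ⟨μ, hμ, funext h⟩
  rwa [Matrix.det_fin_two] at this

theorem ker_unique {M : Fin 2 → Fin 2 → ℂ} (hM : ∃ k l, M k l ≠ 0) {μ ν : Fin 2 → ℂ} (hμ : μ ≠ 0)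
    (hν : ν ≠ 0) (h : ∀ k, ∑ l, M k l * μ l = 0) (h' : ∀ k, ∑ l, M k l * ν l = 0) :
    ∃ c : ℂ, c ≠ 0 ∧ ν = c • μ := by
  obtain ⟨k, l, hkl⟩ := hM
  have h1 := h k
  have h2 := h' k
  have hw : ν 0 * μ 1 = ν 1 * μ 0 := by
    rw [Fin.sum_univ_two] at h1 h2
    have h3 : M k 0 * (ν 0 * μ 1 - ν 1 * μ 0) = 0 := by linear_combination μ 1 * h2 - ν 1 * h1
    have h4 : M k 1 * (ν 0 * μ 1 - ν 1 * μ 0) = 0 := by linear_combination ν 0 * h1 - μ 0 * h2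
    revert l
    rw [Fin.forall_fin_two]
    exact ⟨fun h => sub_eq_zero.1 ((mul_eq_zero.1 h3).resolve_left h),
      fun h => sub_eq_zero.1 ((mul_eq_zero.1 h4).resolve_left h)⟩
  obtain ⟨c, hc⟩ := (exists_smul_iff_minors hμ).2 (show ∀ r s, ν r * μ s = ν s * μ r by
    refine Fin.forall_fin_two.2 ⟨Fin.forall_fin_two.2 ⟨rfl, hw⟩,
      Fin.forall_fin_two.2 ⟨hw.symm, rfl⟩⟩)
  exact ⟨c, fun h0 => hν (by rw [hc, h0, zero_smul]), hc⟩

theorem isCompact_KZ {n : ℕ} (τ : Fin 2 × Fin 2 × (Fin n → Fin 4) → ℂ) : IsCompact (KZ τ) := by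
  refine (isCompact_range continuous_prj_sphZ).of_isClosed_subset
    (isClosed_total_KZ.preimage (Continuous.prodMk_right τ)) ?_
  rintro _ ⟨⟨y, μ⟩, ⟨hy, hμ, -⟩, rfl⟩
  obtain ⟨c, hc, hs⟩ := exists_smul_mem_sphere hy
  obtain ⟨d, hd, ht⟩ := exists_smul_mem_sphere hμ
  exact ⟨(⟨_, hs⟩, ⟨_, ht⟩), Prod.ext (prj_smul hc y) (prj_smul hd μ)⟩

/-- The coefficients of a matrix whose determinant is the Fermat form. -/
def fermatCoeff : Fin 2 → Fin 2 → Fin 4 → ℂ :=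
  ![![![1, -1, 0, 0], ![0, 0, 1, -1]], ![![0, 0, -1, -1], ![1, 1, 0, 0]]]

/-- A matrix of forms whose determinant is the Fermat form. -/
def fermatTensor (n : ℕ) : Fin 2 × Fin 2 × (Fin n → Fin 4) → ℂ :=
  fun a => ∑ s, fermatCoeff a.1 a.2.1 s * if a.2.2 = fun _ => s then 1 else 0

theorem entry_fermatTensor {n : ℕ} (k l : Fin 2) (y : Fin 4 → ℂ) :
    entry (fermatTensor n) k l y = ∑ s, fermatCoeff k l s * y s ^ n := by
  simp only [entry, lin, fermatTensor, Finset.sum_mul]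
  rw [Finset.sum_comm]
  refine Finset.sum_congr rfl fun s _ => ?_
  rw [Finset.sum_eq_single (fun _ => s) (fun a _ ha => by simp [ha]) (by simp)]
  simp [mono]

theorem entries_fermatTensor {n : ℕ} (y : Fin 4 → ℂ) :
    entry (fermatTensor n) 0 0 y = y 0 ^ n - y 1 ^ n ∧
    entry (fermatTensor n) 0 1 y = y 2 ^ n - y 3 ^ n ∧
    entry (fermatTensor n) 1 0 y = - y 2 ^ n - y 3 ^ n ∧
    entry (fermatTensor n) 1 1 y = y 0 ^ n + y 1 ^ n := by
  simp only [entry_fermatTensor, fermatCoeff, Fin.sum_univ_four]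
  refine ⟨?_, ?_, ?_, ?_⟩ <;> simp <;> ring

theorem entry_fermatTensor_ne {n : ℕ} {y : Fin 4 → ℂ} (hy : y ≠ 0) :
    ∃ k l, entry (fermatTensor n) k l y ≠ 0 := by
  by_contra! h
  obtain ⟨h0, h1, h2, h3⟩ := entries_fermatTensor (n := n) y
  rw [h] at h0 h1 h2 h3
  apply hy
  funext s
  refine eq_zero_of_pow_eq_zero (n := n) ?_
  fin_cases s
  · show y 0 ^ n = 0
    linear_combination (-1 / 2 : ℂ) * (h0 + h3)
  · show y 1 ^ n = 0
    linear_combination (1 / 2 : ℂ) * (h0 - h3)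
  · show y 2 ^ n = 0
    linear_combination (1 / 2 : ℂ) * (h2 - h1)
  · show y 3 ^ n = 0
    linear_combination (1 / 2 : ℂ) * (h1 + h2)

theorem fderiv_entry_fermatTensor {n : ℕ} (k l : Fin 2) {y : Fin 4 → ℂ} {b : Fin 4} (hy : y b = 1) :
    fderiv ℂ (entry (fermatTensor n) k l) y (Pi.single b 1) = fermatCoeff k l b * n := by
  have h : HasFDerivAt (fun y : Fin 4 → ℂ => ∑ s, fermatCoeff k l s * y s ^ n) _ y :=
    HasFDerivAt.fun_sum fun s _ =>
      ((hasFDerivAt_apply (𝕜 := ℂ) (F' := fun _ => ℂ) s y).pow n).const_mul (fermatCoeff k l s)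
  rw [funext (entry_fermatTensor k l), h.fderiv, _root_.sum_apply, Finset.sum_eq_single b]
  · simp [hy]
  · intro s _ hs
    simp [hs]
  · simp

theorem smoothZ_fermatTensor {n : ℕ} (hn : n ≠ 0) : SmoothZ (fermatTensor n) := by
  intro y b hb μ η hμ hη h1 h2
  have hy : y ≠ 0 := fun h => by simp [h] at hb
  obtain ⟨c, -, h⟩ := exists_det_differential (entry_fermatTensor_ne hy) hμ hη h1 h2
  have hn' : (n : ℂ) ≠ 0 := Nat.cast_ne_zero.2 hn
  refine ⟨Pi.single b 1, fun h0 => ?_⟩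
  have h3 := h fun k l => fderiv ℂ (entry (fermatTensor n) k l) y (Pi.single b 1)
  rw [h0, mul_zero] at h3
  obtain ⟨e0, e1, e2, e3⟩ := entries_fermatTensor (n := n) y
  simp only [fderiv_entry_fermatTensor _ _ hb, e0, e1, e2, e3] at h3
  have hb' : y b ^ n = 1 := by rw [hb, one_pow]
  have h4 : (n : ℂ) * 2 = 0 := by
    fin_cases b <;> simp [fermatCoeff] at h3 hb'
    · linear_combination h3 - 2 * n * hb'
    · linear_combination - h3 - 2 * n * hb'
    · linear_combination h3 - 2 * n * hb'
    · linear_combination - h3 - 2 * n * hb'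
  simp [hn'] at h4

theorem hasEulerChar_KZ_fermatTensor {n : ℕ} (hn : n ≠ 0) :
    HasEulerChar (KZ (fermatTensor n)) ((2 * n : ℤ) ^ 3 - 4 * (2 * n) ^ 2 + 6 * (2 * n)) := by
  have h := hasEulerChar_fermatSurface (d := 2 * n) (by omega)
  push_cast at h
  have hi : Set.InjOn Prod.fst (KZ (fermatTensor n)) := by
    rintro _ ⟨⟨y, μ⟩, ⟨hy, hμ, h1⟩, rfl⟩ _ ⟨⟨z, ν⟩, ⟨hz, hν, h2⟩, rfl⟩ e
    obtain ⟨c, hc, rfl⟩ := prj_inj hy hz e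
    have h2' := (kernel_smul (d := 1) (μ := ν) (fermatTensor n) hc one_ne_zero).1 (by
      rw [one_smul]; exact h2)
    obtain ⟨d, hd, rfl⟩ := ker_unique (entry_fermatTensor_ne hy) hμ hν h1 h2'
    exact Prod.ext (prj_smul hc y).symm (prj_smul hd μ).symm
  refine (h.congr_set ?_).congr_homeo
    (homeoImage (isCompact_KZ _) continuous_fst.continuousOn hi).symm
  have hdet : ∀ y : Fin 4 → ℂ, y ∈ fermatCone (2 * n) ↔ entry (fermatTensor n) 0 0 y *
      entry (fermatTensor n) 1 1 y - entry (fermatTensor n) 0 1 y * entry (fermatTensor n) 1 0 y = 0 := by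
    intro y
    obtain ⟨e0, e1, e2, e3⟩ := entries_fermatTensor (n := n) y
    rw [e0, e1, e2, e3]
    have : ∀ x : ℂ, x ^ (2 * n) = x ^ n * x ^ n := fun x => by rw [two_mul, pow_add]
    refine Iff.trans (Iff.of_eq (congrArg (· = 0) ?_)) Iff.rfl
    simp only [this]
    ring
  ext p
  constructor
  · rintro ⟨y, ⟨hy, h0⟩, rfl⟩
    obtain ⟨μ, hμ, h1⟩ := exists_ker_of_det (M := fun k l => entry (fermatTensor n) k l y)
      ((hdet y).1 h0)
    exact ⟨_, ⟨(y, μ), ⟨hy, hμ, h1⟩, rfl⟩, rfl⟩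
  · rintro ⟨_, ⟨⟨y, μ⟩, ⟨hy, hμ, h1⟩, rfl⟩, rfl⟩
    exact ⟨y, ⟨hy, (hdet y).2 (det_of_ker (M := fun k l => entry (fermatTensor n) k l y) hμ h1)⟩, rfl⟩

theorem hasEulerChar_KZ {n : ℕ} (hn : n ≠ 0) {τ : Fin 2 × Fin 2 × (Fin n → Fin 4) → ℂ}
    (hτ : SmoothZ τ) :
    HasEulerChar (KZ τ) ((2 * n : ℤ) ^ 3 - 4 * (2 * n) ^ 2 + 6 * (2 * n)) := by
  obtain ⟨q, hq, h⟩ := exists_poly_smoothZ (Nat.pos_of_ne_zero hn)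
  exact hasEulerChar_of_family (K := KZ) (S := {τ | SmoothZ τ}) hq h
    (fun t ht => eventually_homotopyEquiv_KZ ht) (smoothZ_fermatTensor hn) hτ
    (hasEulerChar_KZ_fermatTensor hn)

section Tensor
variable {n : ℕ}

/-- The entries of the `2 × 2` matrix of multilinear forms given by a tensor. -/
def mat (t : Fin 2 × Fin 2 × (Fin n → Fin 3) → ℂ) (k l : Fin 2) (v : Fin n → Fin 3 → ℂ) : ℂ :=
  lin mono (fun j => t (k, l, j)) v

/-- The coefficients of the determinant of a matrix of multilinear forms. -/
def detCoeff (t : Fin 2 × Fin 2 × (Fin n → Fin 3) → ℂ) : (Fin n → Fin 3) × (Fin n → Fin 3) → ℂ :=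
  fun j => t (0, 0, j.1) * t (1, 1, j.2) - t (0, 1, j.1) * t (1, 0, j.2)

theorem biquadForm_detCoeff (t : Fin 2 × Fin 2 × (Fin n → Fin 3) → ℂ) (v : Fin n → Fin 3 → ℂ) :
    biquadForm (detCoeff t) v = mat t 0 0 v * mat t 1 1 v - mat t 0 1 v * mat t 1 0 v := by
  simp only [mat, lin, Finset.sum_mul_sum, ← Finset.sum_sub_distrib, biquadForm, detCoeff,
    Fintype.sum_prod_type, mono]
  exact Finset.sum_congr rfl fun _ _ => Finset.sum_congr rfl fun _ _ => by ring

/-- The pull-back of a tensor along the cameras. -/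
def pullT (A : Fin n → Matrix (Fin 3) (Fin 4) ℂ) (t : Fin 2 × Fin 2 × (Fin n → Fin 3) → ℂ) :
    Fin 2 × Fin 2 × (Fin n → Fin 4) → ℂ :=
  fun a => ∑ j, t (a.1, a.2.1, j) * ∏ i, A i (j i) (a.2.2 i)

theorem entry_pullT (A : Fin n → Matrix (Fin 3) (Fin 4) ℂ)
    (t : Fin 2 × Fin 2 × (Fin n → Fin 3) → ℂ) (k l : Fin 2) (y : Fin 4 → ℂ) :
    entry (pullT A t) k l y = mat t k l fun i => (A i).mulVec y := by
  simp only [entry, mat, lin, pullT, Finset.sum_mul]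
  rw [Finset.sum_comm]
  refine Finset.sum_congr rfl fun j _ => ?_
  have h := lin_mono_prod (fun i s => A i (j i) s) fun _ : Fin n => y
  simp only [lin] at h
  simp only [mul_assoc, ← Finset.mul_sum, h]
  rfl

theorem mat_smul (t : Fin 2 × Fin 2 × (Fin n → Fin 3) → ℂ) (k l : Fin 2) {v w : Fin n → Fin 3 → ℂ}
    {c : Fin n → ℂ} (h : ∀ i, w i = c i • v i) : mat t k l w = (∏ i, c i) * mat t k l v := by
  rw [funext h]
  exact lin_mono_smul _ _ _

/-- A tensor whose determinantal loci are nonsingular. -/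
structure GenTensor {A : Fin n → Matrix (Fin 3) (Fin 4) ℂ} {ι : Type} (ch : ι → BChart A)
    (t : Fin 2 × Fin 2 × (Fin n → Fin 3) → ℂ) : Prop where
  ne : ∀ m, ∀ ξ ∈ (ch m).dom, ∃ k l, mat t k l ((ch m).chV ξ) ≠ 0
  corank : ∀ m, ∀ ξ ∈ (ch m).dom, ∀ μ η : Fin 2 → ℂ, μ ≠ 0 → η ≠ 0 →
    (∀ k, ∑ l, mat t k l ((ch m).chV ξ) * μ l = 0) →
    (∀ l, ∑ k, η k * mat t k l ((ch m).chV ξ) = 0) →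
    ∃ z, ∑ k, ∑ l, η k * fderiv ℂ (fun ξ => mat t k l ((ch m).chV ξ)) ξ z * μ l ≠ 0
  center : ∀ i y, y ≠ 0 → (A i).mulVec y = 0 → ∀ μ η : Fin 2 → ℂ, μ ≠ 0 → η ≠ 0 →
    ∃ r, ∑ k, ∑ l, η k *
      mat t k l (Function.update (fun j => (A j).mulVec y) i (Pi.single r 1)) * μ l ≠ 0

theorem exists_poly_center {A : Fin n → Matrix (Fin 3) (Fin 4) ℂ} (hA : GenCams A) {i : Fin n}
    {P : Fin 4 → ℂ} (hP : P ≠ 0) (h0 : (A i).mulVec P = 0) :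
    ∃ q : MvPolynomial (Fin 2 × Fin 2 × (Fin n → Fin 3)) ℂ, q ≠ 0 ∧ ∀ t, MvPolynomial.eval t q ≠ 0 →
      ∀ μ η : Fin 2 → ℂ, μ ≠ 0 → η ≠ 0 → ∃ r, ∑ k, ∑ l, η k *
        mat t k l (Function.update (fun j => (A j).mulVec P) i (Pi.single r 1)) * μ l ≠ 0 := by
  classical
  refine exists_poly_pairing_ne_zero
    (w := fun r j => mono j (Function.update (fun j => (A j).mulVec P) i (Pi.single r 1)))
    fun φ hφ => ?_
  have hne : ∀ m, ∃ s, m ≠ i → (A m).mulVec P s ≠ 0 := fun m => by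
    by_cases h : m = i
    · exact ⟨0, fun h' => (h' h).elim⟩
    · obtain ⟨s, hs⟩ := Function.ne_iff.1 fun h1 => hP (hA.ker m i h P h1 h0)
      exact ⟨s, fun _ => hs⟩
  choose s hs using hne
  funext r
  have h1 := hφ (Function.update s i r)
  rw [Finset.sum_eq_single r (fun r' _ hr => by
    rw [mono, Finset.prod_eq_zero (Finset.mem_univ i) (by simp [hr.symm]), mul_zero]) (by simp)] at h1
  refine (mul_eq_zero.1 h1).resolve_right (Finset.prod_ne_zero_iff.2 fun m _ => ?_)
  by_cases h : m = i
  · subst h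
    simp
  · rw [Function.update_of_ne h, Function.update_of_ne h]
    exact hs m h

theorem exists_genTensor {A : Fin n → Matrix (Fin 3) (Fin 4) ℂ} (hA : GenCams A)
    {ι : Type} [Fintype ι] (ch : ι → BChart A) : ∃ t, GenTensor ch t := by
  classical
  have hp : ∀ m j, IsPoly fun ξ => mono j ((ch m).chV ξ) := fun m j => isPoly_mono (ch m).isPoly_chV j
  choose q₁ hq₁ h₁ using fun m => exists_poly_matrix_ne_zero (by simp) (hp m)
  choose q₂ hq₂ h₂ using fun m => exists_poly_corank_smooth (hp m)
  choose P hP hP0 hspan using hA.exists_center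
  choose q₃ hq₃ h₃ using fun i => exists_poly_center hA (hP i) (hP0 i)
  obtain ⟨t, ht⟩ := exists_eval_ne_zero (q := (∏ m, q₁ m) * (∏ m, q₂ m) * ∏ i, q₃ i)
    (mul_ne_zero (mul_ne_zero (Finset.prod_ne_zero_iff.2 fun m _ => hq₁ m)
      (Finset.prod_ne_zero_iff.2 fun m _ => hq₂ m)) (Finset.prod_ne_zero_iff.2 fun i _ => hq₃ i))
  simp only [map_mul, map_prod, mul_ne_zero_iff, Finset.prod_ne_zero_iff] at ht
  obtain ⟨⟨t1, t2⟩, t3⟩ := ht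
  refine ⟨t, fun m ξ hξ => ?_, fun m ξ hξ => ?_, fun i y hy h0 μ η hμ hη => ?_⟩
  · exact h₁ m t (t1 m (Finset.mem_univ m)) ξ ((ch m).sepJets hA hξ).exists_ne
  · exact h₂ m t (t2 m (Finset.mem_univ m)) ξ ((ch m).sepJets hA hξ)
  · obtain ⟨c, rfl⟩ := hspan i y h0
    have hc : c ≠ 0 := fun h => hy (by rw [h, zero_smul])
    obtain ⟨r, hr⟩ := h₃ i t (t3 i (Finset.mem_univ i)) μ η hμ hη
    refine ⟨r, ?_⟩
    have e : ∀ k l, mat t k l (Function.update (fun j => (A j).mulVec (c • P i)) i (Pi.single r 1)) =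
        (∏ m, if m = i then 1 else c) *
        mat t k l (Function.update (fun j => (A j).mulVec (P i)) i (Pi.single r 1)) := fun k l =>
      mat_smul t k l fun m => by
        by_cases h : m = i
        · subst h
          simp
        · rw [Function.update_of_ne h, Function.update_of_ne h, if_neg h, Matrix.mulVec_smul]
    have e' : (∏ m, if m = i then 1 else c) ≠ 0 := Finset.prod_ne_zero_iff.2 fun m _ => by
      split_ifs
      exacts [one_ne_zero, hc]
    refine fun h => hr ((mul_eq_zero.1 (Eq.trans ?_ h)).resolve_left e')
    simp only [e, Finset.mul_sum]
    exact Finset.sum_congr rfl fun k _ => Finset.sum_congr rfl fun l _ => by ring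

theorem BChart.differentiable_mat {A : Fin n → Matrix (Fin 3) (Fin 4) ℂ} (m : BChart A)
    (t : Fin 2 × Fin 2 × (Fin n → Fin 3) → ℂ) (k l : Fin 2) :
    Differentiable ℂ fun ξ => mat t k l (m.chV ξ) :=
  (IsPoly.lin (fun j => isPoly_mono m.isPoly_chV j) fun j => t (k, l, j)).differentiable

theorem GenTensor.smoothX {A : Fin n → Matrix (Fin 3) (Fin 4) ℂ} {ι : Type} {ch : ι → BChart A}
    {t : Fin 2 × Fin 2 × (Fin n → Fin 3) → ℂ} (ht : GenTensor ch t) : SmoothX ch (detCoeff t) := by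
  intro m ξ hξ h0
  rw [biquadForm_detCoeff] at h0
  obtain ⟨μ, hμ, h1⟩ := exists_ker_of_det (M := fun k l => mat t k l ((ch m).chV ξ)) h0
  obtain ⟨η, hη, h2⟩ := exists_ker_of_det (M := fun k l => mat t l k ((ch m).chV ξ))
    (by rw [← h0]; ring)
  have h2' : ∀ l, ∑ k, η k * mat t k l ((ch m).chV ξ) = 0 := fun l => by
    rw [← h2 l]
    exact Finset.sum_congr rfl fun k _ => mul_comm _ _
  obtain ⟨c, hc, h3⟩ := exists_det_differential (ht.ne m ξ hξ) hμ hη h1 h2'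
  obtain ⟨z, hz⟩ := ht.corank m ξ hξ μ η hμ hη h1 h2'
  refine ⟨z, fun h4 => hz ?_⟩
  have hd := fun k l => ((ch m).differentiable_mat t k l ξ).hasFDerivAt
  have e : (fun ξ => biquadForm (detCoeff t) ((ch m).chV ξ)) = fun ξ =>
      mat t 0 0 ((ch m).chV ξ) * mat t 1 1 ((ch m).chV ξ) -
        mat t 0 1 ((ch m).chV ξ) * mat t 1 0 ((ch m).chV ξ) := funext fun ξ => biquadForm_detCoeff _ _
  have h5 := DFunLike.congr_fun (((hd 0 0).mul (hd 1 1)).sub ((hd 0 1).mul (hd 1 0))).fderiv z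
  rw [e] at h4
  refine (mul_eq_zero.1 ((h3 fun k l => fderiv ℂ (fun ξ => mat t k l ((ch m).chV ξ)) ξ z).symm.trans
    (Eq.trans ?_ (h5.symm.trans h4)))).resolve_left hc
  simp only [_root_.sub_apply, _root_.add_apply, _root_.smul_apply, smul_eq_mul]
  ring

theorem fderiv_entry_smul (τ : Fin 2 × Fin 2 × (Fin n → Fin 4) → ℂ) (k l : Fin 2) (a : ℂ)
    (y z : Fin 4 → ℂ) :
    fderiv ℂ (entry τ k l) (a • y) (a • z) = a ^ n * fderiv ℂ (entry τ k l) y z := by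
  have h1 : HasFDerivAt (fun y : Fin 4 → ℂ => a • y) (a • ContinuousLinearMap.id ℂ (Fin 4 → ℂ)) y :=
    (hasFDerivAt_id y).const_smul a
  have h2 := (((isPoly_entry τ k l).differentiable (a • y)).hasFDerivAt).comp y h1
  have h3 := (((isPoly_entry τ k l).differentiable y).hasFDerivAt).const_mul (a ^ n)
  have e : (entry τ k l ∘ fun y : Fin 4 → ℂ => a • y) = fun y => a ^ n * entry τ k l y :=
    funext fun y => entry_smul τ k l a y
  rw [e] at h2
  exact DFunLike.congr_fun (h2.unique h3) z

theorem fderiv_entry_center {A : Fin n → Matrix (Fin 3) (Fin 4) ℂ}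
    (t : Fin 2 × Fin 2 × (Fin n → Fin 3) → ℂ) (k l : Fin 2) {i : Fin n} {y : Fin 4 → ℂ}
    (hy : (A i).mulVec y = 0) (z : Fin 4 → ℂ) : fderiv ℂ (entry (pullT A t) k l) y z =
      mat t k l (Function.update (fun j => (A j).mulVec y) i ((A i).mulVec z)) := by
  have h1 : HasDerivAt (fun s : ℂ => entry (pullT A t) k l (y + s • z))
      (fderiv ℂ (entry (pullT A t) k l) y z) 0 := by
    have h2 : HasDerivAt (fun s : ℂ => y + s • z) z 0 := by
      simpa using ((hasDerivAt_id (0 : ℂ)).smul_const z).const_add y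
    have h3 : HasFDerivAt (entry (pullT A t) k l) (fderiv ℂ (entry (pullT A t) k l) y)
        (y + (0 : ℂ) • z) := by
      rw [zero_smul, add_zero]
      exact ((isPoly_entry _ k l).differentiable y).hasFDerivAt
    exact h3.comp_hasDerivAt 0 h2
  refine h1.unique (hasDerivAt_iff_tendsto_slope_zero.2 ?_)
  let g : ℂ → ℂ := fun s => mat t k l
    (Function.update (fun j => (A j).mulVec y + s • (A j).mulVec z) i ((A i).mulVec z))
  have hg : Continuous g := by
    have h : Continuous fun v : Fin n → Fin 3 → ℂ => mat t k l v := by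
      unfold mat lin mono
      fun_prop
    refine h.comp (Continuous.update ?_ i continuous_const)
    fun_prop
  have hg0 : g 0 = mat t k l (Function.update (fun j => (A j).mulVec y) i ((A i).mulVec z)) := by
    simp [g]
  have he : ∀ s, entry (pullT A t) k l (y + s • z) = s * g s := fun s => by
    rw [entry_pullT, mat_smul t k l (c := fun m => if m = i then s else 1)
      (v := Function.update (fun j => (A j).mulVec y + s • (A j).mulVec z) i ((A i).mulVec z))]
    · simp [g]
    · intro m
      by_cases h : m = i
      · subst h
        simp [Matrix.mulVec_add, Matrix.mulVec_smul, hy]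
      · simp [h, Matrix.mulVec_add, Matrix.mulVec_smul]
  rw [← hg0]
  refine ((hg.tendsto 0).mono_left nhdsWithin_le_nhds).congr' ?_
  filter_upwards [self_mem_nhdsWithin] with s hs
  have hs' : s ≠ 0 := hs
  rw [he, he, zero_add, zero_mul, sub_zero, smul_eq_mul, inv_mul_cancel_left₀ hs']

theorem GenTensor.smoothZ {A : Fin n → Matrix (Fin 3) (Fin 4) ℂ} (hA : GenCams A) {ι : Type}
    {ch : ι → BChart A} (hch : IsAtlas ch) {t : Fin 2 × Fin 2 × (Fin n → Fin 3) → ℂ}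
    (ht : GenTensor ch t) : SmoothZ (pullT A t) := by
  intro y b hb μ η hμ hη h1 h2
  have hy : y ≠ 0 := fun h => by simp [h] at hb
  by_cases hc : ∃ i, (A i).mulVec y = 0
  · obtain ⟨i, hi⟩ := hc
    obtain ⟨r, hr⟩ := ht.center i y hy hi μ η hμ hη
    obtain ⟨z, hz⟩ := hA.surj i (Pi.single r 1)
    refine ⟨z, ?_⟩
    simpa only [fderiv_entry_center t _ _ hi, hz] using hr
  push Not at hc
  have hx : (y, fun j => (A j).mulVec y) ∈ bCone A := ⟨hy, fun j => ⟨hc j, 1, (one_smul _ _).symm⟩⟩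
  obtain ⟨m, e1, e2, e3⟩ := hch _ hx
  obtain ⟨hξ, -⟩ := (ch m).coord_spec hx e1 e2 e3
  have hcY := (ch m).cY_coord (one_smul ℂ ((A (ch m).i).mulVec y)).symm e1 e2
  set ξ := (ch m).coord y ((A (ch m).i).mulVec y)
  set a := ((ch m).lam y)⁻¹ with ha
  have ha0 : a ≠ 0 := inv_ne_zero e1
  have hξ0 : ξ 0 ≠ 0 := fun h => hc (ch m).i ((smul_eq_zero.1 (by
    rw [← Matrix.mulVec_smul, ← hcY, BChart.mulVec_cY, h, zero_smul] : a • (A (ch m).i).mulVec y = 0)).resolve_left ha0)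
  have hE : ∀ k l ξ, entry (pullT A t) k l ((ch m).cY ξ) = ξ 0 * mat t k l ((ch m).chV ξ) :=
    fun k l ξ => by
    rw [entry_pullT, mat_smul t k l (c := fun j => if j = (ch m).i then ξ 0 else 1)
      (v := (ch m).chV ξ)]
    · simp
    · intro j
      by_cases h : j = (ch m).i
      · subst h
        rw [BChart.mulVec_cY, BChart.chV_self, if_pos rfl]
      · rw [BChart.chV_of_ne _ h, if_neg h, one_smul]
  have hM : ∀ k l, mat t k l ((ch m).chV ξ) = (ξ 0)⁻¹ * a ^ n * entry (pullT A t) k l y := fun k l => by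
    rw [mul_assoc, ← entry_smul, ← hcY, hE, inv_mul_cancel_left₀ hξ0]
  have h1' : ∀ k, ∑ l, mat t k l ((ch m).chV ξ) * μ l = 0 := fun k => by
    simp only [hM, mul_assoc, ← Finset.mul_sum, h1, mul_zero]
  have h2' : ∀ l, ∑ k, η k * mat t k l ((ch m).chV ξ) = 0 := fun l => by
    simp only [hM, mul_left_comm (η _), ← Finset.mul_sum, h2, mul_zero]
  obtain ⟨z, hz⟩ := ht.corank m ξ hξ μ η hμ hη h1' h2'
  have hd : DifferentiableAt ℂ (ch m).cY ξ :=
    differentiableAt_pi.2 fun s => ((ch m).isPoly_cY s).differentiable ξ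
  have hD : ∀ k l, fderiv ℂ (entry (pullT A t) k l) (a • y) (fderiv ℂ (ch m).cY ξ z) =
      ξ 0 * fderiv ℂ (fun ξ => mat t k l ((ch m).chV ξ)) ξ z + mat t k l ((ch m).chV ξ) * z 0 :=
    fun k l => by
    have h3 := (((isPoly_entry (pullT A t) k l).differentiable ((ch m).cY ξ)).hasFDerivAt).comp ξ
      hd.hasFDerivAt
    have h4 := (hasFDerivAt_apply (𝕜 := ℂ) (F' := fun _ : Fin 3 => ℂ) 0 ξ).mul
      ((ch m).differentiable_mat t k l ξ).hasFDerivAt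
    have e : entry (pullT A t) k l ∘ (ch m).cY = fun ξ => ξ 0 * mat t k l ((ch m).chV ξ) :=
      funext fun ξ => hE k l ξ
    rw [e] at h3
    rw [← hcY]
    exact DFunLike.congr_fun (h3.unique h4) z
  refine ⟨a⁻¹ • fderiv ℂ (ch m).cY ξ z, fun h => hz ?_⟩
  have h5 : ∀ k l, fderiv ℂ (entry (pullT A t) k l) y (a⁻¹ • fderiv ℂ (ch m).cY ξ z) =
      (a ^ n)⁻¹ * (ξ 0 * fderiv ℂ (fun ξ => mat t k l ((ch m).chV ξ)) ξ z +
        mat t k l ((ch m).chV ξ) * z 0) := fun k l => by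
    rw [← hD, eq_inv_mul_iff_mul_eq₀ (pow_ne_zero n ha0), ← fderiv_entry_smul, smul_smul,
      mul_inv_cancel₀ ha0, one_smul]
  simp only [h5] at h
  have h6 : (a ^ n)⁻¹ * ξ 0 *
      ∑ k, ∑ l, η k * fderiv ℂ (fun ξ => mat t k l ((ch m).chV ξ)) ξ z * μ l = 0 := by
    have h7 : ∑ k, η k * ∑ l, mat t k l ((ch m).chV ξ) * μ l = 0 := by simp [h1']
    simp only [Fin.sum_univ_two] at h h7 ⊢
    linear_combination h - (a ^ n)⁻¹ * z 0 * h7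
  exact (mul_eq_zero.1 h6).resolve_left (mul_ne_zero (inv_ne_zero (pow_ne_zero n ha0)) hξ0)

end Tensor

theorem ker_unique_of_rank_two {G : Fin 2 → Fin 3 → ℂ}
    (h : ∀ η : Fin 2 → ℂ, η ≠ 0 → ∃ r, ∑ k, η k * G k r ≠ 0) {v w : Fin 3 → ℂ} (hv : v ≠ 0)
    (hGv : ∀ k, ∑ r, G k r * v r = 0) (hGw : ∀ k, ∑ r, G k r * w r = 0) : ∃ c : ℂ, w = c • v := by
  by_contra hcon
  let N : Fin 3 → ℂ := ![v 1 * w 2 - v 2 * w 1, v 2 * w 0 - v 0 * w 2, v 0 * w 1 - v 1 * w 0]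
  have hN : N ≠ 0 := fun h0 => hcon ((exists_smul_iff_minors hv).2 (by
    have n0 : v 1 * w 2 - v 2 * w 1 = 0 := congrFun h0 0
    have n1 : v 2 * w 0 - v 0 * w 2 = 0 := congrFun h0 1
    have n2 : v 0 * w 1 - v 1 * w 0 = 0 := congrFun h0 2
    intro r s
    fin_cases r <;> fin_cases s <;> simp only [Fin.zero_eta, Fin.mk_one, Fin.reduceFinMk] <;>
      first | linear_combination 0 * n0 | linear_combination n0 | linear_combination -n0 |
        linear_combination n1 | linear_combination -n1 | linear_combination n2 |
        linear_combination -n2))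
  have key : ∀ k, ∃ g : ℂ, G k = g • N := fun k => (exists_smul_iff_minors hN).2 (by
    have a := hGv k
    have b := hGw k
    rw [Fin.sum_univ_three] at a b
    intro r s
    fin_cases r <;> fin_cases s <;> simp only [N, Fin.zero_eta, Fin.mk_one,
      Fin.reduceFinMk, Matrix.cons_val_zero, Matrix.cons_val_one, Matrix.cons_val] <;>
      first | ring1 |
        linear_combination v 0 * b - w 0 * a | linear_combination w 0 * a - v 0 * b |
        linear_combination v 1 * b - w 1 * a | linear_combination w 1 * a - v 1 * b |
        linear_combination v 2 * b - w 2 * a | linear_combination w 2 * a - v 2 * b)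
  choose g hg using key
  by_cases h0 : g 0 = 0
  · obtain ⟨r, hr⟩ := h ![1, 0] fun h => one_ne_zero (congrFun h 0)
    exact hr (by simp [Fin.sum_univ_two, hg, h0])
  · obtain ⟨r, hr⟩ := h ![g 1, -g 0] fun h => h0 (neg_eq_zero.1 (congrFun h 1))
    refine hr ?_
    simp [Fin.sum_univ_two, hg]
    ring

theorem exists_ker_of_two_three (G : Fin 2 → Fin 3 → ℂ) :
    ∃ w : Fin 3 → ℂ, w ≠ 0 ∧ ∀ k, ∑ r, G k r * w r = 0 := by
  have h := LinearMap.ker_ne_bot_of_finrank_lt (f := (Matrix.of G).mulVecLin) (by simp)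
  obtain ⟨w, hw, hw0⟩ := (Submodule.ne_bot_iff _).1 h
  exact ⟨w, hw0, fun k => congrFun hw k⟩

section Compare
variable {n : ℕ} {A : Fin n → Matrix (Fin 3) (Fin 4) ℂ} {ι : Type} {ch : ι → BChart A}
  {t : Fin 2 × Fin 2 × (Fin n → Fin 3) → ℂ}

theorem GenTensor.exists_ne (hch : IsAtlas ch) (ht : GenTensor ch t) {x} (hx : x ∈ bCone A) :
    ∃ k l, mat t k l x.2 ≠ 0 := by
  obtain ⟨m, h1, h2, h3⟩ := hch x hx
  choose c hc e using (ch m).chV_coord (fun j => (hx.2 j).2) h1 h2 h3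
  obtain ⟨k, l, h⟩ := ht.ne m _ ((ch m).coord_spec hx h1 h2 h3).1
  rw [mat_smul t k l e] at h
  exact ⟨k, l, right_ne_zero_of_mul h⟩

theorem mat_kernel_smul (t : Fin 2 × Fin 2 × (Fin n → Fin 3) → ℂ) {v v' : Fin n → Fin 3 → ℂ}
    {μ μ' : Fin 2 → ℂ} (hv : ∀ j, ∃ c : ℂ, v' j = c • v j) {d : ℂ} (hμ : μ' = d • μ)
    (h : ∀ k, ∑ l, mat t k l v * μ l = 0) (k : Fin 2) : ∑ l, mat t k l v' * μ' l = 0 := by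
  choose c hc using hv
  subst hμ
  have := h k
  simp only [mat_smul t k _ hc, Pi.smul_apply, smul_eq_mul]
  rw [Fin.sum_univ_two] at this ⊢
  linear_combination (∏ i, c i) * d * this

/-- The incidence variety of kernel vectors of a matrix of multilinear forms. -/
def KR (A : Fin n → Matrix (Fin 3) (Fin 4) ℂ) (t : Fin 2 × Fin 2 × (Fin n → Fin 3) → ℂ) :
    Set (((Fin 4 → Fin 4 → ℂ) × (Fin n → Fin 3 → Fin 3 → ℂ)) × (Fin 2 → Fin 2 → ℂ)) :=
  (fun x : ((Fin 4 → ℂ) × (Fin n → Fin 3 → ℂ)) × (Fin 2 → ℂ) => (embB x.1, prj x.2)) ''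
    {x | x.1 ∈ bCone A ∧ x.2 ≠ 0 ∧ ∀ k, ∑ l, mat t k l x.1.2 * x.2 l = 0}

/-- The unit vectors over the incidence variety. -/
abbrev SphR (n : ℕ) : Type := SphB n × ↥(Metric.sphere (0 : Fin 2 → ℂ) 1)

theorem isCompact_KR : IsCompact (KR A t) := by
  let C : Set (SphR n) := {s | (∀ i r r', (A i).mulVec s.1.val.1 r * s.1.val.2 i r' =
    (A i).mulVec s.1.val.1 r' * s.1.val.2 i r) ∧ ∀ k, ∑ l, mat t k l s.1.val.2 * s.2.1 l = 0}
  have hC : IsClosed C := by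
    have hv : Continuous fun s : SphR n => s.1.val := continuous_sphB_val.comp continuous_fst
    have hm : ∀ i r, Continuous fun s : SphR n => (A i).mulVec s.1.val.1 r := fun i r =>
      (continuous_apply r).comp ((A i).mulVecLin.continuous_of_finiteDimensional.comp hv.fst)
    have hv2 : ∀ i r, Continuous fun s : SphR n => s.1.val.2 i r := fun i r =>
      (continuous_apply r).comp ((continuous_apply i).comp hv.snd)
    have hmat : ∀ k l, Continuous fun s : SphR n => mat t k l s.1.val.2 := fun k l => by
      have h : Continuous fun v : Fin n → Fin 3 → ℂ => mat t k l v := by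
        unfold mat lin mono
        fun_prop
      exact h.comp hv.snd
    have h1 : IsClosed (⋂ i, ⋂ r, ⋂ r', {s : SphR n |
        (A i).mulVec s.1.val.1 r * s.1.val.2 i r' = (A i).mulVec s.1.val.1 r' * s.1.val.2 i r}) :=
      isClosed_iInter fun i => isClosed_iInter fun r => isClosed_iInter fun r' =>
      isClosed_eq ((hm i r).mul (hv2 i r')) ((hm i r').mul (hv2 i r))
    have h2 : IsClosed (⋂ k, {s : SphR n | ∑ l, mat t k l s.1.val.2 * s.2.1 l = 0}) :=
      isClosed_iInter fun k => isClosed_eq (continuous_finsetSum _ fun l _ =>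
        (hmat k l).mul ((continuous_apply l).comp (continuous_subtype_val.comp continuous_snd)))
        continuous_const
    refine (congrArg IsClosed (Set.ext fun p => ?_)).mpr (h1.inter h2)
    simp only [Set.mem_inter_iff, Set.mem_iInter]
    exact Iff.rfl
  have hcont : Continuous fun s : SphR n => (embB s.1.val, prj s.2.1) :=
    (continuous_embB_val.comp continuous_fst).prodMk
      (continuous_prj_comp (f := fun s : SphR n => s.2.1) (by fun_prop)
        fun s => ne_zero_of_mem_sphere s.2.2)
  refine (congrArg IsCompact (Set.ext fun e => ⟨?_, ?_⟩)).mpr (hC.isCompact.image hcont)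
  · rintro ⟨⟨⟨y, v⟩, μ⟩, ⟨⟨hy, hv⟩, hμ, h0⟩, rfl⟩
    obtain ⟨a, ha, hs⟩ := exists_smul_mem_sphere hy
    choose b hb hb' using fun i => exists_smul_mem_sphere (hv i).1
    obtain ⟨d, hd, hu⟩ := exists_smul_mem_sphere hμ
    refine ⟨((⟨_, hs⟩, fun i => ⟨_, hb' i⟩), ⟨_, hu⟩), ⟨fun i => ?_, ?_⟩,
      Prod.ext (embB_eq_of_smul ⟨a, ha, rfl⟩ fun i => ⟨b i, hb i, rfl⟩) (prj_smul hd μ)⟩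
    · obtain ⟨ρ, hρ⟩ := (hv i).2
      refine (exists_smul_iff_minors (ne_zero_of_mem_sphere (hb' i))).1 ⟨a * ρ * (b i)⁻¹, ?_⟩
      simp only [SphB.val, Matrix.mulVec_smul]
      rw [show (A i).mulVec y = ρ • v i from hρ, smul_smul, smul_smul, mul_assoc,
        inv_mul_cancel₀ (hb i), mul_one]
    · exact mat_kernel_smul t (fun i => ⟨b i, rfl⟩) rfl h0
  · rintro ⟨s, ⟨h1, h2⟩, rfl⟩
    exact ⟨(s.1.val, s.2.1), ⟨⟨ne_zero_of_mem_sphere s.1.1.2, fun i =>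
      ⟨ne_zero_of_mem_sphere (s.1.2 i).2,
      (exists_smul_iff_minors (ne_zero_of_mem_sphere (s.1.2 i).2)).2 (h1 i)⟩⟩,
      ne_zero_of_mem_sphere s.2.2, h2⟩, rfl⟩

theorem image_fst_KR : Prod.fst '' KR A t = KX A (detCoeff t) := by
  ext e
  constructor
  · rintro ⟨_, ⟨⟨x, μ⟩, ⟨hx, hμ, h⟩, rfl⟩, rfl⟩
    exact ⟨x, ⟨hx, (biquadForm_detCoeff t x.2).trans
      (det_of_ker (M := fun k l => mat t k l x.2) hμ h)⟩, rfl⟩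
  · rintro ⟨x, ⟨hx, h⟩, rfl⟩
    obtain ⟨μ, hμ, h'⟩ := exists_ker_of_det (M := fun k l => mat t k l x.2)
      ((biquadForm_detCoeff t x.2).symm.trans h)
    exact ⟨_, ⟨(x, μ), ⟨hx, hμ, h'⟩, rfl⟩, rfl⟩

theorem GenTensor.injOn_fst (hch : IsAtlas ch) (ht : GenTensor ch t) :
    Set.InjOn Prod.fst (KR A t) := by
  rintro _ ⟨⟨x, μ⟩, ⟨hx, hμ, h⟩, rfl⟩ _ ⟨⟨x', μ'⟩, ⟨hx', hμ', h'⟩, rfl⟩ e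
  obtain ⟨-, hv⟩ := embB_inj hx'.1 hx.1 (fun j => (hx'.2 j).1) (fun j => (hx.2 j).1) e.symm
  obtain ⟨c, hc, rfl⟩ := ker_unique (ht.exists_ne hch hx) hμ hμ' h
    (mat_kernel_smul t (fun j => (hv j).imp fun c h => h.2) (one_smul ℂ μ').symm h')
  exact Prod.ext e (prj_smul hc μ).symm

/-- Forgetting the image points. -/
def dropImages (p : ((Fin 4 → Fin 4 → ℂ) × (Fin n → Fin 3 → Fin 3 → ℂ)) × (Fin 2 → Fin 2 → ℂ)) :
    (Fin 4 → Fin 4 → ℂ) × (Fin 2 → Fin 2 → ℂ) := (p.1.1, p.2)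

theorem mat_update (t : Fin 2 × Fin 2 × (Fin n → Fin 3) → ℂ) (k : Fin 2) (v : Fin n → Fin 3 → ℂ)
    (i : Fin n) (w : Fin 3 → ℂ) (μ : Fin 2 → ℂ) :
    ∑ l, mat t k l (Function.update v i w) * μ l =
      ∑ r, (∑ l, mat t k l (Function.update v i (Pi.single r 1)) * μ l) * w r := by
  simp only [mat, lin_mono_update _ v i w, Finset.sum_mul]
  rw [Finset.sum_comm]
  exact Finset.sum_congr rfl fun _ _ => Finset.sum_congr rfl fun _ _ => by ring

theorem image_dropImages_KR (hA : GenCams A) : dropImages '' KR A t = KZ (pullT A t) := by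
  ext e
  constructor
  · rintro ⟨_, ⟨⟨x, μ⟩, ⟨hx, hμ, h⟩, rfl⟩, rfl⟩
    refine ⟨(x.1, μ), ⟨hx.1, hμ, ?_⟩, rfl⟩
    simp only [entry_pullT]
    exact mat_kernel_smul t (fun j => (hx.2 j).2) (one_smul ℂ μ).symm h
  · rintro ⟨⟨y, μ⟩, ⟨hy, hμ, h⟩, rfl⟩
    simp only [entry_pullT] at h
    by_cases hc : ∃ i, (A i).mulVec y = 0
    · obtain ⟨i, hi⟩ := hc
      obtain ⟨w, hw, h'⟩ := exists_ker_of_two_three fun k r => ∑ l,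
        mat t k l (Function.update (fun j => (A j).mulVec y) i (Pi.single r 1)) * μ l
      refine ⟨_, ⟨((y, Function.update (fun j => (A j).mulVec y) i w), μ),
        ⟨⟨hy, fun j => ?_⟩, hμ, fun k => (mat_update t k _ i w μ).trans (h' k)⟩, rfl⟩, rfl⟩
      by_cases hj : j = i
      · subst hj
        refine ⟨by simpa using hw, 0, by simpa using hi⟩
      · refine ⟨?_, 1, ?_⟩
        · simp only [Function.update_of_ne hj]
          exact fun h0 => hy (hA.ker j i hj y h0 hi)
        · simp [Function.update_of_ne hj]
    · push Not at hc
      exact ⟨_, ⟨((y, fun j => (A j).mulVec y), μ),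
        ⟨⟨hy, fun j => ⟨hc j, 1, (one_smul _ _).symm⟩⟩, hμ, h⟩, rfl⟩, rfl⟩

theorem GenTensor.injOn_dropImages (ht : GenTensor ch t) :
    Set.InjOn dropImages (KR A t) := by
  rintro _ ⟨⟨⟨y, v⟩, μ⟩, ⟨⟨hy, hv⟩, hμ, h⟩, rfl⟩ _ ⟨⟨⟨y', v'⟩, μ'⟩, ⟨⟨hy', hv'⟩, hμ', h'⟩, rfl⟩ e
  obtain ⟨a, ha, rfl⟩ := prj_inj hy hy' (congrArg Prod.fst e)
  obtain ⟨d, hd, rfl⟩ := prj_inj hμ hμ' (congrArg Prod.snd e)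
  dsimp only at hv hv' h h' hy hμ
  refine Prod.ext (embB_eq_of_smul ⟨a, ha, rfl⟩ fun j => ?_).symm (prj_smul hd μ).symm
  suffices hs : ∃ c : ℂ, v' j = c • v j by
    obtain ⟨c, hc⟩ := hs
    refine ⟨c, fun h0 => (hv' j).1 ?_, hc⟩
    rw [hc, h0, zero_smul]
  obtain ⟨-, ρ, hρ⟩ := hv j
  obtain ⟨hv'j, ρ', hρ'⟩ := hv' j
  rw [Matrix.mulVec_smul, hρ, smul_smul] at hρ'
  by_cases hj : (A j).mulVec y = 0
  · have hker : ∀ {v : Fin n → Fin 3 → ℂ} {ν : Fin 2 → ℂ} {b : ℂ}, b ≠ 0 →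
        (∀ m, v m ≠ 0 ∧ ∃ ρ : ℂ, (A m).mulVec (b • y) = ρ • v m) → (∃ d : ℂ, μ = d • ν) →
        (∀ k, ∑ l, mat t k l v * ν l = 0) → ∀ k, ∑ r, (∑ l,
          mat t k l (Function.update (fun j => (A j).mulVec y) j (Pi.single r 1)) * μ l) * v j r = 0 := by
      rintro v ν b hb hv ⟨d, hd⟩ h k
      rw [← mat_update]
      refine mat_kernel_smul t (fun m => ?_) hd h k
      by_cases hm : m = j
      · subst hm
        exact ⟨1, by simp⟩
      · obtain ⟨-, ρ, hρ⟩ := hv m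
        refine ⟨b⁻¹ * ρ, ?_⟩
        rw [Function.update_of_ne hm, mul_smul, ← hρ, Matrix.mulVec_smul, smul_smul,
          inv_mul_cancel₀ hb, one_smul]
    refine ker_unique_of_rank_two (fun η hη => ?_) (hv j).1
      (hker one_ne_zero (by simpa only [one_smul] using hv) ⟨1, (one_smul _ _).symm⟩ h)
      (hker ha hv' ⟨d⁻¹, by rw [smul_smul, inv_mul_cancel₀ hd, one_smul]⟩ h')
    obtain ⟨r, hr⟩ := ht.center j y hy hj μ η hμ hη
    refine ⟨r, fun h0 => hr (Eq.trans ?_ h0)⟩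
    simp only [Finset.mul_sum, mul_assoc]
  · have hρ0 : ρ ≠ 0 := fun h0 => hj (by rw [hρ, h0, zero_smul])
    have hρ'0 : ρ' ≠ 0 := fun h0 => (hv j).1 (by
      rw [h0, zero_smul] at hρ'
      exact (smul_eq_zero.1 hρ').resolve_left (mul_ne_zero ha hρ0))
    exact ⟨ρ'⁻¹ * (a * ρ), by rw [mul_smul, hρ', smul_smul, inv_mul_cancel₀ hρ'0, one_smul]⟩

theorem hasEulerChar_KX_detCoeff (hn : n ≠ 0) (hA : GenCams A) (hch : IsAtlas ch)
    (ht : GenTensor ch t) : HasEulerChar (KX A (detCoeff t))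
      ((2 * n : ℤ) ^ 3 - 4 * (2 * n) ^ 2 + 6 * (2 * n)) := by
  have h := (hasEulerChar_KZ hn (ht.smoothZ hA hch)).congr_set (image_dropImages_KR hA).symm
  have hc : Continuous (dropImages (n := n)) := by
    unfold dropImages
    fun_prop
  have h1 := h.congr_homeo (homeoImage isCompact_KR hc.continuousOn (ht.injOn_dropImages)).symm
  exact (h1.congr_homeo (homeoImage isCompact_KR continuous_fst.continuousOn
    (ht.injOn_fst hch))).congr_set image_fst_KR

theorem hasEulerChar_KX [Fintype ι] (hn : n ≠ 0) (hA : GenCams A) (hch : IsAtlas ch)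
    {c : (Fin n → Fin 3) × (Fin n → Fin 3) → ℂ} (hc : SmoothX ch c) :
    HasEulerChar (KX A c) ((2 * n : ℤ) ^ 3 - 4 * (2 * n) ^ 2 + 6 * (2 * n)) := by
  obtain ⟨t, ht⟩ := exists_genTensor hA ch
  obtain ⟨q, hq, h⟩ := exists_poly_smoothX hA ch
  exact hasEulerChar_of_family (K := KX A) (S := {c | SmoothX ch c}) hq h
    (fun c hc => eventually_homotopyEquiv_KX hch hc) ht.smoothX hc
    (hasEulerChar_KX_detCoeff hn hA hch ht)

end Compare

theorem mkP_smul {c : ℂ} (hc : c ≠ 0) {v : Fin 3 → ℂ} (hv : v ≠ 0) : mkP (c • v) = mkP v := by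
  rw [mkP, mkP, dif_pos (smul_ne_zero hc hv), dif_pos hv, Projectivization.mk_eq_mk_iff]
  exact ⟨Units.mk0 c hc, rfl⟩

theorem exists_mkP_eq (p : P2) : ∃ v : Fin 3 → ℂ, v ≠ 0 ∧ mkP v = p :=
  ⟨p.rep, p.rep_nonzero, by rw [mkP, dif_pos p.rep_nonzero, p.mk_rep]⟩

theorem continuous_mkP_comp {X : Type} [TopologicalSpace X] {f : X → Fin 3 → ℂ}
    (hf : Continuous f) (h0 : ∀ x, f x ≠ 0) : Continuous fun x => mkP (f x) := by
  have h : (fun x => mkP (f x)) = fun x =>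
      (Quotient.mk (projectivizationSetoid ℂ (Fin 3 → ℂ)) ⟨f x, h0 x⟩ : P2) :=
    funext fun x => dif_pos (h0 x)
  rw [h]
  exact continuous_quotient_mk'.comp (Continuous.subtype_mk hf _)

theorem continuousAt_mkP {v : Fin 3 → ℂ} (hv : v ≠ 0) : ContinuousAt mkP v := by
  have h : ContinuousOn mkP {v : Fin 3 → ℂ | v ≠ 0} :=
    continuousOn_iff_continuous_domRestrict.2
      (continuous_mkP_comp (f := fun v : {v : Fin 3 → ℂ | v ≠ 0} => v.1) continuous_subtype_val
        fun v => v.2)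
  exact h.continuousAt (isOpen_ne.mem_nhds hv)

/-- The projector onto the line of a point of the projective plane. -/
def prjP (p : P2) : Fin 3 → Fin 3 → ℂ :=
  Quotient.lift (s := projectivizationSetoid ℂ (Fin 3 → ℂ))
    (fun v : { v : Fin 3 → ℂ // v ≠ 0 } => prj v.1) (by
      rintro ⟨v, hv⟩ ⟨w, hw⟩ ⟨c, rfl⟩
      exact prj_smul c.ne_zero w) p

theorem prjP_mkP {v : Fin 3 → ℂ} (hv : v ≠ 0) : prjP (mkP v) = prj v := by
  rw [mkP, dif_pos hv]
  rfl

theorem continuous_prjP : Continuous prjP :=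
  Continuous.quotient_lift (s := projectivizationSetoid ℂ (Fin 3 → ℂ))
    (continuous_prj_comp (f := fun v : { v : Fin 3 → ℂ // v ≠ 0 } => v.1) continuous_subtype_val
      fun v => v.2) _

theorem mkP_inj {v w : Fin 3 → ℂ} (hv : v ≠ 0) (hw : w ≠ 0) (h : mkP v = mkP w) :
    ∃ c : ℂ, c ≠ 0 ∧ w = c • v :=
  prj_inj hv hw (by rw [← prjP_mkP hv, ← prjP_mkP hw, h])

theorem prjP_injective : Function.Injective prjP := by
  intro p q h
  obtain ⟨v, hv, rfl⟩ := exists_mkP_eq p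
  obtain ⟨w, hw, rfl⟩ := exists_mkP_eq q
  rw [prjP_mkP hv, prjP_mkP hw] at h
  obtain ⟨c, hc, rfl⟩ := prj_inj hv hw h
  exact (mkP_smul hc hv).symm

instance : T2Space P2 := T2Space.of_injective_continuous prjP_injective continuous_prjP

section Multiview
variable {n : ℕ} {A : Fin n → Matrix (Fin 3) (Fin 4) ℂ}

/-- The images of the points of the blow-up in the product of image planes. -/
def bImage (A : Fin n → Matrix (Fin 3) (Fin 4) ℂ) : Set (Fin n → P2) :=
  (fun x i => mkP (x.2 i)) '' bCone A

theorem isCompact_setOf_minors (A : Fin n → Matrix (Fin 3) (Fin 4) ℂ) :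
    IsCompact {s : SphB n | ∀ i r r',
      (A i).mulVec s.val.1 r * s.val.2 i r' = (A i).mulVec s.val.1 r' * s.val.2 i r} := by
  have hv := continuous_sphB_val (n := n)
  have hm : ∀ i r, Continuous fun s : SphB n => (A i).mulVec s.val.1 r := fun i r =>
    (continuous_apply r).comp ((A i).mulVecLin.continuous_of_finiteDimensional.comp hv.fst)
  have hv2 : ∀ i r, Continuous fun s : SphB n => s.val.2 i r := fun i r =>
    (continuous_apply r).comp ((continuous_apply i).comp hv.snd)
  have h1 : IsClosed (⋂ i, ⋂ r, ⋂ r', {s : SphB n |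
      (A i).mulVec s.val.1 r * s.val.2 i r' = (A i).mulVec s.val.1 r' * s.val.2 i r}) :=
    isClosed_iInter fun i => isClosed_iInter fun r => isClosed_iInter fun r' =>
    isClosed_eq ((hm i r).mul (hv2 i r')) ((hm i r').mul (hv2 i r))
  refine IsClosed.isCompact ((congrArg IsClosed (Set.ext fun p => ?_)).mpr h1)
  simp only [Set.mem_iInter]
  exact Iff.rfl

theorem isClosed_bImage : IsClosed (bImage A) := by
  have hcont : Continuous fun (s : SphB n) (i : Fin n) => mkP (s.val.2 i) :=
    continuous_pi fun i => continuous_mkP_comp (f := fun s : SphB n => (s.2 i).1) (by fun_prop)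
      fun s => ne_zero_of_mem_sphere (s.2 i).2
  refine (congrArg IsClosed (Set.ext fun P => ⟨?_, ?_⟩)).mpr
    ((isCompact_setOf_minors A).image hcont).isClosed
  · rintro ⟨⟨y, v⟩, ⟨hy, hv⟩, rfl⟩
    obtain ⟨a, ha, hs⟩ := exists_smul_mem_sphere hy
    choose b hb hb' using fun i => exists_smul_mem_sphere (hv i).1
    refine ⟨(⟨_, hs⟩, fun i => ⟨_, hb' i⟩), fun i => ?_, funext fun i => mkP_smul (hb i) (hv i).1⟩
    obtain ⟨ρ, hρ⟩ := (hv i).2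
    refine (exists_smul_iff_minors (ne_zero_of_mem_sphere (hb' i))).1 ⟨a * ρ * (b i)⁻¹, ?_⟩
    simp only [SphB.val, Matrix.mulVec_smul]
    rw [show (A i).mulVec y = ρ • v i from hρ, smul_smul, smul_smul, mul_assoc,
      inv_mul_cancel₀ (hb i), mul_one]
  · rintro ⟨s, h, rfl⟩
    exact ⟨s.val, ⟨ne_zero_of_mem_sphere s.1.2, fun i => ⟨ne_zero_of_mem_sphere (s.2 i).2,
      (exists_smul_iff_minors (ne_zero_of_mem_sphere (s.2 i).2)).2 (h i)⟩⟩, rfl⟩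

theorem mkP_mulVec_eq {x : (Fin 4 → ℂ) × (Fin n → Fin 3 → ℂ)} (hx : x ∈ bCone A) {i : Fin n}
    (h : (A i).mulVec x.1 ≠ 0) : mkP ((A i).mulVec x.1) = mkP (x.2 i) := by
  obtain ⟨hv, ρ, hρ⟩ := hx.2 i
  rw [hρ] at h ⊢
  exact mkP_smul (fun h0 => h (by rw [h0, zero_smul])) hv

theorem mvVariety_eq (hA : GenCams A) : mvVariety A = bImage A := by
  refine Set.Subset.antisymm (closure_minimal ?_ isClosed_bImage) ?_
  · rintro P ⟨y, hy, h, e⟩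
    exact ⟨(y, fun i => (A i).mulVec y), ⟨hy, fun i => ⟨h i, 1, (one_smul _ _).symm⟩⟩,
      funext fun i => (e i).symm⟩
  · rintro _ ⟨x, hx, rfl⟩
    by_cases hc : ∃ i, (A i).mulVec x.1 = 0
    · obtain ⟨i, hi⟩ := hc
      have hne : ∀ j, j ≠ i → (A j).mulVec x.1 ≠ 0 := fun j hj h0 =>
        hx.1 (hA.ker j i hj _ h0 hi)
      obtain ⟨z, hz⟩ := hA.surj i (x.2 i)
      have hlim : Tendsto (fun s : ℂ => x.1 + s • z) (𝓝[≠] 0) (𝓝 x.1) := by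
        have h : Continuous fun s : ℂ => x.1 + s • z := by fun_prop
        have h' := (h.tendsto 0).mono_left (nhdsWithin_le_nhds (s := {(0 : ℂ)}ᶜ))
        simpa using h'
      have hlimA : ∀ j, Tendsto (fun s : ℂ => (A j).mulVec (x.1 + s • z)) (𝓝[≠] 0)
          (𝓝 ((A j).mulVec x.1)) := fun j =>
        ((A j).mulVecLin.continuous_of_finiteDimensional.tendsto _).comp hlim
      have hi' : ∀ s : ℂ, (A i).mulVec (x.1 + s • z) = s • x.2 i := fun s => by
        rw [Matrix.mulVec_add, hi, Matrix.mulVec_smul, hz, zero_add]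
      have hev : ∀ᶠ s : ℂ in 𝓝[≠] 0, ∀ j, (A j).mulVec (x.1 + s • z) ≠ 0 :=
        eventually_all.2 fun j => by
          by_cases hj : j = i
          · subst hj
            filter_upwards [self_mem_nhdsWithin] with s hs
            rw [hi']
            exact smul_ne_zero hs (hx.2 j).1
          · exact (hlimA j).eventually_ne (hne j hj)
      refine mem_closure_of_tendsto
        (f := fun (s : ℂ) (j : Fin n) => mkP ((A j).mulVec (x.1 + s • z))) (b := 𝓝[≠] (0 : ℂ))
        (tendsto_pi_nhds.2 fun j => ?_) ?_
      · dsimp only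
        by_cases hj : j = i
        · subst hj
          refine tendsto_const_nhds.congr' ?_
          filter_upwards [self_mem_nhdsWithin] with s hs
          rw [hi']
          exact (mkP_smul hs (hx.2 j).1).symm
        · rw [← mkP_mulVec_eq hx (hne j hj)]
          exact (continuousAt_mkP (hne j hj)).tendsto.comp (hlimA j)
      · filter_upwards [hev] with s hs
        refine ⟨_, fun h0 => hs i ?_, hs, fun _ => rfl⟩
        rw [h0, Matrix.mulVec_zero]
    · push Not at hc
      exact subset_closure ⟨x.1, hx.1, hc, fun i => (mkP_mulVec_eq hx (hc i)).symm⟩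

theorem mem_biquadDivisor_iff (hA : GenCams A) {c : (Fin n → Fin 3) × (Fin n → Fin 3) → ℂ}
    {P : Fin n → P2} : P ∈ biquadDivisor A c ↔
      ∃ x ∈ bCone A, (∀ i, P i = mkP (x.2 i)) ∧ biquadForm c x.2 = 0 := by
  rw [biquadDivisor, mvVariety_eq hA]
  constructor
  · rintro ⟨⟨x, hx, rfl⟩, v, hv, e, h0⟩
    exact ⟨x, hx, fun _ => rfl, (biquadForm_eq_zero_iff c fun j =>
      mkP_inj (hx.2 j).1 (hv j) (e j)).1 h0⟩
  · rintro ⟨x, hx, e, h0⟩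
    exact ⟨⟨x, hx, (funext e).symm⟩, x.2, fun i => (hx.2 i).1, e, h0⟩

theorem isCompact_KX (c : (Fin n → Fin 3) × (Fin n → Fin 3) → ℂ) : IsCompact (KX A c) :=
  isCompact_range_embB.of_isClosed_subset
    ((isClosed_total_KX A).preimage (Continuous.prodMk_right c)) (KX_subset A c)

theorem GenCams.eq_embB (hA : GenCams A) {x x' : (Fin 4 → ℂ) × (Fin n → Fin 3 → ℂ)}
    (hx : x ∈ bCone A) (hx' : x' ∈ bCone A) (h : ∀ j, prj (x.2 j) = prj (x'.2 j)) :
    embB x' = embB x := by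
  have hv := fun j => prj_inj (hx.2 j).1 (hx'.2 j).1 (h j)
  obtain ⟨c, hc⟩ := hA.eq_smul hx.1 (fun i => (hx.2 i).2) (z := x'.1) fun i => by
    obtain ⟨c, -, e⟩ := hv i
    obtain ⟨ρ, hρ⟩ := (hx'.2 i).2
    exact ⟨ρ * c, by rw [hρ, e, smul_smul]⟩
  exact embB_eq_of_smul ⟨c, fun h0 => hx'.1 (by rw [hc, h0, zero_smul]), hc⟩ hv

theorem GenCams.injOn_snd (hA : GenCams A) (c : (Fin n → Fin 3) × (Fin n → Fin 3) → ℂ) :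
    Set.InjOn Prod.snd (KX A c) := by
  rintro _ ⟨x, ⟨hx, -⟩, rfl⟩ _ ⟨x', ⟨hx', -⟩, rfl⟩ e
  exact (hA.eq_embB hx hx' fun j => congrFun e j).symm

theorem image_prjP_biquadDivisor (hA : GenCams A) (c : (Fin n → Fin 3) × (Fin n → Fin 3) → ℂ) :
    (fun P i => prjP (P i)) '' biquadDivisor A c = Prod.snd '' KX A c := by
  ext e
  constructor
  · rintro ⟨P, hP, rfl⟩
    obtain ⟨x, hx, hP, h0⟩ := (mem_biquadDivisor_iff hA).1 hP
    exact ⟨_, ⟨x, ⟨hx, h0⟩, rfl⟩, funext fun i =>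
      ((congrArg prjP (hP i)).trans (prjP_mkP (hx.2 i).1)).symm⟩
  · rintro ⟨_, ⟨x, ⟨hx, h0⟩, rfl⟩, rfl⟩
    exact ⟨fun i => mkP (x.2 i), (mem_biquadDivisor_iff hA).2 ⟨x, hx, fun _ => rfl, h0⟩,
      funext fun i => prjP_mkP (hx.2 i).1⟩

theorem isCompact_biquadDivisor (hA : GenCams A) (c : (Fin n → Fin 3) × (Fin n → Fin 3) → ℂ) :
    IsCompact (biquadDivisor A c) := by
  have hcont : Continuous fun (P : Fin n → P2) i => prjP (P i) :=
    continuous_pi fun i => continuous_prjP.comp (continuous_apply i)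
  have hinj : Function.Injective fun (P : Fin n → P2) i => prjP (P i) :=
    fun P Q h => funext fun i => prjP_injective (congrFun h i)
  have hsurj : Function.Surjective fun (v : Fin n → ↥(Metric.sphere (0 : Fin 3 → ℂ) 1)) i =>
      mkP (v i).1 := fun P => by
    choose v hv e using fun i => exists_mkP_eq (P i)
    choose c hc hs using fun i => exists_smul_mem_sphere (hv i)
    exact ⟨fun i => ⟨_, hs i⟩, funext fun i => (mkP_smul (hc i) (hv i)).trans (e i)⟩
  have hcomp : CompactSpace (Fin n → P2) := hsurj.compactSpace (continuous_pi fun i =>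
    continuous_mkP_comp (by fun_prop) fun v => ne_zero_of_mem_sphere (v i).2)
  rw [← hinj.preimage_image (biquadDivisor A c), image_prjP_biquadDivisor hA]
  exact (((isCompact_KX c).image continuous_snd).isClosed.preimage hcont).isCompact

theorem hasEulerChar_biquadDivisor {ι : Type} [Fintype ι] {ch : ι → BChart A} (hn : n ≠ 0)
    (hA : GenCams A) (hch : IsAtlas ch) {c : (Fin n → Fin 3) × (Fin n → Fin 3) → ℂ}
    (hc : SmoothX ch c) :
    HasEulerChar (biquadDivisor A c) (8 * (n : ℤ) ^ 3 - 16 * (n : ℤ) ^ 2 + 12 * (n : ℤ)) := by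
  have h := hasEulerChar_KX hn hA hch hc
  rw [show (2 * n : ℤ) ^ 3 - 4 * (2 * n) ^ 2 + 6 * (2 * n) = 8 * n ^ 3 - 16 * n ^ 2 + 12 * n by ring]
    at h
  have hcont : Continuous fun (P : Fin n → P2) i => prjP (P i) :=
    continuous_pi fun i => continuous_prjP.comp (continuous_apply i)
  have hinj : Function.Injective fun (P : Fin n → P2) i => prjP (P i) :=
    fun P Q h => funext fun i => prjP_injective (congrFun h i)
  have h1 := h.congr_homeo (homeoImage (isCompact_KX c) continuous_snd.continuousOn
    (hA.injOn_snd c))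
  exact (h1.congr_set (image_prjP_biquadDivisor hA c).symm).congr_homeo
    (homeoImage (isCompact_biquadDivisor hA c) hcont.continuousOn hinj.injOn).symm

end Multiview

/-- A local holomorphic parametrization of a smooth hypersurface. -/
theorem exists_param_zero {d : ℕ} {F : (Fin (d + 1) → ℂ) → ℂ} (hF : ContDiff ℂ 1 F)
    {ξ₀ : Fin (d + 1) → ℂ} (h0 : F ξ₀ = 0) (hη : ∃ η, fderiv ℂ F ξ₀ η ≠ 0)
    {W' : Set (Fin (d + 1) → ℂ)} (hW' : W' ∈ 𝓝 ξ₀) :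
    ∃ (ψ : (Fin d → ℂ) → Fin (d + 1) → ℂ) (U : Set (Fin d → ℂ)) (W : Set (Fin (d + 1) → ℂ)),
      IsOpen U ∧ 0 ∈ U ∧ ψ 0 = ξ₀ ∧ DifferentiableOn ℂ ψ U ∧ Set.InjOn ψ U ∧
      Function.Injective (fderiv ℂ ψ 0) ∧ IsOpen W ∧ ξ₀ ∈ W ∧ W ⊆ W' ∧
      ψ '' U = W ∩ {ξ | F ξ = 0} := by
  obtain ⟨m, hm⟩ : ∃ m, fderiv ℂ F ξ₀ (Pi.single m 1) ≠ 0 := by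
    by_contra! h
    obtain ⟨η, hη⟩ := hη
    refine hη ?_
    rw [pi_eq_sum_univ' η, map_sum]
    exact Finset.sum_eq_zero fun i _ => by rw [map_smul, h, smul_zero]
  let R : (Fin (d + 1) → ℂ) →L[ℂ] (Fin d → ℂ) :=
    ContinuousLinearMap.pi fun b => ContinuousLinearMap.proj (m.succAbove b)
  have hR : ∀ ξ b, R ξ b = ξ (m.succAbove b) := fun _ _ => rfl
  let Φ : (Fin (d + 1) → ℂ) → (Fin d → ℂ) × ℂ := fun ξ => (R ξ - R ξ₀, F ξ)
  have hΦ : ContDiff ℂ 1 Φ := (R.contDiff.sub contDiff_const).prodMk hF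
  have hΦ0 : Φ ξ₀ = (0, 0) := Prod.ext (sub_self _) h0
  let L : (Fin (d + 1) → ℂ) →L[ℂ] (Fin d → ℂ) × ℂ := R.prod (fderiv ℂ F ξ₀)
  have hL : HasFDerivAt Φ L ξ₀ := (R.hasFDerivAt.sub_const _).prodMk
    (hF.differentiable one_ne_zero ξ₀).hasFDerivAt
  have hinj : Function.Injective L.toLinearMap := (injective_iff_map_eq_zero _).2 fun η h => by
    have h1 : R η = 0 := congrArg Prod.fst h
    have h2 : fderiv ℂ F ξ₀ η = 0 := congrArg Prod.snd h
    have e : η = η m • Pi.single m 1 := by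
      funext s
      rcases Fin.eq_self_or_eq_succAbove m s with rfl | ⟨b, rfl⟩
      · simp
      · have h3 : η (m.succAbove b) = 0 := congrFun h1 b
        simp [h3]
    rw [e, map_smul, smul_eq_mul] at h2
    rw [e, (mul_eq_zero.1 h2).resolve_right hm, zero_smul]
  let Le : (Fin (d + 1) → ℂ) ≃L[ℂ] (Fin d → ℂ) × ℂ :=
    (LinearEquiv.ofInjectiveOfFinrankEq L.toLinearMap hinj (by simp)).toContinuousLinearEquiv
  have hLe : HasFDerivAt Φ (Le : (Fin (d + 1) → ℂ) →L[ℂ] (Fin d → ℂ) × ℂ) ξ₀ :=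
    hL.congr_fderiv (ContinuousLinearMap.ext fun _ => rfl)
  let e := hΦ.contDiffAt.toOpenPartialHomeomorph Φ hLe one_ne_zero
  have hs : ξ₀ ∈ e.source := hΦ.contDiffAt.mem_toOpenPartialHomeomorph_source hLe one_ne_zero
  have hcoe : ∀ ξ, e ξ = Φ ξ := fun _ => rfl
  have ht : ((0, 0) : (Fin d → ℂ) × ℂ) ∈ e.target := by
    rw [← hΦ0]
    exact e.map_source hs
  have hsymm0 : e.symm (0, 0) = ξ₀ := by
    rw [← hΦ0]
    exact e.left_inv hs
  have hcd : ContDiffAt ℂ 1 e.symm (0, 0) :=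
    e.contDiffAt_symm ht (by rw [hsymm0]; exact hLe) (by rw [hsymm0]; exact hΦ.contDiffAt)
  obtain ⟨T, hT, hTo, h0T⟩ : ∃ T ⊆ e.target ∩ e.symm ⁻¹' W' ∩ {p | ContDiffAt ℂ 1 e.symm p},
      IsOpen T ∧ ((0, 0) : (Fin d → ℂ) × ℂ) ∈ T :=
    mem_nhds_iff.1 (inter_mem (inter_mem (e.open_target.mem_nhds ht)
      ((e.continuousAt_symm ht).preimage_mem_nhds (by rw [hsymm0]; exact hW')))
      (hcd.eventually (by simp)))
  have hdiff : ∀ u, (u, (0 : ℂ)) ∈ T → DifferentiableAt ℂ (fun u => e.symm (u, (0 : ℂ))) u :=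
    fun u hu => DifferentiableAt.comp u
      (ContDiffAt.differentiableAt (hT hu).2.out one_ne_zero) (by fun_prop)
  have hinv : ∀ u, (u, (0 : ℂ)) ∈ T → R (e.symm (u, 0)) - R ξ₀ = u := fun u hu =>
    congrArg Prod.fst (e.right_inv (hT hu).1.1)
  have hU : IsOpen {u : Fin d → ℂ | (u, (0 : ℂ)) ∈ T} := hTo.preimage (by fun_prop)
  refine ⟨fun u => e.symm (u, 0), {u | (u, 0) ∈ T}, e.source ∩ e ⁻¹' T, hU, h0T, hsymm0,
    fun u hu => (hdiff u hu).differentiableWithinAt, fun u hu u' hu' h => ?_, ?_,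
    e.isOpen_inter_preimage hTo, ⟨hs, ?_⟩, ?_, ?_⟩
  · rw [← hinv u hu, ← hinv u' hu', show e.symm (u, 0) = e.symm (u', 0) from h]
  · have h1 : HasFDerivAt (fun u => R (e.symm (u, 0)) - R ξ₀)
        (R.comp (fderiv ℂ (fun u => e.symm (u, (0 : ℂ))) 0)) 0 :=
      (R.hasFDerivAt.comp 0 (hdiff 0 h0T).hasFDerivAt).sub_const _
    have h2 : HasFDerivAt (fun u => R (e.symm (u, 0)) - R ξ₀)
        (ContinuousLinearMap.id ℂ (Fin d → ℂ)) 0 :=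
      (hasFDerivAt_id 0).congr_of_eventuallyEq (by
        filter_upwards [hU.mem_nhds h0T] with u hu
        exact hinv u hu)
    have h3 := h1.unique h2
    exact Function.LeftInverse.injective (g := R) fun v => DFunLike.congr_fun h3 v
  · rw [Set.mem_preimage, hcoe, hΦ0]
    exact h0T
  · rintro ξ ⟨h1, h2⟩
    have h := (hT h2).1.2
    rwa [Set.mem_preimage, e.left_inv h1] at h
  · ext ξ
    constructor
    · rintro ⟨u, hu, rfl⟩
      have h1 := (hT hu).1.1
      refine ⟨⟨e.map_target h1, ?_⟩, congrArg Prod.snd (e.right_inv h1)⟩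
      rw [Set.mem_preimage, e.right_inv h1]
      exact hu
    · rintro ⟨⟨h1, h2⟩, h3⟩
      have h4 : e ξ = (R ξ - R ξ₀, 0) := Prod.ext rfl h3
      refine ⟨R ξ - R ξ₀, ?_, ?_⟩
      · rw [Set.mem_preimage, h4] at h2
        exact h2
      · dsimp only
        rw [← h4]
        exact e.left_inv h1

section Smooth
variable {n : ℕ} {A : Fin n → Matrix (Fin 3) (Fin 4) ℂ}

/-- A point of the affine chart of the projective plane. -/
def affVec (r : Fin 3) (z : Fin 2 → ℂ) : Fin 3 → ℂ := Fin.insertNth r (1 : ℂ) z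

theorem affVec_self (r : Fin 3) (z : Fin 2 → ℂ) : affVec r z r = 1 := Fin.insertNth_apply_same (α := fun _ => ℂ) r 1 z

theorem affVec_succAbove (r : Fin 3) (z : Fin 2 → ℂ) (b : Fin 2) : affVec r z (r.succAbove b) = z b :=
  Fin.insertNth_apply_succAbove (α := fun _ => ℂ) r 1 z b

theorem affVec_ne_zero (r : Fin 3) (z : Fin 2 → ℂ) : affVec r z ≠ 0 := fun h =>
  one_ne_zero ((affVec_self r z).symm.trans (congrFun h r))

/-- The affine coordinates of a homogeneous vector. -/
def deh (r : Fin 3) (v : Fin 3 → ℂ) : Fin 2 → ℂ := fun b => v (r.succAbove b) / v r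

theorem affVec_deh {r : Fin 3} {v : Fin 3 → ℂ} (hv : v r ≠ 0) : affVec r (deh r v) = (v r)⁻¹ • v := by
  funext s
  rcases Fin.eq_self_or_eq_succAbove r s with rfl | ⟨b, rfl⟩
  · simp [affVec_self, hv]
  · simp [affVec_succAbove, deh, div_eq_inv_mul]

theorem deh_affVec (r : Fin 3) (z : Fin 2 → ℂ) : deh r (affVec r z) = z := by
  funext b
  simp [deh, affVec_self, affVec_succAbove]

theorem deh_smul {c : ℂ} (hc : c ≠ 0) (r : Fin 3) (v : Fin 3 → ℂ) : deh r (c • v) = deh r v := by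
  funext b
  simp [deh, mul_div_mul_left _ _ hc]

theorem continuous_affVec (r : Fin 3) : Continuous (affVec r) := by
  refine continuous_pi fun s => ?_
  rcases Fin.eq_self_or_eq_succAbove r s with rfl | ⟨b, rfl⟩
  · simp only [affVec_self]
    exact continuous_const
  · simp only [affVec_succAbove]
    fun_prop

namespace BChart
variable (k : BChart A)

/-- The chart of the blow-up in affine coordinates of the image planes. -/
def aff (j : Fin n → Fin 3) (ξ : Fin 3 → ℂ) : Fin n → Fin 2 → ℂ := fun i => deh (j i) (k.chV ξ i)

/-- The domain of the chart in affine coordinates of the image planes. -/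
def affDom (j : Fin n → Fin 3) : Set (Fin 3 → ℂ) := {ξ | ∀ i, k.chV ξ i (j i) ≠ 0}

theorem affDom_subset (j : Fin n → Fin 3) : k.affDom j ⊆ k.dom := fun _ h i h0 =>
  h i (congrFun h0 (j i))

theorem isOpen_affDom (j : Fin n → Fin 3) : IsOpen (k.affDom j) := by
  have : IsOpen (⋂ i, {ξ | k.chV ξ i (j i) ≠ 0}) := isOpen_iInter_of_finite fun i =>
    isOpen_ne_fun (k.isPoly_chV i (j i)).differentiable.continuous continuous_const
  refine (congrArg IsOpen (Set.ext fun p => ?_)).mpr this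
  simp only [Set.mem_iInter]
  exact Iff.rfl

theorem differentiableAt_aff {j : Fin n → Fin 3} {ξ : Fin 3 → ℂ} (h : ξ ∈ k.affDom j) :
    DifferentiableAt ℂ (k.aff j) ξ :=
  differentiableAt_pi.2 fun i => differentiableAt_pi.2 fun b => by
    have h1 : DifferentiableAt ℂ (fun ξ => k.chV ξ i ((j i).succAbove b) * (k.chV ξ i (j i))⁻¹) ξ :=
      ((k.isPoly_chV i _).differentiable ξ).mul
        (((k.isPoly_chV i (j i)).differentiable ξ).inv (h i))
    simp only [← div_eq_mul_inv] at h1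
    exact h1

theorem chV_eq_aff {j : Fin n → Fin 3} {ξ : Fin 3 → ℂ} (h : ξ ∈ k.affDom j) (i : Fin n) :
    k.chV ξ i = k.chV ξ i (j i) • affVec (j i) (k.aff j ξ i) := by
  rw [aff, affVec_deh (h i), smul_smul, mul_inv_cancel₀ (h i), one_smul]

theorem injective_fderiv_aff (hA : GenCams A) {j : Fin n → Fin 3} {ξ : Fin 3 → ℂ}
    (h : ξ ∈ k.affDom j) : Function.Injective (fderiv ℂ (k.aff j) ξ) := by
  refine (injective_iff_map_eq_zero _).2 fun η hη => k.immersiveAt hA ξ η fun i =>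
    ⟨fderiv ℂ (fun ξ => k.chV ξ i (j i)) ξ η / k.chV ξ i (j i), fun r => ?_⟩
  have hi := h i
  rcases Fin.eq_self_or_eq_succAbove (j i) r with rfl | ⟨b, rfl⟩
  · rw [div_mul_cancel₀ _ hi]
  · have hd : HasFDerivAt (fun ξ => k.aff j ξ i b)
        ((ContinuousLinearMap.proj b).comp ((ContinuousLinearMap.proj (R := ℂ)
          (φ := fun _ : Fin n => Fin 2 → ℂ) i).comp (fderiv ℂ (k.aff j) ξ))) ξ :=
      hasFDerivAt_pi'.1 (hasFDerivAt_pi'.1 (k.differentiableAt_aff h).hasFDerivAt i) b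
    have h1 := ((k.isPoly_chV i (j i)).differentiable ξ).hasFDerivAt.mul hd
    have h2 : (fun ξ => k.chV ξ i ((j i).succAbove b)) =ᶠ[𝓝 ξ]
        (fun ξ => k.chV ξ i (j i)) * fun ξ => k.aff j ξ i b := by
      filter_upwards [(k.isOpen_affDom j).mem_nhds h] with ξ' h'
      have := congrFun (k.chV_eq_aff h' i) ((j i).succAbove b)
      rwa [Pi.smul_apply, affVec_succAbove] at this
    have h3 := DFunLike.congr_fun (h1.congr_of_eventuallyEq h2).fderiv η
    have h4 := congrFun (k.chV_eq_aff h i) ((j i).succAbove b)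
    rw [Pi.smul_apply, affVec_succAbove, smul_eq_mul] at h4
    rw [h3]
    simp only [_root_.add_apply, _root_.smul_apply, ContinuousLinearMap.comp_apply, hη, map_zero,
      smul_eq_mul]
    rw [h4]
    field_simp
    ring

theorem injOn_aff (hA : GenCams A) (j : Fin n → Fin 3) : Set.InjOn (k.aff j) (k.affDom j) := by
  intro ξ h ξ' h' e
  have hm := k.mem_bCone (k.affDom_subset j h)
  have hm' := k.mem_bCone (k.affDom_subset j h')
  have he := hA.eq_embB hm' hm fun i => by
    dsimp only
    rw [k.chV_eq_aff h i, k.chV_eq_aff h' i, e, prj_smul (h i), prj_smul (h' i)]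
  obtain ⟨⟨c, hc, h1⟩, h2⟩ := embB_inj hm.1 hm'.1 (fun j => (hm.2 j).1) (fun j => (hm'.2 j).1) he
  obtain ⟨c', hc', h3⟩ := h2 k.i
  rw [← k.coord_self ξ', show k.cY ξ' = c • k.cY ξ from h1,
    show k.chV ξ' k.i = c' • k.chV ξ k.i from h3, k.coord_smul _ _ hc hc', k.coord_self]

theorem exists_isOpen_par {W : Set (Fin 3 → ℂ)} (hW : IsOpen W) (hWd : W ⊆ k.dom) :
    ∃ O, IsOpen O ∧ (∀ ξ ∈ W, k.par ξ ∈ O) ∧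
      ∀ x ∈ bCone A, embB x ∈ O → ∃ ξ ∈ W, k.par ξ = embB x := by
  refine ⟨⋃ b, k.locDom b ∩ k.loc b ⁻¹' W, isOpen_iUnion fun b => ?_, fun ξ hξ => ?_,
    fun x hx h => ?_⟩
  · have hc : ContinuousOn (k.loc b) (k.locDom b) := fun e he =>
      (k.contDiffAt_loc b he (m := 0)).continuousAt.continuousWithinAt
    exact hc.isOpen_inter_preimage (k.isOpen_locDom b) hW
  · have hm := k.mem_bCone (hWd hξ)
    obtain ⟨b, hb⟩ := Function.ne_iff.1 hm.1
    have hd := k.mem_locDom hm hb (by rw [k.lam_cY]; exact one_ne_zero)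
      (by dsimp only; rw [k.chV_self, cV_self]; exact one_ne_zero)
      (fun j hj => by dsimp only; rw [← k.chV_of_ne hj]; exact (hm.2 j).1)
    refine Set.mem_iUnion.2 ⟨b, hd, ?_⟩
    rw [Set.mem_preimage, par, (k.loc_spec b hm hd).2.2.2, k.coord_self]
    exact hξ
  · obtain ⟨b, hd, h⟩ := Set.mem_iUnion.1 h
    obtain ⟨h1, h2, h3, h4⟩ := k.loc_spec b hx hd
    rw [Set.mem_preimage, h4] at h
    exact ⟨_, h, (k.coord_spec hx h1 h2 h3).2⟩

/-- Openness of a chart of the blow-up in the product of image planes. -/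
theorem exists_isOpen_aff (hA : GenCams A) {j : Fin n → Fin 3} {W : Set (Fin 3 → ℂ)}
    (hW : IsOpen W) (hWd : W ⊆ k.affDom j) : ∃ V, IsOpen V ∧ (∀ ξ ∈ W, k.aff j ξ ∈ V) ∧
      ∀ z ∈ V, ∀ x ∈ bCone A, (∀ i, stdChart j z i = mkP (x.2 i)) → ∃ ξ ∈ W, k.aff j ξ = z := by
  obtain ⟨O, hO, h1, h2⟩ := k.exists_isOpen_par hW (hWd.trans (k.affDom_subset j))
  have hK : ∀ x ∈ bCone A, embB x ∈ KX A 0 := fun x hx => ⟨x, ⟨hx, by simp [biquadForm]⟩, rfl⟩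
  have hC : IsClosed (Prod.snd '' (KX A 0 \ O)) :=
    (((isCompact_KX 0).diff hO).image continuous_snd).isClosed
  have hcont : Continuous fun (z : Fin n → Fin 2 → ℂ) i => prj (affVec (j i) (z i)) :=
    continuous_pi fun i => continuous_prj_comp
      ((continuous_affVec (j i)).comp (continuous_apply i)) fun z => affVec_ne_zero _ _
  refine ⟨_, hC.isOpen_compl.preimage hcont, fun ξ hξ => ?_, fun z hz x hx e => ?_⟩
  · rintro ⟨p, ⟨hp, hpO⟩, e⟩
    refine hpO ?_
    rw [hA.injOn_snd 0 hp (hK _ (k.mem_bCone (k.affDom_subset j (hWd hξ)))) (e.trans ?_)]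
    · exact h1 ξ hξ
    · funext i
      show _ = prj (k.chV ξ i)
      rw [k.chV_eq_aff (hWd hξ) i, prj_smul (hWd hξ i)]
  · have e' : ∀ i, ∃ c : ℂ, c ≠ 0 ∧ x.2 i = c • affVec (j i) (z i) := fun i =>
      mkP_inj (affVec_ne_zero _ _) (hx.2 i).1 (e i)
    have hO' : embB x ∈ O := by
      by_contra h
      refine hz ⟨_, ⟨hK x hx, h⟩, funext fun i => ?_⟩
      obtain ⟨c, hc, h⟩ := e' i
      show prj (x.2 i) = _
      rw [h, prj_smul hc]
    obtain ⟨ξ, hξ, hp⟩ := h2 x hx hO'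
    refine ⟨ξ, hξ, funext fun i => ?_⟩
    have hm := k.mem_bCone (k.affDom_subset j (hWd hξ))
    obtain ⟨c, hc, h⟩ := (embB_inj hx.1 hm.1 (fun j => (hx.2 j).1) (fun j => (hm.2 j).1) hp.symm).2 i
    obtain ⟨c', hc', h'⟩ := e' i
    rw [aff, show k.chV ξ i = c • x.2 i from h, h', deh_smul hc, deh_smul hc', deh_affVec]

end BChart

theorem isSmoothPtP_biquadDivisor {ι : Type} {ch : ι → BChart A} (hA : GenCams A)
    (hch : IsAtlas ch) {c : (Fin n → Fin 3) × (Fin n → Fin 3) → ℂ} (hc : SmoothX ch c)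
    {p : Fin n → P2} (hp : p ∈ biquadDivisor A c) : IsSmoothPtP (biquadDivisor A c) p 2 := by
  obtain ⟨x, hx, hpx, h0⟩ := (mem_biquadDivisor_iff hA).1 hp
  obtain ⟨k, h1, h2, h3⟩ := hch x hx
  obtain ⟨hξ, hpar⟩ := (ch k).coord_spec hx h1 h2 h3
  generalize (ch k).coord x.1 (x.2 (ch k).i) = ξ at hξ hpar
  have hm := (ch k).mem_bCone hξ
  have hv := (embB_inj hx.1 hm.1 (fun j => (hx.2 j).1) (fun j => (hm.2 j).1) hpar.symm).2
  choose j hj using fun i => Function.ne_iff.1 (hξ i)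
  have hF0 : biquadForm c ((ch k).chV ξ) = 0 := (biquadForm_eq_zero_iff c hv).2 h0
  have hstd : ∀ ξ ∈ (ch k).affDom j, ∀ i,
      stdChart j ((ch k).aff j ξ) i = mkP ((ch k).chV ξ i) := fun ξ h i => by
    rw [(ch k).chV_eq_aff h i, mkP_smul (h i) (affVec_ne_zero _ _)]
    rfl
  obtain ⟨ψ, U, W, hU, h0U, hψ0, hψ, hψi, hψd, hW, hξW, hWd, him⟩ := exists_param_zero
    ((ch k).isPoly_biquadForm c).contDiff hF0 (hc k ξ hξ hF0)
    (((ch k).isOpen_affDom j).mem_nhds hj)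
  have hUW : ∀ u ∈ U, ψ u ∈ W ∧ biquadForm c ((ch k).chV (ψ u)) = 0 := fun u hu => by
    have h : ψ u ∈ W ∩ {ξ | biquadForm c ((ch k).chV ξ) = 0} := him ▸ Set.mem_image_of_mem ψ hu
    exact h
  obtain ⟨V, hV, hWV, hVW⟩ := (ch k).exists_isOpen_aff hA hW hWd
  refine ⟨j, (ch k).aff j ξ, funext fun i => ?_, fun u => (ch k).aff j (ψ u), U, hU, h0U,
    congrArg _ hψ0, fun u hu => ?_, fun u hu u' hu' e => ?_, ?_, V, hV.mem_nhds (hWV ξ hξW), ?_⟩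
  · obtain ⟨c, hc, e⟩ := hv i
    rw [hstd ξ hj, show (ch k).chV ξ i = c • x.2 i from e, mkP_smul hc (hx.2 i).1, hpx]
  · exact (DifferentiableAt.comp u ((ch k).differentiableAt_aff (hWd (hUW u hu).1))
      ((hψ u hu).differentiableAt (hU.mem_nhds hu))).differentiableWithinAt
  · exact hψi hu hu' ((ch k).injOn_aff hA j (hWd (hUW u hu).1) (hWd (hUW u' hu').1) e)
  · have hd : HasFDerivAt (fun u => (ch k).aff j (ψ u))
        ((fderiv ℂ ((ch k).aff j) (ψ 0)).comp (fderiv ℂ ψ 0)) 0 :=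
      HasFDerivAt.comp 0 ((ch k).differentiableAt_aff (hWd (hUW 0 h0U).1)).hasFDerivAt
        ((hψ 0 h0U).differentiableAt (hU.mem_nhds h0U)).hasFDerivAt
    rw [hd.fderiv]
    exact ((ch k).injective_fderiv_aff hA (hWd (hUW 0 h0U).1)).comp hψd
  · ext z
    constructor
    · rintro ⟨u, hu, rfl⟩
      obtain ⟨hW, hF⟩ := hUW u hu
      exact ⟨(mem_biquadDivisor_iff hA).2 ⟨_, (ch k).mem_bCone ((ch k).affDom_subset j (hWd hW)),
        hstd _ (hWd hW), hF⟩, hWV _ hW⟩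
    · rintro ⟨hz, hzV⟩
      obtain ⟨x', hx', e, h0'⟩ := (mem_biquadDivisor_iff hA).1 hz
      obtain ⟨ξ', hξ', rfl⟩ := hVW z hzV x' hx' e
      have hm' := (ch k).mem_bCone ((ch k).affDom_subset j (hWd hξ'))
      have hF : biquadForm c ((ch k).chV ξ') = 0 := (biquadForm_eq_zero_iff c fun i =>
        mkP_inj (hx'.2 i).1 (hm'.2 i).1 ((e i).symm.trans (hstd _ (hWd hξ') i))).2 h0'
      obtain ⟨u, hu, rfl⟩ : ξ' ∈ ψ '' U := him ▸ ⟨hξ', hF⟩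
      exact ⟨u, hu, rfl⟩

end Smooth

end

/-- **Proposition 4.5.** On `Yₙ` (the blowup of ℙ³ at `n ≥ 3` general points,
realized as the multiview variety), a general divisor `D'` in the linear system
`|2nD_H + 2E₁ + ⋯ + 2Eₙ|` is smooth (a surface) and `χ(D') = 8n³ - 16n² + 12n`. -/
theorem chi_general_member_linear_system (n : ℕ) (hn : 3 ≤ n) :
    Generically (K := ℂ) (σ := Fin n × Fin 3 × Fin 4) fun a =>
      (∀ i, (camOfC a i).rank = 3) →
      Generically (K := ℂ) (σ := (Fin n → Fin 3) × (Fin n → Fin 3)) fun c =>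
        (∀ p ∈ biquadDivisor (camOfC a) c, IsSmoothPtP (biquadDivisor (camOfC a) c) p 2) ∧
        HasEulerChar ↥(biquadDivisor (camOfC a) c)
          (8 * (n : ℤ) ^ 3 - 16 * (n : ℤ) ^ 2 + 12 * (n : ℤ)) := by
  obtain ⟨q, hq, h⟩ := exists_poly_genCams hn
  refine ⟨q, hq, fun a ha hr => ?_⟩
  have hA := h a ha hr
  obtain ⟨ι, _, ch, hch⟩ := hA.exists_atlas hn
  obtain ⟨q', hq', h'⟩ := exists_poly_smoothX hA ch
  exact ⟨q', hq', fun c hc => ⟨fun p hp => isSmoothPtP_biquadDivisor hA hch (h' c hc) hp,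
    hasEulerChar_biquadDivisor (by omega) hA hch (h' c hc)⟩⟩

end PaperED
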